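/- Let 0 < A_0 < 1 be fixed and let C, D > 0 with C + D < 1/32. Then for all sufficiently large primes q there exists a prime p with A_0·q ≤ p ≤ (A_0 + q^{-C})·q, p ≠ q, such that |p̄| ≤ q^{1-D}, where p̄ denotes the unique integer with |p̄| ≤ q/2 and p·p̄ ≡ 1 (mod q). -/

import Mathlib

namespace H12
open Real Finset

/-! ### M1: exponential sums (Kusmin-Landau, van der Corput) -/
section M1

noncomputable def ee (x:ℝ) : ℂ := Complex.exp (((2*π*x:ℝ):ℂ)*Complex.I)

lemma ee_norm (x:ℝ) : ‖ee x‖=1 := by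
  unfold ee; exact Complex.norm_exp_ofReal_mul_I _

lemma ee_add (x y:ℝ) : ee (x+y)=ee x*ee y := by
  unfold ee; rw [← Complex.exp_add]; congr 1; push_cast; ring


lemma ee_neg (x:ℝ) : ee (-x)=(starRingEnd ℂ) (ee x) := by
  unfold ee; rw [← Complex.exp_conj, map_mul, Complex.conj_ofReal, Complex.conj_I]; congr 1; push_cast; ring

lemma ee_conj_mul (x y:ℝ) : ee x*(starRingEnd ℂ) (ee y)=ee (x-y) := by
  rw [← ee_neg, ← ee_add, sub_eq_add_neg]

lemma ee_sub_norm (x y:ℝ) : ‖ee x-ee y‖≤2*π * |x-y| := by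
  have h : ee x-ee y=ee y*(ee (x-y)-1) := by
    rw [mul_sub, ← ee_add]; simp
  rw [h, norm_mul, ee_norm, one_mul]
  have := norm_exp_I_mul_ofReal_sub_one_le (x := 2*π*(x-y))
  unfold ee
  rw [mul_comm]
  refine this.trans ?_
  rw [norm_eq_abs, abs_mul, abs_of_pos (by positivity)]

lemma one_sub_ee_norm {x : ℝ} (h0 : 0≤x) (h1 : x≤1/2) : 4*x≤‖1-ee x‖ := by
  have h := Complex.norm_exp_I_mul_ofReal_sub_one (2*π*x)
  unfold ee
  rw [norm_sub_rev, mul_comm (_:ℂ) Complex.I, h]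
  have h2 : (2*π*x/2)=π*x := by ring
  rw [h2]
  have := mul_le_sin (x := π*x) (by positivity) (by nlinarith [pi_pos])
  have h3 : 2/π*(π*x)=2*x := by field_simp
  rw [h3] at this
  calc 4*x=2*(2*x) := by ring
    _≤2*sin (π*x) := by linarith
    _≤_ := by rw [norm_eq_abs]; exact le_abs_self _

/-- Kusmin–Landau -/
lemma kusmin (a : ℕ → ℝ) (l:ℝ) (hl : 0< l) (L:ℕ)
    (h1 : ∀ n<L, l≤a (n+1)-a n) (h2 : ∀ n<L, a (n+1)-a n≤1/2)
    (hm : ∀ n, n+1<L → a (n+2)-a (n+1)≤a (n+1)-a n) :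
    ‖∑ n ∈ range L, ee (a n)‖≤2/l := by
  set d : ℕ → ℝ := fun n => a (n+1)-a n with hd
  set c : ℕ → ℂ := fun n => (1-ee (d n))⁻¹ with hc
  have key : ∀ n<L, 1-ee (d n) ≠ 0 := by
    intro n hn h
    have := one_sub_ee_norm (x := d n) (hl.le.trans (h1 n hn)) (h2 n hn)
    rw [h, norm_zero] at this
    linarith [h1 n hn]
  have hcn : ∀ n<L, ‖c n‖≤1/(4*d n) := by
    intro n hn
    have := one_sub_ee_norm (x := d n) (hl.le.trans (h1 n hn)) (h2 n hn)
    have h0 : 0<d n := hl.trans_le (h1 n hn)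
    simp only [hc]
    rw [norm_inv, ← one_div]
    exact one_div_le_one_div_of_le (by linarith) this
  have hdiff : ∀ n, n+1<L → ‖c (n+1)-c n‖≤π/8*(1/d (n+1)-1/d n) := by
    intro n hn
    have h0 : 0<d n := hl.trans_le (h1 n (by omega))
    have h0' : 0<d (n+1) := hl.trans_le (h1 (n+1) (by omega))
    have e1 : c (n+1)-c n=(ee (d (n+1))-ee (d n))*(c (n+1)*c n) := by
      have k1 := key n (by omega)
      have k2 := key (n+1) (by omega)
      simp only [hc]
      field_simp
      ring
    rw [e1, norm_mul, norm_mul]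
    have s1 := ee_sub_norm (d (n+1)) (d n)
    rw [abs_of_nonpos (by have := hm n hn; simp only [hd]; linarith)] at s1
    calc _≤(2*π*(-(d (n+1)-d n)))*(1/(4*d (n+1))*(1/(4*d n))) := by
          have := hcn n (by omega)
          have := hcn (n+1) (by omega)
          gcongr
          exact (norm_nonneg _).trans s1
      _=_ := by field_simp; ring
  -- partial sums
  have main : ∀ K, K+1≤L → ∃ z : ℂ, ‖z‖≤1/(4*d 0)+π/8*(1/d K-1/d 0) ∧
      ∑ n ∈ range (K+1), ee (a n)=z-c K*ee (a (K+1)) := by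
    intro K
    induction K with
    | zero =>
      intro hK
      refine ⟨c 0*ee (a 0), ?_, ?_⟩
      · rw [norm_mul, ee_norm]; have := hcn 0 (by omega); simpa using this
      · have : ee (a 1)=ee (a 0)*ee (d 0) := by rw [← ee_add]; congr 1; simp [hd]
        have k := key 0 (by omega)
        simp only [zero_add, range_one, sum_singleton, hc]
        rw [this]; field_simp
    | succ K ih =>
      intro hK
      obtain ⟨z, hz, hs⟩ := ih (by omega)
      refine ⟨z+(c (K+1)-c K)*ee (a (K+1)), ?_, ?_⟩
      · refine (norm_add_le _ _).trans ?_
        rw [norm_mul, ee_norm]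
        have := hdiff K (by omega)
        linarith
      · rw [sum_range_succ, hs]
        have : ee (a (K+1+1))=ee (a (K+1))*ee (d (K+1)) := by
          rw [← ee_add]; congr 1; simp [hd]
        have k := key (K+1) (by omega)
        have k' : c (K+1)*(1-ee (d (K+1)))=1 := inv_mul_cancel₀ k
        rw [this]
        linear_combination (-ee (a (K+1)))*k'
  rcases L with _ | K
  · simp; positivity
  · obtain ⟨z, hz, hs⟩ := main K le_rfl
    rw [hs]
    refine (norm_sub_le _ _).trans ?_
    rw [norm_mul, ee_norm]
    have := hcn K (by omega)
    have p1 : 1/d K≤1/l := one_div_le_one_div_of_le hl (h1 K (by omega))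
    have p0 : 1/d 0≤1/l := one_div_le_one_div_of_le hl (h1 0 (by omega))
    have q0 : 0<1/d 0 := one_div_pos.mpr (hl.trans_le (h1 0 (by omega)))
    have e1 : 1/(4*d 0)=1/4*(1/d 0) := by rw [one_div_mul_one_div]
    have e2 : 1/(4*d K)=1/4*(1/d K) := by rw [one_div_mul_one_div]
    have e3 : 2/l=2*(1/l) := by ring
    have e4 : 0<1/l := by positivity
    rw [e1] at hz; rw [e2] at this; rw [e3]
    nlinarith [pi_lt_four, pi_pos]

/-- van der Corput inequality, crude form -/
lemma vdc (u : ℕ → ℂ) (hu : ∀ n, ‖u n‖≤1) (L H:ℕ) (hH : 1≤H) (B : ℕ → ℝ)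
    (hB : ∀ h, 1≤h → h<H →
      ‖∑ n ∈ range L, u (n+h)*(starRingEnd ℂ) (u n)‖≤B h) :
    ‖∑ n ∈ range L, u n‖^2 ≤
      2*L^2/H+4*L/H*(∑ h ∈ Ico 1 H, B h)+8*L*H+8*H^2 := by
  have shift : ∀ (v : ℕ → ℂ), (∀ n, ‖v n‖≤1) → ∀ h : ℕ,
      ‖∑ n ∈ range L, v n-∑ n ∈ range L, v (n+h)‖≤2*h := by
    intro v hv h
    have e : ∑ n ∈ range L, v n-∑ n ∈ range L, v (n+h)
        = ∑ n ∈ range h, v n-∑ n ∈ range h, v (L+n) := by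
      have e1 := sum_range_add v h L
      have e2 := sum_range_add v L h
      simp_rw [add_comm h] at e1
      rw [e2] at e1
      linear_combination e1
    rw [e]
    refine (norm_sub_le _ _).trans ?_
    have b1 : ‖∑ n ∈ range h, v n‖≤h := by
      refine (norm_sum_le _ _).trans ?_
      refine (sum_le_sum (fun i _ => hv i)).trans ?_; simp
    have b2 : ‖∑ n ∈ range h, v (L+n)‖≤h := by
      refine (norm_sum_le _ _).trans ?_
      refine (sum_le_sum (fun i _ => hv _)).trans ?_; simp
    linarith
  set S := ∑ n ∈ range L, u n with hS
  set W := ∑ n ∈ range L, ∑ h ∈ range H, u (n+h) with hW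
  have hHr : (1:ℝ)≤H := by exact_mod_cast hH
  have d1 : ‖(H:ℂ)*S-W‖≤2*H*H := by
    have : (H:ℂ)*S-W=∑ h ∈ range H, (S-∑ n ∈ range L, u (n+h)) := by
      rw [hW, sum_comm, sum_sub_distrib]; simp
    rw [this]
    refine (norm_sum_le _ _).trans ?_
    refine (sum_le_sum (g := fun _ => 2*(H:ℝ)) (fun i hi => ?_)).trans ?_
    · refine (shift u hu i).trans ?_
      have : (i:ℝ)≤H := by exact_mod_cast (mem_range.mp hi).le
      linarith
    · simp; linarith
  -- correlation
  have corr : ∀ h h' : ℕ, h<H → h' < H → h' < h →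
      ‖∑ n ∈ range L, u (n+h)*(starRingEnd ℂ) (u (n+h'))‖≤B (h-h')+2*H := by
    intro h h' hh hh' hlt
    have s := shift (fun n => u (n+(h-h'))*(starRingEnd ℂ) (u n)) (by
      intro n; rw [norm_mul, RCLike.norm_conj]
      exact mul_le_one₀ (hu _) (norm_nonneg _) (hu _)) h'
    have e : ∀ n, n+h' + (h-h')=n+h := by intro n; omega
    simp only [e] at s
    have b := hB (h-h') (by omega) (by omega)
    have : (h':ℝ)≤H := by exact_mod_cast hh'.le
    have t := norm_sub_norm_le
      (∑ n ∈ range L, u (n+h)*(starRingEnd ℂ) (u (n+h')))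
      (∑ n ∈ range L, u (n+(h-h'))*(starRingEnd ℂ) (u n))
    rw [norm_sub_rev] at t
    linarith
  have B0 : ∀ h, 1≤h → h<H → 0≤B h := fun h h1 h2 => (norm_nonneg _).trans (hB h h1 h2)
  set SB := ∑ h ∈ Ico 1 H, B h with hSB
  have SB0 : 0≤SB := sum_nonneg (fun i hi => B0 i (mem_Ico.mp hi).1 (mem_Ico.mp hi).2)
  have sq : ∑ n ∈ range L, ‖∑ h ∈ range H, u (n+h)‖^2
      ≤ H*L+2*H*SB+2*H^3 := by
    have e1 : ((∑ n ∈ range L, ‖∑ h ∈ range H, u (n+h)‖^2:ℝ):ℂ)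
        = ∑ h ∈ range H, ∑ h' ∈ range H,
          ∑ n ∈ range L, u (n+h)*(starRingEnd ℂ) (u (n+h')) := by
      push_cast
      have : ∀ n, ((‖∑ h ∈ range H, u (n+h)‖:ℂ))^2 =
          ∑ h ∈ range H, ∑ h' ∈ range H, u (n+h)*(starRingEnd ℂ) (u (n+h')) := by
        intro n
        rw [← Complex.mul_conj', map_sum, sum_mul_sum]
      simp_rw [this]
      rw [sum_comm]
      refine sum_congr rfl (fun h _ => ?_)
      rw [sum_comm]
    have e2 : (∑ n ∈ range L, ‖∑ h ∈ range H, u (n+h)‖^2:ℝ)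
        = ‖((∑ n ∈ range L, ‖∑ h ∈ range H, u (n+h)‖^2:ℝ):ℂ)‖ := by
      rw [Complex.norm_real, norm_of_nonneg (by positivity)]
    rw [e2, e1]
    refine (norm_sum_le _ _).trans ?_
    have row : ∀ h ∈ range H, ‖∑ h' ∈ range H,
          ∑ n ∈ range L, u (n+h)*(starRingEnd ℂ) (u (n+h'))‖
          ≤ L+2*SB+2*H*H := by
      intro h hh
      rw [mem_range] at hh
      refine (norm_sum_le _ _).trans ?_
      have e3 : range H=range h ∪ ({h} ∪ Ico (h+1) H) := by
        ext i; simp only [mem_range, mem_union, mem_singleton, mem_Ico]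
        omega
      have t1 : ∑ h' ∈ range h, ‖∑ n ∈ range L, u (n+h)*(starRingEnd ℂ) (u (n+h'))‖
          ≤ SB+h*(2*H) := by
        refine (sum_le_sum (fun i hi => corr h i hh
          ((mem_range.mp hi).trans hh) (mem_range.mp hi))).trans ?_
        rw [sum_add_distrib]
        simp only [sum_const, card_range, nsmul_eq_mul]
        gcongr
        rw [hSB, ← sum_image (s := range h) (g := fun i => h-i) (f := B)]
        · apply sum_le_sum_of_subset_of_nonneg
          · intro i hi
            simp only [mem_image, mem_range, mem_Ico] at hi ⊢
            omega
          · intro i hi _; exact B0 i (mem_Ico.mp hi).1 (mem_Ico.mp hi).2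
        · intro i hi j hj hij
          simp only [coe_range, Set.mem_Iio] at hi hj
          simp only at hij
          omega
      have t2 : ∑ h' ∈ Ico (h+1) H, ‖∑ n ∈ range L, u (n+h)*(starRingEnd ℂ) (u (n+h'))‖
          ≤ SB+(H-(h+1):ℕ)*(2*H) := by
        refine (sum_le_sum (g := fun i => B (i-h)+2*H) (fun i hi => ?_)).trans ?_
        · rw [mem_Ico] at hi
          have := corr i h hi.2 hh (by omega)
          rw [← RCLike.norm_conj, map_sum]
          simpa [mul_comm] using this
        rw [sum_add_distrib]
        simp only [sum_const, Nat.card_Ico, nsmul_eq_mul]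
        gcongr
        rw [hSB, ← sum_image (s := Ico (h+1) H) (g := fun i => i-h) (f := B)]
        · apply sum_le_sum_of_subset_of_nonneg
          · intro i hi
            simp only [mem_image, mem_Ico] at hi ⊢
            omega
          · intro i hi _; exact B0 i (mem_Ico.mp hi).1 (mem_Ico.mp hi).2
        · intro i hi j hj hij
          simp only [coe_Ico, Set.mem_Ico] at hi hj
          simp only at hij
          omega
      have t3 : ‖∑ n ∈ range L, u (n+h)*(starRingEnd ℂ) (u (n+h))‖≤L := by
        refine (norm_sum_le _ _).trans ?_
        refine (sum_le_sum (g := fun _ => (1:ℝ)) (fun i _ => ?_)).trans ?_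
        · rw [norm_mul, RCLike.norm_conj]
          exact mul_le_one₀ (hu _) (norm_nonneg _) (hu _)
        · simp
      rw [e3, sum_union, sum_union, sum_singleton]
      · have c1 : ((H-(h+1):ℕ):ℝ)=H-(h+1) := by
          rw [Nat.cast_sub (by omega)]; push_cast; ring
        rw [c1] at t2
        nlinarith
      · simp
      · rw [disjoint_left]; intro i hi hi'
        simp only [mem_range, mem_union, mem_singleton, mem_Ico] at hi hi'
        omega
    refine (sum_le_sum row).trans ?_
    simp only [sum_const, card_range, nsmul_eq_mul]
    apply le_of_eq; ring
  have cs : ‖W‖^2≤L*(H*L+2*H*SB+2*H^3) := by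
    have : ‖W‖≤∑ n ∈ range L, ‖∑ h ∈ range H, u (n+h)‖ := norm_sum_le _ _
    calc ‖W‖^2≤(∑ n ∈ range L, ‖∑ h ∈ range H, u (n+h)‖)^2 := by gcongr
      _≤(range L).card*∑ n ∈ range L, ‖∑ h ∈ range H, u (n+h)‖^2 :=
        sq_sum_le_card_mul_sum_sq
      _≤_ := by rw [card_range]; gcongr
  have fin : (H*‖S‖)^2≤2*(L*(H*L+2*H*SB+2*H^3))+2*(2*H*H)^2 := by
    have : H*‖S‖≤‖W‖+2*H*H := by
      have t := norm_sub_norm_le ((H:ℂ)*S) W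
      rw [norm_mul, Complex.norm_natCast] at t
      linarith
    have p : 0≤H*‖S‖ := by positivity
    have p1 := norm_nonneg W
    nlinarith [sq_nonneg (‖W‖-2*H*H), mul_self_le_mul_self p this]
  have Hp : (0:ℝ)<H := by linarith
  rw [mul_pow] at fin
  have := (le_div_iff₀' (by positivity : (0:ℝ)<(H:ℝ)^2)).mpr fin
  refine this.trans ?_
  rw [div_le_iff₀ (by positivity)]
  have e : (2*(L:ℝ)^2/H+4*L/H*SB+8*L*H+8*H^2)*H^2
     = 2*L^2*H+4*L*H*SB+8*L*H^3+8*H^4 := by field_simp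
  rw [e]
  have : (0:ℝ)≤L*H^3 := by positivity
  nlinarith

end M1
end H12
namespace H12
open Real Finset
section M1b

def dif : ℕ → (ℕ → ℝ) → ℕ → ℝ
  | 0, a => a
  | (k+1), a => dif k (fun n => a (n+1)-a n)

lemma dif_succ (k:ℕ) : ∀ (a : ℕ → ℝ) (n:ℕ), dif (k+1) a n=dif k a (n+1)-dif k a n := by
  induction k with
  | zero => intro a n; rfl
  | succ k ih =>
    intro a n
    rw [dif, ih, dif]

lemma dif_sub (k:ℕ) : ∀ (a b : ℕ → ℝ) (n:ℕ), dif k (fun n => a n-b n) n=dif k a n-dif k b n := by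
  induction k with
  | zero => intro a b n; rfl
  | succ k ih =>
    intro a b n
    rw [dif_succ, dif_succ, dif_succ, ih, ih]; ring

lemma dif_shift (k:ℕ) : ∀ (a : ℕ → ℝ) (h n:ℕ), dif k (fun n => a (n+h)) n=dif k a (n+h) := by
  induction k with
  | zero => intro a h n; rfl
  | succ k ih =>
    intro a h n
    rw [dif_succ, dif_succ, ih, ih]; congr 2; omega

lemma dif_delta (k:ℕ) (a : ℕ → ℝ) (h n:ℕ) :
    dif k (fun n => a (n+h)-a n) n=∑ i ∈ range h, dif (k+1) a (n+i) := by
  rw [dif_sub, dif_shift]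
  simp_rw [dif_succ]
  have := sum_range_sub (fun i => dif k a (n+i)) h
  simp only [add_zero] at this
  rw [← this]; rfl

def Good (k:ℕ) (lo hi:ℝ) : Prop :=
  ∀ A : ℝ, 1≤A → ∃ C > (0:ℝ), ∃ c > (0:ℝ), ∀ N : ℕ, 1≤N → ∀ l : ℝ, 0< l →
    (N:ℝ)^lo≤A*l → l≤A*(N:ℝ)^hi → ∀ a : ℕ → ℝ,
    (∀ n, n<(k+1)*N → l≤dif k a n ∧ dif k a n≤A*l) →
    (∀ n, n<(k+1)*N → dif k a (n+1)≤dif k a n) →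
    ∀ L, L≤N → ‖∑ n ∈ range L, ee (a n)‖≤C*(N:ℝ)^(1-c)

lemma triv_sum (a : ℕ → ℝ) (L:ℕ) : ‖∑ n ∈ range L, ee (a n)‖≤L := by
  refine (norm_sum_le _ _).trans ?_
  simp [ee_norm]

lemma good_one (δ:ℝ) (hδ : 0<δ) : Good 1 (-1+δ) (-δ) := by
  intro A hA
  refine ⟨2*A^2, by positivity, δ, hδ, ?_⟩
  intro N hN l hl h1 h2 a ha hm L hL
  have hNp : (0:ℝ)<N := by exact_mod_cast hN
  have hLr : (L:ℝ)≤N := by exact_mod_cast hL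
  by_cases hc : A*l≤1/2
  · have k := kusmin a l hl L (fun n hn => (ha n (by omega)).1)
      (fun n hn => (ha n (by omega)).2.trans hc) (fun n hn => hm n (by omega))
    refine k.trans ?_
    rw [div_le_iff₀ hl]
    have e : (N:ℝ)^(1-δ)*(N:ℝ)^(-1+δ)=1 := by
      rw [← rpow_add hNp]; simp
    have : 1≤(N:ℝ)^(1-δ)*(A*l) := by
      calc (1:ℝ)=(N:ℝ)^(1-δ)*(N:ℝ)^(-1+δ) := e.symm
        _≤_ := by gcongr
    nlinarith [mul_nonneg (by positivity : (0:ℝ)≤(N:ℝ)^(1-δ)) hl.le, mul_nonneg (mul_nonneg (by positivity : (0:ℝ)≤(N:ℝ)^(1-δ)) hl.le) (by nlinarith : (0:ℝ)≤A*(A-1))]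
  · push Not at hc
    refine (triv_sum a L).trans (hLr.trans ?_)
    have e : (N:ℝ)=(N:ℝ)^(1-δ)*(N:ℝ)^δ := by
      rw [← rpow_add hNp]; simp
    have e2 : (N:ℝ)^(-δ)*(N:ℝ)^δ=1 := by
      rw [← rpow_add hNp]; simp
    have hp : 0<(N:ℝ)^δ := by positivity
    have : (N:ℝ)^δ≤2*A^2 := by
      have : 1/2≤A*(A*(N:ℝ)^(-δ)) := hc.le.trans (by gcongr)
      nlinarith
    calc (N:ℝ)=(N:ℝ)^(1-δ)*(N:ℝ)^δ := e
      _≤(N:ℝ)^(1-δ)*(2*A^2) := by gcongr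
      _=_ := by ring

lemma good_step (k:ℕ) (lo hi δ η:ℝ) (hG : Good k lo hi) (hδ : 0<δ) (hη : δ<η) (hη1 : η<1) :
    Good (k+1) (lo-δ) (hi-η) := by
  intro A hA
  obtain ⟨C, hC, c, hc, H0⟩ := hG A hA
  set c' := min (min (η-δ) c) (1-η) with hc'
  have hc'0 : 0<c' := lt_min (lt_min (by linarith) hc) (by linarith)
  refine ⟨40+4*C, by positivity, c' / 2, by positivity, ?_⟩
  intro N hN l hl h1 h2 a ha hm L hL
  have hN1 : (1:ℝ)≤N := by exact_mod_cast hN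
  have hNp : (0:ℝ)<N := by linarith
  have hLr : (L:ℝ)≤N := by exact_mod_cast hL
  set H := ⌊(N:ℝ)^η⌋₊ with hH
  have hHle : (H:ℝ)≤(N:ℝ)^η := Nat.floor_le (by positivity)
  have hNη1 : 1≤(N:ℝ)^η := one_le_rpow hN1 (by linarith)
  have hH1 : 1≤H := by rw [hH]; exact Nat.le_floor (by simpa using hNη1)
  have hHr1 : (1:ℝ)≤H := by exact_mod_cast hH1
  have hHge : (N:ℝ)^η≤2*H := by
    have := Nat.lt_floor_add_one ((N:ℝ)^η)
    rw [← hH] at this; linarith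
  have hHN : H≤N := by
    have : (H:ℝ)≤N := hHle.trans (by
      calc (N:ℝ)^η≤(N:ℝ)^(1:ℝ) := rpow_le_rpow_of_exponent_le hN1 hη1.le
        _=N := rpow_one _)
    exact_mod_cast this
  have hcorr : ∀ h, 1≤h → h<H →
      ‖∑ n ∈ range L, ee (a (n+h))*(starRingEnd ℂ) (ee (a n))‖
        ≤ (if (h:ℝ)<(N:ℝ)^δ then (N:ℝ) else 0)+C*(N:ℝ)^(1-c) := by
    intro h hh1 hhH
    simp_rw [ee_conj_mul]
    have hp : 0≤C*(N:ℝ)^(1-c) := by positivity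
    split_ifs with hlt
    · refine (triv_sum (fun n => a (n+h)-a n) L).trans ?_
      linarith
    · push Not at hlt
      rw [zero_add]
      have hhr : (1:ℝ)≤h := by exact_mod_cast hh1
      have hhl : (0:ℝ)<h := by linarith
      refine H0 N hN (h*l) (by positivity) ?_ ?_ (fun n => a (n+h)-a n) ?_ ?_ L hL
      · calc (N:ℝ)^lo=(N:ℝ)^δ*(N:ℝ)^(lo-δ) := by rw [← rpow_add hNp]; ring_nf
          _≤h*(A*l) := by gcongr
          _=_ := by ring
      · calc h*l≤(N:ℝ)^η*(A*(N:ℝ)^(hi-η)) := by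
              gcongr
              refine le_trans ?_ hHle
              exact_mod_cast hhH.le
          _=A*((N:ℝ)^η*(N:ℝ)^(hi-η)) := by ring
          _=_ := by rw [← rpow_add hNp]; ring_nf
      · intro n hn
        rw [dif_delta]
        have hr : ∀ i ∈ range h, l≤dif (k+1) a (n+i) ∧ dif (k+1) a (n+i)≤A*l := by
          intro i hi
          rw [mem_range] at hi
          apply ha; nlinarith
        constructor
        · have := card_nsmul_le_sum _ _ _ (fun i hi => (hr i hi).1)
          simpa using this
        · have := sum_le_card_nsmul _ _ _ (fun i hi => (hr i hi).2)
          simp at this; linarith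
      · intro n hn
        rw [dif_delta, dif_delta]
        apply sum_le_sum
        intro i hi
        rw [mem_range] at hi
        have := hm (n+i) (by nlinarith)
        have e : n+1+i=n+i+1 := by ring
        rw [e]; exact this
  have V := vdc (fun n => ee (a n)) (fun n => (ee_norm _).le) L H hH1 _ hcorr
  have sumB : ∑ h ∈ Ico 1 H, ((if (h:ℝ)<(N:ℝ)^δ then (N:ℝ) else 0)+C*(N:ℝ)^(1-c))
      ≤ (N:ℝ)^δ*N+H*(C*(N:ℝ)^(1-c)) := by
    rw [sum_add_distrib]
    apply add_le_add
    · rw [← sum_filter]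
      simp only [sum_const, nsmul_eq_mul]
      gcongr
      have : (filter (fun h : ℕ => (h:ℝ)<(N:ℝ)^δ) (Ico 1 H)) ⊆ Ioc 0 ⌊(N:ℝ)^δ⌋₊ := by
        intro i hi
        simp only [mem_filter, mem_Ico, mem_Ioc] at hi ⊢
        exact ⟨by omega, Nat.le_floor hi.2.le⟩
      have := card_le_card this
      simp at this
      calc _≤((⌊(N:ℝ)^δ⌋₊:ℕ):ℝ) := by exact_mod_cast this
        _≤_ := Nat.floor_le (by positivity)
    · simp only [sum_const, Nat.card_Ico, nsmul_eq_mul]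
      gcongr
      omega
  -- bounds
  set E := (N:ℝ)^(-c') with hE
  have E0 : 0<E := by positivity
  have r1 : (N:ℝ)^(-(η-δ))≤E := rpow_le_rpow_of_exponent_le hN1 (by
    have : c' ≤ η-δ := (min_le_left _ _).trans (min_le_left _ _)
    linarith)
  have r2 : (N:ℝ)^(-c)≤E := rpow_le_rpow_of_exponent_le hN1 (by
    have : c' ≤ c := (min_le_left _ _).trans (min_le_right _ _)
    linarith)
  have r3 : (N:ℝ)^(-(1-η))≤E := rpow_le_rpow_of_exponent_le hN1 (by
    have : c' ≤ 1-η := (min_le_right _ _)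
    linarith)
  have f1 : (N:ℝ)^δ/H≤2*E := by
    rw [div_le_iff₀ (by linarith)]
    calc (N:ℝ)^δ=(N:ℝ)^(-(η-δ))*(N:ℝ)^η := by rw [← rpow_add hNp]; ring_nf
      _≤E*(2*H) := by gcongr
      _=_ := by ring
  have f0 : 1/H≤2*E := by
    refine le_trans ?_ f1
    gcongr
    exact one_le_rpow hN1 hδ.le
  have f2 : (H:ℝ)≤N*E := by
    calc (H:ℝ)≤(N:ℝ)^η := hHle
      _=N*(N:ℝ)^(-(1-η)) := by rw [← rpow_one_add' hNp.le (by linarith)]; ring_nf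
      _≤_ := by gcongr
  have f3 : (N:ℝ)^(1-c)≤N*E := by
    calc (N:ℝ)^(1-c)=N*(N:ℝ)^(-c) := by rw [sub_eq_add_neg, rpow_add hNp, rpow_one]
      _≤_ := by gcongr
  have hHNr : (H:ℝ)≤N := by exact_mod_cast hHN
  have S2 : ‖∑ n ∈ range L, ee (a n)‖^2≤(36+4*C)*(N:ℝ)^2*E := by
    refine V.trans ?_
    have g1 : 2*(L:ℝ)^2/H≤4*N^2*E := by
      calc 2*(L:ℝ)^2/H=2*(L:ℝ)^2*(1/H) := by ring
        _≤2*(N:ℝ)^2*(2*E) := by gcongr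
        _=_ := by ring
    have g2 : 4*(L:ℝ)/H*(∑ h ∈ Ico 1 H, ((if (h:ℝ)<(N:ℝ)^δ then (N:ℝ) else 0)+C*(N:ℝ)^(1-c)))
        ≤ (8+4*C)*N^2*E := by
      calc _≤4*(N:ℝ)/H*((N:ℝ)^δ*N+H*(C*(N:ℝ)^(1-c))) := by gcongr
        _=4*(N:ℝ)^2*((N:ℝ)^δ/H)+4*N*C*(N:ℝ)^(1-c) := by field_simp
        _≤4*(N:ℝ)^2*(2*E)+4*N*C*(N*E) := by gcongr
        _=_ := by ring
    have g3 : 8*(L:ℝ)*H≤8*N^2*E := by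
      calc 8*(L:ℝ)*H≤8*N*(N*E) := by gcongr
        _=_ := by ring
    have g4 : 8*(H:ℝ)^2≤8*N^2*E := by
      calc 8*(H:ℝ)^2=8*H*H := by ring
        _≤8*N*(N*E) := by gcongr
        _=_ := by ring
    have : 0≤(N:ℝ)^2*E := by positivity
    linarith
  have tgt : ((40+4*C)*(N:ℝ)^(1-c' / 2))^2=(40+4*C)^2*((N:ℝ)^2*E) := by
    rw [mul_pow]; congr 1
    rw [hE, ← rpow_natCast, ← rpow_mul hNp.le, ← rpow_natCast, ← rpow_add hNp]
    congr 1; push_cast; ring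
  refine le_of_sq_le_sq ?_ (by positivity)
  rw [tgt]
  refine S2.trans ?_
  have : 0≤(N:ℝ)^2*E := by positivity
  nlinarith

lemma good_all (δ:ℝ) (hδ : 0<δ) (k:ℕ) (hk : 2^(k+2)*δ<1) :
    Good (k+1) (-1-δ*(2^(k+1)-3)) (- (δ*(2^(k+2)-3))) := by
  induction k with
  | zero =>
    have := good_one δ hδ
    norm_num at this ⊢
    convert this using 1
  | succ k ih =>
    have h2 : (0:ℝ)<2^k*δ := by positivity
    have h := good_step _ _ _ (2^(k+1)*δ) (2^(k+2)*δ) (ih (by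
      refine lt_of_le_of_lt ?_ hk
      gcongr <;> norm_num)) (by positivity) (by rw [pow_succ _ (k+1)]; nlinarith [pow_succ (2:ℝ) k]) (by
        rw [pow_succ] at hk
        have : (0:ℝ)<2^(k+2)*δ := by positivity
        rw [show k+1+1=k+2 by ring] at hk
        nlinarith)
    convert h using 1 <;> ring

end M1b
end H12
namespace H12
open Real Finset
section M1c
open MeasureTheory

lemma euler_sum (f f' : ℝ → ℂ) (a b:ℝ) (ha : 0≤a) (hab : a≤b)
    (hf : ∀ x ∈ Set.Icc a b, HasDerivAt f (f' x) x) (hc : ContinuousOn f' (Set.Icc a b)) :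
    ‖∑ k ∈ Ioc ⌊a⌋₊ ⌊b⌋₊, f k-∫ x in a..b, f x‖≤‖f a‖+‖f b‖+∫ x in a..b, ‖f' x‖ := by
  have hd : ∀ x ∈ Set.Icc a b, deriv f x=f' x := fun x hx => (hf x hx).deriv
  have hitg' : IntegrableOn f' (Set.Icc a b) := hc.integrableOn_Icc
  have hitg : IntegrableOn (deriv f) (Set.Icc a b) :=
    hitg'.congr_fun (fun x hx => (hd x hx).symm) measurableSet_Icc
  have A := sum_mul_eq_sub_sub_integral_mul (f := f) (fun _ => (1:ℂ)) ha hab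
    (fun x hx => (hf x hx).differentiableAt) hitg
  simp only [mul_one, sum_const, Nat.card_Icc, nsmul_eq_mul] at A
  have huIcc : Set.uIcc a b=Set.Icc a b := Set.uIcc_of_le hab
  have hii : IntervalIntegrable f' volume a b := by
    rw [intervalIntegrable_iff_integrableOn_Icc_of_le hab]; exact hitg'
  have P := intervalIntegral.integral_mul_deriv_eq_deriv_mul (u := fun x : ℝ => (x:ℂ)) (v := f)
    (u' := fun _ => 1) (v' := f') (a := a) (b := b)
    (fun x _ => Complex.ofRealCLM.hasDerivAt) (by rw [huIcc]; exact hf)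
    (by simp) hii
  simp only [one_mul] at P
  have B : ∫ t in Set.Ioc a b, deriv f t*((⌊t⌋₊+1-0:ℕ):ℂ)
      = ∫ t in a..b, f' t*((⌊t⌋₊:ℂ)+1) := by
    rw [intervalIntegral.integral_of_le hab]
    apply setIntegral_congr_fun measurableSet_Ioc
    intro x hx
    simp only [hd x ⟨hx.1.le, hx.2⟩, tsub_zero]
    push_cast; ring
  rw [B] at A
  have hmeas : IntervalIntegrable (fun t : ℝ => f' t*((⌊t⌋₊:ℂ)+1)) volume a b := by
    rw [intervalIntegrable_iff_integrableOn_Icc_of_le hab]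
    refine Integrable.mul_bdd (c := b+1) hitg' ?_ ?_
    · exact ((measurable_from_nat.comp Nat.measurable_floor).add_const 1).aestronglyMeasurable
    · refine (ae_restrict_iff' measurableSet_Icc).mpr (Filter.Eventually.of_forall (fun x hx => ?_))
      have : ((⌊x⌋₊:ℂ)+1)=((⌊x⌋₊+1:ℕ):ℂ) := by push_cast; rfl
      rw [this, Complex.norm_natCast]; push_cast
      have := Nat.floor_le (ha.trans hx.1)
      linarith [hx.2]
  have hmeas2 : IntervalIntegrable (fun t : ℝ => (t:ℂ)*f' t) volume a b := by
    apply ContinuousOn.intervalIntegrable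
    rw [huIcc]; exact (Complex.continuous_ofReal.continuousOn).mul hc
  have e : ∑ k ∈ Ioc ⌊a⌋₊ ⌊b⌋₊, f k-∫ x in a..b, f x
      = f b*((⌊b⌋₊:ℂ)+1-b)-f a*((⌊a⌋₊:ℂ)+1-a)
        - ∫ t in a..b, f' t*((⌊t⌋₊:ℂ)+1-t) := by
    have : ∫ t in a..b, f' t*((⌊t⌋₊:ℂ)+1-t) =
      (∫ t in a..b, f' t*((⌊t⌋₊:ℂ)+1))-∫ t in a..b, (t:ℂ)*f' t := by
      rw [← intervalIntegral.integral_sub hmeas hmeas2]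
      congr 1; ext t; ring
    rw [this, P, A]
    push_cast [tsub_zero]
    ring
  have fl : ∀ t : ℝ, 0≤t → ‖(⌊t⌋₊:ℂ)+1-t‖≤1 := by
    intro t ht
    have : (⌊t⌋₊:ℂ)+1-t=((⌊t⌋₊+1-t:ℝ):ℂ) := by push_cast; ring
    rw [this, Complex.norm_real, norm_eq_abs, abs_le]
    have := Nat.floor_le ht
    have := Nat.lt_floor_add_one t
    constructor <;> linarith
  rw [e]
  have i1 : ‖∫ t in a..b, f' t*((⌊t⌋₊:ℂ)+1-t)‖≤∫ t in a..b, ‖f' t‖ := by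
    refine intervalIntegral.norm_integral_le_of_norm_le hab ?_ hii.norm
    refine Filter.Eventually.of_forall (fun t ht => ?_)
    rw [norm_mul]
    exact mul_le_of_le_one_right (norm_nonneg _) (fl t (ha.trans ht.1.le))
  refine (norm_sub_le _ _).trans (add_le_add ((norm_sub_le _ _).trans ?_) i1)
  rw [norm_mul, norm_mul, add_comm]
  exact add_le_add (mul_le_of_le_one_right (norm_nonneg _) (fl a ha))
    (mul_le_of_le_one_right (norm_nonneg _) (fl b (ha.trans hab)))

/-- `u^{-it}` -/
noncomputable def cx (t u:ℝ) : ℂ := Complex.exp (((-(t*log u):ℝ):ℂ)*Complex.I)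

lemma cx_norm (t u:ℝ) : ‖cx t u‖=1 := Complex.norm_exp_ofReal_mul_I _

lemma cx_mul (t:ℝ) {u v : ℝ} (hu : 0<u) (hv : 0<v) : cx t (u*v)=cx t u*cx t v := by
  unfold cx; rw [log_mul hu.ne' hv.ne', ← Complex.exp_add]; congr 1; push_cast; ring

lemma cx_ee (t u:ℝ) : cx t u=ee (-(t*log u)/(2*π)) := by
  unfold cx ee; congr 3; field_simp

lemma cx_neg (t u:ℝ) : cx (-t) u=(starRingEnd ℂ) (cx t u) := by
  rw [cx_ee, cx_ee, ← ee_neg]; congr 1; ring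

lemma cx_hasDeriv (t:ℝ) {u : ℝ} (hu : 0<u) :
    HasDerivAt (cx t) (cx t u*((-(t/u):ℝ)*Complex.I)) u := by
  unfold cx
  have h : HasDerivAt (fun u : ℝ => (-(t*log u):ℝ)) (-(t*u⁻¹)) u :=
    ((hasDerivAt_log hu.ne').const_mul t).neg
  have := ((h.ofReal_comp).mul_const Complex.I).cexp
  rw [← div_eq_mul_inv] at this
  exact this

lemma cx_continuousOn (t:ℝ) : ContinuousOn (cx t) (Set.Ioi 0) :=
  fun _ hu => (cx_hasDeriv t hu).continuousAt.continuousWithinAt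

lemma cx_integral (t a b:ℝ) (ha : 0<a) (hab : a≤b) (ht : t ≠ 0) :
    ‖∫ u in a..b, cx t u‖≤2*b / |t| := by
  have hne : (1-(t:ℂ)*Complex.I) ≠ 0 := by
    intro h; have := congrArg Complex.re h; simp at this
  have H : ∀ u ∈ Set.uIcc a b, HasDerivAt (fun u : ℝ => (u:ℂ)*cx t u/(1-(t:ℂ)*Complex.I)) (cx t u) u := by
    intro u hu
    rw [Set.uIcc_of_le hab] at hu
    have hu0 : 0<u := ha.trans_le hu.1
    have := ((Complex.ofRealCLM.hasDerivAt (x := u)).mul (cx_hasDeriv t hu0)).div_const (1-(t:ℂ)*Complex.I)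
    refine this.congr_deriv ?_
    simp only [Complex.ofRealCLM_apply, Complex.ofReal_one]
    have : (u:ℂ) ≠ 0 := by exact_mod_cast hu0.ne'
    field_simp
    push_cast
    field_simp
    ring
  rw [intervalIntegral.integral_eq_sub_of_hasDerivAt H]
  · have hn : |t| ≤ ‖(1-(t:ℂ)*Complex.I)‖ := by
      have := Complex.abs_im_le_norm (1-(t:ℂ)*Complex.I)
      simpa using this
    have htp : 0 < |t| := abs_pos.mpr ht
    have hb : 0<b := ha.trans_le hab
    refine (norm_sub_le _ _).trans ?_
    rw [norm_div, norm_div, norm_mul, norm_mul, cx_norm, cx_norm, Complex.norm_real, Complex.norm_real,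
      norm_of_nonneg ha.le, norm_of_nonneg hb.le, mul_one, mul_one, ← add_div]
    gcongr
    linarith
  · apply ContinuousOn.intervalIntegrable
    rw [Set.uIcc_of_le hab]
    exact (cx_continuousOn t).mono (fun u hu => ha.trans_le hu.1)

lemma cx_euler (t a b:ℝ) (ha : 0<a) (hab : a≤b) (hb : b≤2*a) :
    ‖∑ k ∈ Ioc ⌊a⌋₊ ⌊b⌋₊, cx t k-∫ x in a..b, cx t x‖≤2 + |t| := by
  have := euler_sum (cx t) (fun u => cx t u*((-(t/u):ℝ)*Complex.I)) a b ha.le hab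
    (fun x hx => cx_hasDeriv t (ha.trans_le hx.1)) (by
      apply ContinuousOn.mul
      · exact (cx_continuousOn t).mono (fun u hu => ha.trans_le hu.1)
      · apply ContinuousOn.mul _ continuousOn_const
        refine Complex.continuous_ofReal.comp_continuousOn ?_
        refine ContinuousOn.neg (continuousOn_const.div continuousOn_id ?_)
        intro x hx; exact (ha.trans_le hx.1).ne')
  refine this.trans ?_
  rw [cx_norm, cx_norm]
  have i : ∫ x in a..b, ‖cx t x*((-(t/x):ℝ)*Complex.I)‖≤∫ x in a..b, |t| / a := by
    apply intervalIntegral.integral_mono_on hab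
    · apply ContinuousOn.intervalIntegrable
      rw [Set.uIcc_of_le hab]
      apply ContinuousOn.norm
      apply ContinuousOn.mul
      · exact (cx_continuousOn t).mono (fun u hu => ha.trans_le hu.1)
      · apply ContinuousOn.mul _ continuousOn_const
        refine Complex.continuous_ofReal.comp_continuousOn ?_
        refine ContinuousOn.neg (continuousOn_const.div continuousOn_id ?_)
        intro x hx; exact (ha.trans_le hx.1).ne'
    · simp
    · intro x hx
      rw [norm_mul, norm_mul, cx_norm, Complex.norm_real, Complex.norm_I, one_mul, mul_one, norm_neg,
        norm_eq_abs, abs_div, abs_of_pos (ha.trans_le hx.1)]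
      gcongr
      exact hx.1
  rw [intervalIntegral.integral_const, smul_eq_mul] at i
  have : (b-a)*(|t| / a) ≤ |t| := by
    rw [← mul_div_assoc, div_le_iff₀ ha]
    nlinarith [abs_nonneg t]
  linarith

/-- finite differences through derivatives -/
lemma dif_mvt (k:ℕ) : ∀ (F : ℕ → ℝ → ℝ), (∀ (j:ℕ) (y:ℝ), 0<y → HasDerivAt (F j) (F (j+1) y) y) →
    ∀ x : ℝ, 0<x → ∃ ξ ∈ Set.Icc x (x+k), dif k (fun n => F 0 (x+n)) 0=F k ξ := by
  induction k with
  | zero => intro F _ x _; exact ⟨x, by simp, by simp [dif]⟩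
  | succ k ih =>
    intro F hF x hx
    obtain ⟨ξ, hξ, e⟩ := ih (fun j y => F j (y+1)-F j y) (by
      intro j y hy
      have h1 := (hF j (y+1) (by linarith)).comp_add_const y 1
      exact h1.sub (hF j y hy)) x hx
    have hξ0 : 0<ξ := hx.trans_le hξ.1
    obtain ⟨ζ, hζ, e2⟩ := exists_hasDerivAt_eq_slope (F k) (F (k+1)) (show ξ<ξ+1 by linarith)
      (fun y hy => (hF k y (hξ0.trans_le hy.1)).continuousAt.continuousWithinAt)
      (fun y hy => hF k y (show 0<y by have := hy.1; linarith))
    refine ⟨ζ, ⟨by linarith [hξ.1, hζ.1], by push_cast; linarith [hξ.2, hζ.2]⟩, ?_⟩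
    rw [dif, e2]
    simp only [add_sub_cancel_left, div_one]
    rw [← e]
    congr 1; ext n
    push_cast
    ring_nf

noncomputable def lgF (c:ℝ) : ℕ → ℝ → ℝ
  | 0, y => c*log y
  | (j+1), y => c*((-1)^j*(Nat.factorial j)*(y^(j+1))⁻¹)

lemma lgF_deriv (c:ℝ) (j:ℕ) (y:ℝ) (hy : 0<y) : HasDerivAt (lgF c j) (lgF c (j+1) y) y := by
  cases j with
  | zero =>
    have := (hasDerivAt_log hy.ne').const_mul c
    have e : lgF c (0+1) y=c*y⁻¹ := by simp [lgF]
    rw [e]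
    exact this
  | succ j =>
    have h := ((hasDerivAt_pow (j+1) y).inv (pow_ne_zero _ hy.ne')).const_mul ((-1)^j*(Nat.factorial j:ℝ))
    have h2 := h.const_mul c
    have e : lgF c (j+1+1) y=c*((-1)^j*(Nat.factorial j:ℝ)*(-(((j+1:ℕ):ℝ)*y^(j+1-1))/(y^(j+1))^2)) := by
      simp only [lgF, Nat.factorial_succ, add_tsub_cancel_right]; push_cast
      field_simp
      ring
    rw [e]
    exact h2

lemma weyl_k (δ:ℝ) (hδ : 0<δ) (k:ℕ) (hk : 2^(k+2)*δ<1) :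
    ∃ C > (0:ℝ), ∃ c > (0:ℝ), ∀ M N : ℕ, 1≤M → N=2*M → ∀ t : ℝ, 0<t →
      (N:ℝ)^((k:ℝ)+1+(-1-δ*(2^(k+1)-3)))≤t →
      t≤(N:ℝ)^((k:ℝ)+1+(- (δ*(2^(k+2)-3)))) →
      ∀ L, L≤N → ‖∑ n ∈ range L, cx t ((M+1+n:ℕ):ℝ)‖≤C*(N:ℝ)^(1-c) := by
  set κ : ℝ := 1/(2*π)*(Nat.factorial k)*(2/(3*k+8))^(k+1) with hκ
  have hκ0 : 0<κ := by positivity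
  set A : ℝ := 1+κ+κ⁻¹+(3*k+8)^(k+1) with hA
  have hA1 : 1≤A := by
    have : 0<κ⁻¹ := by positivity
    have : (0:ℝ)<(3*k+8)^(k+1) := by positivity
    linarith
  obtain ⟨C, hC, c, hc, G⟩ := good_all δ hδ k hk A hA1
  refine ⟨C, hC, c, hc, ?_⟩
  intro M N hM hN t ht h1 h2 L hL
  have hM1 : (1:ℝ)≤M := by exact_mod_cast hM
  have hNr : (N:ℝ)=2*M := by rw [hN]; push_cast; ring
  have hNp : (0:ℝ)<N := by rw [hNr]; linarith
  set cc : ℝ := (-1)^k*(t/(2*π)) with hcc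
  set a : ℕ → ℝ := fun n => lgF cc 0 ((M+1+n:ℕ):ℝ) with ha
  have hsum : ‖∑ n ∈ range L, cx t ((M+1+n:ℕ):ℝ)‖=‖∑ n ∈ range L, ee (a n)‖ := by
    rcases Nat.even_or_odd k with hev | hod
    · rw [← RCLike.norm_conj, map_sum]
      congr 1
      refine sum_congr rfl (fun n _ => ?_)
      rw [← cx_neg, cx_ee]; congr 1
      simp only [ha, lgF, hcc, hev.neg_one_pow]; ring
    · congr 1
      refine sum_congr rfl (fun n _ => ?_)
      rw [cx_ee]; congr 1
      simp only [ha, lgF, hcc, hod.neg_one_pow]; ring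
  have hdif : ∀ j n : ℕ, ∃ ξ ∈ Set.Icc ((M+1+n:ℕ):ℝ) ((M+1+n:ℕ)+j), dif j a n=lgF cc j ξ := by
    intro j n
    obtain ⟨ξ, hξ, e⟩ := dif_mvt j (lgF cc) (fun j y hy => lgF_deriv cc j y hy) ((M+1+n:ℕ):ℝ) (by positivity)
    refine ⟨ξ, hξ, ?_⟩
    rw [← e]
    have := dif_shift j a n 0
    rw [zero_add] at this
    rw [← this]
    congr 1; ext m
    simp only [ha]; congr 1; push_cast; ring
  set l : ℝ := t*κ/(N:ℝ)^(k+1) with hl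
  have hl0 : 0< l := by positivity
  have hNk : (N:ℝ)^((k:ℝ)+1)=(N:ℝ)^(k+1) := by
    rw [← rpow_natCast]; push_cast; rfl
  have hpk : (0:ℝ)<(3*k+8)^(k+1) := by positivity
  have hκi : 0<κ⁻¹ := by positivity
  rw [hsum]
  refine G N (by omega) l hl0 ?_ ?_ a ?_ ?_ L hL
  · rw [rpow_add hNp, hNk] at h1
    have : (N:ℝ)^(-1-δ*(2^(k+1)-3))≤t/(N:ℝ)^(k+1) := by
      rw [le_div_iff₀ (by positivity)]; linarith
    refine this.trans ?_
    calc t/(N:ℝ)^(k+1)=κ⁻¹*l := by rw [hl]; field_simp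
      _≤A*l := by gcongr; linarith
  · rw [rpow_add hNp, hNk] at h2
    have : t/(N:ℝ)^(k+1)≤(N:ℝ)^(- (δ*(2^(k+2)-3))) := by
      rw [div_le_iff₀ (by positivity)]; linarith
    calc l=κ*(t/(N:ℝ)^(k+1)) := by rw [hl]; ring
      _≤A*_ := by gcongr; linarith
  · intro n hn
    obtain ⟨ξ, hξ, e⟩ := hdif (k+1) n
    rw [e]
    have hnr : (n:ℝ)≤(k+2)*(2*M) := by
      have : n≤(k+1+1)*N := hn.le
      rw [hN] at this
      calc (n:ℝ)≤(((k+1+1)*(2*M):ℕ):ℝ) := by exact_mod_cast this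
        _=_ := by push_cast; ring
    have x1 : (M:ℝ)≤ξ := by
      have := hξ.1; push_cast at this
      have : (0:ℝ)≤n := by positivity
      linarith
    have x0 : 0<ξ := by linarith
    have x2 : ξ≤(3*k+8)*M := by
      have := hξ.2; push_cast at this
      have : (0:ℝ)≤k := by positivity
      nlinarith
    have ev : lgF cc (k+1) ξ=t/(2*π)*(Nat.factorial k)*(ξ^(k+1))⁻¹ := by
      simp only [lgF, hcc]
      have : ((-1:ℝ))^k*(-1)^k=1 := by rw [← mul_pow]; simp
      linear_combination (t/(2*π)*(Nat.factorial k)*(ξ^(k+1))⁻¹)*this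
    have el : l=t/(2*π)*(Nat.factorial k)*(((3*k+8)*(M:ℝ))^(k+1))⁻¹ := by
      rw [hl, hκ, hNr, div_pow, mul_pow, mul_pow]
      field_simp
    rw [ev]
    constructor
    · rw [el]; gcongr
    · calc t/(2*π)*(Nat.factorial k)*(ξ^(k+1))⁻¹
          ≤ t/(2*π)*(Nat.factorial k)*((M:ℝ)^(k+1))⁻¹ := by gcongr
        _=(3*k+8)^(k+1)*l := by rw [el, mul_pow]; field_simp
        _≤A*l := by gcongr; linarith
  · intro n hn
    obtain ⟨ξ, hξ, e⟩ := hdif (k+2) n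
    have s := dif_succ (k+1) a n
    have x0 : 0<ξ := lt_of_lt_of_le (by positivity) hξ.1
    have ev : lgF cc (k+2) ξ = - (t/(2*π)*(Nat.factorial (k+1))*(ξ^(k+2))⁻¹) := by
      simp only [lgF, hcc]
      have : ((-1:ℝ))^k*(-1)^k=1 := by rw [← mul_pow]; simp
      rw [pow_succ]
      linear_combination (-(t/(2*π)*(Nat.factorial (k+1))*(ξ^(k+2))⁻¹))*this
    have : 0≤t/(2*π)*(Nat.factorial (k+1))*(ξ^(k+2))⁻¹ := by positivity
    rw [show k+1+1=k+2 from rfl] at s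
    rw [e, ev] at s
    linarith

lemma weyl_range (δ:ℝ) (hδ : 0<δ) (k:ℕ) (hk : 2^(k+2)*δ<1) :
    ∃ C > (0:ℝ), ∃ c > (0:ℝ), ∀ M N : ℕ, 1≤M → N=2*M → ∀ t : ℝ, 0<t →
      (N:ℝ)^δ≤t →
      t≤(N:ℝ)^((k:ℝ)+1+(- (δ*(2^(k+2)-3)))) →
      ∀ L, L≤N → ‖∑ n ∈ range L, cx t ((M+1+n:ℕ):ℝ)‖≤C*(N:ℝ)^(1-c) := by
  induction k with
  | zero =>
    obtain ⟨C, hC, c, hc, G⟩ := weyl_k δ hδ 0 hk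
    refine ⟨C, hC, c, hc, fun M N hM hN t ht h1 h2 => G M N hM hN t ht ?_ h2⟩
    convert h1 using 2; norm_num
  | succ k ih =>
    obtain ⟨C, hC, c, hc, G⟩ := ih (by
      refine lt_of_le_of_lt ?_ hk
      gcongr <;> norm_num)
    obtain ⟨C', hC', c', hc', G'⟩ := weyl_k δ hδ (k+1) hk
    refine ⟨C+C', by positivity, min c c', lt_min hc hc', ?_⟩
    intro M N hM hN t ht h1 h2 L hL
    have hN1 : (1:ℝ)≤N := by exact_mod_cast (by omega : 1≤N)
    have p1 : (N:ℝ)^(1-c)≤(N:ℝ)^(1-min c c') :=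
      rpow_le_rpow_of_exponent_le hN1 (by linarith [min_le_left c c'])
    have p2 : (N:ℝ)^(1-c')≤(N:ℝ)^(1-min c c') :=
      rpow_le_rpow_of_exponent_le hN1 (by linarith [min_le_right c c'])
    have p0 : 0≤(N:ℝ)^(1-min c c') := by positivity
    rcases le_total t ((N:ℝ)^((k:ℝ)+1+(- (δ*(2^(k+2)-3))))) with h | h
    · refine (G M N hM hN t ht h1 h L hL).trans ?_
      nlinarith
    · refine (G' M N hM hN t ht ?_ h2 L hL).trans ?_
      · refine le_trans (le_of_eq ?_) h
        congr 1; push_cast; ring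
      · nlinarith

/-- Weyl-type bound with main term. -/
theorem weyl (K:ℝ) : ∃ C > (0:ℝ), ∃ c > (0:ℝ), ∀ a b t : ℝ, 1≤a → a≤b → b≤2*a → |t| ≤ a^K →
    ‖∑ m ∈ Ioc ⌊a⌋₊ ⌊b⌋₊, cx t m-∫ u in a..b, cx t u‖≤C*a^(1-c) := by
  obtain ⟨k, hk⟩ := exists_nat_ge K
  set δ : ℝ := 1/2^(k+3) with hδ
  have hδ0 : 0<δ := by positivity
  have hδ1 : δ≤1/8 := by
    rw [hδ]; apply one_div_le_one_div_of_le (by norm_num)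
    have : (1:ℝ)≤2^k := one_le_pow₀ (by norm_num)
    rw [pow_add]; linarith
  have hδk : 2^(k+2)*δ=1/2 := by rw [hδ, pow_succ 2 (k+2)]; field_simp
  obtain ⟨C, hC, c, hc, G⟩ := weyl_range δ hδ0 k (by rw [hδk]; norm_num)
  refine ⟨2*C+12, by positivity, min c δ, lt_min hc hδ0, ?_⟩
  intro a b t ha hab hb ht
  set M := ⌊a⌋₊ with hM
  have hM1 : 1≤M := Nat.le_floor (by simpa using ha)
  have hMa : (M:ℝ)≤a := Nat.floor_le (by linarith)
  have haM : a<M+1 := Nat.lt_floor_add_one a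
  have hM1r : (1:ℝ)≤M := by exact_mod_cast hM1
  set N := 2*M with hN
  have hNr : (N:ℝ)=2*M := by rw [hN]; push_cast; ring
  have haN : a≤N := by linarith
  have hNa : (N:ℝ)≤2*a := by linarith
  have ha0 : 0<a := by linarith
  have q1 : a^(1-c)≤a^(1-min c δ) :=
    rpow_le_rpow_of_exponent_le ha (by linarith [min_le_left c δ])
  have q2 : a^(1-δ)≤a^(1-min c δ) :=
    rpow_le_rpow_of_exponent_le ha (by linarith [min_le_right c δ])
  have q0 : 0<a^(1-min c δ) := by positivity
  have q3 : 1≤a^(1-δ) := one_le_rpow ha (by linarith)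
  by_cases hcase : |t| < (N:ℝ)^δ
  · refine (cx_euler t a b ha0 hab hb).trans ?_
    have : (N:ℝ)^δ≤2*a^(1-δ) := by
      calc (N:ℝ)^δ≤(2*a)^δ := by gcongr
        _=2^δ*a^δ := mul_rpow (by norm_num) ha0.le
        _≤2^(1:ℝ)*a^(1-δ) := by
          gcongr
          · norm_num
          · linarith
          · linarith
        _=_ := by rw [rpow_one]
    nlinarith
  · push Not at hcase
    have htp : 0 < |t| := lt_of_lt_of_le (by positivity) hcase
    have ht0 : t ≠ 0 := abs_pos.mp htp
    have hb2 : ⌊b⌋₊≤M+N := by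
      have : ⌊b⌋₊<2*M+2 := by
        rw [Nat.floor_lt (by linarith)]; push_cast; linarith
      omega
    have hbM : M≤⌊b⌋₊ := Nat.floor_le_floor hab
    have S : ‖∑ m ∈ Ioc M ⌊b⌋₊, cx t m‖≤C*(N:ℝ)^(1-c) := by
      have e : ∀ t : ℝ, ∑ m ∈ Ioc M ⌊b⌋₊, cx t m=∑ n ∈ range (⌊b⌋₊-M), cx t ((M+1+n:ℕ):ℝ) := by
        intro t
        rw [← Ico_add_one_add_one_eq_Ioc, sum_Ico_eq_sum_range]
        congr 2; omega
      have up : |t| ≤ (N:ℝ)^((k:ℝ)+1+(- (δ*(2^(k+2)-3)))) := by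
        refine ht.trans ?_
        have hN1 : (1:ℝ)≤N := by linarith
        calc a^K≤a^((k:ℝ)+1+(- (δ*(2^(k+2)-3)))) := by
              apply rpow_le_rpow_of_exponent_le ha
              nlinarith
          _≤_ := by
              apply rpow_le_rpow ha0.le haN
              have : (0:ℝ)≤k := by positivity
              nlinarith
      have key := G M N hM1 hN |t| htp hcase up (⌊b⌋₊-M) (by omega)
      rw [← e] at key
      rcases abs_choice t with h | h
      · rwa [h] at key
      · rw [h] at key
        simp_rw [cx_neg] at key
        rwa [← map_sum, RCLike.norm_conj] at key
    have I := cx_integral t a b ha0 hab ht0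
    refine (norm_sub_le _ _).trans ?_
    have n1 : (N:ℝ)^(1-c)≤2*a^(1-c) := by
      have e1 : (N:ℝ)^(1-c)=N*(N:ℝ)^(-c) := by
        rw [sub_eq_add_neg, rpow_add (by linarith), rpow_one]
      have e2 : a^(1-c)=a*a^(-c) := by
        rw [sub_eq_add_neg, rpow_add ha0, rpow_one]
      rw [e1, e2, ← mul_assoc]
      apply mul_le_mul hNa _ (by positivity) (by positivity)
      exact rpow_le_rpow_of_nonpos ha0 haN (by linarith)
    have n2 : 2*b / |t| ≤ 4*a^(1-δ) := by
      rw [div_le_iff₀ htp]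
      have e2 : a=a^(1-δ)*a^δ := by
        rw [← rpow_add ha0]; simp
      have : a^δ ≤ |t| := le_trans (by gcongr) hcase
      have : a^(1-δ)*a^δ≤a^(1-δ) * |t| := by gcongr
      linarith
    have : C*(N:ℝ)^(1-c)≤C*(2*a^(1-c)) := by gcongr
    nlinarith

end M1c
end H12
namespace H12
open Real Finset
section M2a

/-! ### M2a: Brun–Hooley sieve, fundamental lemma -/

lemma bonf (x : ℕ → ℝ) (P : Finset ℕ) (hx : ∀ p ∈ P, 0≤x p ∧ x p≤1) (m:ℕ) :
    0≤(-1)^m*(∑ S ∈ P.powerset.filter (fun S => S.card≤ m), (-1)^S.card*∏ p ∈ S, x p-∏ p ∈ P, (1-x p)) ∧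
    (-1)^m*(∑ S ∈ P.powerset.filter (fun S => S.card≤ m), (-1)^S.card*∏ p ∈ S, x p-∏ p ∈ P, (1-x p))
      ≤ ∑ S ∈ P.powersetCard (m+1), ∏ p ∈ S, x p := by
  classical
  induction P using Finset.induction_on generalizing m with
  | empty =>
    have : (powerset (∅ : Finset ℕ)).filter (fun S => S.card≤ m)={∅} := by
      ext S; simp only [powerset_empty, mem_filter, mem_singleton]
      constructor
      · exact fun h => h.1
      · rintro rfl; simp
    rw [this]; simp
    exact sum_nonneg (fun S hS => prod_nonneg (fun p hp => by
      have := (mem_powersetCard.mp hS).1 hp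
      simp at this))
  | insert a P ha ih =>
    have hxP : ∀ p ∈ P, 0≤x p ∧ x p≤1 := fun p hp => hx p (mem_insert_of_mem hp)
    have hxa := hx a (mem_insert_self a P)
    have hinj : Set.InjOn (insert a) (P.powerset : Set (Finset ℕ)) := by
      intro S hS T hT h
      have hS' : a ∉ S := fun h' => ha (mem_powerset.mp hS h')
      have hT' : a ∉ T := fun h' => ha (mem_powerset.mp hT h')
      rw [← erase_insert hS', ← erase_insert hT', h]
    have hpc : ∀ (f : Finset ℕ → ℝ) (m:ℕ), ∑ S ∈ (insert a P).powersetCard (m+1), f S =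
        ∑ S ∈ P.powersetCard (m+1), f S+∑ S ∈ P.powersetCard m, f (insert a S) := by
      intro f m
      rw [powersetCard_succ_insert ha, sum_union, sum_image]
      · intro S hS T hT h
        exact hinj (by simpa using (mem_powersetCard.mp hS).1) (by simpa using (mem_powersetCard.mp hT).1) h
      · rw [disjoint_left]
        intro S hS hS'
        obtain ⟨T, hT, rfl⟩ := mem_image.mp hS'
        exact ha ((mem_powersetCard.mp hS).1 (mem_insert_self a T))
    have hprod : ∀ S ∈ P.powerset, ∏ p ∈ insert a S, x p=x a*∏ p ∈ S, x p := by
      intro S hS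
      exact prod_insert (fun h' => ha (mem_powerset.mp hS h'))
    have hcard : ∀ S ∈ P.powerset, (insert a S).card=S.card+1 := by
      intro S hS
      exact card_insert_of_notMem (fun h' => ha (mem_powerset.mp hS h'))
    have hE : ∑ S ∈ (insert a P).powersetCard (m+1), ∏ p ∈ S, x p =
        ∑ S ∈ P.powersetCard (m+1), ∏ p ∈ S, x p+x a*∑ S ∈ P.powersetCard m, ∏ p ∈ S, x p := by
      rw [hpc, mul_sum]
      congr 1
      refine sum_congr rfl (fun S hS => hprod S ?_)
      exact mem_powerset.mpr (mem_powersetCard.mp hS).1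
    have hR : ∏ p ∈ insert a P, (1-x p)=(1-x a)*∏ p ∈ P, (1-x p) := prod_insert ha
    have hT : ∀ m : ℕ, ∑ S ∈ (insert a P).powerset.filter (fun S => S.card≤ m), (-1)^S.card*∏ p ∈ S, x p
        = ∑ S ∈ P.powerset.filter (fun S => S.card≤ m), (-1)^S.card*∏ p ∈ S, x p
          - x a*∑ S ∈ P.powerset.filter (fun S => S.card+1≤ m), (-1)^S.card*∏ p ∈ S, x p := by
      intro m
      simp only [sum_filter]
      rw [sum_powerset_insert ha, sub_eq_add_neg, mul_sum, ← sum_neg_distrib]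
      congr 1
      refine sum_congr rfl (fun S hS => ?_)
      rw [hprod S hS, hcard S hS]
      split_ifs
      · ring
      · simp
    rw [hE, hR, hT]
    obtain ⟨i1, i2⟩ := ih hxP m
    cases m with
    | zero =>
      have z : (P.powerset.filter (fun S => S.card+1≤0))=∅ := by
        ext; simp
      rw [z]
      simp only [pow_zero, one_mul, sum_empty, mul_zero, sub_zero, powersetCard_zero,
        sum_singleton, prod_empty, mul_one] at i1 i2 ⊢
      have q0 : 0≤∏ p ∈ P, (1-x p) := prod_nonneg (fun p hp => by linarith [(hxP p hp).2])
      have q1 : ∏ p ∈ P, (1-x p)≤1 := prod_le_one (fun p hp => by linarith [(hxP p hp).2])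
        (fun p hp => by linarith [(hxP p hp).1])
      constructor <;> nlinarith
    | succ m =>
      obtain ⟨j1, j2⟩ := ih hxP m
      simp only [Nat.add_le_add_iff_right]
      set T1 := ∑ S ∈ P.powerset.filter (fun S => S.card≤ m+1), (-1)^S.card*∏ p ∈ S, x p
      set T0 := ∑ S ∈ P.powerset.filter (fun S => S.card≤ m), (-1)^S.card*∏ p ∈ S, x p
      set R := ∏ p ∈ P, (1-x p)
      have e : (-1:ℝ)^(m+1)*(T1-x a*T0-(1-x a)*R) =
          (-1)^(m+1)*(T1-R)+x a*((-1)^m*(T0-R)) := by rw [pow_succ]; ring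
      rw [e]
      constructor
      · have := mul_nonneg hxa.1 j1; linarith
      · have := mul_le_mul_of_nonneg_left j2 hxa.1; linarith

noncomputable def pr (w:ℝ) : Finset ℕ := (Icc 1 ⌊w⌋₊).filter Nat.Prime

lemma mem_pr {w : ℝ} {p : ℕ} : p ∈ pr w ↔ p.Prime ∧ (p:ℝ)≤w := by
  unfold pr
  simp only [mem_filter, mem_Icc]
  constructor
  · rintro ⟨⟨h1, h2⟩, h3⟩
    exact ⟨h3, (Nat.le_floor_iff' (by omega)).mp h2⟩
  · rintro ⟨h1, h2⟩
    exact ⟨⟨h1.one_le, (Nat.le_floor_iff' h1.ne_zero).mpr h2⟩, h1⟩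

/-- product of `1 - f p` over primes up to `w` -/
noncomputable def Rp (w:ℝ) (f : ℕ → ℝ) : ℝ := ∏ p ∈ pr w, (1-f p)

/-- functions for which the sieve inequalities are valid -/
def SF (f : ℕ → ℝ) : Prop :=
  f 1=1 ∧ (∀ a b, Nat.Coprime a b → f (a*b)=f a*f b) ∧ ∀ p, p.Prime → 0≤ f p ∧ f p≤1

lemma SF.prod {f : ℕ → ℝ} (hf : SF f) (S : Finset ℕ) (hS : ∀ p ∈ S, p.Prime) :
    f (∏ p ∈ S, p)=∏ p ∈ S, f p := by
  classical
  induction S using Finset.induction_on with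
  | empty => simp [hf.1]
  | insert a S ha ih =>
    rw [prod_insert ha, prod_insert ha, hf.2.1, ih (fun p hp => hS p (mem_insert_of_mem hp))]
    apply Nat.Coprime.prod_right
    intro p hp
    rw [Nat.coprime_primes (hS a (mem_insert_self a S)) (hS p (mem_insert_of_mem hp))]
    rintro rfl; exact ha hp

lemma sum_log_p (N:ℕ) : ∑ p ∈ (Icc 1 N).filter Nat.Prime, log p/p≤2*log N := by
  rcases Nat.eq_zero_or_pos N with rfl | hN
  · simp
  have hNr : (0:ℝ)<N := by exact_mod_cast hN
  -- log N! = ∑ Λ(d) ⌊N/d⌋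
  have h1 : ∑ p ∈ (Icc 1 N).filter Nat.Prime, (N/p:ℕ)*log p≤log (N.factorial) := by
    have hdvd : ∏ p ∈ (Icc 1 N).filter Nat.Prime, p^(N/p) ∣ N.factorial := by
      refine prod_dvd_of_isRelPrime ?_ ?_
      rotate_left
      · intro p hp
        have hpp := (mem_filter.mp hp).2
        rw [hpp.pow_dvd_factorial_iff (b := N+1) (Nat.lt_succ_of_le (Nat.log_le_self p N))]
        have hpN := (mem_Icc.mp (mem_filter.mp hp).1)
        have : (N/p^1)≤∑ i ∈ Ico 1 (N+1), N/p^i :=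
          single_le_sum (f := fun i => N/p^i) (fun i _ => Nat.zero_le _)
            (mem_Ico.mpr ⟨le_rfl, by omega⟩)
        simpa using this
      · intro p hp q hq hpq
        have hpp := (mem_filter.mp hp).2
        have hqq := (mem_filter.mp hq).2
        exact Nat.coprime_iff_isRelPrime.mp (Nat.Coprime.pow _ _ ((Nat.coprime_primes hpp hqq).mpr hpq))
    have hle := Nat.le_of_dvd (Nat.factorial_pos N) hdvd
    have hpos : 0<∏ p ∈ (Icc 1 N).filter Nat.Prime, p^(N/p) :=
      prod_pos (fun p hp => pow_pos (mem_filter.mp hp).2.pos _)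
    have : log ((∏ p ∈ (Icc 1 N).filter Nat.Prime, p^(N/p):ℕ):ℝ)≤log (N.factorial) := by
      apply log_le_log (by exact_mod_cast hpos) (by exact_mod_cast hle)
    rw [Nat.cast_prod, log_prod] at this
    · simpa using this
    · intro p hp
      have := (mem_filter.mp hp).2.pos
      positivity
  have h2 : log (N.factorial)≤N*log N := by
    have : (N.factorial:ℝ)≤(N:ℝ)^N := by exact_mod_cast Nat.factorial_le_pow N
    calc log (N.factorial)≤log ((N:ℝ)^N) := log_le_log (by positivity) this
      _=_ := by rw [log_pow]
  have h3 : ∑ p ∈ (Icc 1 N).filter Nat.Prime, log p/p*(N/2) ≤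
      ∑ p ∈ (Icc 1 N).filter Nat.Prime, (N/p:ℕ)*log p := by
    apply sum_le_sum
    intro p hp
    have hp2 := mem_filter.mp hp
    have hpN := mem_Icc.mp hp2.1
    have hp0 : (0:ℝ)<p := by exact_mod_cast hp2.2.pos
    have hlog : 0≤log p := log_natCast_nonneg p
    have hq1 : 1≤N/p := (Nat.one_le_div_iff hp2.2.pos).mpr hpN.2
    have hlt : N<p*(N/p+1) := Nat.lt_mul_div_succ N hp2.2.pos
    have : (N:ℝ)≤p*(2*(N/p:ℕ)) := by
      have : N≤p*(2*(N/p)) := by nlinarith [hp2.2.pos]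
      exact_mod_cast this
    calc log p/p*(N/2)=log p*(N/(2*p)) := by field_simp
      _≤log p*(N/p:ℕ) := by
        apply mul_le_mul_of_nonneg_left _ hlog
        rw [div_le_iff₀ (by positivity)]; linarith
      _=_ := by ring
  rw [← sum_mul] at h3
  have := h3.trans (h1.trans h2)
  nlinarith

lemma sum_inv_class (w:ℝ) (hw : 1≤w) : ∑ p ∈ (pr w) \ (pr (√w)), (1:ℝ)/p≤4 := by
  rcases eq_or_lt_of_le hw with rfl | hw1
  · simp
  have hlog : 0<log w := log_pos hw1
  have h := sum_log_p ⌊w⌋₊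
  have hf : (⌊w⌋₊:ℝ)≤w := Nat.floor_le (by linarith)
  have hf1 : 1≤⌊w⌋₊ := Nat.le_floor (by simpa using hw)
  have h2 : log ⌊w⌋₊≤log w := log_le_log (by exact_mod_cast hf1) hf
  have h3 : ∑ p ∈ (pr w) \ (pr (√w)), (1:ℝ)/p*(log w/2)≤∑ p ∈ pr w, log p/p := by
    refine le_trans (sum_le_sum (g := fun p : ℕ => log p/p) ?_)
      (sum_le_sum_of_subset_of_nonneg sdiff_subset ?_)
    · intro p hp
      rw [mem_sdiff, mem_pr, mem_pr] at hp
      have : √w<p := by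
        by_contra hcon
        exact hp.2 ⟨hp.1.1, not_lt.mp hcon⟩
      have hl : log w/2≤log p := by
        rw [← log_sqrt (by linarith)]
        exact log_le_log (sqrt_pos.mpr (by linarith)) this.le
      have : (0:ℝ)≤p := by positivity
      rw [div_mul_eq_mul_div, one_mul]
      gcongr
    · intro p _ _
      have := log_natCast_nonneg p
      positivity
  rw [← sum_mul] at h3
  have h4 : ∑ p ∈ pr w, log p/p≤2*log w := le_trans h (by linarith)
  nlinarith

lemma prod_class_lower (w:ℝ) (hw : 1≤w) : 1/256≤∏ p ∈ (pr w) \ (pr (√w)), (1-(1:ℝ)/p) := by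
  have h := sum_inv_class w hw
  have h1 : ∀ p ∈ (pr w) \ (pr (√w)), (4:ℝ)^(-((1:ℝ)/p))≤1-(1:ℝ)/p := by
    intro p hp
    have hp2 := (mem_pr.mp (mem_sdiff.mp hp).1).1.two_le
    have hp2r : (2:ℝ)≤p := by exact_mod_cast hp2
    set y : ℝ := 1/p
    have y0 : 0≤y := by positivity
    have y1 : y≤1/2 := one_div_le_one_div_of_le (by norm_num) hp2r
    -- convexity
    have e : (4:ℝ)^(-y)=(1/2:ℝ)^(2*y) := by
      rw [show (4:ℝ)=((1/2:ℝ))^(-2:ℝ) by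
        rw [rpow_neg (by norm_num)]; norm_num, ← rpow_mul (by norm_num)]
      congr 1; ring
    rw [e]
    have := rpow_one_add_le_one_add_mul_self (s := -(1/2)) (by norm_num) (p := 2*y) (by positivity) (by linarith)
    norm_num at this
    norm_num
    linarith
  calc (1:ℝ)/256=(4:ℝ)^(-(4:ℝ)) := by rw [rpow_neg (by norm_num)]; norm_num
    _≤(4:ℝ)^(∑ p ∈ (pr w) \ (pr (√w)), (-((1:ℝ)/p))) := by
      apply rpow_le_rpow_of_exponent_le (by norm_num)
      rw [sum_neg_distrib]; linarith
    _=∏ p ∈ (pr w) \ (pr (√w)), (4:ℝ)^(-((1:ℝ)/p)) := by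
      rw [rpow_sum_of_pos (by norm_num)]
    _≤_ := prod_le_prod (fun p _ => by positivity) h1

lemma esymm_class (w:ℝ) (hw : 1≤w) (m:ℕ) :
    ∑ S ∈ ((pr w) \ (pr (√w))).powersetCard m, ∏ p ∈ S, (1:ℝ)/p≤exp 8/2^m := by
  have h := sum_inv_class w hw
  rw [le_div_iff₀ (by positivity), sum_mul]
  calc ∑ S ∈ ((pr w) \ (pr (√w))).powersetCard m, (∏ p ∈ S, (1:ℝ)/p)*2^m
      = ∑ S ∈ ((pr w) \ (pr (√w))).powersetCard m, ∏ p ∈ S, (2*((1:ℝ)/p)) := by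
        refine sum_congr rfl (fun S hS => ?_)
        rw [prod_mul_distrib, prod_const, (mem_powersetCard.mp hS).2, mul_comm]
    _≤∑ S ∈ ((pr w) \ (pr (√w))).powerset, ∏ p ∈ S, (2*((1:ℝ)/p)) := by
        apply sum_le_sum_of_subset_of_nonneg
        · intro S hS
          exact mem_powerset.mpr (mem_powersetCard.mp hS).1
        · intro S _ _; exact prod_nonneg (fun p _ => by positivity)
    _=∏ p ∈ (pr w) \ (pr (√w)), (1+2*((1:ℝ)/p)) := by rw [prod_one_add]
    _≤∏ p ∈ (pr w) \ (pr (√w)), exp (2*((1:ℝ)/p)) :=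
        prod_le_prod (fun p _ => by positivity) (fun p _ => by
          have := add_one_le_exp (2*((1:ℝ)/p)); linarith)
    _=exp (∑ p ∈ (pr w) \ (pr (√w)), 2*((1:ℝ)/p)) := by rw [exp_sum]
    _≤exp 8 := by
        apply exp_le_exp.mpr
        rw [← mul_sum]; linarith

end M2a
end H12
namespace H12
open Real Finset
section M2b

noncomputable def Ksv : ℝ := 512*exp 8

/-- existence of an upper-bound sieve for primes up to `w` with precision parameter `b` -/
def SieveOK (w:ℝ) (b:ℕ) : Prop :=
  ∃ (ι κ : Type) (_ : Fintype ι) (_ : Fintype κ) (c : ι → ℝ) (d : ι → ℕ) (c' : κ → ℝ) (d' : κ → ℕ),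
    (∀ i, 1≤d i ∧ (d i:ℝ)≤w^(4*b+8) ∧ ∀ p, p.Prime → p ∣ d i → (p:ℝ)≤w) ∧
    (∀ i, 1≤d' i ∧ (d' i:ℝ)≤w^(4*b+8) ∧ ∀ p, p.Prime → p ∣ d' i → (p:ℝ)≤w) ∧
    ∑ i, |c i| ≤ w^(4*b+8) ∧ ∑ i, |c' i| ≤ w^(4*b+8) ∧
    ∑ i, |c i| * (1/(d i:ℝ))≤(1+log w)^24 ∧ ∑ i, |c' i| * (1/(d' i:ℝ))≤(1+log w)^24 ∧
    (∀ f, SF f → Rp w f≤∑ i, c i*f (d i) ∧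
      ∑ i, c i*f (d i)≤Rp w f+∑ i, c' i*f (d' i)) ∧
    ∑ i, c' i*(1/(d' i:ℝ))≤Rp w (fun n => 1/(n:ℝ))*(exp (Ksv/2^b)-1)

lemma sf_inv : SF (fun n => 1/(n:ℝ)) := by
  refine ⟨by simp, ?_, ?_⟩
  · intro a b _; push_cast; rw [one_div_mul_one_div]
  · intro p hp
    have : (1:ℝ)≤p := by exact_mod_cast hp.one_le
    exact ⟨by positivity, by rw [div_le_one (by linarith)]; exact this⟩

lemma sum_choose_le (n k:ℕ) : ∑ j ∈ range (k+1), n.choose j≤(n+1)^k := by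
  rw [add_pow]
  apply sum_le_sum
  intro j hj
  have h1 := Nat.choose_le_pow n j
  have h2 : 1≤k.choose j := Nat.choose_pos (by simp at hj; omega)
  simp only [one_pow, mul_one, Nat.cast_id]
  nlinarith

lemma card_pr_le (w:ℝ) (hw : 1≤w) : ((pr w).card:ℝ)+1≤w := by
  have h : pr w ⊆ Icc 2 ⌊w⌋₊ := by
    intro p hp
    have := mem_pr.mp hp
    exact mem_Icc.mpr ⟨this.1.two_le, Nat.le_floor this.2⟩
  have h2 := card_le_card h
  rw [Nat.card_Icc] at h2
  have h3 : 1≤⌊w⌋₊ := Nat.le_floor (by simpa using hw)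
  have h4 : (pr w).card+1≤⌊w⌋₊ := by omega
  calc ((pr w).card:ℝ)+1≤⌊w⌋₊ := by exact_mod_cast h4
    _≤w := Nat.floor_le (by linarith)

lemma card_class1 (w:ℝ) (hw : 1≤w) (P : Finset ℕ) (hP : P ⊆ pr w) (k:ℕ) :
    ((P.powerset.filter (fun S => S.card≤k)).card:ℝ)≤w^k := by
  have h : (P.powerset.filter (fun S => S.card≤k)).card≤∑ j ∈ range (k+1), P.card.choose j := by
    have : P.powerset.filter (fun S => S.card≤k) ⊆ (range (k+1)).biUnion (fun j => P.powersetCard j) := by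
      intro S hS
      rw [mem_filter, mem_powerset] at hS
      rw [mem_biUnion]
      exact ⟨S.card, mem_range.mpr (by omega), mem_powersetCard.mpr ⟨hS.1, rfl⟩⟩
    refine (card_le_card this).trans (card_biUnion_le.trans ?_)
    simp
  have h2 := h.trans (sum_choose_le P.card k)
  have h3 := card_pr_le w hw
  have h4 : (P.card:ℝ)≤(pr w).card := by exact_mod_cast card_le_card hP
  calc ((P.powerset.filter (fun S => S.card≤k)).card:ℝ)≤((P.card:ℝ)+1)^k := by exact_mod_cast h2
    _≤w^k := by gcongr; linarith

lemma card_class2 (w:ℝ) (hw : 1≤w) (P : Finset ℕ) (hP : P ⊆ pr w) (k:ℕ) :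
    ((P.powersetCard k).card:ℝ)≤w^k := by
  rw [card_powersetCard]
  have h3 := card_pr_le w hw
  have h4 : (P.card:ℝ)≤(pr w).card := by exact_mod_cast card_le_card hP
  calc ((P.card.choose k:ℕ):ℝ)≤(P.card:ℝ)^k := by exact_mod_cast Nat.choose_le_pow _ _
    _≤w^k := by gcongr; linarith

lemma prod_class_le (w:ℝ) (hw : 1≤w) (S : Finset ℕ) (hS : S ⊆ pr w) (k:ℕ) (hk : S.card≤k) :
    1≤∏ p ∈ S, p ∧ ((∏ p ∈ S, p:ℕ):ℝ)≤w^k := by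
  constructor
  · exact prod_pos (fun p hp => (mem_pr.mp (hS hp)).1.pos)
  · push_cast
    calc ∏ p ∈ S, (p:ℝ)≤∏ p ∈ S, w := prod_le_prod (fun p _ => by positivity) (fun p hp => (mem_pr.mp (hS hp)).2)
      _=w^S.card := by simp
      _≤w^k := pow_le_pow_right₀ hw hk

lemma prime_dvd_class {S : Finset ℕ} (hS : ∀ p ∈ S, p.Prime) {p : ℕ} (hp : p.Prime) (h : p ∣ ∏ p ∈ S, p) : p ∈ S := by
  obtain ⟨a, ha, hd⟩ := (hp.prime.dvd_finsetProd_iff _).mp h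
  rwa [(Nat.prime_dvd_prime_iff_eq hp (hS a ha)).mp hd]

/-- the one-class (Brun) sieve -/
lemma class_sieve (w:ℝ) (hw : 1≤w) (b:ℕ) :
  ∃ (ι κ : Type) (_ : Fintype ι) (_ : Fintype κ) (c : ι → ℝ) (d : ι → ℕ) (c' : κ → ℝ) (d' : κ → ℕ),
    (∀ i, 1≤d i ∧ (d i:ℝ)≤w^(2*b+1) ∧ ∀ p, p.Prime → p ∣ d i → p ∈ pr w \ pr (√w)) ∧
    (∀ i, 1≤d' i ∧ (d' i:ℝ)≤w^(2*b+1) ∧ ∀ p, p.Prime → p ∣ d' i → p ∈ pr w \ pr (√w)) ∧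
    ∑ i, |c i| ≤ w^(2*b+1) ∧ ∑ i, |c' i| ≤ w^(2*b+1) ∧
    ∑ i, |c i| * (1/(d i:ℝ))≤exp 4 ∧ ∑ i, |c' i| * (1/(d' i:ℝ))≤exp 4 ∧
    (∀ f, SF f → ∏ p ∈ pr w \ pr (√w), (1-f p)≤∑ i, c i*f (d i) ∧
      ∑ i, c i*f (d i)≤∏ p ∈ pr w \ pr (√w), (1-f p)+∑ i, c' i*f (d' i)) ∧
    ∑ i, c' i*(1/(d' i:ℝ))≤(∏ p ∈ pr w \ pr (√w), (1-1/(p:ℝ)))*(256*exp 8/2^(2*b+1)) := by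
  classical
  set P := pr w \ pr (√w) with hPdef
  have htot : ∀ A : Finset (Finset ℕ), A ⊆ P.powerset → ∑ S ∈ A, (1/((∏ p ∈ S, p:ℕ):ℝ))≤exp 4 := by
    intro A hA
    refine (sum_le_sum_of_subset_of_nonneg hA (fun S _ _ => by positivity)).trans ?_
    have e : ∑ S ∈ P.powerset, (1/((∏ p ∈ S, p:ℕ):ℝ))=∏ p ∈ P, (1+1/(p:ℝ)) := by
      rw [prod_one_add]
      refine sum_congr rfl (fun S _ => ?_)
      push_cast; rw [prod_div_distrib]; simp
    rw [e]
    calc ∏ p ∈ P, (1+1/(p:ℝ))≤∏ p ∈ P, exp (1/(p:ℝ)) := by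
          apply prod_le_prod
          · intro p _; positivity
          · intro p _; linarith [add_one_le_exp (1/(p:ℝ))]
      _=exp (∑ p ∈ P, 1/(p:ℝ)) := by rw [exp_sum]
      _≤exp 4 := exp_le_exp.mpr (sum_inv_class w hw)
  have hPw : P ⊆ pr w := sdiff_subset
  have hPp : ∀ p ∈ P, p.Prime := fun p hp => (mem_pr.mp (hPw hp)).1
  set I := P.powerset.filter (fun S => S.card≤2*b) with hI
  set K := P.powersetCard (2*b+1) with hK
  have sI : ∀ S ∈ I, S ⊆ P := fun S hS => mem_powerset.mp (mem_filter.mp hS).1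
  have sK : ∀ S ∈ K, S ⊆ P := fun S hS => (mem_powersetCard.mp hS).1
  have cI : ∀ S ∈ I, S.card≤2*b := fun S hS => (mem_filter.mp hS).2
  have cK : ∀ S ∈ K, S.card=2*b+1 := fun S hS => (mem_powersetCard.mp hS).2
  have conv : ∀ (A : Finset (Finset ℕ)) (g : Finset ℕ → ℝ), ∑ i : A, g i=∑ S ∈ A, g S :=
    fun A g => sum_coe_sort A g
  refine ⟨I, K, inferInstance, inferInstance, fun S => (-1)^(S:Finset ℕ).card, fun S => ∏ p ∈ (S:Finset ℕ), p,
    fun S => 1, fun S => ∏ p ∈ (S:Finset ℕ), p, ?_, ?_, ?_, ?_, ?_, ?_, ?_, ?_⟩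
  · rintro ⟨S, hS⟩
    have := prod_class_le w hw S ((sI S hS).trans hPw) (2*b+1) (by have := cI S hS; omega)
    refine ⟨this.1, this.2, fun p hp hd => sI S hS (prime_dvd_class (fun p hp => hPp p (sI S hS hp)) hp hd)⟩
  · rintro ⟨S, hS⟩
    have := prod_class_le w hw S ((sK S hS).trans hPw) (2*b+1) (by have := cK S hS; omega)
    refine ⟨this.1, this.2, fun p hp hd => sK S hS (prime_dvd_class (fun p hp => hPp p (sK S hS hp)) hp hd)⟩
  · rw [conv I (fun S => |(-1:ℝ)^S.card|)]
    simp only [abs_pow, abs_neg, abs_one, one_pow, sum_const, nsmul_eq_mul, mul_one]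
    exact (card_class1 w hw P hPw (2*b)).trans (pow_le_pow_right₀ hw (by omega))
  · rw [conv K (fun S => |(1:ℝ)|)]
    simp only [abs_one, sum_const, nsmul_eq_mul, mul_one]
    exact card_class2 w hw P hPw (2*b+1)
  · rw [conv I (fun S => |(-1:ℝ)^S.card| * (1/((∏ p ∈ S, p:ℕ):ℝ)))]
    simp only [abs_pow, abs_neg, abs_one, one_pow, one_mul]
    exact htot I (filter_subset _ _)
  · rw [conv K (fun S => |(1:ℝ)| * (1/((∏ p ∈ S, p:ℕ):ℝ)))]
    simp only [abs_one, one_mul]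
    exact htot K (fun S hS => mem_powerset.mpr (sK S hS))
  · intro f hf
    rw [conv I (fun S => (-1:ℝ)^S.card*f (∏ p ∈ S, p)), conv K (fun S => (1:ℝ)*f (∏ p ∈ S, p))]
    have e1 : ∑ S ∈ I, (-1:ℝ)^S.card*f (∏ p ∈ S, p)=∑ S ∈ I, (-1:ℝ)^S.card*∏ p ∈ S, f p :=
      sum_congr rfl (fun S hS => by rw [hf.prod S (fun p hp => hPp p (sI S hS hp))])
    have e2 : ∑ S ∈ K, (1:ℝ)*f (∏ p ∈ S, p)=∑ S ∈ K, ∏ p ∈ S, f p :=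
      sum_congr rfl (fun S hS => by rw [one_mul, hf.prod S (fun p hp => hPp p (sK S hS hp))])
    rw [e1, e2]
    have := bonf f P (fun p hp => hf.2.2 p (hPp p hp)) (2*b)
    rw [pow_mul, neg_one_sq, one_pow, one_mul] at this
    constructor
    · linarith [this.1]
    · linarith [this.2]
  · rw [conv K (fun S => (1:ℝ)*(1/((∏ p ∈ S, p:ℕ):ℝ)))]
    have e2 : ∑ S ∈ K, (1:ℝ)*(1/((∏ p ∈ S, p:ℕ):ℝ))=∑ S ∈ K, ∏ p ∈ S, (1:ℝ)/p :=
      sum_congr rfl (fun S hS => by rw [one_mul]; push_cast; rw [prod_div_distrib]; simp)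
    rw [e2]
    have h1 := esymm_class w hw (2*b+1)
    have h2 := prod_class_lower w hw
    have h3 : (0:ℝ)<exp 8/2^(2*b+1) := by positivity
    calc ∑ S ∈ K, ∏ p ∈ S, (1:ℝ)/p≤exp 8/2^(2*b+1) := h1
      _=1/256*(256*exp 8/2^(2*b+1)) := by ring
      _≤_ := by gcongr

set_option maxHeartbeats 1000000 in
lemma sieve_step (w:ℝ) (hw : 2≤w) (b:ℕ) (h : SieveOK (√w) (b+1)) : SieveOK w b := by
  classical
  obtain ⟨ι1, κ1, _, _, c1, d1, c1', d1', hd1, hd1', hs1, hs1', hW1, hW1', hf1, hr1⟩ := h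
  obtain ⟨ι2, κ2, _, _, c2, d2, c2', d2', hd2, hd2', hs2, hs2', hW2, hW2', hf2, hr2⟩ := class_sieve w (by linarith) b
  have w0 : 0≤w := by linarith
  have hsq : ∀ n : ℕ, (√w)^(2*n)=w^n := fun n => by rw [pow_mul, sq_sqrt w0]
  have hE : (√w)^(4*(b+1)+8)=w^(2*b+6) := by rw [← hsq]; ring_nf
  rw [hE] at hs1 hs1'
  simp only [hE] at hd1 hd1'
  have hmul : w^(2*b+6)*w^(2*b+1)=w^(4*b+7) := by rw [← pow_add]; ring_nf
  have hsub : w^(4*b+7)≤w^(4*b+8) := pow_le_pow_right₀ (by linarith) (by omega)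
  have hdbl : w^(4*b+7)+w^(4*b+7)≤w^(4*b+8) := by
    rw [pow_succ w (4*b+7)]
    have : 0≤w^(4*b+7) := by positivity
    calc w^(4*b+7)+w^(4*b+7)=w^(4*b+7)*2 := by ring
      _≤_ := by gcongr
  have hsqw : √w≤w := by
    rw [sqrt_le_left (by linarith)]; nlinarith
  have hcop : ∀ a b : ℕ, (∀ p, p.Prime → p ∣ a → (p:ℝ)≤√w) → (∀ p, p.Prime → p ∣ b → p ∈ pr w \ pr (√w)) →
      Nat.Coprime a b := by
    intro a b ha hb
    refine Nat.Coprime.symm ?_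
    rw [Nat.coprime_comm]
    by_contra hne
    obtain ⟨p, hp, h1, h2⟩ := Nat.Prime.not_coprime_iff_dvd.mp hne
    have := mem_sdiff.mp (hb p hp h2)
    exact this.2 (mem_pr.mpr ⟨hp, ha p hp h1⟩)
  have size : ∀ a b' : ℕ, (1≤a ∧ (a:ℝ)≤w^(2*b+6) ∧ ∀ p, p.Prime → p ∣ a → (p:ℝ)≤√w) →
     (1≤b' ∧ (b':ℝ)≤w^(2*b+1) ∧ ∀ p, p.Prime → p ∣ b' → p ∈ pr w \ pr (√w)) →
     (1≤a*b' ∧ ((a*b':ℕ):ℝ)≤w^(4*b+8) ∧ ∀ p, p.Prime → p ∣ a*b' → (p:ℝ)≤w) := by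
    intro a b' ha hb
    refine ⟨Nat.mul_pos ha.1 hb.1, ?_, ?_⟩
    · push_cast
      refine le_trans ?_ hsub
      rw [← hmul]
      exact mul_le_mul ha.2.1 hb.2.1 (by positivity) (by positivity)
    · intro p hp hd
      rcases (hp.dvd_mul).mp hd with h | h
      · exact (ha.2.2 p hp h).trans hsqw
      · exact (mem_pr.mp (mem_sdiff.mp (hb.2.2 p hp h)).1).2
  have hRp : ∀ f, Rp w f=Rp (√w) f*∏ p ∈ pr w \ pr (√w), (1-f p) := by
    intro f
    unfold Rp
    rw [mul_comm, prod_sdiff]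
    intro p hp
    exact mem_pr.mpr ⟨(mem_pr.mp hp).1, (mem_pr.mp hp).2.trans hsqw⟩
  have prodsum : ∀ {α β : Type} [Fintype α] [Fintype β] (x : α → ℝ) (y : β → ℝ),
      ∑ i : α × β, x i.1*y i.2=(∑ i, x i)*∑ j, y j := by
    intro α β _ _ x y
    rw [Fintype.sum_prod_type, sum_mul_sum]
  have prodsumf : ∀ {α β : Type} [Fintype α] [Fintype β] (x : α → ℝ) (y : β → ℝ) (u : α → ℕ) (v : β → ℕ)
      (_ : ∀ i, ∀ p, p.Prime → p ∣ u i → (p:ℝ)≤√w) (_ : ∀ i, ∀ p, p.Prime → p ∣ v i → p ∈ pr w \ pr (√w))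
      (f : ℕ → ℝ) (_ : SF f), ∑ i : α × β, x i.1*y i.2*f (u i.1*v i.2) =
        (∑ i, x i*f (u i))*∑ j, y j*f (v j) := by
    intro α β _ _ x y u v hu hv f hf
    rw [← prodsum]
    refine sum_congr rfl (fun i _ => ?_)
    rw [hf.2.1 _ _ (hcop _ _ (hu i.1) (hv i.2))]; ring
  have abssum : ∀ {α β : Type} [Fintype α] [Fintype β] (x : α → ℝ) (y : β → ℝ)
     (_ : ∑ i, |x i| ≤ w^(2*b+6)) (_ : ∑ i, |y i| ≤ w^(2*b+1)), ∑ i : α × β, |x i.1*y i.2| ≤ w^(4*b+7) := by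
    intro α β _ _ x y hx hy
    simp only [abs_mul]
    rw [prodsum (fun i => |x i|) (fun i => |y i|), ← hmul]
    exact mul_le_mul hx hy (sum_nonneg (fun i _ => abs_nonneg _)) (by positivity)
  have abssumW : ∀ {α β : Type} [Fintype α] [Fintype β] (x : α → ℝ) (y : β → ℝ) (u : α → ℕ) (v : β → ℕ)
     (_ : ∑ i, |x i| * (1/(u i:ℝ))≤(1+log (√w))^24) (_ : ∑ i, |y i| * (1/(v i:ℝ))≤exp 4),
     ∑ i : α × β, |x i.1*y i.2| * (1/((u i.1*v i.2:ℕ):ℝ))≤(1+log (√w))^24*exp 4 := by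
    intro α β _ _ x y u v hx hy
    have : ∀ i : α × β, |x i.1*y i.2| * (1/((u i.1*v i.2:ℕ):ℝ)) =
        (|x i.1| * (1/(u i.1:ℝ)))*(|y i.2| * (1/(v i.2:ℝ))) := by
      intro i; rw [abs_mul]; push_cast; rw [← one_div_mul_one_div]; ring
    rw [sum_congr rfl (fun i _ => this i), prodsum (fun i => |x i| * (1/(u i:ℝ))) (fun i => |y i| * (1/(v i:ℝ)))]
    refine mul_le_mul hx hy (sum_nonneg (fun i _ => by positivity)) ?_
    exact le_trans (sum_nonneg (fun i _ => by positivity)) hx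
  have hWW : (1+log (√w))^24*exp 4+(1+log (√w))^24*exp 4≤(1+log w)^24 := by
    rw [log_sqrt w0]
    have hl : 0.69≤log w := by
      have := log_two_gt_d9
      have h2 : log 2≤log w := log_le_log (by norm_num) hw
      linarith
    have h4 : exp 4≤60 := by
      have := exp_one_lt_d9
      have e : exp 4=exp 1^4 := by rw [← exp_nat_mul]; norm_num
      rw [e]
      calc exp 1^4≤2.72^4 := by gcongr; linarith
        _≤60 := by norm_num
    have h5 : 1.25*(1+log w/2)≤1+log w := by linarith
    have h6 : (1.25*(1+log w/2))^24≤(1+log w)^24 := by gcongr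
    rw [mul_pow] at h6
    have h7 : (120:ℝ)≤1.25^24 := by norm_num
    have h8 : 0≤(1+log w/2)^24 := by positivity
    calc _=(1+log w/2)^24*(2*exp 4) := by ring
      _≤(1+log w/2)^24*1.25^24 := by gcongr; linarith only [h4, h7]
      _≤_ := by rw [mul_comm]; exact h6
  have Rnn : ∀ f, SF f → 0≤Rp (√w) f := fun f hf =>
    prod_nonneg (fun p hp => by linarith [(hf.2.2 p (mem_pr.mp hp).1).2])
  have Pnn : ∀ f, SF f → 0≤∏ p ∈ pr w \ pr (√w), (1-f p) := fun f hf =>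
    prod_nonneg (fun p hp => by linarith [(hf.2.2 p (mem_pr.mp (mem_sdiff.mp hp).1).1).2])
  have hsumf : ∀ f, SF f → ∑ i : (κ1 × ι2) ⊕ (ι1 × κ2),
      (Sum.elim (fun i : κ1 × ι2 => c1' i.1*c2 i.2) (fun i : ι1 × κ2 => c1 i.1*c2' i.2) i) *
      f (Sum.elim (fun i : κ1 × ι2 => d1' i.1*d2 i.2) (fun i : ι1 × κ2 => d1 i.1*d2' i.2) i) =
      (∑ i, c1' i*f (d1' i))*(∑ i, c2 i*f (d2 i))+(∑ i, c1 i*f (d1 i))*(∑ i, c2' i*f (d2' i)) := by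
    intro f hf
    rw [Fintype.sum_sum_type]
    simp only [Sum.elim_inl, Sum.elim_inr]
    rw [prodsumf c1' c2 d1' d2 (fun i => (hd1' i).2.2) (fun i => (hd2 i).2.2) f hf,
      prodsumf c1 c2' d1 d2' (fun i => (hd1 i).2.2) (fun i => (hd2' i).2.2) f hf]
  refine ⟨ι1 × ι2, (κ1 × ι2) ⊕ (ι1 × κ2), inferInstance, inferInstance, fun i => c1 i.1*c2 i.2,
    fun i => d1 i.1*d2 i.2, Sum.elim (fun i => c1' i.1*c2 i.2) (fun i => c1 i.1*c2' i.2),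
    Sum.elim (fun i => d1' i.1*d2 i.2) (fun i => d1 i.1*d2' i.2), ?_, ?_, ?_, ?_, ?_, ?_, ?_, ?_⟩
  · intro i; exact size _ _ (hd1 i.1) (hd2 i.2)
  · rintro (i | i)
    · exact size _ _ (hd1' i.1) (hd2 i.2)
    · exact size _ _ (hd1 i.1) (hd2' i.2)
  · exact (abssum c1 c2 hs1 hs2).trans hsub
  · rw [Fintype.sum_sum_type]
    simp only [Sum.elim_inl, Sum.elim_inr]
    exact (add_le_add (abssum c1' c2 hs1' hs2) (abssum c1 c2' hs1 hs2')).trans hdbl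
  · refine (abssumW c1 c2 d1 d2 hW1 hW2).trans (le_trans ?_ hWW)
    rw [log_sqrt w0]
    have hl : 0≤log w := log_nonneg (by linarith)
    have : 0≤(1+log w/2)^24*exp 4 := by positivity
    linarith
  · rw [Fintype.sum_sum_type]
    simp only [Sum.elim_inl, Sum.elim_inr]
    exact (add_le_add (abssumW c1' c2 d1' d2 hW1' hW2) (abssumW c1 c2' d1 d2' hW1 hW2')).trans hWW
  · intro f hf
    rw [prodsumf c1 c2 d1 d2 (fun i => (hd1 i).2.2) (fun i => (hd2 i).2.2) f hf, hsumf f hf, hRp f]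
    have a1 := hf1 f hf
    have a2 := hf2 f hf
    have r := Rnn f hf
    have q := Pnn f hf
    set A := ∑ i, c1 i*f (d1 i)
    set B := ∑ i, c2 i*f (d2 i)
    set e1 := ∑ i, c1' i*f (d1' i)
    set e2 := ∑ i, c2' i*f (d2' i)
    set X := Rp (√w) f
    set Y := ∏ p ∈ pr w \ pr (√w), (1-f p)
    constructor
    · exact mul_le_mul a1.1 a2.1 q (r.trans a1.1)
    · have g1 : (A-X)*B≤e1*B := mul_le_mul_of_nonneg_right (by linarith) (q.trans a2.1)
      have g2 : X*(B-Y)≤A*e2 := mul_le_mul a1.1 (by linarith) (by linarith) (r.trans a1.1)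
      have e : A*B=X*Y+(A-X)*B+X*(B-Y) := by ring
      linarith only [e, g1, g2]
  · have := hsumf _ sf_inv
    beta_reduce at this
    rw [this, hRp]
    have a1 := hf1 _ sf_inv
    have a2 := hf2 _ sf_inv
    have r := Rnn _ sf_inv
    have q := Pnn _ sf_inv
    beta_reduce at a1 a2 q r
    set A := ∑ i, c1 i*(1/(d1 i:ℝ))
    set B := ∑ i, c2 i*(1/(d2 i:ℝ))
    set e1 := ∑ i, c1' i*(1/(d1' i:ℝ))
    set e2 := ∑ i, c2' i*(1/(d2' i:ℝ))
    set X := Rp (√w) (fun n => 1/(n:ℝ))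
    set Y := ∏ p ∈ pr w \ pr (√w), (1-1/(p:ℝ))
    set η := exp (Ksv/2^(b+1))
    set ε := 256*exp 8/2^(2*b+1) with hε
    have hη : 1≤η := one_le_exp (by unfold Ksv; positivity)
    have hε0 : 0≤ε := by positivity
    have e1nn : 0≤e1 := by linarith [a1.1]
    have e2nn : 0≤e2 := by linarith [a2.1]
    have hB : B≤Y*(1+ε) := by
      have e : Y*(1+ε)=Y+Y*ε := by ring
      rw [e]; linarith only [a2.2, hr2]
    have hA : A≤X*η := by
      have e : X*η=X+X*(η-1) := by ring
      rw [e]; exact a1.2.trans (add_le_add le_rfl hr1)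
    have key : η*(1+2*ε)≤exp (Ksv/2^b) := by
      have : 1+2*ε≤exp (Ksv/2^(b+1)) := by
        refine le_trans ?_ (exp_le_exp.mpr (?_ : 2*ε≤_))
        · linarith [add_one_le_exp (2*ε)]
        · rw [hε]; unfold Ksv
          rw [show 2*(256*exp 8/2^(2*b+1))=512*exp 8/2^(2*b+1) by ring]
          gcongr
          · norm_num
          · omega
      calc η*(1+2*ε)≤η*exp (Ksv/2^(b+1)) := by gcongr
        _=exp (Ksv/2^b) := by
          rw [← exp_add]; congr 1; rw [pow_succ]; field_simp; norm_num
    have g1 : e1*B≤(X*(η-1))*(Y*(1+ε)) := mul_le_mul hr1 hB (q.trans a2.1) (mul_nonneg r (by linarith))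
    have g2 : A*e2≤(X*η)*(Y*ε) := mul_le_mul hA hr2 e2nn (mul_nonneg r (by linarith))
    calc e1*B+A*e2≤(X*(η-1))*(Y*(1+ε))+(X*η)*(Y*ε) := add_le_add g1 g2
      _=X*Y*((η-1)*(1+ε)+η*ε) := by ring
      _≤X*Y*(exp (Ksv/2^b)-1) := by
        gcongr
        have e : (η-1)*(1+ε)+η*ε=η*(1+2*ε)-1-ε := by ring
        rw [e]; linarith only [key, hε0]

lemma sieve_base (w:ℝ) (hw1 : 1≤w) (hw : w<2) (b:ℕ) : SieveOK w b := by
  have hpr : pr w=∅ := by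
    ext p; simp only [mem_pr, notMem_empty, iff_false, not_and, not_le]
    intro hp
    have : (2:ℝ)≤p := by exact_mod_cast hp.two_le
    linarith
  have h1 : 1≤w^(4*b+8) := one_le_pow₀ hw1
  have hL : 0≤log w := log_nonneg hw1
  have h2 : 1≤(1+log w)^24 := one_le_pow₀ (by linarith)
  refine ⟨Unit, Empty, inferInstance, inferInstance, fun _ => 1, fun _ => 1, fun _ => 1, fun _ => 1, ?_, ?_, ?_, ?_, ?_, ?_, ?_, ?_⟩
  · intro _
    refine ⟨le_rfl, by simpa using h1, fun p hp h => ?_⟩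
    exact absurd (Nat.dvd_one.mp h) hp.one_lt.ne'
  · intro i; exact i.elim
  · simpa using h1
  · simp; linarith
  · simpa using h2
  · simp; linarith
  · intro f hf
    simp [Rp, hpr, hf.1]
  · simp [Rp, hpr]
    unfold Ksv; positivity

theorem sieve_ok (w:ℝ) (hw : 1≤w) (b:ℕ) : SieveOK w b := by
  have main : ∀ J : ℕ, ∀ w : ℝ, 1≤w → w<2^(2^J) → ∀ b, SieveOK w b := by
    intro J
    induction J with
    | zero => intro w h1 h2 b; exact sieve_base w h1 (by simpa using h2) b
    | succ J ih =>
      intro w h1 h2 b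
      rcases lt_or_ge w 2 with h | h
      · exact sieve_base w h1 h b
      · apply sieve_step w h b
        apply ih
        · exact one_le_sqrt.mpr h1
        · rw [sqrt_lt' (by positivity), ← pow_mul, ← pow_succ]
          exact h2
  obtain ⟨J, hJ⟩ := pow_unbounded_of_one_lt w (by norm_num : (1:ℝ)<2)
  refine main J w hw (hJ.trans_le ?_) b
  exact pow_le_pow_right₀ (by norm_num) (Nat.lt_two_pow_self).le

end M2b
end H12
namespace H12
open Real Finset
section M2c

open Classical in
/-- indicator of the integers without prime factor `≤ z` -/
noncomputable def rf (z:ℝ) (n:ℕ) : ℝ := if n ≠ 0 ∧ ∀ p, p.Prime → p ∣ n → z<p then 1 else 0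

noncomputable def Vz (z:ℝ) : ℝ := Rp z (fun n => 1/(n:ℝ))

lemma rf_nonneg (z:ℝ) (n:ℕ) : 0≤ rf z n := by unfold rf; split_ifs <;> norm_num
lemma rf_le_one (z:ℝ) (n:ℕ) : rf z n≤1 := by unfold rf; split_ifs <;> norm_num
lemma rf_zero (z:ℝ) : rf z 0=0 := by unfold rf; simp
lemma rf_one (z:ℝ) : rf z 1=1 := by
  unfold rf; rw [if_pos]
  exact ⟨one_ne_zero, fun p hp h => absurd (Nat.dvd_one.mp h) hp.one_lt.ne'⟩


lemma rf_small (z:ℝ) (n:ℕ) (h1 : n ≠ 1) (hz : (n:ℝ)≤z) : rf z n=0 := by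
  unfold rf
  rw [if_neg]
  rintro ⟨h0, h⟩
  have hp := Nat.minFac_prime h1
  have := h _ hp (Nat.minFac_dvd n)
  have h3 : (n.minFac:ℝ)≤n := by exact_mod_cast Nat.minFac_le (Nat.pos_of_ne_zero h0)
  linarith

lemma sf_dvd (n:ℕ) : SF (fun d => if d ∣ n then 1 else 0) := by
  refine ⟨by simp, ?_, ?_⟩
  · intro a b hab
    have : a*b ∣ n ↔ a ∣ n ∧ b ∣ n :=
      ⟨fun h => ⟨(Dvd.intro _ rfl).trans h, (Dvd.intro_left _ rfl).trans h⟩, fun h => hab.mul_dvd_of_dvd_of_dvd h.1 h.2⟩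
    simp only [this]
    by_cases h1 : a ∣ n <;> by_cases h2 : b ∣ n <;> simp [h1, h2]
  · intro p _; beta_reduce; split_ifs <;> norm_num

lemma Rp_dvd (z:ℝ) (n:ℕ) (hn : n ≠ 0) : Rp z (fun d => if d ∣ n then 1 else 0)=rf z n := by
  unfold Rp rf
  split_ifs with h
  · apply prod_eq_one
    intro p hp
    have hp' := mem_pr.mp hp
    beta_reduce
    rw [if_neg, sub_zero]
    intro hd
    linarith [h.2 p hp'.1 hd, hp'.2]
  · have : ∃ p, p.Prime ∧ p ∣ n ∧ (p:ℝ)≤z := by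
      by_contra hcon
      push Not at hcon
      exact h ⟨hn, hcon⟩
    obtain ⟨p, hp, hd, hz⟩ := this
    apply prod_eq_zero (mem_pr.mpr ⟨hp, hz⟩)
    simp [hd]

lemma Vz_pos (z:ℝ) : 0<Vz z := by
  unfold Vz Rp
  apply prod_pos
  intro p hp
  have : (2:ℝ)≤p := by exact_mod_cast (mem_pr.mp hp).1.two_le
  have : 1/(p:ℝ)≤1/2 := one_div_le_one_div_of_le (by norm_num) this
  linarith

noncomputable def invHom : ℕ →* ℝ where
  toFun n := (n:ℝ)⁻¹
  map_one' := by simp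
  map_mul' a b := by push_cast; rw [mul_inv]

lemma Vz_le (z:ℝ) (hz : 1<z) : Vz z≤1/log z := by
  have hlog := log_pos hz
  set N := ⌊z⌋₊+1
  have h := EulerProduct.summable_and_hasSum_smoothNumbers_prod_primesBelow_geometric (f := invHom)
    (by intro p hp
        have : (2:ℝ)≤p := by exact_mod_cast hp.two_le
        simp only [invHom, MonoidHom.coe_mk, OneHom.coe_mk]
        rw [norm_inv, RCLike.norm_natCast]
        exact inv_lt_one_of_one_lt₀ (by linarith)) N
  have e : ∏ p ∈ N.primesBelow, (1-invHom p)⁻¹=(Vz z)⁻¹ := by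
    rw [prod_inv_distrib]
    congr 1
    unfold Vz Rp
    refine prod_congr ?_ ?_
    · ext p
      rw [Nat.mem_primesBelow, mem_pr]
      constructor
      · rintro ⟨h1, h2⟩; exact ⟨h2, (Nat.le_floor_iff' h2.ne_zero).mp (Nat.lt_succ_iff.mp h1)⟩
      · rintro ⟨h1, h2⟩; exact ⟨Nat.lt_succ_iff.mpr ((Nat.le_floor_iff' h1.ne_zero).mpr h2), h1⟩
    · intro p _; simp [invHom]
  rw [e] at h
  have hsum : ∑ n ∈ Icc 1 ⌊z⌋₊, ((n:ℝ))⁻¹≤(Vz z)⁻¹ := by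
    classical
    have hmem : ∀ n ∈ Icc 1 ⌊z⌋₊, n ∈ N.smoothNumbers := by
      intro n hn
      rw [mem_Icc] at hn
      rw [Nat.mem_smoothNumbers']
      intro p hp hd
      have := Nat.le_of_dvd (by omega) hd
      omega
    let emb : (Icc 1 ⌊z⌋₊) ↪ N.smoothNumbers :=
      ⟨fun n => ⟨n.1, hmem n.1 n.2⟩, fun a b hab => Subtype.ext (by simpa using hab)⟩
    have := sum_le_hasSum ((univ).map emb) (fun m _ => by
      simp only [invHom, MonoidHom.coe_mk, OneHom.coe_mk]; positivity) h.2
    rw [sum_map] at this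
    rw [← sum_coe_sort]
    exact this
  have hl : log z≤∑ n ∈ Icc 1 ⌊z⌋₊, ((n:ℝ))⁻¹ := by
    have := log_le_harmonic_floor z (by linarith)
    rw [harmonic_eq_sum_Icc] at this
    push_cast at this
    exact this
  have h4 := hl.trans hsum
  rw [le_div_iff₀ hlog]
  have hV := Vz_pos z
  calc Vz z*log z≤Vz z*(Vz z)⁻¹ := by gcongr
    _=1 := mul_inv_cancel₀ hV.ne'


noncomputable def etab (b:ℕ) : ℝ := exp (Ksv/2^b)-1

lemma etab_nonneg (b:ℕ) : 0≤etab b := by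
  unfold etab
  have : 1≤exp (Ksv/2^b) := one_le_exp (by unfold Ksv; positivity)
  linarith

/-- density form of the fundamental lemma -/
theorem dens (z:ℝ) (hz : 1≤z) (b:ℕ) (g : ℕ → ℂ) (g0 : g 0=0) (hg : Summable (fun n => ‖g n‖))
    (G:ℂ) (G' E E':ℝ) (hG : 0≤G') (hE : 0≤E) (hE' : 0≤E')
    (h1 : ∀ d : ℕ, 1≤d → (d:ℝ)≤z^(4*b+8) → ‖(∑' n, if d ∣ n then g n else 0)-G/d‖≤E+E' * (1/d))
    (h2 : ∀ d : ℕ, 1≤d → (d:ℝ)≤z^(4*b+8) → |(∑' n, if d ∣ n then ‖g n‖ else 0)-G' / d| ≤ E+E' * (1/d)) :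
    ‖∑' n, (rf z n:ℂ)*g n-Vz z*G‖≤etab b*Vz z*(‖G‖+G') +
      2*(z^(4*b+8)*E+(1+log z)^24*E') := by
  obtain ⟨ι, κ, _, _, c, d, c', d', hd, hd', hs, hs', hW, hW', hf, hr⟩ := sieve_ok z hz b
  set D := z^(4*b+8)
  set W := (1+log z)^24
  have sg : ∀ k : ℕ, Summable (fun n => if k ∣ n then g n else 0) := fun k =>
    Summable.of_norm_bounded hg (fun n => by split_ifs <;> simp)
  have sg' : ∀ k : ℕ, Summable (fun n => if k ∣ n then ‖g n‖ else 0) := fun k =>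
    Summable.of_norm_bounded hg (fun n => by split_ifs <;> simp)
  have srg : Summable (fun n => (rf z n:ℂ)*g n) :=
    Summable.of_norm_bounded hg (fun n => by
      rw [norm_mul, Complex.norm_real, norm_of_nonneg (rf_nonneg z n)]
      exact mul_le_of_le_one_left (norm_nonneg _) (rf_le_one z n))
  -- step 1
  have e1 : ∑ i, (c i:ℂ)*(∑' n, if d i ∣ n then g n else 0) =
      ∑' n, ((∑ i, c i*(if d i ∣ n then 1 else 0):ℝ):ℂ)*g n := by
    rw [show (∑ i, (c i:ℂ)*(∑' n, if d i ∣ n then g n else 0)) =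
      ∑ i, ∑' n, (c i:ℂ)*(if d i ∣ n then g n else 0) from
        sum_congr rfl (fun i _ => (tsum_mul_left).symm)]
    rw [← Summable.tsum_finsetSum (fun i _ => (sg (d i)).mul_left _)]
    congr 1; ext n
    push_cast
    rw [sum_mul]
    refine sum_congr rfl (fun i _ => ?_)
    split_ifs <;> simp
  have e2 : ∑ i, c' i*(∑' n, if d' i ∣ n then ‖g n‖ else 0) =
      ∑' n, (∑ i, c' i*(if d' i ∣ n then 1 else 0))*‖g n‖ := by
    rw [show (∑ i, c' i*(∑' n, if d' i ∣ n then ‖g n‖ else 0)) =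
      ∑ i, ∑' n, c' i*(if d' i ∣ n then ‖g n‖ else 0) from
        sum_congr rfl (fun i _ => (tsum_mul_left).symm)]
    rw [← Summable.tsum_finsetSum (fun i _ => (sg' (d' i)).mul_left _)]
    congr 1; ext n
    rw [sum_mul]
    refine sum_congr rfl (fun i _ => ?_)
    split_ifs <;> simp
  have s1 : Summable (fun n => ((∑ i, c i*(if d i ∣ n then 1 else 0):ℝ):ℂ)*g n) := by
    have : (fun n => ((∑ i, c i*(if d i ∣ n then 1 else 0):ℝ):ℂ)*g n) =
        fun n => ∑ i, (c i:ℂ)*(if d i ∣ n then g n else 0) := by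
      ext n; push_cast; rw [sum_mul]
      refine sum_congr rfl (fun i _ => ?_)
      split_ifs <;> simp
    rw [this]
    exact summable_sum (fun i _ => (sg (d i)).mul_left _)
  have s2 : Summable (fun n => (∑ i, c' i*(if d' i ∣ n then 1 else 0))*‖g n‖) := by
    have : (fun n => (∑ i, c' i*(if d' i ∣ n then 1 else 0))*‖g n‖) =
        fun n => ∑ i, (c' i)*(if d' i ∣ n then ‖g n‖ else 0) := by
      ext n; rw [sum_mul]
      refine sum_congr rfl (fun i _ => ?_)
      split_ifs <;> simp
    rw [this]
    exact summable_sum (fun i _ => (sg' (d' i)).mul_left _)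
  have V0 := Vz_pos z
  have a1 : ‖∑' n, (rf z n:ℂ)*g n-∑ i, (c i:ℂ)*(∑' n, if d i ∣ n then g n else 0)‖ ≤
      ∑ i, c' i*(∑' n, if d' i ∣ n then ‖g n‖ else 0) := by
    rw [e1, e2, ← Summable.tsum_sub srg s1]
    apply tsum_of_norm_bounded s2.hasSum
    intro n
    rcases Nat.eq_zero_or_pos n with rfl | hn
    · simp [g0]
    rw [← sub_mul, norm_mul, ← Complex.ofReal_sub, Complex.norm_real]
    gcongr
    have := hf _ (sf_dvd n)
    rw [Rp_dvd z n (by omega)] at this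
    rw [norm_eq_abs, abs_le]
    constructor <;> linarith [this.1, this.2]
  have a2 : ∑ i, c' i*(∑' n, if d' i ∣ n then ‖g n‖ else 0)≤etab b*Vz z*G' + (D*E+W*E') := by
    have : ∀ i, c' i*(∑' n, if d' i ∣ n then ‖g n‖ else 0)≤c' i*(1/d' i)*G' + |c' i| * (E+E' * (1/d' i)) := by
      intro i
      have h := h2 (d' i) (hd' i).1 (hd' i).2.1
      have : c' i*((∑' n, if d' i ∣ n then ‖g n‖ else 0)-G' / d' i) ≤ |c' i| * (E+E' * (1/d' i)) :=
        (le_abs_self _).trans (by rw [abs_mul]; gcongr)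
      calc _=c' i*(1/d' i)*G' + c' i*((∑' n, if d' i ∣ n then ‖g n‖ else 0)-G' / d' i) := by ring
        _≤_ := by linarith
    refine (sum_le_sum (fun i _ => this i)).trans ?_
    rw [sum_add_distrib, ← sum_mul]
    have t2 : ∑ i, |c' i| * (E+E' * (1/d' i))≤D*E+W*E' := by
      calc _=(∑ i, |c' i|)*E+(∑ i, |c' i| * (1/(d' i:ℝ)))*E' := by
            rw [sum_mul, sum_mul, ← sum_add_distrib]
            exact sum_congr rfl (fun i _ => by ring)
        _≤_ := by gcongr
    have : (∑ i, c' i*(1/(d' i:ℝ)))*G' ≤ (Vz z*etab b)*G' := by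
      gcongr; exact hr
    linarith
  have a3 : ‖∑ i, (c i:ℂ)*(∑' n, if d i ∣ n then g n else 0)-Vz z*G‖≤etab b*Vz z*‖G‖+(D*E+W*E') := by
    have hh := hf _ sf_inv
    have k1 : |∑ i, c i*(1/(d i:ℝ))-Vz z| ≤ etab b*Vz z := by
      rw [abs_le]
      have x1 := hh.1
      have x2 := hh.2
      have := etab_nonneg b
      change Vz z≤_ at x1
      change _≤Vz z+_ at x2
      change _≤Vz z*etab b at hr
      constructor
      · nlinarith
      · linarith
    have : ∑ i, (c i:ℂ)*(∑' n, if d i ∣ n then g n else 0)-Vz z*G =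
       ((∑ i, c i*(1/(d i:ℝ))-Vz z:ℝ):ℂ)*G +
        ∑ i, (c i:ℂ)*((∑' n, if d i ∣ n then g n else 0)-G/d i) := by
      push_cast
      simp only [mul_sub, sum_sub_distrib]
      rw [sub_mul, sum_mul]
      have : ∑ i, (c i:ℂ)*(1/(d i:ℂ))*G=∑ i, (c i:ℂ)*(G/(d i:ℂ)) :=
        sum_congr rfl (fun i _ => by ring)
      rw [this]; ring
    rw [this]
    refine (norm_add_le _ _).trans (add_le_add ?_ ?_)
    · rw [norm_mul, Complex.norm_real]; gcongr; exact k1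
    · refine (norm_sum_le _ _).trans ?_
      calc ∑ i, ‖(c i:ℂ)*((∑' n, if d i ∣ n then g n else 0)-G/d i)‖≤∑ i, |c i| * (E+E' * (1/d i)) := by
            refine sum_le_sum (fun i _ => ?_)
            rw [norm_mul, Complex.norm_real, norm_eq_abs]
            gcongr
            exact h1 _ (hd i).1 (hd i).2.1
        _=(∑ i, |c i|)*E+(∑ i, |c i| * (1/(d i:ℝ)))*E' := by
            rw [sum_mul, sum_mul, ← sum_add_distrib]
            exact sum_congr rfl (fun i _ => by ring)
        _≤(D*E+W*E') := by gcongr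
  calc _=‖(∑' n, (rf z n:ℂ)*g n-∑ i, (c i:ℂ)*(∑' n, if d i ∣ n then g n else 0)) +
        (∑ i, (c i:ℂ)*(∑' n, if d i ∣ n then g n else 0)-Vz z*G)‖ := by congr 1; ring
    _≤(etab b*Vz z*G' + (D*E+W*E'))+(etab b*Vz z*‖G‖+(D*E+W*E')) := (norm_add_le _ _).trans (add_le_add (a1.trans a2) a3)
    _=_ := by ring

theorem dens_fin (z:ℝ) (hz : 1≤z) (b:ℕ) (A : Finset ℕ) (hA : 0 ∉ A) (g : ℕ → ℂ)
    (G:ℂ) (G' E E':ℝ) (hG : 0≤G') (hE : 0≤E) (hE' : 0≤E')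
    (h1 : ∀ d : ℕ, 1≤d → (d:ℝ)≤z^(4*b+8) → ‖∑ n ∈ A.filter (d ∣ ·), g n-G/d‖≤E+E' * (1/d))
    (h2 : ∀ d : ℕ, 1≤d → (d:ℝ)≤z^(4*b+8) → |∑ n ∈ A.filter (d ∣ ·), ‖g n‖-G' / d| ≤ E+E' * (1/d)) :
    ‖∑ n ∈ A, (rf z n:ℂ)*g n-Vz z*G‖≤etab b*Vz z*(‖G‖+G') +
      2*(z^(4*b+8)*E+(1+log z)^24*E') := by
  classical
  have e1 : ∀ d : ℕ, (∑' n, if d ∣ n then (if n ∈ A then g n else 0) else 0)=∑ n ∈ A.filter (d ∣ ·), g n := by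
    intro d
    rw [tsum_eq_sum (s := A), sum_filter]
    · exact sum_congr rfl (fun n hn => by simp [hn])
    · intro n hn; simp [hn]
  have e2 : ∀ d : ℕ, (∑' n, if d ∣ n then ‖(if n ∈ A then g n else 0)‖ else 0)=∑ n ∈ A.filter (d ∣ ·), ‖g n‖ := by
    intro d
    rw [tsum_eq_sum (s := A), sum_filter]
    · exact sum_congr rfl (fun n hn => by simp [hn])
    · intro n hn; simp [hn]
  have e3 : ∑' n, (rf z n:ℂ)*(if n ∈ A then g n else 0)=∑ n ∈ A, (rf z n:ℂ)*g n := by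
    rw [tsum_eq_sum (s := A)]
    · exact sum_congr rfl (fun n hn => by simp [hn])
    · intro n hn; simp [hn]
  rw [← e3]
  apply dens z hz b (fun n => if n ∈ A then g n else 0) (by simp [hA])
    (summable_of_hasFiniteSupport ((A.finite_toSet).subset (fun n hn => by
      by_contra hc; simp at hc; simp [hc] at hn))) G G' E E' hG hE hE'
  · intro d hd hd2; rw [e1]; exact h1 d hd hd2
  · intro d hd hd2; rw [e2]; exact h2 d hd hd2

lemma sum_dvd_Ioc {M : Type*} [AddCommMonoid M] (a b:ℝ) (ha : 0≤a) (hab : a≤b) (d:ℕ) (hd : 1≤d) (g : ℕ → M) :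
    ∑ n ∈ (Ioc ⌊a⌋₊ ⌊b⌋₊).filter (d ∣ ·), g n=∑ m ∈ Ioc ⌊a/d⌋₊ ⌊b/d⌋₊, g (d*m) := by
  have hd0 : (0:ℝ)<d := by exact_mod_cast hd
  symm
  refine sum_bij (fun m _ => d*m) ?_ ?_ ?_ ?_
  · intro m hm
    rw [mem_Ioc, Nat.floor_lt (by positivity), Nat.le_floor_iff (by have := ha.trans hab; positivity)] at hm
    rw [mem_filter, mem_Ioc, Nat.floor_lt ha, Nat.le_floor_iff (ha.trans hab)]
    rw [div_lt_iff₀ hd0, le_div_iff₀ hd0] at hm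
    push_cast
    exact ⟨⟨by linarith [hm.1], by linarith [hm.2]⟩, dvd_mul_right _ _⟩
  · intro m _ m' _ h
    exact Nat.eq_of_mul_eq_mul_left hd h
  · intro n hn
    rw [mem_filter, mem_Ioc, Nat.floor_lt ha, Nat.le_floor_iff (ha.trans hab)] at hn
    obtain ⟨⟨h1, h2⟩, m, rfl⟩ := hn
    refine ⟨m, ?_, rfl⟩
    rw [mem_Ioc, Nat.floor_lt (by positivity), Nat.le_floor_iff (by have := ha.trans hab; positivity),
      div_lt_iff₀ hd0, le_div_iff₀ hd0]
    push_cast at h1 h2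
    constructor <;> linarith
  · intro m _; rfl

lemma card_Ioc_floor (a b:ℝ) (ha : 0≤a) (hab : a≤b) : |(((Ioc ⌊a⌋₊ ⌊b⌋₊).card:ℕ):ℝ)-(b-a)| ≤ 1 := by
  rw [Nat.card_Ioc, Nat.cast_sub (Nat.floor_mono hab)]
  have h1 := Nat.floor_le ha
  have h2 := Nat.floor_le (ha.trans hab)
  have h3 := Nat.lt_floor_add_one a
  have h4 := Nat.lt_floor_add_one b
  rw [abs_le]; constructor <;> linarith

/-- upper bound for rough numbers in short intervals -/
theorem bt : ∃ C : ℝ, 1≤C ∧ ∀ z a h : ℝ, 2≤z → 0≤a → z^10≤h →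
    ∑ n ∈ Ioc ⌊a⌋₊ ⌊a+h⌋₊, rf z n≤C*h/log z := by
  refine ⟨1+2*etab 0+2, by have := etab_nonneg 0; linarith, ?_⟩
  intro z a h hz ha hh
  have hlog : 0<log z := log_pos (by linarith)
  have h0 : 0<h := lt_of_lt_of_le (by positivity) hh
  have h2 : ∀ d : ℕ, 1≤d → |∑ n ∈ (Ioc ⌊a⌋₊ ⌊a+h⌋₊).filter (d ∣ ·), (1:ℝ)-h/d| ≤ 1 := by
    intro d hd
    have hd0 : (0:ℝ)<d := by exact_mod_cast hd
    rw [sum_dvd_Ioc a (a+h) ha (by linarith) d hd]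
    have := card_Ioc_floor (a/d) ((a+h)/d) (by positivity) (by gcongr; linarith)
    rw [sum_const, nsmul_eq_mul, mul_one]
    rwa [show (a+h)/d-a/d=h/d by ring] at this
  have := dens_fin z (by linarith) 0 (Ioc ⌊a⌋₊ ⌊a+h⌋₊) (by simp) (fun _ => 1) h h 1 0 h0.le zero_le_one le_rfl
    (by intro d hd _
        have := h2 d hd
        rw [← norm_eq_abs, ← Complex.norm_real] at this
        push_cast at this
        simpa using this) (by intro d hd _; simpa using h2 d hd)
  have e : ‖∑ n ∈ Ioc ⌊a⌋₊ ⌊a+h⌋₊, (rf z n:ℂ)*(1:ℂ)-Vz z*(h:ℂ)‖ =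
      |∑ n ∈ Ioc ⌊a⌋₊ ⌊a+h⌋₊, rf z n-Vz z*h| := by
    rw [← norm_eq_abs, ← Complex.norm_real]; push_cast; simp
  rw [e, Complex.norm_real, norm_of_nonneg h0.le] at this
  have t1 := (abs_le.mp this).2
  have hV := Vz_le z (by linarith)
  have hV0 := Vz_pos z
  have he := etab_nonneg 0
  have k1 : Vz z*h*(1+2*etab 0)≤1/log z*h*(1+2*etab 0) := by gcongr
  have k2 : 2*z^8≤2*(h/log z) := by
    have : z^8≤h/log z := by
      rw [le_div_iff₀ hlog]
      have hl : log z≤z^2 := by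
        have := log_le_sub_one_of_pos (show 0<z by linarith)
        nlinarith
      calc z^8*log z≤z^8*z^2 := by gcongr
        _=z^10 := by ring
        _≤h := hh
    linarith
  norm_num at t1
  calc ∑ n ∈ Ioc ⌊a⌋₊ ⌊a+h⌋₊, rf z n≤Vz z*h*(1+2*etab 0)+2*z^8 := by linarith
    _≤1/log z*h*(1+2*etab 0)+2*(h/log z) := add_le_add k1 k2
    _=_ := by ring

/-- equidistribution of rough numbers against `n^{-it}` -/
theorem star (K:ℝ) (hK : 0≤K) : ∃ C : ℝ, 1≤C ∧ ∃ c : ℝ, 0<c ∧ c≤1/4 ∧ ∀ (z:ℝ) (b:ℕ) (N N' t:ℝ), 1≤z → 1≤N →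
    z^(8*b+16)≤N → N≤N' → N' ≤ 2*N → |t| ≤ N^K →
    ‖∑ n ∈ Ioc ⌊N⌋₊ ⌊N'⌋₊, (rf z n:ℂ)*cx t n-Vz z*∫ u in N..N', cx t u‖ ≤
      2*etab b*Vz z*N+C*(1+log N)^24*N^(1-c) := by
  obtain ⟨C, hC, c, hc, hw⟩ := weyl (2*K)
  set c0 := min (c/2) (1/4) with hc0
  have c0pos : 0<c0 := by positivity
  have c0le : c0≤1/4 := min_le_right _ _
  have c0le2 : c0≤c/2 := min_le_left _ _
  refine ⟨2*(C+1), by linarith, c0, c0pos, c0le, ?_⟩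
  intro z b N N' t hz hN hD hNN hN2 ht
  have N0 : 0<N := by linarith
  have hD2 : z^(4*b+8)≤N^(1/2:ℝ) := by
    rw [← sqrt_eq_rpow]
    apply le_sqrt_of_sq_le
    rw [← pow_mul]
    exact le_trans (le_of_eq (by ring_nf)) hD
  have hzN : z≤N := le_trans (by simpa using pow_le_pow_right₀ hz (show 1≤8*b+16 by omega)) hD
  have intN : ‖∫ u in N..N', cx t u‖≤N' - N := by
    have := intervalIntegral.norm_integral_le_of_norm_le_const (a := N) (b := N') (f := fun u => cx t u) (C := 1)
      (fun u _ => (cx_norm t u).le)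
    rwa [one_mul, abs_of_nonneg (by linarith)] at this
  have hmain := dens_fin z hz b (Ioc ⌊N⌋₊ ⌊N'⌋₊) (by simp) (fun n => cx t n) (∫ u in N..N', cx t u) (N' - N)
    1 (C*N^(1-c0)) (by linarith) zero_le_one (by positivity) ?_ ?_
  · refine hmain.trans ?_
    have he := etab_nonneg b
    have hV := Vz_pos z
    have hl0 : 0≤log z := log_nonneg hz
    have hl1 : log z≤log N := log_le_log (by linarith) hzN
    refine add_le_add ?_ ?_
    · calc etab b*Vz z*(‖∫ u in N..N', cx t u‖+(N' - N))≤etab b*Vz z*(2*N) := by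
            gcongr; linarith
        _=_ := by ring
    · have k1 : z^(4*b+8)*1≤(1+log N)^24*N^(1-c0) := by
        calc z^(4*b+8)*1≤1*N^(1-c0) := by
              rw [mul_one, one_mul]
              exact hD2.trans (rpow_le_rpow_of_exponent_le hN (by linarith))
          _≤_ := by gcongr; exact one_le_pow₀ (by linarith)
      have k2 : (1+log z)^24*(C*N^(1-c0))≤(1+log N)^24*(C*N^(1-c0)) := by gcongr
      calc _≤2*((1+log N)^24*N^(1-c0)+(1+log N)^24*(C*N^(1-c0))) := by gcongr
        _=_ := by ring
  · intro d hd hdD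
    have hd0 : (0:ℝ)<d := by exact_mod_cast hd
    have hd4 := hdD.trans hD2
    have hhalf : N^(1/2:ℝ)≤N/d := by
      rw [le_div_iff₀ hd0]
      calc N^(1/2:ℝ)*d≤N^(1/2:ℝ)*N^(1/2:ℝ) := by gcongr
        _=N := by rw [← rpow_add N0]; norm_num
    have hNd1 : 1≤N/d := le_trans (one_le_rpow hN (by norm_num)) hhalf
    have hw' := hw (N/d) (N'/d) t hNd1 (by gcongr) (by rw [← mul_div_assoc]; gcongr) (by
      calc |t| ≤ N^K := ht
        _=(N^(1/2:ℝ))^(2*K) := by rw [← rpow_mul N0.le]; congr 1; ring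
        _≤(N/d)^(2*K) := by gcongr)
    rw [sum_dvd_Ioc N N' N0.le hNN d hd]
    have e1 : ∑ m ∈ Ioc ⌊N/d⌋₊ ⌊N'/d⌋₊, cx t ((d*m:ℕ))=cx t d*∑ m ∈ Ioc ⌊N/d⌋₊ ⌊N'/d⌋₊, cx t m := by
      rw [mul_sum]
      refine sum_congr rfl (fun m hm => ?_)
      have : 0< m := by have := (mem_Ioc.mp hm).1; omega
      push_cast
      rw [cx_mul t hd0 (by exact_mod_cast this)]
    have e2 : (∫ u in N..N', cx t u)/d=cx t d*∫ u in (N/d)..(N'/d), cx t u := by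
      have h := intervalIntegral.integral_comp_mul_left (a := N/d) (b := N'/d) (fun u => cx t u) hd0.ne'
      rw [mul_div_cancel₀ _ hd0.ne', mul_div_cancel₀ _ hd0.ne'] at h
      rw [← intervalIntegral.integral_const_mul]
      have : ∫ u in (N/d)..(N'/d), cx t d*cx t u=∫ u in (N/d)..(N'/d), cx t (d*u) := by
        apply intervalIntegral.integral_congr
        intro u hu
        rw [Set.uIcc_of_le (by gcongr)] at hu
        beta_reduce
        have hu0 : 0<u := by linarith [hu.1]
        rw [cx_mul t hd0 hu0]
      rw [this, h, Complex.real_smul]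
      push_cast; field_simp
    rw [e1, e2, ← mul_sub, norm_mul, cx_norm, one_mul]
    refine hw'.trans ?_
    have hNd0 : (0:ℝ)<N/d := by linarith
    have hx0 : (N/(d:ℝ))^(-(2*c0))≤(N^(1/2:ℝ))^(-(2*c0)) :=
      rpow_le_rpow_of_nonpos (rpow_pos_of_pos N0 (1/2)) hhalf (by linarith)
    have : (N/d)^(1-c)≤N^(1-c0)*(1/d) := by
      calc (N/d)^(1-c)≤(N/d)^(1-2*c0) := rpow_le_rpow_of_exponent_le hNd1 (by linarith)
        _=(N/d)*(N/d)^(-(2*c0)) := by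
          rw [sub_eq_add_neg, rpow_add (show (0:ℝ)<N/d by linarith), rpow_one]
        _≤(N/d)*(N^(1/2:ℝ))^(-(2*c0)) := mul_le_mul_of_nonneg_left hx0 hNd0.le
        _=(N*N^(-c0))*(1/d) := by
          rw [← rpow_mul N0.le, show (1/2:ℝ)*(-(2*c0)) = -c0 by ring]; ring
        _=N^(1-c0)*(1/d) := by
          rw [sub_eq_add_neg, rpow_add N0, rpow_one]
    calc C*(N/d)^(1-c)≤C*(N^(1-c0)*(1/d)) := by gcongr
      _≤_ := by linarith
  · intro d hd hdD
    have hd0 : (0:ℝ)<d := by exact_mod_cast hd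
    rw [sum_dvd_Ioc N N' N0.le hNN d hd]
    simp only [cx_norm, sum_const, nsmul_eq_mul, mul_one]
    have := card_Ioc_floor (N/d) (N'/d) (by positivity) (by gcongr)
    rw [show N'/d-N/d=(N'-N)/d by ring] at this
    refine this.trans ?_
    have : 0≤C*N^(1-c0)*(1/d) := by positivity
    linarith

end M2c
end H12
namespace H12
open Real Finset
section M3a
open MeasureTheory

lemma rf_anti {z z' : ℝ} (h : z' ≤ z) (n:ℕ) : rf z n≤ rf z' n := by
  unfold rf
  by_cases h1 : n ≠ 0 ∧ ∀ p, p.Prime → p ∣ n → z<p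
  · rw [if_pos h1, if_pos ⟨h1.1, fun p hp hd => lt_of_le_of_lt h (h1.2 p hp hd)⟩]
  · rw [if_neg h1]; split_ifs <;> norm_num

theorem bt2 : ∃ C : ℝ, 1≤C ∧ ∀ z a h : ℝ, 2^10≤z → 0≤a → z≤h →
    ∑ n ∈ Ioc ⌊a⌋₊ ⌊a+h⌋₊, rf z n≤C*h/log z := by
  obtain ⟨C, hC, hb⟩ := bt
  refine ⟨10*C, by linarith, ?_⟩
  intro z a h hz ha hh
  have z0 : (0:ℝ)<z := by norm_num at hz; linarith
  have h1 : (2:ℝ)≤z^(1/10:ℝ) := by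
    calc (2:ℝ)=((2:ℝ)^10)^(1/10:ℝ) := by
          rw [← rpow_natCast, ← rpow_mul (by norm_num)]; norm_num
      _≤_ := by gcongr
  have h2 : (z^(1/10:ℝ))^10=z := by
    rw [← rpow_natCast, ← rpow_mul z0.le]; norm_num
  have h3 := hb (z^(1/10:ℝ)) a h h1 ha (by rw [h2]; exact hh)
  rw [log_rpow z0] at h3
  have h4 : z^(1/10:ℝ)≤z := by
    have : z^(1/10:ℝ)≤z^(1:ℝ) := rpow_le_rpow_of_exponent_le (by norm_num at hz; linarith) (by norm_num)
    simpa using this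
  calc _≤∑ n ∈ Ioc ⌊a⌋₊ ⌊a+h⌋₊, rf (z^(1/10:ℝ)) n := sum_le_sum (fun n _ => rf_anti h4 n)
    _≤_ := h3
    _=_ := by
      have : 0<log z := log_pos (by norm_num at hz; linarith)
      field_simp

lemma abel_m (a : ℕ → ℂ) (m g g' : ℝ → ℂ) (N0 N:ℝ) (hN0 : 0<N0) (hN : N0≤N)
    (hg : ∀ u : ℝ, 0<u → HasDerivAt g (g' u) u) (hg' : ContinuousOn g' (Set.Ioi 0))
    (hm : ContinuousOn m (Set.Ioi 0)) (B : ℝ → ℝ) (hBc : ContinuousOn B (Set.Ioi 0))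
    (hB : ∀ u ∈ Set.Icc N0 N, ‖∑ n ∈ Ioc ⌊N0⌋₊ ⌊u⌋₊, a n-∫ v in N0..u, m v‖≤B u) :
    ‖∑ n ∈ Ioc ⌊N0⌋₊ ⌊N⌋₊, a n*g n-∫ u in N0..N, m u*g u‖ ≤
      ‖g N‖*B N+∫ u in N0..N, ‖g' u‖*B u := by
  set c : ℕ → ℂ := fun n => if ⌊N0⌋₊<n then a n else 0 with hc
  have hsub : Set.Icc N0 N ⊆ Set.Ioi 0 := fun u hu => lt_of_lt_of_le hN0 hu.1
  have hcs : ∀ u : ℝ, N0≤u → ∑ k ∈ Icc 0 ⌊u⌋₊, c k=∑ n ∈ Ioc ⌊N0⌋₊ ⌊u⌋₊, a n := by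
    intro u hu
    rw [hc, ← sum_filter]
    congr 1
    ext k; simp only [mem_filter, mem_Icc, mem_Ioc]
    omega
  have hder : ∀ u : ℝ, 0<u → deriv g u=g' u := fun u hu => (hg u hu).deriv
  have hcd : ContinuousOn (deriv g) (Set.Icc N0 N) := (hg'.mono hsub).congr (fun u hu => hder u (hsub hu))
  have habel := sum_mul_eq_sub_sub_integral_mul (f := g) c hN0.le hN
    (fun t ht => (hg t (hsub ht)).differentiableAt) hcd.integrableOn_Icc
  have hC0 : ∑ k ∈ Icc 0 ⌊N0⌋₊, c k=0 := by rw [hcs N0 le_rfl]; simp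
  rw [hC0, hcs N hN, mul_zero, sub_zero] at habel
  have hsum : ∑ n ∈ Ioc ⌊N0⌋₊ ⌊N⌋₊, a n*g n=∑ k ∈ Ioc ⌊N0⌋₊ ⌊N⌋₊, g k*c k := by
    refine sum_congr rfl (fun n hn => ?_)
    rw [hc]; simp only [(mem_Ioc.mp hn).1, if_true]; ring
  set M : ℝ → ℂ := fun u => ∫ v in N0..u, m v with hM
  have hMd : ∀ u ∈ Set.uIcc N0 N, HasDerivAt M (m u) u := by
    intro u hu
    rw [Set.uIcc_of_le hN] at hu
    have hu0 : 0<u := hsub hu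
    apply intervalIntegral.integral_hasDerivAt_right
    · apply ContinuousOn.intervalIntegrable
      rw [Set.uIcc_of_le hu.1]
      exact hm.mono (fun v hv => lt_of_lt_of_le hN0 hv.1)
    · exact hm.stronglyMeasurableAtFilter isOpen_Ioi u hu0
    · exact hm.continuousAt (Ioi_mem_nhds hu0)
  have hparts := intervalIntegral.integral_mul_deriv_eq_deriv_mul (a := N0) (b := N) (u := g) (v := M) (u' := g') (v' := m)
    (fun u hu => hg u (by rw [Set.uIcc_of_le hN] at hu; exact hsub hu)) hMd
    (ContinuousOn.intervalIntegrable (by rw [Set.uIcc_of_le hN]; exact hg'.mono hsub))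
    (ContinuousOn.intervalIntegrable (by rw [Set.uIcc_of_le hN]; exact hm.mono hsub))
  have hM0 : M N0=0 := by rw [hM]; simp
  rw [hM0, mul_zero, sub_zero] at hparts
  have hi1 : IntegrableOn (fun t => deriv g t*∑ k ∈ Icc 0 ⌊t⌋₊, c k) (Set.Ioc N0 N) :=
    (integrableOn_mul_sum_Icc c hN0.le hcd.integrableOn_Icc).mono_set Set.Ioc_subset_Icc_self
  have hMc : ContinuousOn M (Set.Icc N0 N) := fun u hu =>
    (hMd u (by rw [Set.uIcc_of_le hN]; exact hu)).continuousAt.continuousWithinAt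
  have hi2 : IntegrableOn (fun t => g' t*M t) (Set.Ioc N0 N) :=
    (((hg'.mono hsub).mul hMc).integrableOn_Icc).mono_set Set.Ioc_subset_Icc_self
  have hkey : ∑ n ∈ Ioc ⌊N0⌋₊ ⌊N⌋₊, a n*g n-∫ u in N0..N, m u*g u
      = g N*(∑ n ∈ Ioc ⌊N0⌋₊ ⌊N⌋₊, a n-M N) -
        ∫ t in Set.Ioc N0 N, (deriv g t*(∑ k ∈ Icc 0 ⌊t⌋₊, c k)-g' t*M t) := by
    rw [hsum, habel, show (fun u => m u*g u)=(fun u => g u*m u) by ext u; ring, hparts]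
    have := integral_sub hi1 hi2
    rw [this, intervalIntegral.integral_of_le hN]
    ring
  rw [hkey]
  refine (norm_sub_le _ _).trans ?_
  rw [norm_mul]
  gcongr
  · exact hB N ⟨hN, le_rfl⟩
  · rw [intervalIntegral.integral_of_le hN]
    refine norm_integral_le_of_norm_le ?_ ?_
    · exact (((hg'.mono hsub).norm.mul (hBc.mono hsub)).integrableOn_Icc).mono_set Set.Ioc_subset_Icc_self
    · refine (ae_restrict_mem measurableSet_Ioc).mono (fun t ht => ?_)
      have ht' : t ∈ Set.Icc N0 N := Set.Ioc_subset_Icc_self ht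
      rw [hder t (hsub ht'), hcs t ht'.1, ← mul_sub, norm_mul]
      gcongr
      exact hB t ht'


lemma pow_le_exp_ev (C κ:ℝ) (hκ : 0<κ) (k:ℕ) : ∃ L1 : ℝ, 1≤L1 ∧ ∀ L : ℝ, L1≤L → C*(1+L)^k≤exp (κ*L) := by
  have h := (tendsto_exp_div_pow_atTop k)
  have h2 := (Filter.tendsto_atTop.mp h) (|C| * (2/κ)^k)
  rw [Filter.eventually_atTop] at h2
  obtain ⟨y, hy⟩ := h2
  refine ⟨max 1 (max 1 y/κ), le_max_left _ _, ?_⟩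
  intro L hL
  have hL1 : 1≤L := (le_max_left _ _).trans hL
  have hL2 : max 1 y≤κ*L := by
    have := (le_max_right _ _).trans hL
    rwa [div_le_iff₀ hκ, mul_comm] at this
  have h3 := hy (κ*L) ((le_max_right _ _).trans hL2)
  have hp : 0<κ*L := by positivity
  rw [le_div_iff₀ (by positivity)] at h3
  calc C*(1+L)^k ≤ |C| * (2*L)^k := by
        gcongr
        · exact le_abs_self C
        · linarith
    _ = |C| * (2/κ)^k*(κ*L)^k := by rw [mul_assoc, ← mul_pow]; congr 2; field_simp
    _≤_ := h3

/-- `star` with an explicit decay, absolute constant. -/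
theorem star1 : ∃ C : ℝ, 1≤C ∧ ∀ K : ℝ, 0≤K → ∃ z1 : ℝ, 2^10≤z1 ∧ ∀ z N N' t : ℝ, z1≤z → z^16≤N → N≤N' → N' ≤ 2*N →
    |t| ≤ N^K →
    ‖∑ n ∈ Ioc ⌊N⌋₊ ⌊N'⌋₊, (rf z n:ℂ)*cx t n-Vz z*∫ u in N..N', cx t u‖ ≤
      C*N^(1-1/(16*log z))/log z := by
  have hK0 : 0<Ksv := by unfold Ksv; positivity
  refine ⟨16 * (Ksv * exp Ksv) + 1, by
    have : 0 < Ksv * exp Ksv := by positivity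
    linarith, ?_⟩
  intro K hK
  obtain ⟨C, hC, c, hc, hc4, hs⟩ := star K hK
  obtain ⟨L1, hL1, hL⟩ := pow_le_exp_ev C (c/2) (by linarith) 25
  refine ⟨max (2^10) (exp (max L1 (1/(8*c)))), le_max_left _ _, ?_⟩
  intro z N N' t hz hzN hNN hN2 ht
  have hz10 : (2:ℝ)^10≤z := (le_max_left _ _).trans hz
  have hz1 : (1:ℝ)<z := lt_of_lt_of_le (by norm_num) hz10
  have hlz : max L1 (1/(8*c))≤log z := by
    rw [le_log_iff_exp_le (by linarith)]; exact (le_max_right _ _).trans hz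
  have hl1 : L1≤log z := (le_max_left _ _).trans hlz
  have hl2 : 1/(8*c)≤log z := (le_max_right _ _).trans hlz
  set l := log z with hl
  have l0 : 0< l := by linarith
  have hN1 : 1≤N := le_trans (one_le_pow₀ hz1.le) hzN
  have N0 : 0<N := by linarith
  set L := log N with hLdef
  have hLl : 16*l≤L := by
    have := log_le_log (by positivity) hzN
    rw [log_pow] at this; push_cast at this; exact this
  set y := L/(8*l) with hy
  have hy2 : 2≤y := by rw [hy, le_div_iff₀ (by positivity)]; linarith
  have hfl : 2≤⌊y⌋₊ := Nat.le_floor (by exact_mod_cast hy2)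
  obtain ⟨b, hb⟩ : ∃ b, ⌊y⌋₊=b+2 := ⟨⌊y⌋₊-2, by omega⟩
  have hby : ((b:ℝ)+2)≤y := by
    have := Nat.floor_le (show 0≤y by linarith)
    rw [hb] at this; push_cast at this; exact this
  have hby2 : y≤b+3 := by
    have := Nat.lt_floor_add_one y
    rw [hb] at this; push_cast at this; linarith
  have hzb : z^(8*b+16)≤N := by
    rw [← log_le_log_iff (by positivity) N0, log_pow]
    push_cast
    rw [hy, le_div_iff₀ (by positivity)] at hby
    linarith
  have h := hs z b N N' t hz1.le hN1 hzb hNN hN2 ht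
  refine h.trans ?_
  have hV : Vz z≤1/l := Vz_le z hz1
  have hV0 := Vz_pos z
  have he : etab b≤8*(Ksv*exp Ksv)*N^(-(1/(16*l))) := by
    have hx0 : Ksv/2^b≤Ksv := div_le_self hK0.le (one_le_pow₀ (by norm_num))
    have h1 : exp (Ksv/2^b)-1≤(Ksv/2^b)*exp (Ksv/2^b) := by
      have h := add_one_le_exp (-(Ksv/2^b))
      have h' := exp_pos (Ksv/2^b)
      have : exp (-(Ksv/2^b))*exp (Ksv/2^b)=1 := by rw [← exp_add]; simp
      nlinarith
    have h2 : (1:ℝ)/2^b≤8*N^(-(1/(16*l))) := by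
      rw [rpow_def_of_pos N0, ← hLdef]
      have : L * -(1/(16*l)) = - (y/2) := by rw [hy]; field_simp; ring
      rw [this]
      have h3 : exp (y/2)≤8*2^b := by
        have hlog2 : (1:ℝ)/2≤log 2 := by linarith [log_two_gt_d9]
        calc exp (y/2)≤exp (log 2*((b+3:ℕ):ℝ)) := by
              apply exp_le_exp.mpr; push_cast; nlinarith only [hlog2, hby2, hy2]
          _=2^(b+3) := by rw [mul_comm, exp_nat_mul, exp_log (by norm_num)]
          _=_ := by ring
      rw [exp_neg, div_le_iff₀ (by positivity)]
      have := exp_pos (y/2)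
      calc (1:ℝ)=exp (y/2)*(exp (y/2))⁻¹ := by field_simp
        _≤(8*2^b)*(exp (y/2))⁻¹ := by gcongr
        _=_ := by ring
    unfold etab
    refine h1.trans ?_
    calc (Ksv/2^b)*exp (Ksv/2^b)≤(Ksv/2^b)*exp Ksv := by gcongr
      _=(Ksv*exp Ksv)*(1/2^b) := by ring
      _≤(Ksv*exp Ksv)*(8*N^(-(1/(16*l)))) := by gcongr
      _=_ := by ring
  have hpow : N^(1-1/(16*l))=N*N^(-(1/(16*l))) := by
    rw [sub_eq_add_neg, rpow_add N0, rpow_one]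
  have hA : 2*etab b*Vz z*N≤16*(Ksv*exp Ksv)*N^(1-1/(16*l))/l := by
    have := etab_nonneg b
    have hNp := rpow_pos_of_pos N0 (-(1/(16*l)))
    calc 2*etab b*Vz z*N≤2*(8*(Ksv*exp Ksv)*N^(-(1/(16*l))))*(1/l)*N := by gcongr
      _=_ := by rw [hpow]; ring
  have hB : C*(1+L)^24*N^(1-c)≤N^(1-1/(16*l))/l := by
    have h25 := hL L (by linarith)
    have e1 : C*(1+L)^24*l≤N^(c/2) := by
      calc C*(1+L)^24*l≤C*(1+L)^24*(1+L) := by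
            have : 0≤L := by linarith
            gcongr; linarith
        _=C*(1+L)^25 := by ring
        _≤_ := h25
        _=_ := by rw [rpow_def_of_pos N0, ← hLdef, mul_comm]
    rw [le_div_iff₀ l0]
    calc C*(1+L)^24*N^(1-c)*l=(C*(1+L)^24*l)*N^(1-c) := by ring
      _≤N^(c/2)*N^(1-c) := by gcongr
      _=N^(1-c/2) := by rw [← rpow_add N0]; congr 1; ring
      _≤_ := by
        apply rpow_le_rpow_of_exponent_le hN1
        have : 1/(16*l)≤c/2 := by
          rw [div_le_iff₀ (by positivity)] at hl2 ⊢
          have e : c/2*(16*l)=l*(8*c) := by ring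
          rw [e]; exact hl2
        linarith only [this]
  calc _≤16*(Ksv*exp Ksv)*N^(1-1/(16*l))/l+N^(1-1/(16*l))/l := add_le_add hA hB
    _=_ := by ring

theorem star2 : ∃ C : ℝ, 1≤C ∧ ∀ K : ℝ, 0≤K → ∃ z1 : ℝ, 2^10≤z1 ∧ ∀ z N t : ℝ, z1≤z → z^16≤N →
    |t| ≤ z^K →
    ‖∑ n ∈ Ioc ⌊z^16⌋₊ ⌊N⌋₊, (rf z n:ℂ)*cx t n-Vz z*∫ u in (z^16)..N, cx t u‖ ≤
      C*N^(1-1/(16*log z))/log z := by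
  obtain ⟨C, hC, hs⟩ := star1
  refine ⟨3*C, by linarith, ?_⟩
  intro K hK
  obtain ⟨z1, hz1, hs⟩ := hs K hK
  refine ⟨z1, hz1, ?_⟩
  intro z N t hz hN ht
  have hzz : (2:ℝ)^10≤z := hz1.trans hz
  have hz1' : (1:ℝ)<z := lt_of_lt_of_le (by norm_num) hzz
  set l := log z with hl
  have l1 : 1≤ l := by
    rw [hl, le_log_iff_exp_le (by linarith)]
    have := exp_one_lt_d9
    norm_num at hzz; linarith
  have hδ : 1/(16*l)≤1/16 := by
    apply one_div_le_one_div_of_le <;> linarith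
  have hδ0 : 0<1/(16*l) := by positivity
  set δ := 1/(16*l) with hδd
  set N0 := z^16 with hN0d
  have hzN0 : z≤N0 := le_self_pow₀ hz1'.le (by norm_num)
  have N00 : 0<N0 := by linarith
  have htN : ∀ M, N0≤M → |t| ≤ M^K := fun M hM => ht.trans (rpow_le_rpow (by linarith) (by linarith) hK)
  have hitg : ∀ a b : ℝ, 0<a → a≤b → IntervalIntegrable (cx t) volume a b := by
    intro a b ha hab
    apply ContinuousOn.intervalIntegrable
    rw [Set.uIcc_of_le hab]
    exact (cx_continuousOn t).mono (fun u hu => lt_of_lt_of_le ha hu.1)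
  have key : ∀ k : ℕ, ∀ M : ℝ, N0≤M → M≤2^k*N0 →
    ‖∑ n ∈ Ioc ⌊N0⌋₊ ⌊M⌋₊, (rf z n:ℂ)*cx t n-Vz z*∫ u in N0..M, cx t u‖ ≤
      3*C*M^(1-δ)/l := by
    intro k
    induction k with
    | zero =>
      intro M h1 h2
      have : M=N0 := le_antisymm (by simpa using h2) h1
      rw [this]; simp; positivity
    | succ k ih =>
      intro M h1 h2
      have hM0 : 0<M := by linarith
      by_cases h3 : N0≤M/2
      · have i1 := ih (M/2) h3 (by rw [pow_succ] at h2; linarith)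
        have i2 := hs z (M/2) M t hz h3 (by linarith) (by linarith) (htN _ h3)
        have e1 : ∑ n ∈ Ioc ⌊N0⌋₊ ⌊M⌋₊, (rf z n:ℂ)*cx t n=∑ n ∈ Ioc ⌊N0⌋₊ ⌊M/2⌋₊, (rf z n:ℂ)*cx t n
            + ∑ n ∈ Ioc ⌊M/2⌋₊ ⌊M⌋₊, (rf z n:ℂ)*cx t n :=
          (sum_Ioc_consecutive _ (Nat.floor_mono h3) (Nat.floor_mono (by linarith))).symm
        have e2 : ∫ u in N0..M, cx t u=(∫ u in N0..(M/2), cx t u)+∫ u in (M/2)..M, cx t u :=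
          (intervalIntegral.integral_add_adjacent_intervals (hitg _ _ N00 h3) (hitg _ _ (by linarith) (by linarith))).symm
        have e3 : (M/2)^(1-δ)≤3/4*M^(1-δ) := by
          rw [div_rpow hM0.le (by norm_num), div_le_iff₀ (by positivity)]
          have : (4/3:ℝ)≤2^(1-δ) := by
            calc (4/3:ℝ)≤2^(1/2:ℝ) := by
                  rw [← sqrt_eq_rpow]; apply le_sqrt_of_sq_le; norm_num
              _≤_ := rpow_le_rpow_of_exponent_le (by norm_num) (by linarith)
          have hp := rpow_pos_of_pos hM0 (1-δ)
          nlinarith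
        calc _=‖(∑ n ∈ Ioc ⌊N0⌋₊ ⌊M/2⌋₊, (rf z n:ℂ)*cx t n-Vz z*∫ u in N0..(M/2), cx t u)
              + (∑ n ∈ Ioc ⌊M/2⌋₊ ⌊M⌋₊, (rf z n:ℂ)*cx t n-Vz z*∫ u in (M/2)..M, cx t u)‖ := by
              rw [e1, e2]; congr 1; ring
          _≤3*C*(M/2)^(1-δ)/l+C*(M/2)^(1-δ)/l := (norm_add_le _ _).trans (add_le_add i1 i2)
          _=4*C*((M/2)^(1-δ))/l := by ring
          _≤4*C*(3/4*M^(1-δ))/l := by gcongr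
          _=_ := by ring
      · push Not at h3
        have i2 := hs z N0 M t hz le_rfl h1 (by linarith) (htN _ le_rfl)
        refine i2.trans ?_
        have : N0^(1-δ)≤M^(1-δ) := rpow_le_rpow N00.le h1 (by linarith)
        calc C*N0^(1-δ)/l≤(3*C)*M^(1-δ)/l := by gcongr; linarith
          _=_ := by ring
  obtain ⟨k, hk⟩ := pow_unbounded_of_one_lt (N/N0) (show (1:ℝ)<2 by norm_num)
  refine key k N hN ?_
  rw [div_lt_iff₀ N00] at hk
  exact hk.le

end M3a
end H12
namespace H12
open Real Finset
section M3b
open MeasureTheory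

lemma tsum_le_of_partial (f : ℕ → ℂ) (hf : Summable f) (f0 : f 0=0) (B:ℝ) (n0:ℕ)
    (h : ∀ n : ℕ, n0≤n → ‖∑ k ∈ Ioc 0 n, f k‖≤B) : ‖∑' n, f n‖≤B := by
  have ht := hf.hasSum.tendsto_sum_nat
  have ht2 := (ht.comp (Filter.tendsto_add_atTop_nat 1)).norm
  refine le_of_tendsto ht2 ?_
  filter_upwards [Filter.eventually_ge_atTop n0] with n hn
  have : ∑ i ∈ range (n+1), f i=∑ k ∈ Ioc 0 n, f k := by
    rw [range_eq_Ico, sum_eq_sum_Ico_succ_bot (by omega), f0, zero_add]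
    congr 1
  simp only [Function.comp]
  rw [this]; exact h n hn

/-- log bounded by small powers -/
lemma log_le_pow (κ u:ℝ) (hκ : 0<κ) (hu : 0<u) : log u≤(1/κ)*u^κ := by
  have := log_le_rpow_div hu.le hκ
  linarith [this, show u^κ/κ=(1/κ)*u^κ by ring]

noncomputable def gw (j:ℕ) (σ u:ℝ) : ℝ := u^(-σ)*log u^j
noncomputable def gw' (j:ℕ) (σ u:ℝ) : ℝ := (-σ)*u^(-σ-1)*log u^j+u^(-σ)*(j*log u^(j-1)*u⁻¹)

lemma gw_deriv (j:ℕ) (σ u:ℝ) (hu : 0<u) : HasDerivAt (gw j σ) (gw' j σ u) u := by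
  have h1 := hasDerivAt_rpow_const (x := u) (p := -σ) (Or.inl hu.ne')
  have h2 := (hasDerivAt_log hu.ne').pow j
  exact h1.mul h2

lemma gw'_cont (j:ℕ) (σ:ℝ) : ContinuousOn (gw' j σ) (Set.Ioi 0) := by
  unfold gw'
  have h0 : ∀ u ∈ Set.Ioi (0:ℝ), u ≠ 0 := fun u hu => ne_of_gt hu
  have hr : ∀ p : ℝ, ContinuousOn (fun u : ℝ => u^p) (Set.Ioi 0) := fun p =>
    continuousOn_id.rpow_const (fun u hu => Or.inl (h0 u hu))
  have hl : ContinuousOn log (Set.Ioi 0) := continuousOn_log.mono (fun u hu => h0 u hu)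
  exact (((hr _).const_mul _).mul (hl.pow j)).add ((hr _).mul (((hl.pow _).const_mul _).mul (continuousOn_id.inv₀ h0)))


lemma gw'_bound (j:ℕ) (hj : j≤2) (σ u:ℝ) (hσ : 1≤σ) (hσ2 : σ≤2) (hu0 : 0<u) (hu : 1≤log u) :
    |gw' j σ u| ≤ 4*u^(-σ-1)*log u^j := by
  unfold gw'
  have e : u^(-σ)*(j*log u^(j-1)*u⁻¹)=j*(u^(-σ-1)*log u^(j-1)) := by
    rw [rpow_sub_one hu0.ne']; ring
  rw [e]
  have hp := rpow_pos_of_pos hu0 (-σ-1)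
  have hl : log u^(j-1)≤log u^j := pow_le_pow_right₀ hu (by omega)
  have hl0 : 0≤log u^(j-1) := by positivity
  have hj2 : (j:ℝ)≤2 := by exact_mod_cast hj
  refine (abs_add_le _ _).trans ?_
  rw [abs_of_nonpos (by
    have : 0≤σ*u^(-σ-1)*log u^j := by positivity
    linarith [this, show -σ*u^(-σ-1)*log u^j = -(σ*u^(-σ-1)*log u^j) by ring]),
    abs_of_nonneg (by positivity)]
  have a1 : σ*(u^(-σ-1)*log u^j)≤2*(u^(-σ-1)*log u^j) := by gcongr
  have a2 : j*(u^(-σ-1)*log u^(j-1))≤2*(u^(-σ-1)*log u^j) := by gcongr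
  linarith

lemma rpow_int (κ a b:ℝ) (hκ : 0<κ) (ha : 1≤a) (hab : a≤b) : ∫ u in a..b, u^(-1-κ)≤1/κ := by
  rw [integral_rpow (Or.inr ⟨by linarith, by rw [Set.uIcc_of_le hab]; intro h; linarith [h.1]⟩)]
  have h1 : a^(-κ)≤1 := rpow_le_one_of_one_le_of_nonpos ha (by linarith)
  have h2 : 0≤b^(-κ) := rpow_nonneg (by linarith) _
  rw [show -1-κ+1 = -κ by ring, div_neg, ← neg_div]
  gcongr; linarith

theorem rough_sum : ∃ C : ℝ, 1≤C ∧ ∀ z κ N : ℝ, 2^10≤z → 0<κ → κ≤1 → z≤N →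
    ∑ n ∈ Ioc ⌊z⌋₊ ⌊N⌋₊, rf z n*(n:ℝ)^(-(1+κ))≤C/(κ*log z) := by
  obtain ⟨C, hC, hb⟩ := bt2
  refine ⟨10*C, by linarith, ?_⟩
  intro z κ N hz hκ hκ1 hN
  have hz0 : 0<z := by norm_num at hz; linarith
  have hz1 : 1<z := by norm_num at hz; linarith
  have l0 : 0<log z := log_pos hz1
  have l1 : 1≤log z := by
    rw [le_log_iff_exp_le (by linarith)]
    have := exp_one_lt_d9
    norm_num at hz; linarith
  set l := log z
  have h := abel_m (fun n => (rf z n:ℂ)) (fun _ => 0) (fun u => ((gw 0 (1+κ) u:ℝ):ℂ)) (fun u => ((gw' 0 (1+κ) u:ℝ):ℂ)) z N hz0 hN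
    (fun u hu => (gw_deriv 0 (1+κ) u hu).ofReal_comp)
    (Complex.continuous_ofReal.comp_continuousOn (gw'_cont 0 (1+κ))) continuousOn_const (fun u => 2*C*u/l)
    (by fun_prop) (by
      intro u hu
      simp only [intervalIntegral.integral_zero, sub_zero]
      rw [← Complex.ofReal_sum, Complex.norm_real, norm_of_nonneg (sum_nonneg (fun n _ => rf_nonneg z n))]
      have := hb z z u hz hz0.le hu.1
      calc _≤∑ n ∈ Ioc ⌊z⌋₊ ⌊z+u⌋₊, rf z n := by
            apply sum_le_sum_of_subset_of_nonneg
            · exact Ioc_subset_Ioc_right (Nat.floor_mono (by linarith))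
            · intro n _ _; exact rf_nonneg z n
        _≤C*u/l := this
        _≤_ := by
          have : 0<u := by linarith [hu.1]
          gcongr; linarith)
  simp only [zero_mul, intervalIntegral.integral_zero, sub_zero] at h
  have e : ∑ n ∈ Ioc ⌊z⌋₊ ⌊N⌋₊, (rf z n:ℂ)*((gw 0 (1+κ) n:ℝ):ℂ)=((∑ n ∈ Ioc ⌊z⌋₊ ⌊N⌋₊, rf z n*(n:ℝ)^(-(1+κ)):ℝ):ℂ) := by
    push_cast
    refine sum_congr rfl (fun n _ => ?_)
    unfold gw; simp
  rw [e, Complex.norm_real] at h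
  refine (le_norm_self _).trans (h.trans ?_)
  have b1 : ‖((gw 0 (1+κ) N:ℝ):ℂ)‖*(2*C*N/l)≤2*C/l := by
    have hN0 : 0<N := by linarith
    rw [Complex.norm_real]
    unfold gw
    rw [pow_zero, mul_one, norm_of_nonneg (by positivity)]
    have : N^(-(1+κ))*N≤1 := by
      rw [← rpow_add_one hN0.ne']
      exact rpow_le_one_of_one_le_of_nonpos (by linarith) (by linarith)
    calc _=(N^(-(1+κ))*N)*(2*C/l) := by ring
      _≤1*(2*C/l) := by gcongr
      _=_ := by ring
  have b2 : ∫ u in z..N, ‖((gw' 0 (1+κ) u:ℝ):ℂ)‖*(2*C*u/l)≤8*C/l*(1/κ) := by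
    calc _≤∫ u in z..N, (8*C/l)*u^(-1-κ) := by
          apply intervalIntegral.integral_mono_on hN
          · apply ContinuousOn.intervalIntegrable
            rw [Set.uIcc_of_le hN]
            have := (gw'_cont 0 (1+κ)).mono (fun u (hu : u ∈ Set.Icc z N) => (lt_of_lt_of_le hz0 hu.1 : (0:ℝ)<u))
            exact ((Complex.continuous_ofReal.comp_continuousOn this).norm).mul (by fun_prop)
          · apply ContinuousOn.intervalIntegrable
            rw [Set.uIcc_of_le hN]
            exact continuousOn_const.mul (continuousOn_id.rpow_const (fun u hu => Or.inl (by have := hu.1; simp only [id]; linarith)))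
          · intro u hu
            have hu0 : 0<u := by linarith [hu.1]
            have hlu : l≤log u := log_le_log hz0 hu.1
            have := gw'_bound 0 (by norm_num) (1+κ) u (by linarith) (by linarith) hu0 (by linarith)
            rw [Complex.norm_real, norm_eq_abs]
            rw [pow_zero, mul_one] at this
            have e3 : u^(-(1+κ)-1)*u=u^(-1-κ) := by
              rw [← rpow_add_one hu0.ne']; congr 1; ring
            calc |gw' 0 (1+κ) u| * (2*C*u/l)≤(4*u^(-(1+κ)-1))*(2*C*u/l) := by gcongr
              _=(8*C/l)*(u^(-(1+κ)-1)*u) := by ring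
              _=_ := by rw [e3]
      _=(8*C/l)*∫ u in z..N, u^(-1-κ) := by rw [intervalIntegral.integral_const_mul]
      _≤_ := by gcongr; exact rpow_int κ z N hκ hz1.le hN
  refine (add_le_add b1 b2).trans ?_
  calc 2*C/l+8*C/l*(1/κ)≤2*C/l*(1/κ)+8*C/l*(1/κ) := by
        have : 1≤1/κ := by rw [le_div_iff₀ hκ]; linarith
        have h0 : 0≤2*C/l := by positivity
        nlinarith
    _=_ := by field_simp; ring

/-- powers of log against powers -/
lemma logpow_le (j:ℕ) (hj : j≤2) (δ u:ℝ) (hδ : 0<δ) (hu : 1≤u) :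
    log u^j≤(4/δ)^j*u^(δ/2) := by
  have h1 := log_le_pow (δ/4) u (by linarith) (by linarith)
  have h0 : 0≤log u := log_nonneg hu
  have hup : 1≤u^(δ/4) := one_le_rpow hu (by linarith)
  calc log u^j≤((4/δ)*u^(δ/4))^j := by
        gcongr
        calc _≤_ := h1
          _=_ := by field_simp
    _=(4/δ)^j*(u^(δ/4))^j := by rw [mul_pow]
    _≤(4/δ)^j*(u^(δ/4))^2 := by gcongr
    _=_ := by
      rw [← rpow_natCast (u^(δ/4)), ← rpow_mul (by linarith)]; congr 2; push_cast; ring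

noncomputable def Qw (w:ℂ) (j:ℕ) (L:ℝ) : ℂ := -((L:ℂ)^j/w+j*(L:ℂ)^(j-1)/w^2+j*(j-1)*(L:ℂ)^(j-2)/w^3)

lemma Qw_deriv (w:ℂ) (hw : w ≠ 0) (j:ℕ) (hj : j≤2) (L:ℝ) :
    HasDerivAt (fun L : ℝ => Qw w j L) (w*Qw w j L+(L:ℂ)^j) L := by
  unfold Qw
  have hL : HasDerivAt (fun L : ℝ => (L:ℂ)) 1 L := Complex.ofRealCLM.hasDerivAt
  interval_cases j
  · refine ((hasDerivAt_const L (-(1/w))).congr_of_eventuallyEq ?_).congr_deriv ?_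
    · filter_upwards with y; simp
    · simp; field_simp; simp
  · refine (((hL.div_const w).neg.sub_const (1/w^2)).congr_of_eventuallyEq ?_).congr_deriv ?_
    · filter_upwards with y; simp; ring
    · simp; field_simp; ring
  · refine ((((((hL.pow 2).div_const w)).add ((hL.const_mul 2).div_const (w^2))).neg.sub_const (2/w^3)).congr_of_eventuallyEq ?_).congr_deriv ?_
    · filter_upwards with y; simp; norm_num; ring
    · simp; field_simp; ring


lemma Qw_norm (κ t:ℝ) (hκ : 0<κ) (ht : t ≠ 0) (j:ℕ) (hj : j≤2) (u:ℝ) (hu : 1≤u) :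
    u^(-κ)*‖Qw (κ+t*Complex.I) j (log u)‖≤40/(κ^j * |t|) := by
  have hu0 : 0<u := by linarith
  set w : ℂ := κ+t*Complex.I with hw
  have ht0 : 0 < |t| := abs_pos.mpr ht
  have hw1 : |t| ≤ ‖w‖ := by
    have := Complex.abs_im_le_norm w
    simpa [hw] using this
  have hw2 : κ≤‖w‖ := by
    have := Complex.re_le_norm w
    simpa [hw] using this
  have hw0 : 0<‖w‖ := by linarith
  set L := log u with hL
  have hL0 : 0≤L := log_nonneg hu
  have hp := rpow_pos_of_pos hu0 (-κ)
  have hLj : ∀ i : ℕ, i≤2 → u^(-κ)*L^i≤(4/κ)^i := by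
    intro i hi
    have h := logpow_le i hi κ u hκ hu
    calc u^(-κ)*L^i≤u^(-κ)*((4/κ)^i*u^(κ/2)) := by gcongr
      _=(4/κ)^i*(u^(-κ)*u^(κ/2)) := by ring
      _=(4/κ)^i*u^(-(κ/2)) := by rw [← rpow_add hu0]; congr 2; ring
      _≤(4/κ)^i*1 := by
        gcongr; exact rpow_le_one_of_one_le_of_nonpos hu (by linarith)
      _=_ := by ring
  have h1 : 1/‖w‖≤1/|t| := one_div_le_one_div_of_le ht0 hw1
  have h2 : 1/‖w‖^2≤1/(κ * |t|) := by
    apply one_div_le_one_div_of_le (by positivity); nlinarith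
  have h3 : 1/‖w‖^3≤1/(κ^2 * |t|) := by
    apply one_div_le_one_div_of_le (by positivity)
    calc κ^2 * |t| ≤ ‖w‖^2*‖w‖ := by gcongr
      _=_ := by ring
  unfold Qw
  rw [norm_neg]
  interval_cases j
  · simp
    have := hLj 0 (by norm_num)
    simp at this h1
    have h4 : 0<‖w‖⁻¹ := by positivity
    have h5 : 0 < |t|⁻¹ := by positivity
    calc u^(-κ)*‖w‖⁻¹≤1 * |t|⁻¹ := by gcongr
      _≤_ := by rw [div_eq_mul_inv]; linarith
  · have e : ‖(L:ℂ)^1/w+(1:ℕ)*(L:ℂ)^(1-1)/w^2+(1:ℕ)*((1:ℕ)-1)*(L:ℂ)^(1-2)/w^3‖≤L*(1/‖w‖)+1/‖w‖^2 := by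
      refine (norm_add_le _ _).trans ?_
      refine (add_le_add (norm_add_le _ _) le_rfl).trans ?_
      simp [abs_of_nonneg hL0]
      apply le_of_eq; ring
    have := hLj 1 (by norm_num)
    have h00 := hLj 0 (by norm_num)
    simp only [pow_one, pow_zero, mul_one] at this h00
    calc _≤u^(-κ)*(L*(1/‖w‖)+1/‖w‖^2) := by gcongr
      _=(u^(-κ)*L)*(1/‖w‖)+u^(-κ)*(1/‖w‖^2) := by ring
      _≤(4/κ)*(1/|t|)+1*(1/(κ * |t|)) := by gcongr
      _=5/(κ^1 * |t|) := by field_simp; ring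
      _≤_ := by gcongr; norm_num
  · have e : ‖(L:ℂ)^2/w+(2:ℕ)*(L:ℂ)^(2-1)/w^2+(2:ℕ)*((2:ℕ)-1)*(L:ℂ)^(2-2)/w^3‖≤L^2*(1/‖w‖)+2*L*(1/‖w‖^2)+2*(1/‖w‖^3) := by
      refine (norm_add_le _ _).trans ?_
      refine (add_le_add (norm_add_le _ _) le_rfl).trans ?_
      norm_num [abs_of_nonneg hL0]
      apply le_of_eq; ring
    have a2 := hLj 2 (by norm_num)
    have a1 := hLj 1 (by norm_num)
    have a0 := hLj 0 (by norm_num)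
    simp only [pow_one, pow_zero, mul_one] at a1 a0
    calc _≤u^(-κ)*(L^2*(1/‖w‖)+2*L*(1/‖w‖^2)+2*(1/‖w‖^3)) := by gcongr
      _=(u^(-κ)*L^2)*(1/‖w‖)+2*(u^(-κ)*L)*(1/‖w‖^2)+2*u^(-κ)*(1/‖w‖^3) := by ring
      _≤(4/κ)^2*(1/|t|)+2*(4/κ)*(1/(κ*|t|))+2*1*(1/(κ^2 * |t|)) := by gcongr
      _=26/(κ^2 * |t|) := by field_simp; ring
      _≤_ := by gcongr; norm_num

lemma pole_int (κ t a b:ℝ) (hκ : 0<κ) (ht : t ≠ 0) (j:ℕ) (hj : j≤2) (ha : 1≤a) (hab : a≤b) :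
    ‖∫ u in a..b, cx t u*((gw j (1+κ) u:ℝ):ℂ)‖≤80/(κ^j * |t|) := by
  set w : ℂ := κ+t*Complex.I with hw
  have hw0 : w ≠ 0 := by
    intro h
    have := congrArg Complex.re h
    simp [hw] at this; linarith
  have hd : ∀ u : ℝ, 0<u → HasDerivAt (fun u : ℝ => cx t u*((u^(-κ):ℝ):ℂ)*Qw w j (log u)) (cx t u*((gw j (1+κ) u:ℝ):ℂ)) u := by
    intro u hu
    have h1 := cx_hasDeriv t hu
    have h2 := (hasDerivAt_rpow_const (x := u) (p := -κ) (Or.inl hu.ne')).ofReal_comp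
    have h3 := (Qw_deriv w hw0 j hj (log u)).scomp u (hasDerivAt_log hu.ne')
    refine ((h1.mul h2).mul h3).congr_deriv ?_
    have e1 : u^(-κ)=u^(-(1+κ))*u := by
      rw [← rpow_add_one hu.ne']; congr 1; ring
    have e2 : u^(-κ-1)=u^(-(1+κ)) := by congr 1; ring
    unfold gw
    simp only [Function.comp, Complex.real_smul, Pi.mul_apply]
    rw [e2, e1]
    push_cast
    have hu' : (u:ℂ) ≠ 0 := by exact_mod_cast hu.ne'
    rw [hw]
    field_simp
    ring
  have hsub : Set.uIcc a b ⊆ Set.Ioi 0 := by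
    rw [Set.uIcc_of_le hab]; intro u hu; exact lt_of_lt_of_le (by linarith) hu.1
  have hitg := intervalIntegral.integral_eq_sub_of_hasDerivAt (a := a) (b := b)
    (f := (fun u : ℝ => cx t u*((u^(-κ):ℝ):ℂ)*Qw w j (log u)))
    (fun u hu => hd u (hsub hu)) (by
      apply ContinuousOn.intervalIntegrable
      refine ((cx_continuousOn t).mono hsub).mul (Complex.continuous_ofReal.comp_continuousOn ?_)
      exact fun u hu => (gw_deriv j (1+κ) u (hsub hu)).continuousAt.continuousWithinAt)
  rw [hitg]
  refine (norm_sub_le _ _).trans ?_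
  have hn : ∀ u : ℝ, 1≤u → ‖cx t u*((u^(-κ):ℝ):ℂ)*Qw w j (log u)‖≤40/(κ^j * |t|) := by
    intro u hu
    rw [norm_mul, norm_mul, cx_norm, one_mul, Complex.norm_real, norm_of_nonneg (rpow_nonneg (by linarith) _)]
    exact Qw_norm κ t hκ ht j hj u hu
  have := add_le_add (hn b (by linarith)) (hn a ha)
  refine this.trans (le_of_eq ?_)
  ring

end M3b
end H12
namespace H12
open Real Finset
section M3c
open MeasureTheory

noncomputable def rt (z:ℝ) (j:ℕ) (σ t:ℝ) (n:ℕ) : ℂ := (rf z n:ℂ)*cx t n*((gw j σ n:ℝ):ℂ)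

lemma rt_norm (z:ℝ) (j:ℕ) (σ t:ℝ) (n:ℕ) : ‖rt z j σ t n‖=rf z n*gw j σ n := by
  unfold rt gw
  rw [norm_mul, norm_mul, cx_norm, mul_one, Complex.norm_real, Complex.norm_real, norm_of_nonneg (rf_nonneg z n), norm_of_nonneg]
  have := log_natCast_nonneg n
  positivity

lemma gw_nonneg (j:ℕ) (σ:ℝ) (n:ℕ) : 0≤gw j σ n := by
  unfold gw
  have := log_natCast_nonneg n
  positivity

lemma gw_summable (j:ℕ) (hj : j≤2) (σ:ℝ) (hσ : 1<σ) : Summable (fun n : ℕ => gw j σ n) := by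
  have h : Summable (fun n : ℕ => (4/(σ-1))^j*(n:ℝ)^(-(1+(σ-1)/2))) := by
    apply Summable.mul_left
    exact summable_nat_rpow.mpr (by linarith)
  refine Summable.of_nonneg_of_le (fun n => gw_nonneg j σ n) (fun n => ?_) h
  rcases Nat.eq_zero_or_pos n with h0 | h0
  · subst h0
    unfold gw
    have : (0:ℝ)^(-σ)=0 := zero_rpow (by linarith)
    simp only [Nat.cast_zero]
    rw [this, zero_mul]
    have : 0<σ-1 := by linarith
    positivity
  · have h1 : (1:ℝ)≤n := by exact_mod_cast h0
    have := logpow_le j hj (σ-1) n (by linarith) h1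
    have hn0 : (0:ℝ)<n := by linarith
    unfold gw
    calc (n:ℝ)^(-σ)*log n^j≤(n:ℝ)^(-σ)*((4/(σ-1))^j*n^((σ-1)/2)) := by gcongr
      _=(4/(σ-1))^j*((n:ℝ)^(-σ)*n^((σ-1)/2)) := by ring
      _=_ := by rw [← rpow_add hn0]; congr 2; ring

lemma rt_summable (z:ℝ) (j:ℕ) (hj : j≤2) (σ t:ℝ) (hσ : 1<σ) : Summable (rt z j σ t) := by
  refine Summable.of_norm_bounded (gw_summable j hj σ hσ) (fun n => ?_)
  rw [rt_norm]
  have := rf_le_one z n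
  have := gw_nonneg j σ n
  nlinarith

lemma rt_zero (z:ℝ) (j:ℕ) (σ t:ℝ) : rt z j σ t 0=0 := by unfold rt; rw [rf_zero]; simp

/-- the sum over `n ≤ z`. -/
lemma small_part (z:ℝ) (hz : 1≤z) (f : ℕ → ℝ) : ∑ n ∈ Ioc 0 ⌊z⌋₊, rf z n*f n=f 1 := by
  rw [sum_eq_single 1]
  · rw [rf_one, one_mul]
  · intro n hn h1
    rw [rf_small z n h1, zero_mul]
    exact (Nat.le_floor_iff (by linarith)).mp (mem_Ioc.mp hn).2
  · intro h
    exfalso; apply h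
    rw [mem_Ioc]
    exact ⟨one_pos, Nat.le_floor (by exact_mod_cast hz)⟩

/-- bound on real axis -/
theorem R_real : ∃ C : ℝ, 1≤C ∧ ∀ z κ : ℝ, 2^10≤z → 0<κ → κ≤1 →
    ∑' n, rf z n*(n:ℝ)^(-(1+κ))≤1+C/(κ*log z) := by
  obtain ⟨C, hC, h⟩ := rough_sum
  refine ⟨C, hC, ?_⟩
  intro z κ hz hκ hκ1
  have hz1 : 1≤z := by norm_num at hz; linarith
  have hsm : Summable (fun n : ℕ => rf z n*(n:ℝ)^(-(1+κ))) := by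
    refine Summable.of_nonneg_of_le (fun n => mul_nonneg (rf_nonneg z n) (by positivity)) (fun n => ?_) (gw_summable 0 (by norm_num) (1+κ) (by linarith))
    unfold gw
    rw [pow_zero, mul_one]
    have := rf_le_one z n
    have : 0≤(n:ℝ)^(-(1+κ)) := by positivity
    nlinarith
  have ht := (hsm.hasSum.tendsto_sum_nat).comp (Filter.tendsto_add_atTop_nat 1)
  refine le_of_tendsto ht ?_
  filter_upwards [Filter.eventually_ge_atTop ⌈z⌉₊] with n hn
  simp only [Function.comp]
  have hzn : z≤n := Nat.ceil_le.mp hn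
  have : ∑ i ∈ range (n+1), rf z i*(i:ℝ)^(-(1+κ))=∑ k ∈ Ioc 0 n, rf z k*(k:ℝ)^(-(1+κ)) := by
    rw [range_eq_Ico, sum_eq_sum_Ico_succ_bot (by omega), rf_zero, zero_mul, zero_add]
    congr 1
  rw [this, ← sum_Ioc_consecutive _ (Nat.zero_le ⌊z⌋₊) (by have := Nat.floor_mono hzn; simpa using this), small_part z hz1 (fun n => (n:ℝ)^(-(1+κ)))]
  have := h z κ n hz hκ hκ1 hzn
  rw [Nat.floor_natCast] at this
  simp only [Nat.cast_one, one_rpow]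
  linarith

theorem R_bound : ∃ C : ℝ, 1≤C ∧ ∀ η : ℝ, 0<η → η≤1 → ∃ X0 : ℝ, 1≤X0 ∧ ∀ X : ℝ, X0≤X → ∀ t σ : ℝ,
    X^(-(1/3:ℝ)) ≤ |t| → |t| ≤ exp X → 1+1/X≤σ → σ≤2 → ∀ j : ℕ, j≤2 →
    ‖∑' n, rt (exp (η*X)) j σ t n‖≤C*(η*X)^j := by
  obtain ⟨C1, hC1, h1⟩ := rough_sum
  obtain ⟨C2, hC2, h2⟩ := star2
  refine ⟨1 + 256 * (exp 16 * C1) + 2^20 * C2 + 80, by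
    have : 0 < exp 16 := exp_pos _
    have : 0<256*(exp 16*C1) := by positivity
    linarith, ?_⟩
  intro η hη hη1
  obtain ⟨z1, hz1, h2⟩ := h2 (1/η) (by positivity)
  refine ⟨max (log z1/η) ((1/η)^5), ?_, ?_⟩
  · apply le_max_of_le_right
    apply one_le_pow₀
    rw [le_div_iff₀ hη]; linarith
  intro X hX t σ ht1 ht2 hσ hσ2 j hj
  set z := exp (η*X) with hz
  set l := η*X with hl
  have hlz : log z=l := by rw [hz, log_exp]
  have hzz : z1≤z := by
    have := (le_max_left _ _).trans hX
    rw [div_le_iff₀ hη] at this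
    rw [hz, ← log_le_iff_le_exp (lt_of_lt_of_le (by norm_num) hz1)]
    linarith
  have hz10 : (2:ℝ)^10≤z := hz1.trans hzz
  have hz1' : (1:ℝ)<z := lt_of_lt_of_le (by norm_num) hz10
  have l6 : 1≤ l := by
    rw [← hlz, le_log_iff_exp_le (by linarith)]
    have := exp_one_lt_d9
    norm_num at hz10; linarith
  have hX5 : (1/η)^5≤X := (le_max_right _ _).trans hX
  have hη' : 1≤1/η := by rw [le_div_iff₀ hη]; linarith
  have hX1 : 1≤X := le_trans (one_le_pow₀ hη') hX5
  have X0 : 0<X := by linarith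
  have ht0 : t ≠ 0 := by
    intro h
    have : 0<X^(-(1/3:ℝ)) := rpow_pos_of_pos X0 _
    rw [h, abs_zero] at ht1; linarith
  have htz : |t| ≤ z^(1/η) := by
    rw [hz, ← exp_mul]; convert ht2 using 2; rw [hl]; field_simp
  have hσ1 : 1 < σ := by have : 0 < 1/X := by positivity
                         linarith
  set N0 := z^16 with hN0
  have hzN0 : z≤N0 := le_self_pow₀ hz1'.le (by norm_num)
  have hN01 : 1≤N0 := by linarith
  have hlN0 : log N0=16*l := by rw [hN0, log_pow, hlz]; norm_num
  set δ := 1/(16*l) with hδ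
  have δ0 : 0<δ := by positivity
  have hδi : 4/δ=64*l := by rw [hδ]; field_simp; norm_num
  -- part 1
  have part1 : ‖∑ n ∈ Ioc 0 ⌊N0⌋₊, rt z j σ t n‖≤(1+256*(exp 16*C1))*l^j := by
    refine (norm_sum_le _ _).trans ?_
    simp only [rt_norm]
    rw [← sum_Ioc_consecutive _ (Nat.zero_le ⌊z⌋₊) (Nat.floor_mono hzN0), small_part z hz1'.le (fun n => gw j σ n)]
    have a1 : gw j σ (1:ℕ)≤1*l^j := by
      unfold gw
      simp only [Nat.cast_one, one_rpow, log_one, one_mul]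
      exact pow_le_pow_left₀ le_rfl (by linarith) j
    have a2 : ∑ n ∈ Ioc ⌊z⌋₊ ⌊N0⌋₊, rf z n*gw j σ n≤256*(exp 16*C1)*l^j := by
      have hr := h1 z (1/l) N0 hz10 (by positivity) (by rw [div_le_iff₀ (by linarith)]; linarith) hzN0
      rw [hlz, one_div_mul_cancel (by linarith : l ≠ 0), div_one] at hr
      calc _≤∑ n ∈ Ioc ⌊z⌋₊ ⌊N0⌋₊, (256*l^j*exp 16)*(rf z n*(n:ℝ)^(-(1+1/l))) := by
            refine sum_le_sum (fun n hn => ?_)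
            rw [mem_Ioc] at hn
            have hn1 : z<n := (Nat.floor_lt (by linarith)).mp hn.1
            have hn2 : (n:ℝ)≤N0 := (Nat.le_floor_iff (by linarith)).mp hn.2
            have hn0 : (0:ℝ)<n := by linarith
            have hlog : log n≤16*l := by rw [← hlN0]; exact log_le_log hn0 hn2
            have hlog0 : 0≤log n := log_nonneg (by linarith)
            have b1 : (n:ℝ)^(-σ)≤exp 16*(n:ℝ)^(-(1+1/l)) := by
              calc (n:ℝ)^(-σ)≤(n:ℝ)^(-1:ℝ) := rpow_le_rpow_of_exponent_le (by linarith) (by linarith)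
                _=(n:ℝ)^(1/l)*(n:ℝ)^(-(1+1/l)) := by rw [← rpow_add hn0]; congr 1; ring
                _≤_ := by
                  gcongr
                  rw [rpow_def_of_pos hn0]
                  apply exp_le_exp.mpr
                  rw [mul_one_div, div_le_iff₀ (by linarith)]; exact hlog
            have b2 : log n^j≤256*l^j := by
              calc log n^j≤(16*l)^j := by gcongr
                _=16^j*l^j := mul_pow _ _ _
                _≤16^2*l^j := by gcongr; norm_num
                _=_ := by norm_num
            have hrf := rf_nonneg z n
            unfold gw
            calc rf z n*((n:ℝ)^(-σ)*log n^j)≤ rf z n*((exp 16*(n:ℝ)^(-(1+1/l)))*(256*l^j)) := by gcongr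
              _=_ := by ring
        _=(256*l^j*exp 16)*∑ n ∈ Ioc ⌊z⌋₊ ⌊N0⌋₊, rf z n*(n:ℝ)^(-(1+1/l)) := by rw [mul_sum]
        _≤(256*l^j*exp 16)*C1 := by gcongr
        _=_ := by ring
    linarith
  -- part 2
  have part2 : ∀ N : ℝ, N0≤N → ‖∑ n ∈ Ioc ⌊N0⌋₊ ⌊N⌋₊, rt z j σ t n‖≤(2^20*C2+80)*l^j := by
    intro N hN
    have hN1 : 1≤N := by linarith
    have hN0p : 0<N := by linarith
    have l0 : 0< l := by linarith
    have hab := abel_m (fun n => (rf z n:ℂ)*cx t n) (fun u => (Vz z:ℂ)*cx t u) (fun u => ((gw j σ u:ℝ):ℂ)) (fun u => ((gw' j σ u:ℝ):ℂ)) N0 N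
      (by linarith) hN (fun u hu => (gw_deriv j σ u hu).ofReal_comp)
      (Complex.continuous_ofReal.comp_continuousOn (gw'_cont j σ)) ((cx_continuousOn t).const_mul _)
      (fun u => C2*u^(1-δ)/l) (by
        refine ContinuousOn.div_const (continuousOn_const.mul (continuousOn_id.rpow_const (fun u hu => Or.inl (ne_of_gt hu)))) _) (by
        intro u hu
        rw [intervalIntegral.integral_const_mul]
        have := h2 z u t hzz hu.1 htz
        rw [hlz] at this
        exact this)
    have hsub : Set.Icc N0 N ⊆ Set.Ioi 0 := fun u hu => lt_of_lt_of_le (by linarith : (0:ℝ)<N0) hu.1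
    have hgB : ∀ u : ℝ, 1≤u → u^(-σ)*log u^j*u^(1-δ)≤(64*l)^j*u^(-(δ/2)) := by
      intro u hu
      have hu0 : 0<u := by linarith
      have := logpow_le j hj δ u δ0 hu
      rw [hδi] at this
      calc u^(-σ)*log u^j*u^(1-δ)≤u^(-1:ℝ)*((64*l)^j*u^(δ/2))*u^(1-δ) := by
            have : 0≤log u := log_nonneg hu
            have h3 : u^(-σ)≤u^(-1:ℝ) := rpow_le_rpow_of_exponent_le hu (by linarith)
            gcongr
        _=(64*l)^j*(u^(-1:ℝ)*u^(δ/2)*u^(1-δ)) := by ring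
        _=_ := by rw [← rpow_add hu0, ← rpow_add hu0]; congr 2; ring
    have h64 : (64*l)^j≤2^12*l^j := by
      rw [mul_pow]; gcongr
      calc (64:ℝ)^j≤64^2 := by gcongr; norm_num
        _=_ := by norm_num
    have c1 : ‖((gw j σ N:ℝ):ℂ)‖*(C2*N^(1-δ)/l)≤2^12*C2*l^j := by
      rw [Complex.norm_real]
      have hlN : 0≤log N := log_nonneg hN1
      have := hgB N hN1
      have h5 : N^(-(δ/2))≤1 := rpow_le_one_of_one_le_of_nonpos hN1 (by linarith)
      unfold gw
      rw [norm_of_nonneg (by positivity)]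
      calc _=(N^(-σ)*log N^j*N^(1-δ))*(C2/l) := by ring
        _≤((64*l)^j*N^(-(δ/2)))*(C2/1) := by gcongr
        _≤((2^12*l^j)*1)*(C2/1) := by gcongr
        _=_ := by ring
    have c2 : ∫ u in N0..N, ‖((gw' j σ u:ℝ):ℂ)‖*(C2*u^(1-δ)/l)≤2^19*C2*l^j := by
      calc _≤∫ u in N0..N, (4*C2/l*(64*l)^j)*u^(-1-δ/2) := by
            apply intervalIntegral.integral_mono_on hN
            · apply ContinuousOn.intervalIntegrable
              rw [Set.uIcc_of_le hN]
              refine ((Complex.continuous_ofReal.comp_continuousOn ((gw'_cont j σ).mono hsub)).norm).mul ?_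
              exact ContinuousOn.div_const (continuousOn_const.mul (continuousOn_id.rpow_const (fun u hu => Or.inl (ne_of_gt (hsub hu))))) _
            · apply ContinuousOn.intervalIntegrable
              rw [Set.uIcc_of_le hN]
              exact continuousOn_const.mul (continuousOn_id.rpow_const (fun u hu => Or.inl (ne_of_gt (hsub hu))))
            · intro u hu
              have hu1 : 1≤u := by linarith [hu.1]
              have hu0 : 0<u := by linarith
              have hlu : 16*l≤log u := by rw [← hlN0]; exact log_le_log (by linarith) hu.1
              have hb := gw'_bound j hj σ u hσ1.le hσ2 hu0 (by linarith)
              have hg := hgB u hu1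
              rw [Complex.norm_real, norm_eq_abs]
              have e1 : u^(-σ-1)=u^(-σ)*u⁻¹ := by rw [rpow_sub_one hu0.ne']; ring
              have e2 : u^(-1-δ/2)=u^(-(δ/2))*u⁻¹ := by
                rw [← rpow_neg_one u, ← rpow_add hu0]; congr 1; ring
              calc |gw' j σ u| * (C2*u^(1-δ)/l)≤(4*u^(-σ-1)*log u^j)*(C2*u^(1-δ)/l) := by gcongr
                _=(4*C2/l)*((u^(-σ)*log u^j*u^(1-δ))*u⁻¹) := by rw [e1]; ring
                _≤(4*C2/l)*(((64*l)^j*u^(-(δ/2)))*u⁻¹) := by gcongr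
                _=_ := by rw [e2]; ring
        _=(4*C2/l*(64*l)^j)*∫ u in N0..N, u^(-1-δ/2) := by rw [intervalIntegral.integral_const_mul]
        _≤(4*C2/l*(2^12*l^j))*(1/(δ/2)) := by
          have := rpow_int (δ/2) N0 N (by linarith) hN01 hN
          have h0 : 0≤∫ u in N0..N, u^(-1-δ/2) := intervalIntegral.integral_nonneg hN (fun u hu => rpow_nonneg (le_of_lt (hsub hu)) _)
          gcongr
        _=_ := by rw [hδ]; field_simp; norm_num
    have c3 : ‖∫ u in N0..N, (Vz z:ℂ)*cx t u*((gw j σ u:ℝ):ℂ)‖≤80*l^j := by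
      have hp := pole_int (σ-1) t N0 N (by linarith) ht0 j hj hN01 hN
      rw [add_sub_cancel] at hp
      simp only [mul_assoc]
      rw [intervalIntegral.integral_const_mul, norm_mul, Complex.norm_real, norm_of_nonneg (Vz_pos z).le]
      have hV : Vz z≤1/l := by rw [← hlz]; exact Vz_le z hz1'
      have hX3 : 0<X^(-(1/3:ℝ)) := rpow_pos_of_pos X0 _
      have hκ : 1/X≤σ-1 := by linarith
      calc _≤(1/l)*(80/((1/X)^j*X^(-(1/3:ℝ)))) := by
            refine mul_le_mul hV (hp.trans ?_) (norm_nonneg _) (by positivity)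
            gcongr
        _=80*(X^j*(X^(1/3:ℝ)/l)) := by
          rw [rpow_neg X0.le, one_div X, inv_pow]; field_simp
        _≤80*(X^j*η^j) := by
          gcongr
          rw [div_le_iff₀ l0, hl]
          have e1 : X^(1/3:ℝ)*(1/η)^3≤X := by
            have : (1/η)^3≤X^(2/3:ℝ) := by
              calc (1/η)^3≤(1/η)^(10/3:ℝ) := by
                    rw [← rpow_natCast]; apply rpow_le_rpow_of_exponent_le hη'; norm_num
                _=((1/η)^5)^(2/3:ℝ) := by
                    rw [← rpow_natCast, ← rpow_mul (by positivity)]; norm_num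
                _≤_ := by gcongr
            calc X^(1/3:ℝ)*(1/η)^3≤X^(1/3:ℝ)*X^(2/3:ℝ) := by gcongr
              _=X := by rw [← rpow_add X0]; norm_num
          have e2 : X^(1/3:ℝ)≤X*η^3 := by
            rw [one_div η, inv_pow, ← div_eq_mul_inv, div_le_iff₀ (by positivity)] at e1; exact e1
          calc X^(1/3:ℝ)≤X*η^3 := e2
            _≤X*η^(j+1) := by
              gcongr X*?_
              exact pow_le_pow_of_le_one hη.le hη1 (by omega)
            _=_ := by ring
        _=_ := by rw [hl, mul_pow]; ring
    have hsum : ∑ n ∈ Ioc ⌊N0⌋₊ ⌊N⌋₊, rt z j σ t n=∑ n ∈ Ioc ⌊N0⌋₊ ⌊N⌋₊, (rf z n:ℂ)*cx t n*((gw j σ n:ℝ):ℂ) := rfl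
    rw [hsum]
    have htri := norm_le_norm_sub_add (∑ n ∈ Ioc ⌊N0⌋₊ ⌊N⌋₊, (rf z n:ℂ)*cx t n*((gw j σ n:ℝ):ℂ)) (∫ u in N0..N, (Vz z:ℂ)*cx t u*((gw j σ u:ℝ):ℂ))
    have hl0 : 0≤C2*l^j := by positivity
    calc _≤_ := htri
      _≤(2^12*C2*l^j+2^19*C2*l^j)+80*l^j := add_le_add (hab.trans (add_le_add c1 c2)) c3
      _≤_ := by nlinarith only [hl0]
  refine tsum_le_of_partial _ (rt_summable z j hj σ t hσ1) (rt_zero _ _ _ _) _ ⌈N0⌉₊ ?_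
  intro n hn
  have hn' : N0≤n := Nat.ceil_le.mp hn
  have := part2 n hn'
  rw [Nat.floor_natCast] at this
  rw [← sum_Ioc_consecutive _ (Nat.zero_le ⌊N0⌋₊) (by have := Nat.floor_mono hn'; simpa using this)]
  refine (norm_add_le _ _).trans ((add_le_add part1 this).trans (le_of_eq (by ring)))

end M3c
end H12
namespace H12
open Real Finset
section M3d
open MeasureTheory

/-- coefficient sequence of the rough zeta function, times `log^j`. -/
noncomputable def ra (z:ℝ) (j:ℕ) (n:ℕ) : ℂ := ((rf z n*log n^j:ℝ):ℂ)
/-- coefficients of the inverse. -/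
noncomputable def fa (z:ℝ) (j:ℕ) (n:ℕ) : ℂ := ((rf z n*(ArithmeticFunction.moebius n:ℝ)*log n^j:ℝ):ℂ)

lemma LSeries_tsum (f : ℕ → ℂ) (f0 : f 0=0) (σ t:ℝ) :
    LSeries f (σ+t*Complex.I)=∑' n, f n*cx t n*(((n:ℝ)^(-σ):ℝ):ℂ) := by
  unfold LSeries
  refine tsum_congr (fun n => ?_)
  rcases Nat.eq_zero_or_pos n with h | h
  · subst h; simp [f0]
  · rw [LSeries.term_of_ne_zero h.ne', div_eq_mul_inv, mul_assoc]
    congr 1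
    have hn : (n:ℂ) ≠ 0 := by exact_mod_cast h.ne'
    have hn0 : (0:ℝ)<n := by exact_mod_cast h
    rw [← Complex.cpow_neg, Complex.cpow_def_of_ne_zero hn]
    unfold cx
    rw [rpow_def_of_pos hn0]
    rw [Complex.ofReal_exp, ← Complex.exp_add]
    congr 1
    rw [← Complex.natCast_log]
    push_cast
    ring

lemma ra_zero (z:ℝ) (j:ℕ) : ra z j 0=0 := by unfold ra; rw [rf_zero]; simp
lemma fa_zero (z:ℝ) (j:ℕ) : fa z j 0=0 := by unfold fa; rw [rf_zero]; simp

lemma LSeries_ra (z:ℝ) (j:ℕ) (σ t:ℝ) : LSeries (ra z j) (σ+t*Complex.I)=∑' n, rt z j σ t n := by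
  rw [LSeries_tsum _ (ra_zero z j)]
  refine tsum_congr (fun n => ?_)
  unfold ra rt gw
  push_cast; ring

lemma logMul_ra (z:ℝ) (j:ℕ) : LSeries.logMul (ra z j)=ra z (j+1) := by
  ext n
  unfold LSeries.logMul ra
  rw [← Complex.natCast_log]; push_cast; ring

lemma logMul_fa (z:ℝ) (j:ℕ) : LSeries.logMul (fa z j)=fa z (j+1) := by
  ext n
  unfold LSeries.logMul fa
  rw [← Complex.natCast_log]; push_cast; ring

lemma absc_ra (z:ℝ) (j:ℕ) : LSeries.abscissaOfAbsConv (ra z j)≤1 := by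
  induction j with
  | zero =>
    apply LSeries.abscissaOfAbsConv_le_one_of_isBigO_one
    refine Asymptotics.IsBigO.of_bound 1 (Filter.Eventually.of_forall (fun n => ?_))
    unfold ra
    rw [pow_zero, mul_one, Complex.norm_real, norm_of_nonneg (rf_nonneg z n)]
    simpa using rf_le_one z n
  | succ j ih => rw [← logMul_ra, LSeries.abscissaOfAbsConv_logMul]; exact ih

lemma absc_fa (z:ℝ) (j:ℕ) : LSeries.abscissaOfAbsConv (fa z j)≤1 := by
  induction j with
  | zero =>
    apply LSeries.abscissaOfAbsConv_le_one_of_isBigO_one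
    refine Asymptotics.IsBigO.of_bound 1 (Filter.Eventually.of_forall (fun n => ?_))
    unfold fa
    rw [pow_zero, mul_one, Complex.norm_real, norm_mul, norm_of_nonneg (rf_nonneg z n)]
    have h1 := rf_le_one z n
    have h0 := rf_nonneg z n
    have h2 : ‖((ArithmeticFunction.moebius n:ℤ):ℝ)‖≤1 := by
      rw [norm_eq_abs]; exact_mod_cast ArithmeticFunction.abs_moebius_le_one
    simp only [Pi.one_apply, norm_one, mul_one]
    exact mul_le_one₀ h1 (norm_nonneg _) h2
  | succ j ih => rw [← logMul_fa, LSeries.abscissaOfAbsConv_logMul]; exact ih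

lemma ra_deriv (z:ℝ) (j:ℕ) (s:ℂ) (hs : 1< s.re) : HasDerivAt (LSeries (ra z j)) (-LSeries (ra z (j+1)) s) s := by
  have := LSeries_hasDerivAt (f := ra z j) (s := s) (lt_of_le_of_lt (absc_ra z j) (by exact_mod_cast hs))
  rwa [logMul_ra] at this

lemma fa_deriv (z:ℝ) (j:ℕ) (s:ℂ) (hs : 1< s.re) : HasDerivAt (LSeries (fa z j)) (-LSeries (fa z (j+1)) s) s := by
  have := LSeries_hasDerivAt (f := fa z j) (s := s) (lt_of_le_of_lt (absc_fa z j) (by exact_mod_cast hs))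
  rwa [logMul_fa] at this

lemma chi_rf (z:ℝ) (hz : 0≤z) (n:ℕ) (hn : n ≠ 0) : (1 : DirichletCharacter ℂ (primorial ⌊z⌋₊)) (n : ZMod (primorial ⌊z⌋₊))=(rf z n:ℂ) := by
  have hiff : Nat.Coprime n (primorial ⌊z⌋₊) ↔ (n ≠ 0 ∧ ∀ p, p.Prime → p ∣ n → z<p) := by
    constructor
    · intro h
      refine ⟨hn, fun p hp hd => ?_⟩
      by_contra hlt
      push Not at hlt
      have : p ∣ primorial ⌊z⌋₊ := by
        apply dvd_prod_of_mem
        rw [mem_filter, mem_range]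
        exact ⟨Nat.lt_succ_of_le (Nat.le_floor hlt), hp⟩
      exact Nat.not_coprime_of_dvd_of_dvd hp.one_lt hd this h
    · rintro ⟨_, h⟩
      apply Nat.Coprime.prod_right
      intro p hp
      rw [mem_filter, mem_range] at hp
      rw [Nat.coprime_comm, Nat.Prime.coprime_iff_not_dvd hp.2]
      intro hd
      have := h p hp.2 hd
      have h2 : (p:ℝ)≤z := (Nat.le_floor_iff hz).mp (Nat.le_of_lt_succ hp.1)
      linarith
  by_cases h : Nat.Coprime n (primorial ⌊z⌋₊)
  · have h1 := (ZMod.isUnit_iff_coprime n (primorial ⌊z⌋₊)).mpr h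
    rw [MulChar.one_apply h1]
    unfold rf
    rw [if_pos (hiff.mp h)]; simp
  · have h1 : ¬ IsUnit (n : ZMod (primorial ⌊z⌋₊)) := fun hu => h ((ZMod.isUnit_iff_coprime n _).mp hu)
    rw [MulChar.map_nonunit _ h1]
    unfold rf
    rw [if_neg (fun hh => h (hiff.mpr hh))]; simp

lemma RF_one (z:ℝ) (hz : 0≤z) (s:ℂ) (hs : 1< s.re) : LSeries (ra z 0) s*LSeries (fa z 0) s=1 := by
  have h := DirichletCharacter.LSeries.mul_mu_eq_one (1 : DirichletCharacter ℂ (primorial ⌊z⌋₊)) hs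
  rw [← h]
  congr 1
  · apply LSeries_congr
    intro n hn
    rw [chi_rf z hz n hn]; unfold ra; simp
  · apply LSeries_congr
    intro n hn
    simp only [Pi.mul_apply]
    rw [chi_rf z hz n hn]; unfold fa; simp

lemma R341 (z:ℝ) (hz : 0≤z) (x y:ℝ) (hx : 0<x) :
    1≤‖LSeries (ra z 0) ((1+x:ℝ)+(0:ℝ)*Complex.I)‖^3*‖LSeries (ra z 0) ((1+x:ℝ)+y*Complex.I)‖^4*‖LSeries (ra z 0) ((1+x:ℝ)+(2*y:ℝ)*Complex.I)‖ := by
  have h := DirichletCharacter.norm_LSeries_product_ge_one (1 : DirichletCharacter ℂ (primorial ⌊z⌋₊)) hx y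
  have e : ∀ s : ℂ, LSeries (fun n : ℕ => (1 : DirichletCharacter ℂ (primorial ⌊z⌋₊)) (n : ZMod (primorial ⌊z⌋₊))) s=LSeries (ra z 0) s := by
    intro s
    apply LSeries_congr
    intro n hn
    rw [chi_rf z hz n hn]; unfold ra; simp
  rw [one_pow, e, e, e, norm_mul, norm_mul, norm_pow, norm_pow] at h
  have e1 : (((1+x:ℝ):ℂ)+((0:ℝ):ℂ)*Complex.I)=1+x := by push_cast; ring
  have e2 : (((1+x:ℝ):ℂ)+y*Complex.I)=1+x+Complex.I*y := by push_cast; ring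
  have e3 : (((1+x:ℝ):ℂ)+((2*y:ℝ):ℂ)*Complex.I)=1+x+2*Complex.I*y := by push_cast; ring
  rw [e1, e2, e3]; exact h

lemma F_derivs (z:ℝ) (hz : 0≤z) (s:ℂ) (hs : 1< s.re) :
    LSeries (fa z 1) s = - LSeries (ra z 1) s*LSeries (fa z 0) s^2 ∧
    LSeries (fa z 2) s = - LSeries (ra z 2) s*LSeries (fa z 0) s^2+2*LSeries (ra z 1) s^2*LSeries (fa z 0) s^3 := by
  have h1 : ∀ s : ℂ, 1< s.re → LSeries (fa z 1) s = - LSeries (ra z 1) s*LSeries (fa z 0) s^2 := by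
    intro s hs
    have hd := (ra_deriv z 0 s hs).mul (fa_deriv z 0 s hs)
    have he : (LSeries (ra z 0)*LSeries (fa z 0)) =ᶠ[nhds s] fun _ => 1 := by
      filter_upwards [(isOpen_lt continuous_const Complex.continuous_re).mem_nhds hs] with w hw
      exact RF_one z hz w hw
    have hc := (hasDerivAt_const s (1:ℂ)).congr_of_eventuallyEq he
    have hu := hd.unique hc
    have h0 := RF_one z hz s hs
    have : LSeries (fa z 1) s*(LSeries (ra z 0) s*LSeries (fa z 0) s) = - LSeries (ra z 1) s*LSeries (fa z 0) s^2 := by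
      linear_combination (- LSeries (fa z 0) s)*hu
    rwa [h0, mul_one] at this
  refine ⟨h1 s hs, ?_⟩
  have hd := ((ra_deriv z 1 s hs).neg.mul ((fa_deriv z 0 s hs).pow 2))
  have he : (LSeries (fa z 1)) =ᶠ[nhds s] (-LSeries (ra z 1))*(LSeries (fa z 0)^2) := by
    filter_upwards [(isOpen_lt continuous_const Complex.continuous_re).mem_nhds hs] with w hw
    simp only [Pi.mul_apply, Pi.neg_apply, Pi.pow_apply]
    exact h1 w hw
  have hu := (fa_deriv z 1 s hs).unique (hd.congr_of_eventuallyEq he)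
  have h11 := h1 s hs
  simp only [Pi.neg_apply, Pi.pow_apply] at hu
  norm_num at hu h11 ⊢
  rw [h11] at hu
  linear_combination (-1)*hu

end M3d
end H12
namespace H12
open Real Finset
section M3e
open MeasureTheory

lemma exp10 : (2:ℝ)^10≤exp 10 := by
  have h : (2:ℝ)≤exp 1 := by have := add_one_le_exp (1:ℝ); linarith
  calc (2:ℝ)^10≤exp 1^10 := by gcongr
    _=exp 10 := by rw [← exp_nat_mul]; norm_num

lemma R_one_norm (z κ:ℝ) (hκ : 0<κ) :
    ‖LSeries (ra z 0) ((1+κ:ℝ)+(0:ℝ)*Complex.I)‖≤∑' n, rf z n*(n:ℝ)^(-(1+κ)) := by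
  rw [LSeries_ra]
  have hs := (rt_summable z 0 (by norm_num) (1+κ) 0 (by linarith)).norm
  refine (norm_tsum_le_tsum_norm hs).trans (le_of_eq (tsum_congr fun n => ?_))
  rcases Nat.eq_zero_or_pos n with h | h
  · subst h; rw [rt_zero, rf_zero]; simp
  unfold rt
  rw [norm_mul, norm_mul, cx_norm, Complex.norm_real, Complex.norm_real, norm_of_nonneg (rf_nonneg z n)]
  unfold gw
  rw [norm_of_nonneg (by positivity)]
  simp

theorem RF_bounds : ∃ C : ℝ, 1≤C ∧ ∀ η : ℝ, 0<η → η≤1 → ∃ X0 : ℝ, 1≤X0 ∧ ∀ X : ℝ, X0≤X → ∀ t σ : ℝ,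
    X^(-(1/3:ℝ)) ≤ |t| → 2 * |t| ≤ exp X → 1+1/X≤σ → σ≤2 →
    ‖LSeries (ra (exp (η*X)) 0) (σ+t*Complex.I)‖≤C ∧
    ‖LSeries (ra (exp (η*X)) 1) (σ+t*Complex.I)‖≤C*(η*X) ∧
    ‖LSeries (fa (exp (η*X)) 0) (σ+t*Complex.I)‖≤C ∧
    ‖LSeries (fa (exp (η*X)) 2) (σ+t*Complex.I)‖≤C*(η*X)^2 := by
  obtain ⟨C1, hC1, h1⟩ := R_real
  obtain ⟨C, hC, h2⟩ := R_bound
  set B : ℝ := 128*C^5*C1^3 with hB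
  have hB1 : 128≤B := by
    have : 1≤C^5 := one_le_pow₀ hC
    have : 1≤C1^3 := one_le_pow₀ hC1
    rw [hB]; nlinarith
  have hB0 : 0<B := by linarith
  have hC0 : 0<C := by linarith
  have hC10 : 0<C1 := by linarith
  refine ⟨C+B+C*B^2+2*C^2*B^3, by nlinarith [show 0<C*B^2 by positivity, show 0<2*C^2*B^3 by positivity], ?_⟩
  intro η hη hη1
  obtain ⟨X0, hX0, h3⟩ := h2 η hη hη1
  refine ⟨max X0 (10/η), le_max_of_le_left hX0, ?_⟩
  intro X hX t σ ht1 ht2 hσ1 hσ2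
  have hXX : X0≤X := (le_max_left _ _).trans hX
  have hXpos : 0<X := by linarith
  have hl : 10≤η*X := by
    have := (le_max_right _ _).trans hX
    rw [div_le_iff₀ hη] at this; linarith
  set l := η*X with hldef
  set z := exp l with hz
  have hz10 : 2^10≤z := exp10.trans (exp_le_exp.2 hl)
  have hlz : log z=l := log_exp l
  have hz0 : 0≤z := (exp_pos l).le
  have hl0 : 0< l := by linarith
  have hb := h3 X hXX
  have htX : |t| ≤ exp X := by have := abs_nonneg t; linarith
  have hRj : ∀ u : ℝ, 1+1/X≤u → u≤2 → ∀ j≤2, ‖LSeries (ra z j) (u+t*Complex.I)‖≤C*l^j := by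
    intro u h4 h5 j hj
    rw [LSeries_ra]; exact hb t u ht1 htX h4 h5 j hj
  have hX1 : 0<1/X := by positivity
  -- large sigma
  have hlow1 : ∀ u : ℝ, 1+1/X≤u → u≤2 → 1+1/(B*l)≤u → 2*C/B≤‖LSeries (ra z 0) (u+t*Complex.I)‖ := by
    intro u h4 h5 h6
    have hκ : 0<u-1 := by linarith
    have h7 := R341 z hz0 (u-1) t hκ
    rw [show (1+(u-1))=u by ring] at h7
    have h8 : ‖LSeries (ra z 0) ((u:ℝ)+(0:ℝ)*Complex.I)‖≤2*C1*B := by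
      have := R_one_norm z (u-1) hκ
      rw [show (1+(u-1))=u by ring] at this
      have h9 := h1 z (u-1) hz10 hκ (by linarith)
      rw [show (1+(u-1))=u by ring, hlz] at h9
      have h10 : C1/((u-1)*l)≤C1*B := by
        rw [div_le_iff₀ (by positivity)]
        have : 1/(B*l)≤u-1 := by linarith
        rw [div_le_iff₀ (by positivity)] at this
        calc C1=C1*1 := by ring
          _≤C1*((u-1)*(B*l)) := by gcongr
          _=_ := by ring
      have : 1≤C1*B := by nlinarith
      linarith
    have h9 : ‖LSeries (ra z 0) ((u:ℝ)+(2*t:ℝ)*Complex.I)‖≤C := by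
      rw [LSeries_ra]
      have := hb (2*t) u (by rw [abs_mul]; norm_num; have := abs_nonneg t; norm_num at ht1; linarith) (by rw [abs_mul]; norm_num; linarith) h4 h5 0 (by norm_num)
      simpa using this
    set a := ‖LSeries (ra z 0) ((u:ℝ)+t*Complex.I)‖
    by_contra hlt
    push Not at hlt
    have ha0 : 0≤a := norm_nonneg _
    have : ‖LSeries (ra z 0) ((u:ℝ)+(0:ℝ)*Complex.I)‖ ^3*a^4*‖LSeries (ra z 0) ((u:ℝ)+(2*t:ℝ)*Complex.I)‖<1 := by
      calc _≤(2*C1*B)^3*a^4*C := by gcongr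
        _<(2*C1*B)^3*(2*C/B)^4*C := by gcongr
        _=128*C^5*C1^3/B := by field_simp; ring
        _=1 := by rw [← hB]; exact div_self hB0.ne'
    linarith
  have hlow : C/B≤‖LSeries (ra z 0) (σ+t*Complex.I)‖ := by
    rcases le_total (1+1/(B*l)) σ with h | h
    · refine le_trans ?_ (hlow1 σ hσ1 hσ2 h)
      gcongr; linarith
    · set s1 := 1+1/(B*l) with hs1
      have hs12 : s1≤2 := by
        have : 1/(B*l)≤1 := by rw [div_le_one (by positivity)]; nlinarith
        linarith
      have h4 := hlow1 s1 (by linarith) hs12 le_rfl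
      have hd : ∀ u ∈ Set.Icc σ s1, HasDerivWithinAt (fun u : ℝ => LSeries (ra z 0) (u+t*Complex.I)) (-LSeries (ra z 1) (u+t*Complex.I)) (Set.Icc σ s1) u := by
        intro u hu
        have hre : 1<((u:ℂ)+t*Complex.I).re := by simp; linarith [hu.1]
        have := (ra_deriv z 0 _ hre).comp_add_const (u:ℂ) (t*Complex.I)
        exact this.comp_ofReal.hasDerivWithinAt
      have h5 := Convex.norm_image_sub_le_of_norm_hasDerivWithin_le (C := C*l) hd (fun u hu => by
        rw [norm_neg]
        have := hRj u (by linarith [hu.1]) (by linarith [hu.2]) 1 (by norm_num)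
        simpa using this) (convex_Icc σ s1) (Set.left_mem_Icc.2 h) (Set.right_mem_Icc.2 h)
      beta_reduce at h5
      rw [norm_of_nonneg (by linarith)] at h5
      have h6 : C*l*(s1-σ)≤C/B := by
        calc C*l*(s1-σ)≤C*l*(1/(B*l)) := by gcongr; linarith
          _=C/B := by field_simp
      have h7 := norm_sub_norm_le (LSeries (ra z 0) (s1+t*Complex.I)) (LSeries (ra z 0) (σ+t*Complex.I))
      have : 2*C/B=C/B+C/B := by ring
      linarith
  have hre : 1<((σ:ℂ)+t*Complex.I).re := by simp; linarith
  have hF : ‖LSeries (fa z 0) (σ+t*Complex.I)‖≤B := by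
    have := congrArg norm (RF_one z hz0 _ hre)
    rw [norm_mul, norm_one] at this
    set a := ‖LSeries (fa z 0) (σ+t*Complex.I)‖
    have ha : 0≤a := norm_nonneg _
    have h4 : C/B*a≤1 := by rw [← this]; gcongr
    have h5 : 1/B*a≤1 := le_trans (by gcongr) h4
    rw [one_div, inv_mul_le_iff₀ hB0] at h5; linarith
  have hR0 := hRj σ hσ1 hσ2 0 (by norm_num)
  have hR1 := hRj σ hσ1 hσ2 1 (by norm_num)
  have hR2 := hRj σ hσ1 hσ2 2 (by norm_num)
  have p1 : 0<C*B^2 := by positivity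
  have p2 : 0<2*C^2*B^3 := by positivity
  refine ⟨by linarith, ?_, by linarith, ?_⟩
  · rw [pow_one] at hR1
    refine hR1.trans ?_
    gcongr; linarith
  · rw [(F_derivs z hz0 _ hre).2]
    refine (norm_add_le _ _).trans ?_
    rw [norm_mul, norm_mul, norm_mul, norm_neg, norm_pow, norm_pow, norm_pow]
    calc _≤(C*l^2)*B^2+‖(2:ℂ)‖*(C*l^1)^2*B^3 := by gcongr
      _=(C*B^2+2*C^2*B^3)*l^2 := by simp; ring
      _≤_ := by gcongr; linarith

end M3e
end H12
namespace H12
section M4a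
open MeasureTheory Real FourierTransform

/-- the cutoff `u^{-2}` for `u ≥ 1/8`, zero for `u ≤ 1/16`. -/
noncomputable def chr (u:ℝ) : ℝ := smoothTransition (16*u-1)*u^(-2:ℤ)

lemma chr_zero (u:ℝ) (hu : u≤1/16) : chr u=0 := by
  unfold chr; rw [smoothTransition.zero_of_nonpos (by linarith)]; simp
lemma chr_eq (u:ℝ) (hu : 1/8≤u) : chr u=u^(-2:ℤ) := by
  unfold chr; rw [smoothTransition.one_of_one_le (by linarith)]; simp

lemma chr_smooth : ContDiff ℝ (⊤:ℕ∞) chr := by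
  rw [contDiff_iff_contDiffAt]
  intro u
  by_cases h : u<1/16
  · refine (contDiffAt_const (c := (0:ℝ))).congr_of_eventuallyEq ?_
    filter_upwards [Iio_mem_nhds h] with v hv
    exact chr_zero v (le_of_lt hv)
  · have hu : u ≠ 0 := by intro h0; apply h; rw [h0]; norm_num
    have h1 : ContDiffAt ℝ (⊤:ℕ∞) (fun u : ℝ => smoothTransition (16*u-1)) u :=
      (smoothTransition.contDiff.comp (by fun_prop : ContDiff ℝ (⊤:ℕ∞) (fun u : ℝ => 16*u-1))).contDiffAt
    have h2 : ContDiffAt ℝ (⊤:ℕ∞) (fun u : ℝ => u^(-2:ℤ)) u := by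
      have : (fun u : ℝ => u^(-2:ℤ))=fun u => (u^2)⁻¹ := by ext u; rw [zpow_neg]; norm_cast
      rw [this]
      exact (contDiffAt_id.pow 2).inv (pow_ne_zero 2 hu)
    exact h1.mul h2

noncomputable def chc (u:ℝ) : ℂ := (chr u:ℂ)

lemma chc_smooth : ContDiff ℝ (⊤:ℕ∞) chc :=
  Complex.ofRealCLM.contDiff.comp chr_smooth

lemma chc_iter (n:ℕ) : iteratedDeriv n chc=fun u => ((iteratedDeriv n chr u:ℝ):ℂ) := by
  induction n with
  | zero => ext u; simp [chc]
  | succ n ih =>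
    ext u
    rw [iteratedDeriv_succ, ih, iteratedDeriv_succ]
    have hd : DifferentiableAt ℝ (iteratedDeriv n chr) u :=
      (chr_smooth.differentiable_iteratedDeriv n (by exact_mod_cast WithTop.coe_lt_top n)) u
    exact hd.hasDerivAt.ofReal_comp.deriv

lemma chr_iter_int (n:ℕ) : Integrable (iteratedDeriv n chr) := by
  have hc : Continuous (iteratedDeriv n chr) := chr_smooth.continuous_iteratedDeriv n (by exact_mod_cast le_top)
  rw [← integrableOn_univ]
  have : (Set.univ : Set ℝ)=(Set.Iic 0 ∪ Set.Icc 0 1) ∪ Set.Ioi 1 := by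
    ext x; simp
  rw [this]
  refine ((?_ : IntegrableOn _ _ _).union (hc.integrableOn_Icc)).union ?_
  · refine (integrableOn_zero : IntegrableOn (fun _ : ℝ => (0:ℝ)) (Set.Iic 0) volume).congr_fun ?_ measurableSet_Iic
    intro u hu
    have : chr =ᶠ[nhds u] fun _ => 0 := by
      filter_upwards [Iio_mem_nhds (show u<1/16 from lt_of_le_of_lt hu (by norm_num))] with v hv
      exact chr_zero v (le_of_lt hv)
    rw [this.iteratedDeriv_eq n]
    simp
  · have hn0 : (0:ℝ)≤n := by positivity
    have h1 := (integrableOn_Ioi_rpow_of_lt (a := -2-(n:ℝ)) (c := 1) (by linarith) (by norm_num)).const_mul (∏ i ∈ Finset.range n, (((-2:ℤ):ℝ)-i))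
    refine IntegrableOn.congr_fun h1 ?_ measurableSet_Ioi
    intro u hu
    have hu1 : (1:ℝ)<u := hu
    have : chr =ᶠ[nhds u] fun v => v^(-2:ℤ) := by
      filter_upwards [Ioi_mem_nhds hu1] with v hv
      exact chr_eq v (by have : (1:ℝ)<v := hv
                         linarith)
    rw [this.iteratedDeriv_eq n, iteratedDeriv_eq_iterate, iter_deriv_zpow]
    beta_reduce
    rw [← Real.rpow_intCast]
    push_cast
    rfl

theorem chi_fourier : ∃ (h : ℝ → ℂ) (c:ℝ), 1≤c ∧ Integrable h ∧ (∀ v, ‖h v‖≤c*((1+v^2)^2)⁻¹) ∧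
    ∀ u, (chr u:ℂ)=∫ v, h v*ee (u*v) := by
  have hitg : ∀ n : ℕ, Integrable (iteratedDeriv n chc) := by
    intro n; rw [chc_iter]; exact (chr_iter_int n).ofReal
  have hint0 : Integrable chc := by simpa using hitg 0
  set c1 := ∫ v, ‖chc v‖ with hc1
  set c2 := ∫ v, ‖iteratedDeriv 4 chc v‖ with hc2
  have h1 : ∀ v, ‖𝓕 chc v‖≤c1 := fun v => VectorFourier.norm_fourierIntegral_le_integral_norm _ _ _ _ _
  have h2 : ∀ v, (2*π*|v|)^4*‖𝓕 chc v‖≤c2 := by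
    intro v
    have e := congrFun (Real.fourier_iteratedDeriv (n := 4) chc_smooth (fun n _ => hitg n) (by exact_mod_cast le_top)) v
    have e2 : ‖𝓕 (iteratedDeriv 4 chc) v‖≤c2 := VectorFourier.norm_fourierIntegral_le_integral_norm _ _ _ _ _
    rw [e, norm_smul, norm_pow, norm_mul, norm_mul, norm_mul] at e2
    simpa [abs_of_pos Real.pi_pos] using e2
  have hbd : ∀ v, ‖𝓕 chc v‖≤(2*(c1+c2)+1)*((1+v^2)^2)⁻¹ := by
    intro v
    have p : 0<(1+v^2)^2 := by positivity
    rw [← div_eq_mul_inv, le_div_iff₀ p]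
    have a0 := norm_nonneg (𝓕 chc v)
    have hv4 : v^4≤(2*π*|v|)^4 := by
      have : v^4 = |v|^4 := by rw [← abs_pow, abs_of_nonneg (by positivity)]
      rw [this]
      gcongr
      have := Real.pi_gt_three
      nlinarith [abs_nonneg v]
    have h3 : v^4*‖𝓕 chc v‖≤c2 := le_trans (by gcongr) (h2 v)
    have h4 : (1+v^2)^2≤2+2*v^4 := by nlinarith [sq_nonneg (v^2-1)]
    calc ‖𝓕 chc v‖*(1+v^2)^2≤‖𝓕 chc v‖*(2+2*v^4) := by gcongr
      _=2*‖𝓕 chc v‖+2*(v^4*‖𝓕 chc v‖) := by ring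
      _≤2*(c1+c2)+1 := by linarith [h1 v]
  have hc1' : 0≤c1 := integral_nonneg fun _ => norm_nonneg _
  have hc2' : 0≤c2 := integral_nonneg fun _ => norm_nonneg _
  have hFc : Continuous (𝓕 chc) := by
    exact VectorFourier.fourierIntegral_continuous Real.continuous_fourierChar (by exact continuous_inner) hint0
  have hFi : Integrable (𝓕 chc) := by
    refine Integrable.mono' (integrable_inv_one_add_sq.const_mul (2*(c1+c2)+1)) hFc.aestronglyMeasurable (Filter.Eventually.of_forall fun v => (hbd v).trans ?_)
    gcongr
    nlinarith [sq_nonneg v]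
  refine ⟨𝓕 chc, 2*(c1+c2)+1, by linarith, hFi, hbd, ?_⟩
  intro u
  have := congrFun (chc_smooth.continuous.fourierInv_fourier_eq hint0 hFi) u
  change chc u=_
  rw [← this, Real.fourierInv_eq']
  refine integral_congr_ae (Filter.Eventually.of_forall fun v => ?_)
  beta_reduce
  rw [smul_eq_mul, mul_comm]
  congr 1

end M4a
end H12
namespace H12
section M4b
open MeasureTheory Real FourierTransform

noncomputable def psc (X:ℝ) (n:ℕ) : ℝ := smoothTransition (16*(log n/X)-1)
noncomputable def fs (z X:ℝ) (n:ℕ) : ℂ := fa z 0 n*(psc X n:ℂ)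
noncomputable def fb (z X:ℝ) (n:ℕ) : ℂ := fa z 0 n*((1-psc X n:ℝ):ℂ)

lemma psc_mem (X:ℝ) (n:ℕ) : 0≤psc X n ∧ psc X n≤1 := ⟨smoothTransition.nonneg _, smoothTransition.le_one _⟩

lemma fa_norm (z:ℝ) (j n:ℕ) : ‖fa z j n‖≤ rf z n*log n^j := by
  unfold fa
  have h1 := rf_nonneg z n
  have h2 : 0≤ log (n:ℝ) := log_natCast_nonneg n
  rw [Complex.norm_real, norm_mul, norm_mul, Real.norm_of_nonneg h1, Real.norm_of_nonneg (by positivity : 0≤ log (n:ℝ)^j)]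
  have h3 : ‖((ArithmeticFunction.moebius n:ℤ):ℝ)‖≤1 := by
    rw [Real.norm_eq_abs]
    exact_mod_cast ArithmeticFunction.abs_moebius_le_one (n := n)
  have : rf z n*‖((ArithmeticFunction.moebius n:ℤ):ℝ)‖≤ rf z n := by nlinarith
  gcongr

lemma ra_norm (z:ℝ) (j n:ℕ) : ‖ra z j n‖=rf z n*log n^j := by
  unfold ra
  have h1 := rf_nonneg z n
  have h2 : 0≤ log (n:ℝ) := log_natCast_nonneg n
  rw [Complex.norm_real, Real.norm_of_nonneg (by positivity)]

lemma fs_norm (z X:ℝ) (n:ℕ) : ‖fs z X n‖≤ rf z n*psc X n := by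
  unfold fs
  have := fa_norm z 0 n
  rw [norm_mul, Complex.norm_real, Real.norm_of_nonneg (psc_mem X n).1]
  rw [pow_zero, mul_one] at this
  have := (psc_mem X n).1
  gcongr

lemma fb_norm (z X:ℝ) (n:ℕ) : ‖fb z X n‖≤ rf z n := by
  unfold fb
  have := fa_norm z 0 n
  have h1 := psc_mem X n
  rw [norm_mul, Complex.norm_real, Real.norm_of_nonneg (by linarith)]
  rw [pow_zero, mul_one] at this
  nlinarith [rf_nonneg z n]

/-- trivial bounds for the absolute series -/
theorem triv : ∃ K : ℝ, 1≤K ∧ ∀ η X : ℝ, 0<η → η≤1 → 10/η≤X → ∀ j≤2,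
    ∑' n, rf (exp (η*X)) n*gw j (1+1/X) n≤K*X^j/η := by
  obtain ⟨C, hC, h⟩ := R_real
  refine ⟨16*(3*C), by linarith, ?_⟩
  intro η X hη hη1 hX j hj
  have hl : 10≤η*X := by rw [div_le_iff₀ hη] at hX; linarith
  have hX1 : 1≤X := by nlinarith
  have hX0 : 0<X := by linarith
  have hXi : 0<1/X := by positivity
  have hXi2 : 0<1/(2*X) := by positivity
  have hz10 : 2^10≤exp (η*X) := exp10.trans (exp_le_exp.2 hl)
  have h1 := h (exp (η*X)) (1/(2*X)) hz10 (by positivity) (by rw [div_le_one (by positivity)]; linarith)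
  rw [log_exp] at h1
  have hs1 : Summable (fun n : ℕ => rf (exp (η*X)) n*gw j (1+1/X) n) := by
    refine Summable.of_nonneg_of_le (fun n => mul_nonneg (rf_nonneg _ n) (gw_nonneg _ _ _)) (fun n => ?_) (gw_summable j hj (1+1/X) (by linarith))
    exact mul_le_of_le_one_left (gw_nonneg _ _ _) (rf_le_one _ n)
  have hs2 : Summable (fun n : ℕ => rf (exp (η*X)) n*(n:ℝ)^(-(1+1/(2*X)))) := by
    refine Summable.of_nonneg_of_le (fun n => mul_nonneg (rf_nonneg _ n) (by positivity)) (fun n => ?_) (gw_summable 0 (by norm_num) (1+1/(2*X)) (by linarith))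
    unfold gw; rw [pow_zero, mul_one]
    exact mul_le_of_le_one_left (by positivity) (rf_le_one _ n)
  have hle : ∀ n : ℕ, rf (exp (η*X)) n*gw j (1+1/X) n≤(4*X)^j*(rf (exp (η*X)) n*(n:ℝ)^(-(1+1/(2*X)))) := by
    intro n
    rcases Nat.eq_zero_or_pos n with h0 | h0
    · subst h0; rw [rf_zero]; simp
    have hn : (1:ℝ)≤n := by exact_mod_cast h0
    have h2 := logpow_le j hj (1/X) n (by positivity) hn
    unfold gw
    have h3 : (n:ℝ)^(-(1+1/(2*X)))=(n:ℝ)^(-(1+1/X))*(n:ℝ)^(1/X/2) := by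
      rw [← rpow_add (by linarith)]; congr 1; field_simp; ring
    rw [h3]
    have h4 : (4/(1/X))=4*X := by field_simp
    rw [h4] at h2
    calc rf (exp (η*X)) n*((n:ℝ)^(-(1+1/X))*log n^j)≤ rf (exp (η*X)) n*((n:ℝ)^(-(1+1/X))*((4*X)^j*(n:ℝ)^(1/X/2))) := by
          have := rf_nonneg (exp (η*X)) n
          gcongr
      _=_ := by ring
  have h5 : (1:ℝ)+C/(1/(2*X)*(η*X))≤3*C/η := by
    rw [show 1/(2*X)*(η*X)=η/2 by field_simp]
    have : 1≤C/η := by rw [le_div_iff₀ hη]; nlinarith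
    have : C/(η/2)=2*(C/η) := by field_simp
    have : 3*C/η=3*(C/η) := by ring
    linarith
  calc _≤∑' n : ℕ, (4*X)^j*(rf (exp (η*X)) n*(n:ℝ)^(-(1+1/(2*X)))) := hs1.tsum_le_tsum hle (hs2.mul_left _)
    _=(4*X)^j*∑' n : ℕ, (rf (exp (η*X)) n*(n:ℝ)^(-(1+1/(2*X)))) := tsum_mul_left
    _≤(4*X)^j*(3*C/η) := by gcongr; exact h1.trans h5
    _=4^j*X^j*(3*C/η) := by rw [mul_pow]
    _≤4^2*X^j*(3*C/η) := by gcongr; norm_num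
    _=_ := by ring

/-- summability of coefficients dominated by `rf * log^j`. -/
lemma coef_summable (z:ℝ) (a : ℕ → ℂ) (j:ℕ) (hj : j≤2) (ha : ∀ n, ‖a n‖≤ rf z n*log n^j) (σ:ℝ) (hσ : 1<σ) :
    Summable (fun n : ℕ => ‖a n‖*(n:ℝ)^(-σ)) := by
  refine Summable.of_nonneg_of_le (fun n => by positivity) (fun n => ?_) (gw_summable j hj σ hσ)
  have h2 : 0≤ log (n:ℝ) := log_natCast_nonneg n
  calc _≤(1*log n^j)*(n:ℝ)^(-σ) := by
        gcongr
        refine (ha n).trans ?_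
        have := rf_le_one z n
        gcongr
    _=_ := by unfold gw; ring

lemma coef_tsum_le (z:ℝ) (a : ℕ → ℂ) (j:ℕ) (hj : j≤2) (ha : ∀ n, ‖a n‖≤ rf z n*log n^j) (σ:ℝ) (hσ : 1<σ) :
    ∑' n : ℕ, ‖a n‖*(n:ℝ)^(-σ)≤∑' n, rf z n*gw j σ n := by
  refine (coef_summable z a j hj ha σ hσ).tsum_le_tsum (fun n => ?_) ?_
  · unfold gw
    have : 0≤(n:ℝ)^(-σ) := by positivity
    calc _≤(rf z n*log n^j)*(n:ℝ)^(-σ) := by gcongr; exact ha n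
      _=_ := by ring
  · refine Summable.of_nonneg_of_le (fun n => mul_nonneg (rf_nonneg _ n) (gw_nonneg _ _ _)) (fun n => ?_) (gw_summable j hj σ hσ)
    exact mul_le_of_le_one_left (gw_nonneg _ _ _) (rf_le_one _ n)

lemma LSeries_norm_le (a : ℕ → ℂ) (a0 : a 0=0) (σ t:ℝ) (hs : Summable (fun n : ℕ => ‖a n‖*(n:ℝ)^(-σ))) :
    ‖LSeries a (σ+t*Complex.I)‖≤∑' n : ℕ, ‖a n‖*(n:ℝ)^(-σ) := by
  rw [LSeries_tsum a a0]
  have e : ∀ n : ℕ, ‖a n*cx t n*(((n:ℝ)^(-σ):ℝ):ℂ)‖=‖a n‖*(n:ℝ)^(-σ) := by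
    intro n
    rw [norm_mul, norm_mul, cx_norm, Complex.norm_real, Real.norm_of_nonneg (by positivity), mul_one]
  refine (norm_tsum_le_tsum_norm (by simpa only [e] using hs)).trans (le_of_eq (tsum_congr e))

lemma fs_formula (z X:ℝ) (hX : 0<X) (σ t:ℝ) (hσ : 1<σ) (h : ℝ → ℂ) (hi : Integrable h)
    (hf : ∀ u, (chr u:ℂ)=∫ v, h v*ee (u*v)) :
    LSeries (fs z X) (σ+t*Complex.I)=(((X^2)⁻¹:ℝ):ℂ)*∫ v, h v*LSeries (fa z 2) (σ+((t-2*π*v/X:ℝ):ℂ)*Complex.I) := by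
  have f0 : fs z X 0=0 := by unfold fs; rw [fa_zero, zero_mul]
  have hs := coef_summable z (fa z 2) 2 le_rfl (fa_norm z 2) σ hσ
  set F : ℕ → ℝ → ℂ := fun n v => h v*(fa z 2 n*cx (t-2*π*v/X) n*(((n:ℝ)^(-σ):ℝ):ℂ)) with hF
  have hcx : ∀ (n:ℕ) (v:ℝ), cx (t-2*π*v/X) n=cx t n*ee (log n/X*v) := by
    intro n v
    unfold cx ee
    rw [← Complex.exp_add]; congr 1; push_cast; ring
  have hFe : ∀ n, F n=fun v => (fa z 2 n*cx t n*(((n:ℝ)^(-σ):ℝ):ℂ))*(h v*ee (log n/X*v)) := by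
    intro n; ext v; rw [hF]; beta_reduce; rw [hcx]; ring
  have hee : ∀ w : ℝ, Integrable (fun v => h v*ee (w*v)) := by
    intro w
    have : Continuous (fun v => ee (w*v)) := by unfold ee; fun_prop
    exact hi.mul_bdd (c := 1) this.aestronglyMeasurable (Filter.Eventually.of_forall fun v => by rw [ee_norm])
  have hFi : ∀ n, Integrable (F n) := by
    intro n; rw [hFe]; exact (hee _).const_mul _
  have hnorm : ∀ n : ℕ, ∫ v, ‖F n v‖=(‖fa z 2 n‖*(n:ℝ)^(-σ))*∫ v, ‖h v‖ := by
    intro n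
    rw [← integral_const_mul]
    refine integral_congr_ae (Filter.Eventually.of_forall fun v => ?_)
    rw [hF]; beta_reduce
    rw [norm_mul, norm_mul, norm_mul, cx_norm, Complex.norm_real, Real.norm_of_nonneg (by positivity)]; ring
  have hsum := hasSum_integral_of_summable_integral_norm hFi (by simpa only [hnorm] using hs.mul_right _)
  have e1 : ∫ v, h v*LSeries (fa z 2) (σ+((t-2*π*v/X:ℝ):ℂ)*Complex.I)=∫ v, ∑' n, F n v := by
    refine integral_congr_ae (Filter.Eventually.of_forall fun v => ?_)
    beta_reduce
    rw [LSeries_tsum _ (fa_zero z 2), ← tsum_mul_left]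
  rw [e1, ← hsum.tsum_eq, ← tsum_mul_left, LSeries_tsum _ f0]
  refine tsum_congr fun n => ?_
  rw [hFe, integral_const_mul, ← hf]
  have key : fs z X n=(((X^2)⁻¹:ℝ):ℂ)*fa z 2 n*(chr (log n/X):ℂ) := by
    unfold fs fa chr psc
    rw [← Complex.ofReal_mul, ← Complex.ofReal_mul, ← Complex.ofReal_mul]
    congr 1
    rw [pow_zero, mul_one]
    by_cases h0 : log (n:ℝ)=0
    · rw [h0, smoothTransition.zero_of_nonpos (by norm_num)]; ring
    · rw [zpow_neg, div_zpow]
      have : X ≠ 0 := hX.ne'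
      norm_cast
      field_simp
  rw [key]; ring

theorem Fs_sup : ∃ C : ℝ, 1≤C ∧ ∀ η : ℝ, 0<η → η≤1 → ∃ X0 : ℝ, 1≤X0 ∧ ∀ X : ℝ, X0≤X → ∀ t : ℝ,
    X^(-(1/4:ℝ)) ≤ |t| → 4 * |t| ≤ exp X →
    ‖LSeries (fs (exp (η*X)) X) ((1+1/X:ℝ)+t*Complex.I)‖≤C*η^2 := by
  obtain ⟨C, hC, h1⟩ := RF_bounds
  obtain ⟨K, hK, h2⟩ := triv
  obtain ⟨h, c, hc, hi, hb, hf⟩ := chi_fourier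
  refine ⟨c*π*(C+1), by nlinarith [Real.pi_gt_three, mul_pos (by linarith : 0<c) Real.pi_pos], ?_⟩
  intro η hη hη1
  obtain ⟨X1, hX1, h3⟩ := h1 η hη hη1
  refine ⟨max (max X1 (10/η)) (max (4^12) (K/η^3)), le_max_of_le_left (le_max_of_le_left hX1), ?_⟩
  intro X hX t ht1 ht2
  have hXa : X1≤X := (le_max_left _ _).trans ((le_max_left _ _).trans hX)
  have hXb : 10/η≤X := (le_max_right _ _).trans ((le_max_left _ _).trans hX)
  have hXc : 4^12≤X := (le_max_left _ _).trans ((le_max_right _ _).trans hX)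
  have hXd : K/η^3≤X := (le_max_right _ _).trans ((le_max_right _ _).trans hX)
  have hX0 : 0<X := by linarith
  have hXi : 0<1/X := by positivity
  set z := exp (η*X) with hz
  set σ := 1+1/X with hσ
  have hσ1 : 1<σ := by linarith
  have hσ2 : σ≤2 := by
    have : 1/X≤1 := by rw [div_le_one hX0]; norm_num at hXc; linarith
    linarith
  -- power bookkeeping
  obtain ⟨y, hy, hyX⟩ : ∃ y : ℝ, 4≤y ∧ X=y^12 := by
    refine ⟨X^((1:ℝ)/12), ?_, ?_⟩
    · rw [show (4:ℝ)=((4:ℝ)^12)^((1:ℝ)/12) by rw [← rpow_natCast, ← rpow_mul (by norm_num)]; norm_num]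
      gcongr
    · rw [← rpow_natCast, ← rpow_mul hX0.le]; norm_num
  have hy0 : 0<y := by linarith
  have e4 : X^(-(1/4:ℝ))=(y^3)⁻¹ := by
    rw [hyX, ← rpow_natCast, ← rpow_mul hy0.le, ← rpow_natCast, ← rpow_neg hy0.le]; norm_num
  have e3 : X^(-(1/3:ℝ))=(y^4)⁻¹ := by
    rw [hyX, ← rpow_natCast, ← rpow_mul hy0.le, ← rpow_natCast, ← rpow_neg hy0.le]; norm_num
  have hexp : 52≤exp X := by
    have := add_one_le_exp X
    norm_num at hXc; linarith
  have hshift : ∀ v : ℝ, v^2≤X → X^(-(1/3:ℝ)) ≤ |t-2*π*v/X| ∧ 2 * |t-2*π*v/X| ≤ exp X := by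
    intro v hv
    have hvy : |v| ≤ y^6 := by
      apply abs_le_of_sq_le_sq _ (by positivity)
      rw [hyX] at hv; nlinarith
    have h5 : |2*π*v/X| ≤ 7/y^6 := by
      rw [abs_div, abs_mul, abs_of_pos hX0, abs_of_pos (by positivity : 0<2*π), hyX, div_le_div_iff₀ (by positivity) (by positivity)]
      have := Real.pi_lt_d2
      calc 2*π*|v| * y^6≤2*π*y^6*y^6 := by gcongr
        _≤7*y^12 := by nlinarith [show 0<y^12 by positivity]
    have h6 : |t| - |2*π*v/X| ≤ |t-2*π*v/X| := abs_sub_abs_le_abs_sub _ _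
    have h7 : |t-2*π*v/X| ≤ |t| + |2*π*v/X| := abs_sub _ _
    constructor
    · rw [e4] at ht1; rw [e3]
      have : (y^4)⁻¹+7/y^6≤(y^3)⁻¹ := by
        rw [inv_eq_one_div, inv_eq_one_div, div_add_div _ _ (by positivity) (by positivity), div_le_div_iff₀ (by positivity) (by positivity)]
        have h8 : y^2+7≤y^3 := by nlinarith [sq_nonneg y]
        calc (1*y^6+y^4*7)*y^3=(y^2+7)*y^7 := by ring
          _≤y^3*y^7 := by gcongr
          _=_ := by ring
      linarith
    · have : 7/y^6≤7 := by
        apply div_le_self (by norm_num)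
        exact one_le_pow₀ (by linarith)
      linarith
  have hpt : ∀ v : ℝ, ‖h v*LSeries (fa z 2) (σ+((t-2*π*v/X:ℝ):ℂ)*Complex.I)‖≤(c*(C+1)*η^2*X^2)*(1+v^2)⁻¹ := by
    intro v
    rw [norm_mul]
    have hKX : K/(η*X)≤η^2 := by
      rw [div_le_iff₀ (by positivity)] at hXd ⊢; nlinarith
    have hL : ‖LSeries (fa z 2) (σ+((t-2*π*v/X:ℝ):ℂ)*Complex.I)‖≤(C+1)*η^2*X^2*(1+v^2) := by
      rcases le_or_gt (v^2) X with hv | hv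
      · have := (h3 X hXa (t-2*π*v/X) σ (hshift v hv).1 (hshift v hv).2 le_rfl hσ2).2.2.2
        refine this.trans ?_
        calc C*(η*X)^2=C*η^2*X^2*1 := by ring
          _≤(C+1)*η^2*X^2*(1+v^2) := by gcongr <;> nlinarith [sq_nonneg v]
      · have hs := coef_summable z (fa z 2) 2 le_rfl (fa_norm z 2) σ hσ1
        have := (LSeries_norm_le (fa z 2) (fa_zero z 2) σ (t-2*π*v/X) hs).trans ((coef_tsum_le z (fa z 2) 2 le_rfl (fa_norm z 2) σ hσ1).trans (h2 η X hη hη1 hXb 2 le_rfl))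
        refine this.trans ?_
        calc K*X^2/η=K/(η*X)*X^2*X := by field_simp
          _≤η^2*X^2*(1+v^2) := by gcongr; linarith
          _=1*η^2*X^2*(1+v^2) := by ring
          _≤_ := by gcongr; linarith
    calc _≤(c*((1+v^2)^2)⁻¹)*((C+1)*η^2*X^2*(1+v^2)) := by gcongr; exact hb v
      _=_ := by field_simp
  rw [fs_formula z X hX0 σ t hσ1 h hi hf, norm_mul, Complex.norm_real, Real.norm_of_nonneg (by positivity)]
  have hitg : ‖∫ v, h v*LSeries (fa z 2) (σ+((t-2*π*v/X:ℝ):ℂ)*Complex.I)‖≤(c*(C+1)*η^2*X^2)*π := by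
    refine (norm_integral_le_of_norm_le (integrable_inv_one_add_sq.const_mul _) (Filter.Eventually.of_forall hpt)).trans (le_of_eq ?_)
    rw [integral_const_mul, integral_univ_inv_one_add_sq]
  calc _≤(X^2)⁻¹*((c*(C+1)*η^2*X^2)*π) := by gcongr
    _=_ := by field_simp

end M4b
end H12
namespace H12
section M4c
open MeasureTheory Real FourierTransform

lemma int_exp_sum : ∃ S : ℝ, 1≤S ∧ ∀ F : Finset ℤ, ∑ k ∈ F, exp (-|(k:ℝ)|)≤S := by
  have h : Summable (fun k : ℤ => exp (-|(k:ℝ)|)) := by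
    apply Summable.of_nat_of_neg
    · simpa using Real.summable_exp_neg_nat
    · simpa using Real.summable_exp_neg_nat
  refine ⟨max 1 (∑' k : ℤ, exp (-|(k:ℝ)|)), le_max_left _ _, fun F => le_max_of_le_right ?_⟩
  exact h.sum_le_tsum F (fun k _ => (exp_pos _).le)

theorem block_sum : ∃ K : ℝ, 1≤K ∧ ∀ (c : ℕ → ℝ) (H T:ℝ), (∀ n, 0≤c n) → 0≤H → 0<T →
    (∀ (y:ℝ) (s : Finset ℕ), (∀ m ∈ s, y< log m ∧ log m≤y+1/T) → ∑ m ∈ s, c m≤H) →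
    ∀ (y0:ℝ) (s : Finset ℕ), ∑ m ∈ s, c m*exp (-π*T^2*(log m-y0)^2)≤K*H := by
  obtain ⟨S, hS, hS1⟩ := int_exp_sum
  refine ⟨exp 2*S, by nlinarith [add_one_le_exp (2:ℝ)], ?_⟩
  intro c H T hc hH hT hb y0 s
  set k : ℕ → ℤ := fun m => ⌈T*(log m-y0)⌉-1 with hk
  have hk1 : ∀ m : ℕ, (k m:ℝ)<T*(log m-y0) := by
    intro m; rw [hk]; push_cast; have := Int.ceil_lt_add_one (T*(log m-y0)); linarith
  have hk2 : ∀ m : ℕ, T*(log m-y0)≤k m+1 := by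
    intro m; rw [hk]; push_cast; have := Int.le_ceil (T*(log m-y0)); linarith
  have hE : ∀ m : ℕ, exp (-π*T^2*(log m-y0)^2)≤exp 2*exp (-|(k m:ℝ)|) := by
    intro m
    rw [← exp_add]
    apply exp_le_exp.2
    set w := T*(log m-y0) with hw
    have h1 : -π*T^2*(log m-y0)^2 = -π * |w|^2 := by rw [sq_abs, hw]; ring
    rw [h1]
    have h2 : |(k m:ℝ)| ≤ |w| + 1 := by
      have := hk1 m; have := hk2 m
      rw [abs_le]; constructor
      · have := neg_abs_le w; linarith
      · have := le_abs_self w; linarith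
    have := Real.pi_gt_three
    nlinarith [sq_nonneg (|w| - 1/2), sq_nonneg |w|]
  calc _≤∑ m ∈ s, c m*(exp 2*exp (-|(k m:ℝ)|)) := by
        refine Finset.sum_le_sum fun m _ => ?_
        have := hc m; have := hE m
        gcongr
    _=∑ j ∈ s.image k, ∑ m ∈ s with k m=j, c m*(exp 2*exp (-|(k m:ℝ)|)) :=
        (Finset.sum_fiberwise_of_maps_to (fun m hm => Finset.mem_image_of_mem k hm) _).symm
    _≤∑ j ∈ s.image k, (exp 2*H)*exp (-|(j:ℝ)|) := by
        refine Finset.sum_le_sum fun j _ => ?_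
        have h3 : ∑ m ∈ s with k m=j, c m*(exp 2*exp (-|(k m:ℝ)|))=(exp 2*exp (-|(j:ℝ)|))*∑ m ∈ s with k m=j, c m := by
          rw [Finset.mul_sum]
          refine Finset.sum_congr rfl fun m hm => ?_
          rw [(Finset.mem_filter.1 hm).2]; ring
        have h4 : ∑ m ∈ s with k m=j, c m≤H := by
          refine hb (y0+j/T) _ fun m hm => ?_
          have h5 := (Finset.mem_filter.1 hm).2
          have h6 := hk1 m; have h7 := hk2 m
          rw [h5] at h6 h7
          constructor
          · have : (j:ℝ)/T< log m-y0 := by rw [div_lt_iff₀ hT]; linarith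
            linarith
          · have : log m-y0≤((j:ℝ)+1)/T := by rw [le_div_iff₀ hT]; linarith
            rw [add_div] at this; linarith
        rw [h3]
        calc _≤(exp 2*exp (-|(j:ℝ)|))*H := by gcongr
          _=_ := by ring
    _=(exp 2*H)*∑ j ∈ s.image k, exp (-|(j:ℝ)|) := by rw [Finset.mul_sum]
    _≤(exp 2*H)*S := by
        have := hS1 (s.image k)
        gcongr
    _=_ := by ring

/-- generalized absolutely convergent exponential series -/
noncomputable def Sr (b : ℕ → ℂ) (lam : ℕ → ℝ) (v:ℝ) : ℂ := ∑' n, b n*ee (v*lam n)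

lemma Sr_norm (b : ℕ → ℂ) (lam : ℕ → ℝ) (hb : Summable (fun n => ‖b n‖)) (v:ℝ) : ‖Sr b lam v‖≤∑' n, ‖b n‖ := by
  have e : ∀ n, ‖b n*ee (v*lam n)‖=‖b n‖ := fun n => by rw [norm_mul, ee_norm, mul_one]
  exact (norm_tsum_le_tsum_norm (by simpa only [e] using hb)).trans (le_of_eq (tsum_congr e))

lemma ee_cont : Continuous ee := by unfold ee; fun_prop

lemma Sr_cont (b : ℕ → ℂ) (lam : ℕ → ℝ) (hb : Summable (fun n => ‖b n‖)) : Continuous (Sr b lam) := by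
  refine continuous_tsum (fun n => ?_) hb (fun n v => by rw [norm_mul, ee_norm, mul_one])
  exact continuous_const.mul (ee_cont.comp (by fun_prop))

lemma ee_mul_int (K : ℝ → ℂ) (hK : Integrable K) (w:ℝ) : Integrable (fun v => K v*ee (v*w)) :=
  hK.mul_bdd (c := 1) (ee_cont.comp (by fun_prop : Continuous fun v : ℝ => v*w)).aestronglyMeasurable
    (Filter.Eventually.of_forall fun v => by rw [ee_norm])

lemma Sr_mul_int (K : ℝ → ℂ) (hK : Integrable K) (b : ℕ → ℂ) (lam : ℕ → ℝ) (hb : Summable (fun n => ‖b n‖)) :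
    Integrable (fun v => K v*Sr b lam v) :=
  hK.mul_bdd (c := ∑' n, ‖b n‖) (Sr_cont b lam hb).aestronglyMeasurable (Filter.Eventually.of_forall fun v => Sr_norm b lam hb v)

lemma Sr_inter (K : ℝ → ℂ) (hK : Integrable K) (b : ℕ → ℂ) (lam : ℕ → ℝ) (hb : Summable (fun n => ‖b n‖)) :
    ∫ v, K v*Sr b lam v=∑' n, b n*∫ v, K v*ee (v*lam n) := by
  have hFi : ∀ n, Integrable (fun v => b n*(K v*ee (v*lam n))) := fun n => (ee_mul_int K hK _).const_mul _
  have hn : ∀ n, ∫ v, ‖b n*(K v*ee (v*lam n))‖=‖b n‖*∫ v, ‖K v‖ := by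
    intro n
    rw [← integral_const_mul]
    refine integral_congr_ae (Filter.Eventually.of_forall fun v => ?_)
    beta_reduce
    rw [norm_mul, norm_mul, ee_norm, mul_one]
  have hs := hasSum_integral_of_summable_integral_norm hFi (by simpa only [hn] using hb.mul_right _)
  rw [show (fun v => K v*Sr b lam v)=fun v => ∑' n, b n*(K v*ee (v*lam n)) from ?_, ← hs.tsum_eq]
  · exact tsum_congr fun n => integral_const_mul _ _
  · ext v; unfold Sr; rw [← tsum_mul_left]; exact tsum_congr fun n => by ring

lemma Sr_conj (b : ℕ → ℂ) (lam : ℕ → ℝ) (v:ℝ) :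
    (starRingEnd ℂ) (Sr b lam v)=Sr (fun n => (starRingEnd ℂ) (b n)) (fun n => -lam n) v := by
  unfold Sr
  rw [Complex.conj_tsum]
  refine tsum_congr fun n => ?_
  rw [map_mul, ← ee_neg]; congr 2; ring

/-- Gaussian and its transform -/
noncomputable def gT (T v:ℝ) : ℝ := exp (-π*v^2/T^2)

lemma gT_int (T:ℝ) (hT : 0<T) : Integrable (gT T) := by
  have := integrable_exp_neg_mul_sq (b := π/T^2) (by positivity)
  refine this.congr (Filter.Eventually.of_forall fun v => ?_)
  unfold gT; beta_reduce; congr 1; ring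

lemma gT_pos (T v:ℝ) : 0<gT T v := exp_pos _

lemma gT_fourier (T:ℝ) (hT : 0<T) (y:ℝ) : ∫ v, (gT T v:ℂ)*ee (v*y)=((T*exp (-π*T^2*y^2):ℝ):ℂ) := by
  have hb : 0<(((1/T^2:ℝ)):ℂ).re := by rw [Complex.ofReal_re]; positivity
  have h := congrFun (fourier_gaussian_pi hb) (-y)
  rw [Real.fourier_eq'] at h
  have e : (1:ℂ)/(((1/T^2:ℝ)):ℂ)^(1/2:ℂ)=T := by
    rw [show (1/2:ℂ)=(((1/2:ℝ)):ℂ) by push_cast; rfl, ← Complex.ofReal_cpow (by positivity)]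
    rw [← Real.sqrt_eq_rpow, Real.sqrt_div (by norm_num), Real.sqrt_sq hT.le]
    simp
  rw [e] at h
  rw [Complex.ofReal_mul, Complex.ofReal_exp]
  convert h using 1
  · refine integral_congr_ae (Filter.Eventually.of_forall fun v => ?_)
    beta_reduce
    rw [smul_eq_mul, mul_comm]
    unfold gT ee
    rw [Complex.ofReal_exp]
    congr 1
    · congr 1
      simp only [RCLike.inner_apply, conj_trivial]
      push_cast; ring
    · congr 1
      push_cast; ring
  · congr 2
    push_cast
    field_simp
    try ring

/-- mean value estimate -/
lemma mean_value (b : ℕ → ℂ) (lam : ℕ → ℝ) (hb : Summable (fun n => ‖b n‖)) (T M:ℝ) (hT : 0<T)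
    (hM : ∀ (y:ℝ) (s : Finset ℕ), ∑ m ∈ s, ‖b m‖*exp (-π*T^2*(lam m-y)^2)≤M) :
    Integrable (fun v => gT T v*‖Sr b lam v‖^2) ∧
    ∫ v, gT T v*‖Sr b lam v‖^2≤T*M*∑' n, ‖b n‖ := by
  have hM0 : 0≤M := by simpa using hM 0 ∅
  have hgc : Integrable (fun v => (gT T v:ℂ)) := (gT_int T hT).ofReal
  have hK : Integrable (fun v => (gT T v:ℂ)*Sr b lam v) := Sr_mul_int _ hgc b lam hb
  have hbc : Summable (fun n => ‖(starRingEnd ℂ) (b n)‖) := by simpa using hb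
  have hKK := Sr_mul_int _ hK _ (fun n => -lam n) hbc
  have he : ∀ v, (gT T v:ℂ)*Sr b lam v*Sr (fun n => (starRingEnd ℂ) (b n)) (fun n => -lam n) v=((gT T v*‖Sr b lam v‖^2:ℝ):ℂ) := by
    intro v
    rw [← Sr_conj, mul_assoc, Complex.mul_conj, Complex.normSq_eq_norm_sq]; push_cast; rfl
  have hin := Sr_inter _ hK _ (fun n => -lam n) hbc
  simp only [he] at hKK hin
  have hI : Integrable (fun v => gT T v*‖Sr b lam v‖^2) := by
    have := hKK.re
    simpa only [RCLike.re_to_complex, Complex.ofReal_re] using this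
  refine ⟨hI, ?_⟩
  rw [integral_complex_ofReal] at hin
  have h1 : ∀ n, ‖∫ v, (gT T v:ℂ)*Sr b lam v*ee (v * -lam n)‖≤T*M := by
    intro n
    have e1 : ∫ v, (gT T v:ℂ)*Sr b lam v*ee (v * -lam n)=∑' m, b m*((T*exp (-π*T^2*(lam m-lam n)^2):ℝ):ℂ) := by
      rw [show (fun v => (gT T v:ℂ)*Sr b lam v*ee (v * -lam n))=fun v => ((gT T v:ℂ)*ee (v * -lam n))*Sr b lam v by ext v; ring]
      rw [Sr_inter _ (ee_mul_int _ hgc _) b lam hb]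
      refine tsum_congr fun m => ?_
      rw [← gT_fourier T hT]
      congr 1
      refine integral_congr_ae (Filter.Eventually.of_forall fun v => ?_)
      beta_reduce
      rw [mul_assoc, ← ee_add]; congr 2; ring
    rw [e1]
    have hnn : ∀ m, ‖b m*((T*exp (-π*T^2*(lam m-lam n)^2):ℝ):ℂ)‖=T*(‖b m‖*exp (-π*T^2*(lam m-lam n)^2)) := by
      intro m
      rw [norm_mul, Complex.norm_real, Real.norm_of_nonneg (by positivity)]; ring
    have hsum : Summable (fun m => ‖b m‖*exp (-π*T^2*(lam m-lam n)^2)) := by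
      refine Summable.of_nonneg_of_le (fun m => by positivity) (fun m => ?_) hb
      refine mul_le_of_le_one_right (norm_nonneg _) (exp_le_one_iff.2 ?_)
      have : 0≤π*T^2*(lam m-lam n)^2 := by positivity
      linarith
    refine (norm_tsum_le_tsum_norm (by simpa only [hnn] using hsum.mul_left T)).trans ?_
    rw [tsum_congr hnn, tsum_mul_left]
    gcongr
    exact Real.tsum_le_of_sum_le (fun m => by positivity) (hM (lam n))
  have h2 : (∫ v, gT T v*‖Sr b lam v‖^2)=‖((∫ v, gT T v*‖Sr b lam v‖^2:ℝ):ℂ)‖ := by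
    rw [Complex.norm_real, Real.norm_of_nonneg]
    exact integral_nonneg fun v => mul_nonneg (gT_pos T v).le (by positivity)
  rw [h2, hin, mul_comm (T*M), ← tsum_mul_right]
  have h3 : ∀ n, ‖(starRingEnd ℂ) (b n)*∫ v, (gT T v:ℂ)*Sr b lam v*ee (v * -lam n)‖≤‖b n‖*(T*M) := by
    intro n
    rw [norm_mul, RCLike.norm_conj]
    exact mul_le_mul_of_nonneg_left (h1 n) (norm_nonneg _)
  exact tsum_of_norm_bounded (hb.mul_right (T*M)).hasSum h3

end M4c
end H12
namespace H12
section M4d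
open MeasureTheory Real FourierTransform

noncomputable def bb (a : ℕ → ℂ) (X:ℝ) (n:ℕ) : ℂ := a n*(((n:ℝ)^(-(1+1/X)):ℝ):ℂ)
noncomputable def Lv (a : ℕ → ℂ) (X v:ℝ) : ℂ := Sr (bb a X) (fun n => log n) v

lemma Lv_eq (a : ℕ → ℂ) (a0 : a 0=0) (X v:ℝ) :
    Lv a X v=LSeries a ((1+1/X:ℝ)+((-(2*π*v):ℝ):ℂ)*Complex.I) := by
  rw [LSeries_tsum a a0]
  unfold Lv Sr bb
  refine tsum_congr fun n => ?_
  have : cx (-(2*π*v)) n=ee (v*log n) := by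
    unfold cx ee; congr 2; push_cast; ring
  rw [this]; ring

lemma bb_norm (a : ℕ → ℂ) (X:ℝ) (n:ℕ) : ‖bb a X n‖=‖a n‖*(n:ℝ)^(-(1+1/X)) := by
  unfold bb; rw [norm_mul, Complex.norm_real, Real.norm_of_nonneg (by positivity)]

/-- summability and trivial bound, packaged -/
theorem bb_triv : ∃ K : ℝ, 1≤K ∧ ∀ η X : ℝ, 0<η → η≤1 → 10/η≤X → ∀ j≤2, ∀ a : ℕ → ℂ,
    (∀ n, ‖a n‖≤ rf (exp (η*X)) n*log n^j) →
    Summable (fun n => ‖bb a X n‖) ∧ ∑' n, ‖bb a X n‖≤K*X^j/η := by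
  obtain ⟨K, hK, h⟩ := triv
  refine ⟨K, hK, ?_⟩
  intro η X hη hη1 hX j hj a ha
  have hX0 : 0<X := lt_of_lt_of_le (by positivity) hX
  have hσ : 1 < 1 + 1/X := by have : 0 < 1/X := by positivity
                              linarith
  simp only [bb_norm]
  exact ⟨coef_summable _ a j hj ha _ hσ, (coef_tsum_le _ a j hj ha _ hσ).trans (h η X hη hη1 hX j hj)⟩

lemma fs_norm' (z X:ℝ) (n:ℕ) : ‖fs z X n‖≤ rf z n*log n^0 := by
  rw [pow_zero, mul_one]
  refine (fs_norm z X n).trans ?_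
  exact mul_le_of_le_one_right (rf_nonneg z n) (psc_mem X n).2

lemma fs_zero (z X:ℝ) : fs z X 0=0 := by unfold fs; rw [fa_zero, zero_mul]

theorem fs_mean : ∃ C : ℝ, 1≤C ∧ ∀ η X T : ℝ, 0<η → η≤1 → 10/η≤X → 1≤T → T*exp (η*X)≤exp (X/16) →
    Integrable (fun v => gT T v*‖Lv (fs (exp (η*X)) X) X v‖^2) ∧
    ∫ v, gT T v*‖Lv (fs (exp (η*X)) X) X v‖^2≤C/(η^2*X) := by
  obtain ⟨C, hC, h1⟩ := bt2
  obtain ⟨K, hK, h2⟩ := block_sum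
  obtain ⟨K2, hK2, h3⟩ := bb_triv
  refine ⟨K*(2*C)*K2, by nlinarith [mul_le_mul hK (by linarith : (1:ℝ)≤2*C) (by norm_num) (by linarith)], ?_⟩
  intro η X T hη hη1 hX hT hTz
  have hl : 10≤η*X := by rw [div_le_iff₀ hη] at hX; linarith
  have hX0 : 0<X := lt_of_lt_of_le (by positivity) hX
  have hT0 : 0<T := by linarith
  have hXi : 0<1/X := by positivity
  set z := exp (η*X) with hz
  have hz10 : 2^10≤z := exp10.trans (exp_le_exp.2 hl)
  have hlz : log z=η*X := log_exp _
  obtain ⟨hs, hb⟩ := h3 η X hη hη1 hX 0 (by norm_num) (fs z X) (fs_norm' z X)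
  set H := 2*C/(T*(η*X)) with hH
  have hblock : ∀ (y:ℝ) (s : Finset ℕ), (∀ m ∈ s, y< log m ∧ log m≤y+1/T) → ∑ m ∈ s, ‖bb (fs z X) X m‖≤H := by
    intro y s hys
    set y' := max y (X/16) with hy'
    set h := exp y' * (exp (1/T)-1) with hh
    have hT1 : 0<1/T := by positivity
    have he1 : 1/T≤exp (1/T)-1 := by have := add_one_le_exp (1/T); linarith
    have he2 : exp (1/T)-1≤2/T := by
      have hle : 1/T≤1 := by rw [div_le_one hT0]; exact hT
      have h6 := abs_exp_sub_one_sub_id_le (x := 1/T) (by rw [abs_of_pos hT1]; exact hle)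
      have h7 := (abs_le.1 h6).2
      have h8 : 2/T=1/T+1/T := by ring
      nlinarith
    have hzh : z≤h := by
      have h4 : exp (X/16)≤exp y' := exp_le_exp.2 (le_max_right _ _)
      calc z=T*z*(1/T) := by field_simp
        _≤exp (X/16)*(1/T) := by gcongr
        _≤exp y' * (exp (1/T)-1) := by gcongr
    have h5 := h1 z (exp y') h hz10 (exp_pos _).le hzh
    have hah : exp y' + h=exp (y' + 1/T) := by rw [hh, exp_add]; ring
    rw [hah, hlz] at h5
    calc ∑ m ∈ s, ‖bb (fs z X) X m‖≤∑ m ∈ s, (if y' < log m then rf z m*exp (-y') else 0) := by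
          refine Finset.sum_le_sum fun m hm => ?_
          rw [bb_norm]
          have hn := fs_norm z X m
          have hsplit : y' < log m ∨ log m≤X/16 := by
            rcases le_or_gt (log (m:ℝ)) (X/16) with h | h
            · right; exact h
            · left; exact max_lt (hys m hm).1 h
          rcases hsplit with h6 | h6
          · rw [if_pos h6]
            have hm0 : 0< m := by
              rcases Nat.eq_zero_or_pos m with h0 | h0
              · exfalso; rw [h0] at h6; simp at h6
                have : 0<X/16 := by positivity
                have := le_max_right y (X/16); linarith
              · exact h0
            have hmp : (0:ℝ)< m := by exact_mod_cast hm0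
            have hm1 : (1:ℝ)≤ m := by exact_mod_cast hm0
            have h7 : ‖fs z X m‖≤ rf z m := hn.trans (mul_le_of_le_one_right (rf_nonneg z m) (psc_mem X m).2)
            have h8 : (m:ℝ)^(-(1+1/X))≤exp (-y') := by
              rw [rpow_def_of_pos hmp]
              apply exp_le_exp.2
              have := log_nonneg hm1
              nlinarith
            have := rf_nonneg z m
            gcongr
          · have h7 : psc X m=0 := by
              unfold psc; apply smoothTransition.zero_of_nonpos
              have : log m/X≤1/16 := by rw [div_le_iff₀ hX0]; linarith
              linarith
            rw [h7, mul_zero] at hn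
            have h8 : ‖fs z X m‖=0 := le_antisymm hn (norm_nonneg _)
            rw [h8, zero_mul]
            split_ifs
            · exact mul_nonneg (rf_nonneg z m) (exp_pos _).le
            · exact le_rfl
      _=∑ m ∈ s.filter (fun m : ℕ => y' < log (m:ℝ)), rf z m*exp (-y') := by rw [Finset.sum_filter]
      _≤∑ m ∈ Finset.Ioc ⌊exp y'⌋₊ ⌊exp (y' + 1/T)⌋₊, rf z m*exp (-y') := by
          refine Finset.sum_le_sum_of_subset_of_nonneg (fun m hm => ?_) (fun m _ _ => mul_nonneg (rf_nonneg z m) (exp_pos _).le)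
          obtain ⟨hm1, hm2⟩ := Finset.mem_filter.1 hm
          have hm0 : (0:ℝ)< m := by
            rcases Nat.eq_zero_or_pos m with h0 | h0
            · exfalso; rw [h0] at hm2; simp at hm2
              have : 0<X/16 := by positivity
              have := le_max_right y (X/16); linarith
            · exact_mod_cast h0
          rw [Finset.mem_Ioc]
          constructor
          · rw [Nat.floor_lt (exp_pos _).le, ← exp_log hm0]; exact exp_lt_exp.2 hm2
          · apply Nat.le_floor
            rw [← exp_log hm0]; apply exp_le_exp.2
            have := (hys m hm1).2
            have := le_max_left y (X/16)
            linarith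
      _=(∑ m ∈ Finset.Ioc ⌊exp y'⌋₊ ⌊exp (y' + 1/T)⌋₊, rf z m)*exp (-y') := by rw [Finset.sum_mul]
      _≤(C*h/(η*X))*exp (-y') := by gcongr
      _=C*(exp (1/T)-1)/(η*X)*(exp y' * exp (-y')) := by rw [hh]; ring
      _=C*(exp (1/T)-1)/(η*X) := by rw [← exp_add]; simp
      _≤C*(2/T)/(η*X) := by gcongr
      _=H := by rw [hH]; field_simp
  have hH0 : 0≤H := by rw [hH]; positivity
  have h4 := h2 (fun m => ‖bb (fs z X) X m‖) H T (fun _ => norm_nonneg _) hH0 hT0 hblock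
  have h5 := mean_value (bb (fs z X) X) (fun n => log n) hs T (K*H) hT0 h4
  refine ⟨h5.1, h5.2.trans ?_⟩
  calc T*(K*H)*∑' n, ‖bb (fs z X) X n‖≤T*(K*H)*(K2*X^0/η) := by gcongr
    _=_ := by rw [hH]; field_simp

lemma gT_mono (S T v:ℝ) (hS : 0<S) (hST : S≤T) : gT S v≤gT T v := by
  unfold gT
  apply exp_le_exp.2
  rw [neg_mul, neg_div, neg_div, neg_le_neg_iff]
  gcongr

lemma gT_le_one (T v:ℝ) : gT T v≤1 := by
  unfold gT
  rw [exp_le_one_iff]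
  have : 0≤π*v^2/T^2 := by positivity
  rw [neg_mul, neg_div]; linarith

lemma gT_huge (T X v:ℝ) (hT : 1≤T) (hXc : 64≤X) (hTX : T≤exp (X/32)) (hw : exp X<4*(2*π*|v|)) :
    gT T v≤gT (2*T) v*(300*exp (-X)) := by
  have hT0 : 0<T := by linarith
  have e1 : gT T v=gT (2*T) v*exp (-(3*π*v^2/(4*T^2))) := by
    unfold gT; rw [← exp_add]; congr 1; field_simp; ring
  rw [e1]
  refine mul_le_mul_of_nonneg_left ?_ (gT_pos _ _).le
  have hu : exp X/300≤3*π*v^2/(4*T^2) := by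
    rw [div_le_div_iff₀ (by norm_num) (by positivity)]
    have hT4 : T^2≤exp X := by
      calc T^2≤exp (X/32) ^2 := by gcongr
        _=exp (X/16) := by rw [← exp_nat_mul]; congr 1; push_cast; ring
        _≤exp X := exp_le_exp.2 (by linarith)
    have hpi := Real.pi_gt_three
    have hpi2 := Real.pi_lt_d2
    have hv3 : exp X*exp X≤64*π*π*v^2 := by
      rw [← sq_abs v]
      have := mul_self_le_mul_self (exp_pos X).le hw.le
      nlinarith
    calc exp X*(4*T^2)≤4*(exp X*exp X) := by nlinarith [exp_pos X]
      _≤4*(64*π*π*v^2) := by linarith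
      _≤3*π*v^2*300 := by nlinarith [mul_nonneg (by linarith : (0:ℝ)≤π) (sq_nonneg v)]
  have hupos : 0<3*π*v^2/(4*T^2) := lt_of_lt_of_le (by positivity) hu
  have := add_one_le_exp (3*π*v^2/(4*T^2))
  rw [exp_neg, exp_neg, ← div_eq_mul_inv, inv_eq_one_div, div_le_div_iff₀ (exp_pos _) (exp_pos _)]
  linarith

set_option maxHeartbeats 1600000 in
theorem typeII : ∃ C : ℝ, 1≤C ∧ ∀ η : ℝ, 0<η → η≤1/64 → ∃ X0 : ℝ, 1≤X0 ∧ ∀ X : ℝ, X0≤X → ∀ T : ℝ, 1≤T → T≤exp (X/32) →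
    ∀ E : ℝ → ℂ, (∀ v, ‖E v‖≤1) →
    ‖∫ v, ((gT T v-gT 1 v:ℝ):ℂ)*E v*(Lv (ra (exp (η*X)) 1) X v*Lv (ra (exp (η*X)) 0) X v^2*Lv (fs (exp (η*X)) X) X v^3)‖≤C*η := by
  obtain ⟨C1, hC1, h1⟩ := RF_bounds
  obtain ⟨C2, hC2, h2⟩ := Fs_sup
  obtain ⟨C3, hC3, h3⟩ := fs_mean
  obtain ⟨K, hK, h4⟩ := bb_triv
  have hC10 : 0<C1 := by linarith
  have hC20 : 0<C2 := by linarith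
  have hC30 : 0<C3 := by linarith
  have hK0 : 0<K := by linarith
  refine ⟨C1^3*C2*C3 + 2, by have : 0 < C1^3*C2*C3 := by positivity
                             linarith, ?_⟩
  intro η hη hη1
  obtain ⟨X1, hX1, h5⟩ := h1 η hη (by linarith)
  obtain ⟨X2, hX2, h6⟩ := h2 η hη (by linarith)
  refine ⟨max (max X1 X2) (max (max 64 (10/η)) (max ((2*K^4*C3/η^7)^2) (300*K^4*C3/η^7))), le_max_of_le_left (le_max_of_le_left hX1), ?_⟩
  intro X hX T hT hTX E hE
  have hXa : X1≤X := (le_max_left _ _).trans ((le_max_left _ _).trans hX)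
  have hXb : X2≤X := (le_max_right _ _).trans ((le_max_left _ _).trans hX)
  have hX' := (le_max_right _ _).trans hX
  have hXc : 64≤X := (le_max_left _ _).trans ((le_max_left _ _).trans hX')
  have hXd : 10/η≤X := (le_max_right _ _).trans ((le_max_left _ _).trans hX')
  have hXe : (2*K^4*C3/η^7)^2≤X := (le_max_left _ _).trans ((le_max_right _ _).trans hX')
  have hXf : 300*K^4*C3/η^7≤X := (le_max_right _ _).trans ((le_max_right _ _).trans hX')
  have hX0 : 0<X := by linarith
  set z := exp (η*X) with hz
  have hz1 : 1≤z := one_le_exp (by positivity)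
  have hT0 : 0<T := by linarith
  -- mean values
  have hT2 : 2*T*z≤exp (X/16) := by
    have e2 : (2:ℝ)≤exp (X/64) := by have := add_one_le_exp (X/64); linarith
    calc 2*T*z≤exp (X/64)*exp (X/32)*exp (X/64) := by
          gcongr
          rw [hz]; apply exp_le_exp.2; nlinarith
      _=exp (X/16) := by rw [← exp_add, ← exp_add]; congr 1; ring
  obtain ⟨i1, m1⟩ := h3 η X T hη (by linarith) hXd hT (by nlinarith [mul_pos hT0 (show 0<z by linarith)])
  obtain ⟨i2, m2⟩ := h3 η X 1 hη (by linarith) hXd le_rfl (by nlinarith)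
  obtain ⟨i3, m3⟩ := h3 η X (2*T) hη (by linarith) hXd (by linarith) hT2
  -- trivial bounds
  have hra : ∀ j n, ‖ra z j n‖≤ rf z n*log n^j := fun j n => (ra_norm z j n).le
  obtain ⟨s1, t1⟩ := h4 η X hη (by linarith) hXd 1 (by norm_num) (ra z 1) (hra 1)
  obtain ⟨s0, t0⟩ := h4 η X hη (by linarith) hXd 0 (by norm_num) (ra z 0) (hra 0)
  obtain ⟨s2, t2⟩ := h4 η X hη (by linarith) hXd 0 (by norm_num) (fs z X) (fs_norm' z X)
  have b1 : ∀ v, ‖Lv (ra z 1) X v‖≤K*X/η := fun v => by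
    have := (Sr_norm _ (fun n => log n) s1 v).trans t1; rwa [pow_one] at this
  have b0 : ∀ v, ‖Lv (ra z 0) X v‖≤K/η := fun v => by
    have := (Sr_norm _ (fun n => log n) s0 v).trans t0; rwa [pow_zero, mul_one] at this
  have b2 : ∀ v, ‖Lv (fs z X) X v‖≤K/η := fun v => by
    have := (Sr_norm _ (fun n => log n) s2 v).trans t2; rwa [pow_zero, mul_one] at this
  have hσ2 : 1+1/X≤2 := by
    have : 1/X≤1 := by rw [div_le_one hX0]; linarith
    linarith
  set A1 := (C1*(η*X))*C1^2*(C2*η^2) with hA1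
  set A2 := 2*(sqrt X)⁻¹*((K*X/η)*(K/η)^2*(K/η)) with hA2
  set A3 := 300*exp (-X)*((K*X/η)*(K/η)^2*(K/η)) with hA3
  have hA1p : 0≤A1 := by positivity
  have hA2p : 0≤A2 := by positivity
  have hA3p : 0≤A3 := by positivity
  have hpt : ∀ v, ‖((gT T v-gT 1 v:ℝ):ℂ)*E v*(Lv (ra z 1) X v*Lv (ra z 0) X v^2*Lv (fs z X) X v^3)‖ ≤
      A1*(gT T v*‖Lv (fs z X) X v‖^2)+A2*(gT 1 v*‖Lv (fs z X) X v‖^2)+A3*(gT (2*T) v*‖Lv (fs z X) X v‖^2) := by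
    intro v
    have hd0 : 0≤gT T v-gT 1 v := by linarith [gT_mono 1 T v one_pos hT]
    have hd1 : gT T v-gT 1 v≤gT T v := by linarith [gT_pos 1 v]
    rw [norm_mul, norm_mul, norm_mul, norm_mul, norm_pow, norm_pow, Complex.norm_real, Real.norm_of_nonneg hd0]
    set d := ‖Lv (ra z 1) X v‖ with hd
    set r := ‖Lv (ra z 0) X v‖ with hr
    set f := ‖Lv (fs z X) X v‖ with hf
    have d0 : 0≤d := norm_nonneg _
    have r0 : 0≤ r := norm_nonneg _
    have f0 : 0≤ f := norm_nonneg _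
    have q1 : 0≤gT T v*f^2 := mul_nonneg (gT_pos _ _).le (by positivity)
    have q2 : 0≤gT 1 v*f^2 := mul_nonneg (gT_pos _ _).le (by positivity)
    have q3 : 0≤gT (2*T) v*f^2 := mul_nonneg (gT_pos _ _).le (by positivity)
    have p1 := mul_nonneg hA1p q1
    have p2 := mul_nonneg hA2p q2
    have p3 := mul_nonneg hA3p q3
    have hred : (gT T v-gT 1 v)*‖E v‖*(d*r^2*f^3)≤(gT T v-gT 1 v)*(d*r^2*f)*f^2 := by
      have : (gT T v-gT 1 v)*‖E v‖≤(gT T v-gT 1 v) := mul_le_of_le_one_right hd0 (hE v)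
      calc _≤(gT T v-gT 1 v)*(d*r^2*f^3) := by gcongr
        _=_ := by ring
    refine hred.trans ?_
    have htriv : d*r^2*f≤(K*X/η)*(K/η)^2*(K/η) := by
      gcongr
      · exact b1 v
      · exact b0 v
      · exact b2 v
    have habs : |-(2*π*v)| = 2*π*|v| := by rw [abs_neg, abs_mul, abs_of_pos (by positivity)]
    rcases lt_or_ge (2*π*|v|) (X^(-(1/4:ℝ))) with hv | hv
    · -- small v
      have hvv : (2*π*|v|)^2≤(sqrt X)⁻¹ := by
        calc (2*π*|v|)^2≤(X^(-(1/4:ℝ)))^2 := by gcongr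
          _=(sqrt X)⁻¹ := by rw [sqrt_eq_rpow, ← rpow_natCast, ← rpow_mul hX0.le, ← rpow_neg hX0.le]; norm_num
      have hpi := Real.pi_gt_three
      have hv2 : π*v^2≤(sqrt X)⁻¹ := by
        rw [mul_pow, mul_pow, sq_abs] at hvv
        nlinarith [sq_nonneg v, mul_nonneg (by linarith : (0:ℝ)≤π) (sq_nonneg v)]
      have hsq : (sqrt X)⁻¹≤1/2 := by
        rw [inv_le_comm₀ (by positivity) (by norm_num)]
        apply le_sqrt_of_sq_le; norm_num; linarith
      have hg1 : 1-π*v^2≤gT 1 v := by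
        unfold gT
        have := add_one_le_exp (-π*v^2/1^2)
        have e : -π*v^2/1^2 = -(π*v^2) := by ring
        rw [e] at this ⊢; linarith
      have hg2 := gT_le_one T v
      have : (gT T v-gT 1 v)*(d*r^2*f)*f^2≤A2*(gT 1 v*f^2) := by
        calc _≤(sqrt X)⁻¹*((K*X/η)*(K/η)^2*(K/η))*f^2 := by
              gcongr
              linarith
          _=A2*(1/2*f^2) := by rw [hA2]; ring
          _≤A2*(gT 1 v*f^2) := by gcongr; linarith
      linarith
    · rcases le_or_gt (4*(2*π*|v|)) (exp X) with hw | hw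
      · rw [← habs] at hv hw
        have hm : X^(-(1/3:ℝ))≤X^(-(1/4:ℝ)) := rpow_le_rpow_of_exponent_le (by linarith) (by norm_num)
        have g1 := h5 X hXa (-(2*π*v)) (1+1/X) (hm.trans hv) (by have := abs_nonneg (-(2*π*v)); linarith) le_rfl hσ2
        have g2 := h6 X hXb (-(2*π*v)) hv hw
        rw [← Lv_eq _ (ra_zero z 0), ← Lv_eq _ (ra_zero z 1)] at g1
        rw [← Lv_eq _ (fs_zero z X)] at g2
        have : (gT T v-gT 1 v)*(d*r^2*f)*f^2≤A1*(gT T v*f^2) := by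
          calc _≤gT T v*((C1*(η*X))*C1^2*(C2*η^2))*f^2 := by
                have := (gT_pos T v).le
                have := g1.1
                have := g1.2.1
                gcongr
            _=_ := by rw [hA1]; ring
        linarith
      · -- huge v
        have hg := gT_huge T X v hT hXc hTX hw
        have : (gT T v-gT 1 v)*(d*r^2*f)*f^2≤A3*(gT (2*T) v*f^2) := by
          calc _≤gT (2*T) v*(300*exp (-X))*((K*X/η)*(K/η)^2*(K/η))*f^2 := by
                gcongr
                · exact mul_nonneg (gT_pos _ _).le (by positivity)
                · linarith
            _=_ := by rw [hA3]; ring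
        linarith
  refine (norm_integral_le_of_norm_le (((i1.const_mul A1).add (i2.const_mul A2)).add (i3.const_mul A3)) (Filter.Eventually.of_forall hpt)).trans ?_
  have hsplit := integral_add ((i1.const_mul A1).add (i2.const_mul A2)) (i3.const_mul A3)
  have hsplit2 := integral_add (i1.const_mul A1) (i2.const_mul A2)
  simp only [Pi.add_apply] at hsplit hsplit2 ⊢
  rw [hsplit, hsplit2, integral_const_mul, integral_const_mul, integral_const_mul]
  have u1 : A1*(C3/(η^2*X))=C1^3*C2*C3*η := by rw [hA1]; field_simp
  have u2 : A2*(C3/(η^2*X))≤η := by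
    have e : A2*(C3/(η^2*X))=(2*K^4*C3/η^7)*(sqrt X)⁻¹*η := by rw [hA2]; field_simp
    rw [e]
    refine mul_le_of_le_one_left hη.le ?_
    rw [← div_eq_mul_inv, div_le_one (by positivity)]
    exact le_sqrt_of_sq_le hXe
  have u3 : A3*(C3/(η^2*X))≤η := by
    have e : A3*(C3/(η^2*X))=(300*K^4*C3/η^7)*exp (-X)*η := by rw [hA3]; field_simp
    rw [e]
    refine mul_le_of_le_one_left hη.le ?_
    rw [exp_neg, ← div_eq_mul_inv, div_le_one (exp_pos X)]
    have := add_one_le_exp X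
    linarith
  have v1 := mul_le_mul_of_nonneg_left m1 hA1p
  have v2 := mul_le_mul_of_nonneg_left m2 hA2p
  have v3 := mul_le_mul_of_nonneg_left m3 hA3p
  linarith

end M4d
end H12
namespace H12
section M5a
open MeasureTheory Real Filter Topology

lemma dsum (k k' : ℝ → ℝ) (B w0:ℝ) (hB : 0≤B) (hd : ∀ w, HasDerivAt k (k' w) w) (hc : Continuous k')
    (hk0 : ∀ w, 0≤k w) (hkB : ∀ w, k w≤B) (hk'B : ∀ w, |k' w| ≤ B) (hz : ∀ w≤w0, k w=0)
    (hi : Integrable k) (hw0 : 0≤w0) (d:ℕ) (hd1 : 1≤d) :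
    Summable (fun j : ℕ => k (log (d*j))/(d*j)) ∧ |∑' j : ℕ, k (log (d*j))/(d*j)-(∫ w, k w)/d| ≤ 2*B*exp (-w0) := by
  have hd0 : (0:ℝ)<d := by exact_mod_cast hd1
  set f : ℝ → ℝ := fun u => k (log (d*u))/(d*u) with hf
  set f' : ℝ → ℝ := fun u => (k' (log (d*u))-k (log (d*u)))/(d*u^2) with hf'
  set a := exp w0/d with ha
  have ha0 : 0<a := by positivity
  have hkc : Continuous k := continuous_iff_continuousAt.2 fun w => (hd w).continuousAt
  have hlog : ∀ u : ℝ, 0<u → HasDerivAt (fun u : ℝ => log (d*u)) (1/u) u := by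
    intro u hu
    have h1 : HasDerivAt (fun u : ℝ => (d:ℝ)*u) d u := by simpa using (hasDerivAt_id u).const_mul (d:ℝ)
    refine (h1.log (by positivity)).congr_deriv ?_
    field_simp
  have hfd : ∀ u : ℝ, 0<u → HasDerivAt f (f' u) u := by
    intro u hu
    have h1 : HasDerivAt (fun u : ℝ => (d:ℝ)*u) d u := by simpa using (hasDerivAt_id u).const_mul (d:ℝ)
    have h2 := ((hd (log (d*u))).comp u (hlog u hu)).div h1 (by positivity)
    refine h2.congr_deriv ?_
    simp only [hf', Function.comp]
    field_simp
  set P : ℝ → ℝ := fun w => ∫ x in w0..w, k x with hP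
  have hPd : ∀ w, HasDerivAt P (k w) w := fun w => (hkc.integral_hasStrictDerivAt w0 w).hasDerivAt
  have hfc : ContinuousOn f (Set.Ioi 0) := fun u hu => (hfd u hu).continuousAt.continuousWithinAt
  have hlc : ContinuousOn (fun u : ℝ => log (d*u)) (Set.Ioi 0) := fun u hu => (hlog u hu).continuousAt.continuousWithinAt
  have hfc' : ContinuousOn f' (Set.Ioi 0) := by
    refine ContinuousOn.div ((hc.comp_continuousOn hlc).sub (hkc.comp_continuousOn hlc)) (by fun_prop) ?_
    intro u hu
    have : (0:ℝ)<u := hu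
    positivity
  have key : ∀ N : ℕ, a≤N → |∑ j ∈ Finset.range (N+1), f j-P (log (d*N))/d| ≤ B/(d*N)+2*B*exp (-w0) := by
    intro N hN
    have hN0 : (0:ℝ)<N := lt_of_lt_of_le ha0 hN
    have hsub : Set.Icc a (N:ℝ) ⊆ Set.Ioi 0 := fun u hu => lt_of_lt_of_le ha0 hu.1
    have h1 := euler_sum (fun u => (f u:ℂ)) (fun u => (f' u:ℂ)) a N ha0.le hN
      (fun u hu => (hfd u (hsub hu)).ofReal_comp) (Complex.continuous_ofReal.comp_continuousOn (hfc'.mono hsub))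
    rw [intervalIntegral.integral_ofReal, ← Complex.ofReal_sum, ← Complex.ofReal_sub, Complex.norm_real, Nat.floor_natCast] at h1
    have h2 : ∑ j ∈ Finset.Ioc ⌊a⌋₊ N, f j=∑ j ∈ Finset.range (N+1), f j := by
      refine Finset.sum_subset (fun j hj => ?_) (fun j hj hj' => ?_)
      · rw [Finset.mem_Ioc] at hj; rw [Finset.mem_range]; omega
      · rw [Finset.mem_Ioc] at hj'; rw [Finset.mem_range] at hj
        have hja : j≤⌊a⌋₊ := by by_contra h; push Not at h; exact hj' ⟨h, by omega⟩
        simp only [hf]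
        rcases Nat.eq_zero_or_pos j with h0 | h0
        · rw [h0]; simp
        · have hj0 : (0:ℝ)<j := by exact_mod_cast h0
          rw [hz, zero_div]
          rw [log_le_iff_le_exp (by positivity)]
          have := (Nat.le_floor_iff ha0.le).1 hja
          rw [ha, le_div_iff₀ hd0] at this
          linarith
    have h3 : ∫ u in a..(N:ℝ), f u=P (log (d*N))/d := by
      have h4 := intervalIntegral.integral_eq_sub_of_hasDerivAt (a := a) (b := N) (f := fun u => P (log (d*u))/d) (f' := f) ?_ ?_
      · rw [h4]
        have : (d:ℝ)*a=exp w0 := by rw [ha]; field_simp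
        simp only [this, log_exp]
        simp [hP]
      · intro u hu
        rw [Set.uIcc_of_le hN] at hu
        have hu0 : 0<u := hsub hu
        refine (((hPd _).comp u (hlog u hu0)).div_const (d:ℝ)).congr_deriv ?_
        simp only [hf]; field_simp
      · apply ContinuousOn.intervalIntegrable; rw [Set.uIcc_of_le hN]; exact hfc.mono hsub
    have h5 : f a=0 := by
      simp only [hf]
      have : (d:ℝ)*a=exp w0 := by rw [ha]; field_simp
      rw [this, log_exp, hz w0 le_rfl, zero_div]
    have h6 : ‖(f N:ℂ)‖≤B/(d*N) := by
      rw [Complex.norm_real, Real.norm_of_nonneg (div_nonneg (hk0 _) (by positivity))]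
      exact div_le_div_of_nonneg_right (hkB _) (by positivity)
    have h7 : ∫ u in a..(N:ℝ), ‖(f' u:ℂ)‖≤2*B*exp (-w0) := by
      have hA : ∀ u ∈ Set.Icc a (N:ℝ), HasDerivAt (fun u : ℝ => -(2*B/d)*u⁻¹) (2*B/(d*u^2)) u := by
        intro u hu
        have hu0 : 0<u := hsub hu
        refine ((hasDerivAt_inv hu0.ne').const_mul (-(2*B/d))).congr_deriv ?_
        field_simp
      have hcc : ContinuousOn (fun u : ℝ => 2*B/(d*u^2)) (Set.Icc a (N:ℝ)) := by
        refine ContinuousOn.div (by fun_prop) (by fun_prop) ?_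
        intro u hu
        have : (0:ℝ)<u := hsub hu
        positivity
      calc ∫ u in a..(N:ℝ), ‖(f' u:ℂ)‖≤∫ u in a..(N:ℝ), 2*B/(d*u^2) := by
            refine intervalIntegral.integral_mono_on hN ?_ ?_ ?_
            · apply ContinuousOn.intervalIntegrable; rw [Set.uIcc_of_le hN]
              exact (Complex.continuous_ofReal.comp_continuousOn (hfc'.mono hsub)).norm
            · apply ContinuousOn.intervalIntegrable; rw [Set.uIcc_of_le hN]; exact hcc
            · intro u hu
              have hu0 : 0<u := hsub hu
              rw [Complex.norm_real, Real.norm_eq_abs]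
              simp only [hf']
              rw [abs_div, abs_of_pos (by positivity : (0:ℝ)<d*u^2)]
              gcongr
              have := abs_sub (k' (log (d*u))) (k (log (d*u)))
              have h8 := hk'B (log (d*u))
              have h9 := hkB (log (d*u))
              rw [abs_of_nonneg (hk0 _)] at this
              linarith
        _ = -(2*B/d)*(N:ℝ)⁻¹ - -(2*B/d)*a⁻¹ := by
            refine intervalIntegral.integral_eq_sub_of_hasDerivAt (f := fun u : ℝ => -(2*B/d)*u⁻¹) ?_ ?_
            · rw [Set.uIcc_of_le hN]; exact hA
            · apply ContinuousOn.intervalIntegrable; rw [Set.uIcc_of_le hN]; exact hcc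
        _≤(2*B/d)*a⁻¹ := by
            have : 0≤(2*B/d)*(N:ℝ)⁻¹ := by positivity
            linarith
        _=2*B*exp (-w0) := by rw [ha, exp_neg]; field_simp
    rw [h2, h3, h5, Complex.ofReal_zero, norm_zero, zero_add, Real.norm_eq_abs] at h1
    linarith
  have hlim : Tendsto (fun N : ℕ => P (log (d*N))/d) atTop (𝓝 ((∫ w, k w)/d)) := by
    refine Tendsto.div_const ?_ _
    have h1 : Tendsto (fun N : ℕ => log ((d:ℝ)*N)) atTop atTop :=
      tendsto_log_atTop.comp (tendsto_natCast_atTop_atTop.const_mul_atTop hd0)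
    have h2 := intervalIntegral_tendsto_integral_Ioi w0 hi.integrableOn h1
    rwa [setIntegral_eq_integral_of_forall_compl_eq_zero] at h2
    intro x hx
    exact hz x (by simpa using hx)
  have hs : Summable (fun j : ℕ => f j) := by
    refine summable_of_sum_range_le (c := (∫ w, k w)/d+B+2*B*exp (-w0)) (fun j => div_nonneg (hk0 _) (by positivity)) ?_
    intro n
    set N := max (max n 1) ⌈a⌉₊ with hN
    have h1 := (abs_le.1 (key N ((Nat.le_ceil a).trans (by exact_mod_cast le_max_right _ _)))).2
    have hN1 : (1:ℝ)≤N := by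
      have : 1≤N := (le_max_right _ _).trans (le_max_left _ _)
      exact_mod_cast this
    have h2 : B/(d*N)≤B := by
      have hd1' : (1:ℝ)≤d := by exact_mod_cast hd1
      apply div_le_self hB; nlinarith
    have h3 : P (log (d*N))≤∫ w, k w := by
      by_cases h : w0≤ log (d*N)
      · simp only [hP]; rw [intervalIntegral.integral_of_le h]
        exact setIntegral_le_integral hi (Eventually.of_forall hk0)
      · push Not at h
        simp only [hP]; rw [intervalIntegral.integral_symm]
        have : 0≤∫ x in (log (d*N))..w0, k x := intervalIntegral.integral_nonneg h.le (fun x _ => hk0 x)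
        have : 0≤∫ w, k w := integral_nonneg hk0
        linarith
    have h4 : P (log (d*N))/d≤(∫ w, k w)/d := by gcongr
    have h5 : ∑ j ∈ Finset.range n, f j≤∑ j ∈ Finset.range (N+1), f j := by
      refine Finset.sum_le_sum_of_subset_of_nonneg (Finset.range_mono ?_) (fun j _ _ => div_nonneg (hk0 _) (by positivity))
      have : n≤N := (le_max_left _ _).trans (le_max_left _ _)
      omega
    linarith
  refine ⟨hs, ?_⟩
  have t1 : Tendsto (fun N : ℕ => |∑ j ∈ Finset.range (N+1), f j-P (log (d*N))/d|) atTop (𝓝 |∑' j : ℕ, f j-(∫ w, k w)/d|) :=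
    (((tendsto_add_atTop_iff_nat 1).2 hs.hasSum.tendsto_sum_nat).sub hlim).abs
  have t2 : Tendsto (fun N : ℕ => B/(d*N)+2*B*exp (-w0)) atTop (𝓝 (0+2*B*exp (-w0))) :=
    (tendsto_const_nhds.div_atTop (tendsto_natCast_atTop_atTop.const_mul_atTop hd0)).add tendsto_const_nhds
  have := le_of_tendsto_of_tendsto t1 t2 (by
    filter_upwards [eventually_ge_atTop ⌈a⌉₊] with N hN
    exact key N ((Nat.le_ceil a).trans (by exact_mod_cast hN)))
  rwa [zero_add] at this

lemma tsum_dvd {M : Type} [NormedAddCommGroup M] (F : ℕ → M) (d:ℕ) (hd : 1≤d) :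
    ∑' n, (if d ∣ n then F n else 0)=∑' j, F (d*j) := by
  have hinj : Function.Injective (fun j : ℕ => d*j) := fun a b h => Nat.eq_of_mul_eq_mul_left hd h
  rw [← hinj.tsum_eq (f := fun n => if d ∣ n then F n else 0)]
  · simp
  · intro n hn
    rw [Function.mem_support] at hn
    by_cases h : d ∣ n
    · obtain ⟨j, rfl⟩ := h; exact ⟨j, rfl⟩
    · rw [if_neg h] at hn; exact absurd rfl hn

end M5a
end H12
namespace H12
section M5b
open MeasureTheory Real Filter Topology

noncomputable def wT (T s:ℝ) : ℝ := T*exp (-π*T^2*s^2)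
lemma wT_pos (T s:ℝ) (hT : 1≤T) : 0<wT T s := by unfold wT; positivity
lemma wT_le (T s:ℝ) (hT : 1≤T) : wT T s≤T := by
  unfold wT
  have h1 : 0≤π*T^2*s^2 := by positivity
  exact mul_le_of_le_one_right (by linarith) (exp_le_one_iff.2 (by linarith))
lemma wT_int (T:ℝ) (hT : 1≤T) : Integrable (wT T) := by
  have : 0<π*T^2 := by positivity
  have h := (integrable_exp_neg_mul_sq this).const_mul T
  refine h.congr (Eventually.of_forall fun s => ?_)
  simp only [wT, neg_mul]
lemma wT_integral (T:ℝ) (hT : 1≤T) : ∫ s, wT T s=1 := by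
  have h := integral_gaussian (π*T^2)
  have e : ∀ s, wT T s=T*exp (-(π*T^2)*s^2) := fun s => by unfold wT; rw [neg_mul π]
  simp_rw [e]
  rw [integral_const_mul, h, show π/(π*T^2)=(1/T)^2 by field_simp, sqrt_sq (by positivity)]
  field_simp
lemma wT_deriv (T s:ℝ) : HasDerivAt (wT T) (wT T s*(-π*T^2*(2*s))) s := by
  have h1 : HasDerivAt (fun s : ℝ => -π*T^2*s^2) (-π*T^2*(2*s)) s := by
    exact ((hasDerivAt_pow 2 s).const_mul (-π*T^2)).congr_deriv (by norm_num)
  exact (h1.exp.const_mul T).congr_deriv (by unfold wT; ring)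
lemma wT_cont (T:ℝ) : Continuous (wT T) := by unfold wT; fun_prop
lemma exp_half (T s:ℝ) (hT : 1≤T) : |s| * wT T s≤exp (-(π*T^2/2)*s^2) := by
  have h1 : T*|s| ≤ exp (π*T^2/2*s^2) := by
    have h2 := add_one_le_exp (π*T^2/2*s^2)
    have h3 : π*T^2/2*s^2=π/2*(T*|s|)^2 := by rw [mul_pow, sq_abs]; ring
    have := pi_gt_three
    nlinarith [sq_nonneg (T*|s|-1), sq_nonneg (T*|s|)]
  have h4 : exp (-(π*T^2/2)*s^2)=exp (π*T^2/2*s^2)*exp (-π*T^2*s^2) := by rw [← exp_add]; congr 1; ring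
  rw [h4]; unfold wT
  calc _=(T*|s|)*exp (-π*T^2*s^2) := by ring
    _≤_ := by gcongr
lemma wT_deriv_le (T s:ℝ) (hT : 1≤T) : |wT T s*(-π*T^2*(2*s))| ≤ 8*T^2 := by
  have h := exp_half T s hT
  have h1 : exp (-(π*T^2/2)*s^2)≤1 := by
    apply exp_le_one_iff.2
    have : 0≤π*T^2/2*s^2 := by positivity
    linarith
  rw [abs_mul, abs_of_pos (wT_pos T s hT)]
  have h2 : |-π*T^2*(2*s)| = 2*π*T^2*|s| := by
    rw [show -π*T^2*(2*s) = -((2*π*T^2)*s) by ring, abs_neg, abs_mul, abs_of_nonneg (by positivity)]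
  rw [h2]
  calc _=2*π*T^2*(|s| * wT T s) := by ring
    _≤2*π*T^2*1 := by gcongr; linarith
    _≤8*T^2 := by nlinarith [pi_lt_four, sq_nonneg T]
lemma wT_abs (T:ℝ) (hT : 1≤T) : Integrable (fun s => |s| * wT T s) ∧ ∫ s, |s| * wT T s≤2 := by
  have hb : 0<π*T^2/2 := by positivity
  have hi := integrable_exp_neg_mul_sq hb
  have h1 : Integrable (fun s => |s| * wT T s) := by
    refine hi.mono' (by have := wT_cont T; fun_prop) (Eventually.of_forall fun s => ?_)
    rw [Real.norm_of_nonneg (mul_nonneg (abs_nonneg _) (wT_pos T s hT).le)]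
    exact exp_half T s hT
  refine ⟨h1, (integral_mono h1 hi (fun s => exp_half T s hT)).trans ?_⟩
  rw [integral_gaussian, sqrt_le_left (by norm_num), show π/(π*T^2/2)=2/T^2 by field_simp, div_le_iff₀ (by positivity)]
  nlinarith

/-- the kernel times a slowly varying weight -/
lemma kern (h h' : ℝ → ℝ) (A L w0:ℝ) (hL0 : 0≤L) (hLA : L≤A) (hd : ∀ w, HasDerivAt h (h' w) w) (hc : Continuous h')
    (h0 : ∀ w, 0≤h w) (hA : ∀ w, h w≤A) (hL : ∀ w, |h' w| ≤ L) (hz : ∀ w≤w0, h w=0) (hw0 : 0≤w0)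
    (T y:ℝ) (hT : 1≤T) (z:ℝ) (hz1 : 1≤z) (b:ℕ) :
    Summable (fun n : ℕ => ‖((h (log n)/n*wT T (log n+y):ℝ):ℂ)‖) ∧
    ‖∑' n : ℕ, (rf z n:ℂ)*((h (log n)/n*wT T (log n+y):ℝ):ℂ)-(Vz z*h (-y):ℝ)‖ ≤
      etab b*Vz z*(2*A)+Vz z*(2*L)+2*(z^(4*b+8)*(18*A*T^2*exp (-w0))) := by
  set k : ℝ → ℝ := fun w => h w*wT T (w+y) with hk
  set k' : ℝ → ℝ := fun w => h' w*wT T (w+y)+h w*(wT T (w+y)*(-π*T^2*(2*(w+y)))) with hk'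
  have hA0 : 0≤A := hL0.trans hLA
  have hT2 : T≤T^2 := by nlinarith
  have hhc : Continuous h := continuous_iff_continuousAt.2 fun w => (hd w).continuousAt
  have hwc := wT_cont T
  have a1 : ∀ w, HasDerivAt k (k' w) w := fun w => by
    have := (wT_deriv T (w+y)).comp_add_const w y
    exact (hd w).mul this
  have a2 : Continuous k' := by simp only [hk']; fun_prop
  have a3 : ∀ w, 0≤k w := fun w => mul_nonneg (h0 w) (wT_pos _ _ hT).le
  have a4 : ∀ w, k w≤9*A*T^2 := fun w => by
    calc k w≤A*T := mul_le_mul (hA w) (wT_le _ _ hT) (wT_pos _ _ hT).le hA0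
      _≤A*T^2 := by gcongr
      _≤9*A*T^2 := by nlinarith [mul_nonneg hA0 (sq_nonneg T)]
  have a5 : ∀ w, |k' w| ≤ 9*A*T^2 := fun w => by
    refine (abs_add_le _ _).trans ?_
    rw [abs_mul, abs_mul (h w), abs_of_pos (wT_pos T (w+y) hT), abs_of_nonneg (h0 w)]
    calc _≤A*T^2+A*(8*T^2) := by
          exact add_le_add (mul_le_mul ((hL w).trans hLA) ((wT_le _ _ hT).trans hT2) (wT_pos _ _ hT).le hA0)
            (mul_le_mul (hA w) (wT_deriv_le T (w+y) hT) (abs_nonneg _) hA0)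
      _=_ := by ring
  have a6 : ∀ w≤w0, k w=0 := fun w hw => by simp only [hk, hz w hw, zero_mul]
  have iw : Integrable (fun w => wT T (w+y)) := (wT_int T hT).comp_add_right y
  have a7 : Integrable k := by
    refine (iw.const_mul A).mono' (by simp only [hk]; fun_prop) (Eventually.of_forall fun w => ?_)
    rw [Real.norm_of_nonneg (a3 w)]
    exact mul_le_mul_of_nonneg_right (hA w) (wT_pos _ _ hT).le
  have D := dsum k k' (9*A*T^2) w0 (by positivity) a1 a2 a3 a4 a5 a6 a7 hw0
  set G := ∫ w, k w with hG
  have hG0 : 0≤G := integral_nonneg a3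
  have hGA : G≤A := by
    calc G≤∫ w, A*wT T (w+y) := integral_mono a7 (iw.const_mul A) (fun w => mul_le_mul_of_nonneg_right (hA w) (wT_pos _ _ hT).le)
      _=A := by rw [integral_const_mul, integral_add_right_eq_self (fun w => wT T w), wT_integral T hT, mul_one]
  have hGh : |G-h (-y)| ≤ 2*L := by
    have e1 : G=∫ s, h (s-y)*wT T s := by
      rw [hG, ← integral_sub_right_eq_self k y]; simp only [hk, sub_add_cancel]
    have i1 : Integrable (fun s => h (s-y)*wT T s) := by
      have := a7.comp_sub_right y
      simpa only [hk, sub_add_cancel] using this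
    have e2 : h (-y)=∫ s, h (-y)*wT T s := by rw [integral_const_mul, wT_integral T hT, mul_one]
    have hlip : ∀ s, |h (s-y)-h (-y)| ≤ L*|s| := fun s => by
      have := Convex.norm_image_sub_le_of_norm_hasDerivWithin_le (f := h) (f' := h') (C := L) (s := Set.univ) (x := -y) (y := s-y)
        (fun w _ => (hd w).hasDerivWithinAt) (fun w _ => hL w) convex_univ trivial trivial
      simpa using this
    rw [e2, e1, ← integral_sub i1 ((wT_int T hT).const_mul _)]
    obtain ⟨j1, j2⟩ := wT_abs T hT
    calc _≤∫ s, L*(|s| * wT T s) := by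
          rw [← Real.norm_eq_abs]
          refine norm_integral_le_of_norm_le (j1.const_mul L) (Eventually.of_forall fun s => ?_)
          rw [← sub_mul, Real.norm_eq_abs, abs_mul, abs_of_pos (wT_pos T s hT), ← mul_assoc]
          exact mul_le_mul_of_nonneg_right (hlip s) (wT_pos _ _ hT).le
      _≤2*L := by rw [integral_const_mul]; nlinarith
  set g : ℕ → ℂ := fun n => ((h (log n)/n*wT T (log n+y):ℝ):ℂ) with hg
  have hgk : ∀ n : ℕ, h (log n)/n*wT T (log n+y)=k (log n)/n := fun n => by simp only [hk]; ring
  have hgn : ∀ n, ‖g n‖=k (log n)/n := fun n => by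
    simp only [hg]; rw [hgk, Complex.norm_real, Real.norm_of_nonneg (div_nonneg (a3 _) (by positivity))]
  have hgc : ∀ n, g n=((k (log n)/n:ℝ):ℂ) := fun n => by simp only [hg]; rw [hgk]
  have hs : Summable (fun n => ‖g n‖) := by
    have := (D 1 le_rfl).1
    simp_rw [hgn]; simpa using this
  refine ⟨hs, ?_⟩
  have hV := (Vz_pos z).le
  have hmain : ∀ d : ℕ, 1≤d → |(∑' n : ℕ, if d ∣ n then ‖g n‖ else 0)-G/d| ≤ 18*A*T^2*exp (-w0) := by
    intro d hd
    rw [tsum_dvd (fun n => ‖g n‖) d hd]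
    have := (D d hd).2
    simp_rw [hgn]; push_cast
    linarith
  have hD := dens z hz1 b g (by simp [hg]) hs (G:ℂ) G (18*A*T^2*exp (-w0)) 0 hG0 (by positivity) le_rfl (fun d hd _ => ?_) (fun d hd _ => ?_)
  · rw [mul_zero, add_zero, Complex.norm_real, Real.norm_of_nonneg hG0] at hD
    have e3 : ∑' n : ℕ, (rf z n:ℂ)*g n-(Vz z*h (-y):ℝ)=(∑' n : ℕ, (rf z n:ℂ)*g n-Vz z*G)+((Vz z*(G-h (-y)):ℝ):ℂ) := by
      push_cast; ring
    rw [e3]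
    refine (norm_add_le _ _).trans ?_
    rw [Complex.norm_real, norm_mul, Real.norm_of_nonneg hV, Real.norm_eq_abs]
    have h1 : etab b*Vz z*(G+G)≤etab b*Vz z*(2*A) := by
      have := etab_nonneg b
      gcongr; linarith
    have h2 : Vz z * |G-h (-y)| ≤ Vz z*(2*L) := by gcongr
    linarith
  · have := hmain d hd
    have e4 : ∑' n : ℕ, (if d ∣ n then g n else 0)=((∑' n : ℕ, if d ∣ n then ‖g n‖ else 0:ℝ):ℂ) := by
      rw [Complex.ofReal_tsum]
      refine tsum_congr fun n => ?_
      split_ifs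
      · rw [hgn, hgc]
      · simp
    rw [e4]
    rw [zero_mul, add_zero]
    have e5 : ((∑' n : ℕ, if d ∣ n then ‖g n‖ else 0:ℝ):ℂ)-(G:ℂ)/d=(((∑' n : ℕ, if d ∣ n then ‖g n‖ else 0:ℝ)-G/d:ℝ):ℂ) := by
      push_cast; ring
    rw [e5, Complex.norm_real]; exact this
  · rw [zero_mul, add_zero]; exact hmain d hd

end M5b
end H12
namespace H12
section M5c
open MeasureTheory Real Filter Topology

noncomputable def Phi (u:ℝ) : ℝ := smoothTransition (24*(u-1/8))
lemma Phi_mem (u:ℝ) : 0≤Phi u ∧ Phi u≤1 := ⟨smoothTransition.nonneg _, smoothTransition.le_one _⟩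
noncomputable def Hh (i:ℕ) (u:ℝ) : ℝ := Phi u*(u^i*exp (-u))

lemma Hfacts : ∃ M : ℝ, 1≤M ∧ ∀ i≤1, ∃ H' : ℝ → ℝ, Continuous H' ∧ (∀ u, HasDerivAt (Hh i) (H' u) u) ∧ (∀ u, |H' u| ≤ M) ∧
    (∀ u, 0≤Hh i u) ∧ (∀ u, Hh i u≤1) ∧ (∀ u≤1/8, Hh i u=0) := by
  have hcd : ContDiff ℝ 1 smoothTransition := smoothTransition.contDiff
  have hsd : ∀ x, HasDerivAt smoothTransition (deriv smoothTransition x) x := fun x =>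
    (hcd.differentiable (by norm_num) x).hasDerivAt
  have hsc : Continuous (deriv smoothTransition) := hcd.continuous_deriv (by norm_num)
  have hneg : ∀ x<0, deriv smoothTransition x=0 := fun x hx => by
    have : smoothTransition =ᶠ[𝓝 x] fun _ => 0 := by
      filter_upwards [eventually_lt_nhds hx] with w hw using smoothTransition.zero_of_nonpos hw.le
    rw [this.deriv_eq]; simp
  obtain ⟨C, hC⟩ := hsc.bounded_above_of_compact_support (HasCompactSupport.intro (isCompact_Icc (a := (0:ℝ)) (b := 1)) (fun x hx => by
    rcases lt_or_ge x 0 with h | h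
    · exact hneg x h
    · have h1 : 1<x := by by_contra h2; exact hx ⟨h, not_lt.1 h2⟩
      have : smoothTransition =ᶠ[𝓝 x] fun _ => 1 := by
        filter_upwards [eventually_gt_nhds h1] with w hw using smoothTransition.one_of_one_le hw.le
      rw [this.deriv_eq]; simp))
  have hC0 : 0≤C := (norm_nonneg _).trans (hC 0)
  refine ⟨24*C+2, by linarith, ?_⟩
  intro i hi
  have hzero : ∀ u≤1/8, Phi u=0 := fun u hu => smoothTransition.zero_of_nonpos (by linarith)
  have hPd : ∀ u, HasDerivAt Phi (deriv smoothTransition (24*(u-1/8))*24) u := fun u => by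
    have h1 : HasDerivAt (fun u : ℝ => 24*(u-1/8)) 24 u := by
      exact (((hasDerivAt_id u).sub_const (1/8)).const_mul 24).congr_deriv (by norm_num)
    exact (hsd _).comp u h1
  have hPc : Continuous Phi := continuous_iff_continuousAt.2 fun w => (hPd w).continuousAt
  have hb : ∀ u, 0≤u → u^i*exp (-u)≤1 ∧ (i*u^(i-1):ℝ)*exp (-u)≤1 := by
    intro u hu
    have h1 : exp (-u)≤1 := exp_le_one_iff.2 (by linarith)
    have h2 : u*exp (-u)≤1 := by
      rw [exp_neg, ← div_eq_mul_inv, div_le_one (exp_pos _)]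
      have := add_one_le_exp u; linarith
    interval_cases i
    · simp [hu]
    · simp [h2, hu]
  refine ⟨fun u => deriv smoothTransition (24*(u-1/8))*24*(u^i*exp (-u))+Phi u*((i*u^(i-1))*exp (-u)+u^i*(exp (-u)*(-1))), by fun_prop, ?_, ?_, ?_, ?_, ?_⟩
  · intro u
    have h1 : HasDerivAt (fun u : ℝ => exp (-u)) (exp (-u)*(-1)) u := (hasDerivAt_neg u).exp
    exact (hPd u).mul ((hasDerivAt_pow i u).mul h1)
  · intro u
    beta_reduce
    rcases lt_or_ge u (1/8) with h | h
    · rw [hneg _ (by linarith), hzero u h.le]; simp; linarith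
    · have hu : 0≤u := by linarith
      obtain ⟨b1, b2⟩ := hb u hu
      have p1 : 0≤u^i*exp (-u) := by positivity
      have p2 : 0≤(i*u^(i-1):ℝ)*exp (-u) := by positivity
      obtain ⟨f0, f1⟩ := Phi_mem u
      refine (abs_add_le _ _).trans ?_
      have q1 : |deriv smoothTransition (24*(u-1/8))*24*(u^i*exp (-u))| ≤ 24*C := by
        rw [abs_mul, abs_mul, abs_of_nonneg p1]
        have := hC (24*(u-1/8))
        rw [Real.norm_eq_abs] at this
        calc _≤C * |(24:ℝ)| * 1 := by gcongr
          _=24*C := by norm_num; ring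
      have q2 : |Phi u*((i*u^(i-1))*exp (-u)+u^i*(exp (-u)*(-1)))| ≤ 1*2 := by
        rw [abs_mul, abs_of_nonneg f0]
        refine mul_le_mul f1 ?_ (abs_nonneg _) zero_le_one
        rw [abs_le]; constructor <;> linarith
      linarith
  · intro u
    rcases lt_or_ge u (1/8) with h | h
    · unfold Hh; rw [hzero u h.le]; simp
    · have hu : 0≤u := by linarith
      exact mul_nonneg (Phi_mem u).1 (by positivity)
  · intro u
    rcases lt_or_ge u (1/8) with h | h
    · unfold Hh; rw [hzero u h.le]; simp
    · have hu : 0≤u := by linarith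
      exact mul_le_one₀ (Phi_mem u).2 (by positivity) (hb u hu).1
  · intro u hu; unfold Hh; rw [hzero u hu, zero_mul]

noncomputable def la (z X:ℝ) (i n:ℕ) : ℂ := ra z i n*(Phi (log n/X):ℂ)
noncomputable def sa (z X:ℝ) (i n:ℕ) : ℂ := ra z i n*((1-Phi (log n/X):ℝ):ℂ)

lemma la_norm (z X:ℝ) (i n:ℕ) : ‖la z X i n‖≤ rf z n*log n^i := by
  unfold la; rw [norm_mul, ra_norm, Complex.norm_real, Real.norm_of_nonneg (Phi_mem _).1]
  exact mul_le_of_le_one_right (mul_nonneg (rf_nonneg z n) (pow_nonneg (log_natCast_nonneg n) _)) (Phi_mem _).2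
lemma sa_norm (z X:ℝ) (i n:ℕ) : ‖sa z X i n‖≤ rf z n*log n^i := by
  have h := Phi_mem (log n/X)
  unfold sa; rw [norm_mul, ra_norm, Complex.norm_real, Real.norm_of_nonneg (by linarith)]
  exact mul_le_of_le_one_right (mul_nonneg (rf_nonneg z n) (pow_nonneg (log_natCast_nonneg n) _)) (by linarith)

lemma bb_la (z X:ℝ) (hX : 0<X) (i n:ℕ) :
    bb (la z X i) X n=(rf z n:ℂ)*((X^i*Hh i (log n/X)/n:ℝ):ℂ) := by
  rcases Nat.eq_zero_or_pos n with h0 | h0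
  · rw [h0]; simp [bb, la, ra, rf_zero]
  · have hn : (0:ℝ)<n := by exact_mod_cast h0
    have e : (n:ℝ)^(-(1+1/X))=exp (-(log n/X))/n := by
      rw [rpow_def_of_pos hn, show log n*(-(1+1/X)) = -(log n/X)-log n by ring, exp_sub, exp_log hn]
    unfold bb la ra Hh
    rw [e, ← Complex.ofReal_mul, ← Complex.ofReal_mul, ← Complex.ofReal_mul]
    congr 1
    rw [div_pow]; field_simp

set_option maxHeartbeats 1000000 in
theorem delta : ∃ M : ℝ, 1≤M ∧ ∀ η : ℝ, 0<η → η≤1/64 → ∀ b : ℕ, η*(4*b+8)≤1/32 → ∀ X : ℝ, 64≤X → 10/η≤X →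
    ∀ T : ℝ, 1≤T → T≤exp (X/32) → ∀ i≤1, ∀ y : ℝ,
    ‖∫ v, ((gT T v-gT 1 v:ℝ):ℂ)*Lv (la (exp (η*X)) X i) X v*ee (v*y)‖≤X^i/X*(M*etab b/η+M/(η*X)) := by
  obtain ⟨M, hM, hH⟩ := Hfacts
  obtain ⟨K, hK, htr⟩ := bb_triv
  refine ⟨150000*M, by linarith, ?_⟩
  intro η hη hη1 b hb X hX hXη T hT hTX i hi y
  have hX0 : 0<X := by linarith
  set z := exp (η*X) with hz
  have hz1 : 1<z := one_lt_exp_iff.2 (by positivity)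
  obtain ⟨H', hc, hd, hM', h0, h1, hz0⟩ := hH i hi
  obtain ⟨hs, -⟩ := htr η X hη (by linarith) hXη i (by omega) (la z X i) (la_norm z X i)
  -- the kernel estimate
  have kk : ∀ S : ℝ, 1≤S → S≤exp (X/32) → _ := fun S hS (hSX : S≤exp (X/32)) =>
    kern (fun w => X^i*Hh i (w/X)) (fun w => X^i*(H' (w/X)*(1/X))) (M*X^i) (M*X^i/X) (X/8) (by positivity)
      (div_le_self (by positivity) (by linarith))
      (fun w => (((hd (w/X)).comp w ((hasDerivAt_id w).div_const X)).const_mul (X^i)))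
      (by fun_prop) (fun w => mul_nonneg (by positivity) (h0 _))
      (fun w => by
        have := h1 (w/X)
        calc X^i*Hh i (w/X)≤X^i*1 := by gcongr
          _=1*X^i := by ring
          _≤M*X^i := by gcongr)
      (fun w => by
        have := hM' (w/X)
        rw [abs_mul, abs_mul, abs_of_pos (by positivity : 0<X^i), abs_of_pos (by positivity : 0<1/X)]
        calc _≤X^i*(M*(1/X)) := by gcongr
          _=_ := by ring)
      (fun w hw => by
        have : w/X≤1/8 := by rw [div_le_iff₀ hX0]; linarith
        simp only [hz0 _ this, mul_zero])
      (by positivity) S y hS z hz1.le b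
  have hT1 : (1:ℝ)≤exp (X/32) := one_le_exp (by positivity)
  obtain ⟨s1, k1⟩ := kk T hT hTX
  obtain ⟨s2, k2⟩ := kk 1 le_rfl hT1
  have hi1 : Integrable (fun v => ((gT T v-gT 1 v:ℝ):ℂ)) := ((gT_int T (by linarith)).sub (gT_int 1 one_pos)).ofReal
  have hi2 := ee_mul_int _ hi1 y
  have e0 : ∀ v, ((gT T v-gT 1 v:ℝ):ℂ)*Lv (la z X i) X v*ee (v*y) =
      (((gT T v-gT 1 v:ℝ):ℂ)*ee (v*y))*Sr (bb (la z X i) X) (fun n => log n) v := fun v => by unfold Lv; ring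
  simp_rw [e0]
  rw [Sr_inter _ hi2 _ _ hs]
  have e1 : ∀ n : ℕ, ∫ v, ((gT T v-gT 1 v:ℝ):ℂ)*ee (v*y)*ee (v*log n)=((wT T (log n+y)-wT 1 (log n+y):ℝ):ℂ) := by
    intro n
    have e2 : ∀ v, ((gT T v-gT 1 v:ℝ):ℂ)*ee (v*y)*ee (v*log n)=(gT T v:ℂ)*ee (v*(log n+y))-(gT 1 v:ℂ)*ee (v*(log n+y)) := fun v => by
      rw [mul_assoc, ← ee_add, show v*y+v*log n=v*(log n+y) by ring]; push_cast; ring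
    simp_rw [e2]
    rw [integral_sub (ee_mul_int (fun v => (gT T v:ℂ)) (gT_int T (by linarith)).ofReal (log n+y)) (ee_mul_int (fun v => (gT 1 v:ℂ)) (gT_int 1 one_pos).ofReal (log n+y)), gT_fourier T (by linarith), gT_fourier 1 one_pos]
    unfold wT; push_cast; ring
  set g : ℝ → ℕ → ℂ := fun S n => ((X^i*Hh i (log n/X)/n*wT S (log n+y):ℝ):ℂ) with hg
  have e3 : ∀ n : ℕ, bb (la z X i) X n*∫ v, ((gT T v-gT 1 v:ℝ):ℂ)*ee (v*y)*ee (v*log n)=(rf z n:ℂ)*g T n-(rf z n:ℂ)*g 1 n := by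
    intro n
    rw [e1, bb_la z X hX0]; simp only [hg]; push_cast; ring
  simp_rw [e3]
  have hsr : ∀ S, Summable (fun n => ‖g S n‖) → Summable (fun n => (rf z n:ℂ)*g S n) := fun S h => by
    refine Summable.of_norm (Summable.of_nonneg_of_le (fun n => norm_nonneg _) (fun n => ?_) h)
    rw [norm_mul, Complex.norm_real, Real.norm_of_nonneg (rf_nonneg z n)]
    exact mul_le_of_le_one_left (norm_nonneg _) (rf_le_one z n)
  rw [(hsr T s1).tsum_sub (hsr 1 s2)]
  set Q := ((Vz z*(X^i*Hh i (-y/X)):ℝ):ℂ) with hQ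
  have e4 : ∑' n, (rf z n:ℂ)*g T n-∑' n, (rf z n:ℂ)*g 1 n=(∑' n, (rf z n:ℂ)*g T n-Q)-(∑' n, (rf z n:ℂ)*g 1 n-Q) := by ring
  rw [e4]
  refine (norm_sub_le _ _).trans ((add_le_add k1 k2).trans ?_)
  have hV : Vz z≤1/(η*X) := by have := Vz_le z hz1; rwa [hz, log_exp] at this
  have hV0 := (Vz_pos z).le
  have hE := etab_nonneg b
  have hzb : z^(4*b+8)≤exp (X/32) := by
    rw [hz, ← exp_nat_mul]; apply exp_le_exp.2; push_cast; nlinarith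
  have hTT : T^2≤exp (X/16) := by
    calc T^2≤exp (X/32)^2 := by gcongr
      _=_ := by rw [← exp_nat_mul]; congr 1; push_cast; ring
  have hTT1 : (1:ℝ)^2≤exp (X/16) := by rw [one_pow]; exact one_le_exp (by positivity)
  have hexp : exp (-(X/32))≤2048/X^2 := by
    rw [exp_neg, inv_eq_one_div, div_le_div_iff₀ (exp_pos _) (by positivity)]
    have := quadratic_le_exp_of_nonneg (show 0≤X/32 by positivity)
    nlinarith
  have t3 : ∀ S : ℝ, S^2≤exp (X/16) → 2*(z^(4*b+8)*(18*(M*X^i)*S^2*exp (-(X/8))))≤36*M*X^i*(2048/X^2) := by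
    intro S hS
    calc 2*(z^(4*b+8)*(18*(M*X^i)*S^2*exp (-(X/8))))≤2*(exp (X/32)*(18*(M*X^i)*exp (X/16)*exp (-(X/8)))) := by gcongr
      _=36*M*X^i*(exp (X/32)*exp (X/16)*exp (-(X/8))) := by ring
      _=36*M*X^i*exp (-(X/32)) := by rw [← exp_add, ← exp_add]; congr 2; ring
      _≤_ := by gcongr
  have t31 := t3 T hTT
  have t32 := t3 1 hTT1
  have t1 : etab b*Vz z*(2*(M*X^i))≤etab b*(1/(η*X))*(2*(M*X^i)) := by gcongr
  have t2 : Vz z*(2*(M*X^i/X))≤1/(η*X)*(2*(M*X^i/X)) := by gcongr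
  have f1 : 2*(etab b*(1/(η*X))*(2*(M*X^i)))=X^i/X*(4*M*etab b/η) := by field_simp; ring
  have f2 : 2*(1/(η*X)*(2*(M*X^i/X)))=X^i/X*(4*M/(η*X)) := by field_simp; norm_num
  have f3 : 2*(36*M*X^i*(2048/X^2))≤X^i/X*(147456*M/(η*X)) := by
    have : 147456*M/X≤147456*M/(η*X) := by
      apply div_le_div_of_nonneg_left (by positivity) (by positivity)
      nlinarith
    calc _=X^i/X*(147456*M/X) := by field_simp; norm_num
      _≤_ := by gcongr
  have f4 : X^i/X*(4*M*etab b/η)+X^i/X*(4*M/(η*X))+X^i/X*(147456*M/(η*X))≤X^i/X*(150000*M*etab b/η+150000*M/(η*X)) := by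
    rw [← mul_add, ← mul_add]
    refine mul_le_mul_of_nonneg_left ?_ (by positivity)
    have g1 : 0≤M*etab b/η := by positivity
    have g2 : 0≤M/(η*X) := by positivity
    have r1 : ∀ c : ℝ, c*M*etab b/η=c*(M*etab b/η) := fun c => by ring
    have r2 : ∀ c : ℝ, c*M/(η*X)=c*(M/(η*X)) := fun c => by ring
    rw [r1, r1, r2, r2, r2]; linarith
  linarith only [t31, t32, t1, t2, f1, f2, f3, f4]

end M5c
end H12
namespace H12
section M5d
open MeasureTheory Real Filter Topology

def Dm (P Q : ℝ → Prop) (G : ℝ → ℂ) (B:ℝ) : Prop := 0≤B ∧ ∀ K : ℝ → ℂ, Integrable K → Integrable (fun v => K v*G v) ∧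
  ∀ δ : ℝ, 0≤δ → (∀ y, P y → ‖∫ v, K v*ee (v*y)‖≤δ) → ∀ y, Q y → ‖∫ v, K v*G v*ee (v*y)‖≤B*δ

variable {P Q R : ℝ → Prop} {G G' : ℝ → ℂ} {B B' : ℝ}

lemma Dm_mul (h : Dm P Q G B) (h' : Dm Q R G' B') : Dm P R (fun v => G v*G' v) (B*B') := by
  refine ⟨mul_nonneg h.1 h'.1, fun K hK => ?_⟩
  obtain ⟨i1, b1⟩ := h.2 K hK
  obtain ⟨i2, b2⟩ := h'.2 _ i1
  simp_rw [← mul_assoc]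
  refine ⟨i2, fun δ hδ hy y hR => ?_⟩
  have := b2 (B*δ) (mul_nonneg h.1 hδ) (b1 δ hδ hy) y hR
  linarith

lemma Dm_add (h : Dm P Q G B) (h' : Dm P Q G' B') : Dm P Q (fun v => G v+G' v) (B+B') := by
  refine ⟨add_nonneg h.1 h'.1, fun K hK => ?_⟩
  obtain ⟨i1, b1⟩ := h.2 K hK
  obtain ⟨i2, b2⟩ := h'.2 K hK
  simp_rw [mul_add, add_mul]
  refine ⟨i1.add i2, fun δ hδ hy y hR => ?_⟩
  rw [integral_add (ee_mul_int _ i1 y) (ee_mul_int _ i2 y)]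
  exact (norm_add_le _ _).trans (add_le_add (b1 δ hδ hy y hR) (b2 δ hδ hy y hR))

lemma Dm_const (c:ℂ) (hPQ : ∀ y, Q y → P y) : Dm P Q (fun _ => c) ‖c‖ := by
  refine ⟨norm_nonneg c, fun K hK => ⟨hK.mul_const c, fun δ hδ hy y hR => ?_⟩⟩
  have : ∀ v, K v*c*ee (v*y)=c*(K v*ee (v*y)) := fun v => by ring
  simp_rw [this]
  rw [integral_const_mul, norm_mul]
  exact mul_le_mul_of_nonneg_left (hy y (hPQ y hR)) (norm_nonneg c)

lemma Dm_weak (h : Dm P Q G B) (hRQ : ∀ y, R y → Q y) : Dm P R G B :=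
  ⟨h.1, fun K hK => ⟨(h.2 K hK).1, fun δ hδ hy y hR => (h.2 K hK).2 δ hδ hy y (hRQ y hR)⟩⟩

lemma Dm_Lv (a : ℕ → ℂ) (X:ℝ) (hs : Summable (fun n => ‖bb a X n‖)) (hB : ∑' n, ‖bb a X n‖≤B)
    (hPQ : ∀ n, a n ≠ 0 → ∀ y, Q y → P (log n+y)) : Dm P Q (Lv a X) B := by
  have hB0 : 0≤B := (tsum_nonneg fun n => norm_nonneg _).trans hB
  refine ⟨hB0, fun K hK => ⟨Sr_mul_int K hK _ _ hs, fun δ hδ hy y hR => ?_⟩⟩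
  have e : ∀ v, K v*Lv a X v*ee (v*y)=(K v*ee (v*y))*Sr (bb a X) (fun n => log n) v := fun v => by unfold Lv; ring
  simp_rw [e]
  rw [Sr_inter _ (ee_mul_int K hK y) _ _ hs]
  have hb : ∀ n : ℕ, ‖bb a X n*∫ v, K v*ee (v*y)*ee (v*log n)‖≤‖bb a X n‖*δ := fun n => by
    rw [norm_mul]
    by_cases h0 : a n=0
    · have : bb a X n=0 := by unfold bb; rw [h0, zero_mul]
      rw [this]; simp
    · refine mul_le_mul_of_nonneg_left ?_ (norm_nonneg _)
      have e2 : ∀ v, K v*ee (v*y)*ee (v*log n)=K v*ee (v*(log n+y)) := fun v => by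
        rw [mul_assoc, ← ee_add]; congr 2; ring
      simp_rw [e2]
      exact hy _ (hPQ n h0 y hR)
  have h1 : Summable (fun n => ‖bb a X n‖*δ) := hs.mul_right δ
  refine (tsum_of_norm_bounded h1.hasSum hb).trans ?_
  rw [tsum_mul_right]; gcongr

lemma Lv_add (a a' a'' : ℕ → ℂ) (X v:ℝ) (h : ∀ n, a n=a' n+a'' n) (hs : Summable (fun n => ‖bb a' X n‖)) (hs' : Summable (fun n => ‖bb a'' X n‖)) :
    Lv a X v=Lv a' X v+Lv a'' X v := by
  have hsum : ∀ b : ℕ → ℂ, Summable (fun n => ‖b n‖) → Summable (fun n : ℕ => b n*ee (v*log n)) := fun b hb =>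
    Summable.of_norm (by simpa only [norm_mul, ee_norm, mul_one] using hb)
  unfold Lv Sr
  rw [← (hsum _ hs).tsum_add (hsum _ hs')]
  refine tsum_congr fun n => ?_
  unfold bb; rw [h]; ring

lemma small_W (X T y:ℝ) (hX : 64≤X) (hT : 1≤T) (hTX : T≤exp (X/32)) (hy : y ≤ -X/8) :
    ‖∫ v, ((gT T v-gT 1 v:ℝ):ℂ)*ee (v*y)‖≤2*exp (-X) := by
  have e2 : ∀ v, ((gT T v-gT 1 v:ℝ):ℂ)*ee (v*y)=(gT T v:ℂ)*ee (v*y)-(gT 1 v:ℂ)*ee (v*y) := fun v => by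
    push_cast; ring
  simp_rw [e2]
  rw [integral_sub (ee_mul_int (fun v => (gT T v:ℂ)) (gT_int T (by linarith)).ofReal y) (ee_mul_int (fun v => (gT 1 v:ℂ)) (gT_int 1 one_pos).ofReal y),
    gT_fourier T (by linarith), gT_fourier 1 one_pos]
  have hb : ∀ S : ℝ, 1≤S → S≤exp (X/32) → ‖((S*exp (-π*S^2*y^2):ℝ):ℂ)‖≤exp (-X) := fun S hS hSX => by
    rw [Complex.norm_real, Real.norm_of_nonneg (by positivity)]
    calc _≤exp (X/32)*exp (-π*S^2*y^2) := by gcongr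
      _=exp (X/32 + -π*S^2*y^2) := by rw [exp_add]
      _≤_ := by
        apply exp_le_exp.2
        have h1 : (X/8)^2≤y^2 := by nlinarith
        have h2 : 1*(X/8)^2≤S^2*y^2 := by
          apply mul_le_mul _ h1 (by positivity) (by positivity)
          nlinarith
        have := pi_gt_three
        nlinarith [mul_le_mul this.le h2 (by positivity) (by linarith)]
  refine (norm_sub_le _ _).trans ?_
  have := hb T hT hTX
  have := hb 1 le_rfl (one_le_exp (by positivity))
  linarith

lemma fb_supp (z X:ℝ) (hX : 0<X) (n:ℕ) (h : fb z X n ≠ 0) : log n≤X/8 := by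
  by_contra hc; push Not at hc
  apply h
  have : psc X n=1 := by
    unfold psc; apply smoothTransition.one_of_one_le
    have : 1/8< log n/X := by rw [lt_div_iff₀ hX]; linarith
    linarith
  unfold fb; rw [this]; simp

lemma sa_supp (z X:ℝ) (hX : 0<X) (i n:ℕ) (h : sa z X i n ≠ 0) : log n≤X/6 := by
  by_contra hc; push Not at hc
  apply h
  have : Phi (log n/X)=1 := by
    unfold Phi; apply smoothTransition.one_of_one_le
    have : 1/6< log n/X := by rw [lt_div_iff₀ hX]; linarith
    linarith
  unfold sa; rw [this]; simp

set_option maxHeartbeats 1000000 in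
theorem typeI : ∃ M : ℝ, 1≤M ∧ ∀ η : ℝ, 0<η → η≤1/64 → ∀ b : ℕ, η*(4*b+8)≤1/32 → ∀ X : ℝ, 64≤X → 10/η≤X →
    ∀ T : ℝ, 1≤T → T≤exp (X/32) → 
    ‖∫ v, ((gT T v-gT 1 v:ℝ):ℂ)*(Lv (ra (exp (η*X)) 1) X v*(Lv (fb (exp (η*X)) X) X v*(3+(-3)*(Lv (ra (exp (η*X)) 0) X v*Lv (fb (exp (η*X)) X) X v) +
       (Lv (ra (exp (η*X)) 0) X v*Lv (fb (exp (η*X)) X) X v)*(Lv (ra (exp (η*X)) 0) X v*Lv (fb (exp (η*X)) X) X v))))*ee (v*(-X))‖≤M/η^6*(etab b/η+1/(η*X)) := by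
  obtain ⟨M, hM, hdel⟩ := delta
  obtain ⟨K, hK, htr⟩ := bb_triv
  refine ⟨32*K^6*M, ?_, ?_⟩
  · have : 1≤K^6 := one_le_pow₀ hK
    nlinarith
  intro η hη hη1 b hb X hX hXη T hT hTX
  have hX0 : 0<X := by linarith
  have hdl := hdel η hη hη1 b hb X hX hXη T hT hTX
  set z := exp (η*X) with hz
  set B := K/η with hBd
  have hB1 : 1≤B := by rw [hBd, le_div_iff₀ hη]; linarith
  have tr := htr η X hη (by linarith) hXη
  have eB0 : K*X^0/η=B := by rw [pow_zero, mul_one]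
  have eB1 : K*X^1/η=B*X := by rw [pow_one, hBd]; ring
  obtain ⟨sfb, tfb⟩ := tr 0 (by norm_num) (fb z X) (fun n => by rw [pow_zero, mul_one]; exact fb_norm z X n)
  obtain ⟨sR, tR⟩ := tr 0 (by norm_num) (ra z 0) (fun n => (ra_norm z 0 n).le)
  obtain ⟨sS, tS⟩ := tr 0 (by norm_num) (sa z X 0) (sa_norm z X 0)
  obtain ⟨sSD, tSD⟩ := tr 1 (by norm_num) (sa z X 1) (sa_norm z X 1)
  obtain ⟨sL, tL⟩ := tr 0 (by norm_num) (la z X 0) (la_norm z X 0)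
  obtain ⟨sLD, tLD⟩ := tr 1 (by norm_num) (la z X 1) (la_norm z X 1)
  rw [eB0] at tfb tR tS tL
  rw [eB1] at tSD tLD
  have esplit : ∀ i n, ra z i n=sa z X i n+la z X i n := fun i n => by unfold sa la; push_cast; ring
  have eR : ∀ v, Lv (ra z 0) X v=Lv (sa z X 0) X v+Lv (la z X 0) X v := fun v => Lv_add _ _ _ X v (esplit 0) sS sL
  have eD : ∀ v, Lv (ra z 1) X v=Lv (sa z X 1) X v+Lv (la z X 1) X v := fun v => Lv_add _ _ _ X v (esplit 1) sSD sLD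
  set U : ℝ → Prop := fun _ => True with hU
  have n3 : ‖(3:ℂ)‖=3 := by norm_num
  have n3' : ‖(-3:ℂ)‖=3 := by norm_num
  -- global
  have uf : Dm U U (Lv (fb z X) X) B := Dm_Lv _ X sfb tfb (fun _ _ _ _ => trivial)
  have uR : Dm U U (Lv (ra z 0) X) B := Dm_Lv _ X sR tR (fun _ _ _ _ => trivial)
  have uS : Dm U U (Lv (sa z X 0) X) B := Dm_Lv _ X sS tS (fun _ _ _ _ => trivial)
  have uSD : Dm U U (Lv (sa z X 1) X) (B*X) := Dm_Lv _ X sSD tSD (fun _ _ _ _ => trivial)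
  have u3 : ∀ c : ℂ, Dm U U (fun _ => c) ‖c‖ := fun c => Dm_const c (fun _ _ => trivial)
  have uRf := Dm_mul uR uf
  have g1 := Dm_mul uf (Dm_add (Dm_add (u3 3) (Dm_mul (u3 (-3)) uRf)) (Dm_mul uRf uRf))
  have g2 := Dm_mul uSD (Dm_mul (Dm_mul uf uf) (Dm_add (u3 (-3)) (Dm_mul (Dm_add uR uS) uf)))
  -- local
  have lf : ∀ c, Dm (fun y => y≤c) (fun y => y≤c-X/8) (Lv (fb z X) X) B := fun c =>
    Dm_Lv _ X sfb tfb (fun n hn y hy => by have := fb_supp z X hX0 n hn; linarith)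
  have lS : ∀ c, Dm (fun y => y≤c) (fun y => y≤c-X/6) (Lv (sa z X 0) X) B := fun c =>
    Dm_Lv _ X sS tS (fun n hn y hy => by have := sa_supp z X hX0 0 n hn; linarith)
  have lSD : ∀ c, Dm (fun y => y≤c) (fun y => y≤c-X/6) (Lv (sa z X 1) X) (B*X) := fun c =>
    Dm_Lv _ X sSD tSD (fun n hn y hy => by have := sa_supp z X hX0 1 n hn; linarith)
  have l3 : ∀ (c:ℂ) (r s:ℝ), s≤ r → Dm (fun y => y≤ r) (fun y => y≤ s) (fun _ => c) ‖c‖ := fun c r s hrs =>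
    Dm_const c (fun _ h => le_trans h hrs)
  set c0 := -X/8-X/6-X/8 with hc0
  set c1 := c0-X/6-X/8 with hc1
  have lSf := Dm_mul (lS c0) (lf (c0-X/6))
  have lSf' := Dm_mul (lS c1) (lf (c1-X/6))
  have g3 := Dm_mul (Dm_mul (lSD (-X/8)) (lf (-X/8-X/6)))
    (Dm_add (Dm_add (l3 3 c0 (c1-X/6-X/8) (by linarith)) (Dm_mul (l3 (-3) c0 c0 le_rfl) (Dm_weak lSf (fun y (hy : y≤c1-X/6-X/8) => by linarith))))
      (Dm_mul lSf lSf'))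
  set W : ℝ → ℂ := fun v => ((gT T v-gT 1 v:ℝ):ℂ) with hW
  have hi : Integrable W := ((gT_int T (by linarith)).sub (gT_int 1 one_pos)).ofReal
  have iLD := Sr_mul_int W hi _ (fun n : ℕ => log n) sLD
  have iL := Sr_mul_int W hi _ (fun n : ℕ => log n) sL
  obtain ⟨j1, b1⟩ := g1.2 _ iLD
  obtain ⟨j2, b2⟩ := g2.2 _ iL
  obtain ⟨j3, b3⟩ := g3.2 _ hi
  have he := etab_nonneg b
  set Δ := M*etab b/η+M/(η*X) with hΔ
  have hΔ0 : 0≤Δ := by positivity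
  have r1 := b1 (X^1/X*Δ) (by positivity) (fun y _ => hdl 1 le_rfl y) (-X) trivial
  have r2 := b2 (X^0/X*Δ) (by positivity) (fun y _ => hdl 0 (by norm_num) y) (-X) trivial
  have r3 := b3 (2*exp (-X)) (by positivity) (fun y hy => small_W X T y hX hT hTX hy) (-X) (by rw [hc1, hc0]; linarith)
  have k1 := ee_mul_int _ j1 (-X)
  have k2 := ee_mul_int _ j2 (-X)
  have k3 := ee_mul_int _ j3 (-X)
  have hfin := integral_add (k1.add k2) k3
  have hfin2 := integral_add k1 k2
  simp only [Pi.add_apply] at hfin hfin2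
  rw [hfin2] at hfin
  refine (congrArg norm (Eq.trans (integral_congr_ae (Eventually.of_forall fun v => ?_)) hfin)).trans_le ?_
  · beta_reduce
    rw [eD v]
    have := eR v
    simp only [Lv] at this ⊢
    rw [this]; ring
  · skip
    refine (norm_add_le _ _).trans ((add_le_add ((norm_add_le _ _).trans (add_le_add r1 r2)) r3).trans ?_)
    rw [n3, n3', pow_one, pow_zero, div_self hX0.ne', one_mul]
    have q1 : B*(3+3*(B*B)+B*B*(B*B))≤7*B^6 := by
      have h1 : B^1≤B^6 := pow_le_pow_right₀ hB1 (by norm_num)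
      have h3 : B^3≤B^6 := pow_le_pow_right₀ hB1 (by norm_num)
      have h5 : B^5≤B^6 := pow_le_pow_right₀ hB1 (by norm_num)
      calc _=3*B^1+3*B^3+B^5 := by ring
        _≤_ := by linarith
    have q2 : B*X*(B*B*(3+(B+B)*B))≤5*B^6*X := by
      have h3 : B^3≤B^6 := pow_le_pow_right₀ hB1 (by norm_num)
      have h5 : B^5≤B^6 := pow_le_pow_right₀ hB1 (by norm_num)
      calc _=(3*B^3+2*B^5)*X := by ring
        _≤_ := by gcongr; linarith
    have q3 : B*X*B*(3+3*(B*B)+B*B*(B*B))≤7*B^6*X := by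
      have h1 : B^2≤B^6 := pow_le_pow_right₀ hB1 (by norm_num)
      have h3 : B^4≤B^6 := pow_le_pow_right₀ hB1 (by norm_num)
      calc _=(3*B^2+3*B^4+B^6)*X := by ring
        _≤_ := by gcongr; linarith
    have hexp : exp (-X)≤1/X^2 := by
      rw [exp_neg, inv_eq_one_div, div_le_div_iff₀ (exp_pos _) (by positivity)]
      have h6 := Real.pow_div_factorial_le_exp X hX0.le 3
      norm_num [Nat.factorial] at h6
      nlinarith [sq_nonneg X]
    calc _≤7*B^6*Δ+5*B^6*X*(1/X*Δ)+7*B^6*X*(2*(1/X^2)) := by gcongr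
      _=B^6*(12*Δ+14/X) := by field_simp; ring
      _≤B^6*(32*Δ) := by
        gcongr
        have : 1/X≤Δ := by
          have h7 : 1/X≤M/(η*X) := by
            rw [div_le_div_iff₀ hX0 (by positivity)]
            nlinarith
          have h8 : 0≤M*etab b/η := by positivity
          linarith
        have e : 14/X=14*(1/X) := by ring
        linarith
      _=_ := by rw [hBd, hΔ]; field_simp

end M5d
end H12
namespace H12
section M5e
open MeasureTheory Real Filter Topology

noncomputable def lam (z:ℝ) (n:ℕ) : ℂ := ((rf z n*ArithmeticFunction.vonMangoldt n:ℝ):ℂ)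

lemma lam_norm (z:ℝ) (n:ℕ) : ‖lam z n‖≤ rf z n*log n^1 := by
  unfold lam
  rw [Complex.norm_real, Real.norm_of_nonneg (mul_nonneg (rf_nonneg _ _) ArithmeticFunction.vonMangoldt_nonneg), pow_one]
  exact mul_le_mul_of_nonneg_left ArithmeticFunction.vonMangoldt_le_log (rf_nonneg _ _)

lemma lam_Lv (z:ℝ) (hz : 0≤z) (X v:ℝ) (hX : 0<X) : Lv (lam z) X v=Lv (ra z 1) X v*Lv (fa z 0) X v := by
  rw [Lv_eq _ (by unfold lam; rw [rf_zero]; simp), Lv_eq _ (ra_zero z 1), Lv_eq _ (fa_zero z 0)]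
  set s : ℂ := (1+1/X:ℝ)+((-(2*π*v):ℝ):ℂ)*Complex.I with hs
  have hre : 1< s.re := by
    have : 0<1/X := by positivity
    rw [hs, Complex.add_re, Complex.re_ofReal_mul, Complex.I_re, Complex.ofReal_re]; linarith
  have h := DirichletCharacter.LSeries_twist_vonMangoldt_eq (1 : DirichletCharacter ℂ (primorial ⌊z⌋₊)) hre
  have e : LSeries (fun n : ℕ => (1 : DirichletCharacter ℂ (primorial ⌊z⌋₊)) (n : ZMod (primorial ⌊z⌋₊)))=LSeries (ra z 0) := by
    ext s
    apply LSeries_congr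
    intro n hn
    rw [chi_rf z hz n hn]; unfold ra; simp
  rw [e, (ra_deriv z 0 s hre).deriv, neg_neg, zero_add] at h
  have h1 := RF_one z hz s hre
  have h2 : LSeries (ra z 0) s ≠ 0 := left_ne_zero_of_mul_eq_one h1
  have h3 : LSeries (lam z) s=LSeries (ra z 1) s/LSeries (ra z 0) s := by
    rw [← h]
    apply LSeries_congr
    intro n hn
    simp only [Pi.mul_apply]
    rw [chi_rf z hz n hn]; unfold lam; simp
  rw [h3, div_eq_iff h2, mul_assoc, mul_comm (LSeries (fa z 0) s), h1, mul_one]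

lemma choose_b (M ε:ℝ) (hε : 0<ε) : ∃ b0 : ℕ, ∀ b ≥ b0, M*(32*(4*b+8))^7*etab b≤ε := by
  have hK : 0<Ksv := by unfold Ksv; positivity
  have h1 := (tendsto_pow_const_mul_const_pow_of_abs_lt_one 7 (show |(1/2:ℝ)| < 1 by rw [abs_of_pos] <;> norm_num)).const_mul ((|M|+1)*(32*12)^7*(2*Ksv))
  rw [mul_zero] at h1
  have h2 := (tendsto_pow_atTop_nhds_zero_of_lt_one (show (0:ℝ)≤1/2 by norm_num) (by norm_num)).const_mul Ksv
  rw [mul_zero] at h2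
  obtain ⟨b0, hb0⟩ := eventually_atTop.1 ((h1.eventually (gt_mem_nhds hε)).and ((h2.eventually (gt_mem_nhds one_pos)).and (eventually_ge_atTop 1)))
  refine ⟨b0, fun b hb => ?_⟩
  obtain ⟨ha, hc, hd⟩ := hb0 b hb
  have hd' : (1:ℝ)≤b := by exact_mod_cast hd
  have he : etab b≤2*Ksv*(1/2)^b := by
    unfold etab
    have e1 : Ksv/2^b=Ksv*(1/2)^b := by rw [one_div, inv_pow]; rfl
    rw [e1]
    set u := Ksv*(1/2)^b with hu
    have hu0 : 0≤u := by positivity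
    have := Real.abs_exp_sub_one_le (x := u) (by rw [abs_of_nonneg hu0]; exact hc.le)
    rw [abs_of_nonneg hu0] at this
    have := le_abs_self (exp u-1)
    linarith
  have h0 := etab_nonneg b
  calc M*(32*(4*b+8))^7*etab b≤(|M|+1)*(32*(12*b))^7*(2*Ksv*(1/2)^b) := by
        gcongr
        · linarith [le_abs_self M]
        · linarith
    _=(|M|+1)*(32*12)^7*(2*Ksv)*((b:ℝ)^7*(1/2)^b) := by ring
    _≤ε := ha.le

set_option maxHeartbeats 1000000 in
theorem core (ε:ℝ) (hε : 0<ε) : ∃ η : ℝ, 0<η ∧ η≤1/64 ∧ ∃ X0 : ℝ, 64≤X0 ∧ 10/η≤X0 ∧ ∀ X ≥ X0, ∀ T : ℝ, 1≤T → T≤exp (X/32) →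
    ‖∫ v, ((gT T v-gT 1 v:ℝ):ℂ)*Lv (lam (exp (η*X))) X v*ee (v*(-X))‖≤ε := by
  obtain ⟨M, hM, h1⟩ := typeI
  obtain ⟨C, hC, h2⟩ := typeII
  obtain ⟨K, hK, htr⟩ := bb_triv
  obtain ⟨b0, hb0⟩ := choose_b M (ε/3) (by positivity)
  obtain ⟨b1, hb1⟩ := exists_nat_ge (3*C/ε)
  set b := max b0 b1 with hb
  have hbb : (b1:ℝ)≤b := by exact_mod_cast le_max_right _ _
  set η : ℝ := 1/(32*(4*b+8)) with hη
  have hη0 : 0<η := by positivity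
  have hη1 : η≤1/64 := by
    rw [hη]; apply one_div_le_one_div_of_le (by norm_num); have : (0:ℝ)≤b := by positivity
    linarith
  have hηb : η*(4*b+8)≤1/32 := by rw [hη]; apply le_of_eq; field_simp
  have t2 : C*η≤ε/3 := by
    rw [div_le_iff₀ hε] at hb1
    rw [hη, mul_one_div, div_le_div_iff₀ (by positivity) (by norm_num)]
    nlinarith
  have t1 : M/η^6*(etab b/η)≤ε/3 := by
    refine le_trans (le_of_eq ?_) (hb0 b (le_max_left _ _))
    have : (32*(4*(b:ℝ)+8))=1/η := by rw [hη, one_div_one_div]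
    rw [this]; field_simp
  obtain ⟨X1, hX1, h2⟩ := h2 η hη0 hη1
  refine ⟨η, hη0, hη1, max (max 64 (10/η)) (max X1 (3*(M/η^7)/ε)), (le_max_left _ _).trans (le_max_left _ _), (le_max_right _ _).trans (le_max_left _ _), ?_⟩
  intro X hX T hT hTX
  simp only [ge_iff_le, max_le_iff] at hX
  obtain ⟨⟨hX64, hXη⟩, hXX1, hXe⟩ := hX
  have hX0 : 0<X := by linarith
  have g1 := h1 η hη0 hη1 b hηb X hX64 hXη T hT hTX
  have g2 := h2 X hXX1 T hT hTX (fun v => ee (v*(-X))) (fun v => (ee_norm _).le)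
  have t3 : M/η^6*(1/(η*X))≤ε/3 := by
    rw [div_le_iff₀ hε] at hXe
    calc _=(M/η^7)/X := by field_simp
      _≤_ := by rw [div_le_iff₀ hX0]; linarith
  set z := exp (η*X) with hz
  have hz0 : 0≤z := (exp_pos _).le
  have tr := htr η X hη0 (by linarith) hXη
  obtain ⟨sfb, tfb⟩ := tr 0 (by norm_num) (fb z X) (fun n => by rw [pow_zero, mul_one]; exact fb_norm z X n)
  obtain ⟨sfs, tfs⟩ := tr 0 (by norm_num) (fs z X) (fs_norm' z X)
  obtain ⟨sR, tR⟩ := tr 0 (by norm_num) (ra z 0) (fun n => (ra_norm z 0 n).le)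
  obtain ⟨sD, tD⟩ := tr 1 (by norm_num) (ra z 1) (fun n => (ra_norm z 1 n).le)
  set U : ℝ → Prop := fun _ => True with hU
  have uf : Dm U U (Lv (fb z X) X) _ := Dm_Lv _ X sfb tfb (fun _ _ _ _ => trivial)
  have us : Dm U U (Lv (fs z X) X) _ := Dm_Lv _ X sfs tfs (fun _ _ _ _ => trivial)
  have uR : Dm U U (Lv (ra z 0) X) _ := Dm_Lv _ X sR tR (fun _ _ _ _ => trivial)
  have uD : Dm U U (Lv (ra z 1) X) _ := Dm_Lv _ X sD tD (fun _ _ _ _ => trivial)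
  have u3 : ∀ c : ℂ, Dm U U (fun _ => c) ‖c‖ := fun c => Dm_const c (fun _ _ => trivial)
  have uRf := Dm_mul uR uf
  have d1 := Dm_mul uD (Dm_mul uf (Dm_add (Dm_add (u3 3) (Dm_mul (u3 (-3)) uRf)) (Dm_mul uRf uRf)))
  have d2 := Dm_mul (Dm_mul uD (Dm_mul uR uR)) (Dm_mul us (Dm_mul us us))
  have hi : Integrable (fun v => ((gT T v-gT 1 v:ℝ):ℂ)) := ((gT_int T (by linarith)).sub (gT_int 1 one_pos)).ofReal
  have k1 := ee_mul_int _ (d1.2 _ hi).1 (-X)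
  have k2 := ee_mul_int _ (d2.2 _ hi).1 (-X)
  have hfin := integral_add k1 k2
  refine (congrArg norm (Eq.trans (integral_congr_ae (Eventually.of_forall fun v => ?_)) hfin)).trans_le ?_
  · beta_reduce
    rw [lam_Lv z hz0 X v hX0]
    have e1 : Lv (fa z 0) X v=Lv (fb z X) X v+Lv (fs z X) X v := Lv_add _ _ _ X v (fun n => by unfold fb fs; push_cast; ring) sfb sfs
    have e2 : Lv (ra z 0) X v*Lv (fa z 0) X v=1 := by
      rw [Lv_eq _ (ra_zero z 0), Lv_eq _ (fa_zero z 0)]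
      refine RF_one z hz0 _ ?_
      have : 0<1/X := by positivity
      rw [Complex.add_re, Complex.re_ofReal_mul, Complex.I_re, Complex.ofReal_re]; linarith
    have e3 : Lv (fs z X) X v=Lv (fa z 0) X v-Lv (fb z X) X v := by rw [e1]; ring
    rw [e3]
    linear_combination (-((gT T v-gT 1 v:ℝ):ℂ)*Lv (ra z 1) X v*ee (v*(-X))*(Lv (fa z 0) X v*(Lv (ra z 0) X v*Lv (fa z 0) X v+1)-3*Lv (fb z X) X v*(Lv (ra z 0) X v*Lv (fa z 0) X v+1)+3*Lv (fb z X) X v^2*Lv (ra z 0) X v))*e2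
  · refine (norm_add_le _ _).trans ?_
    have q : M/η^6*(etab b/η+1/(η*X))=M/η^6*(etab b/η)+M/η^6*(1/(η*X)) := by ring
    have g2' : ‖∫ v, ((gT T v-gT 1 v:ℝ):ℂ)*(Lv (ra z 1) X v*(Lv (ra z 0) X v*Lv (ra z 0) X v)*(Lv (fs z X) X v*(Lv (fs z X) X v*Lv (fs z X) X v)))*ee (v*(-X))‖≤C*η := by
      refine (congrArg norm (integral_congr_ae (Eventually.of_forall fun v => ?_))).trans_le g2
      beta_reduce; ring
    linarith only [g1, g2', q, t1, t2, t3]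

end M5e
end H12
namespace H12
section M5f
open MeasureTheory Real Filter Topology
open ArithmeticFunction (vonMangoldt)

noncomputable def cl (z X:ℝ) (n:ℕ) : ℝ := rf z n*vonMangoldt n*(n:ℝ)^(-(1+1/X))

lemma cl_nonneg (z X:ℝ) (n:ℕ) : 0≤cl z X n :=
  mul_nonneg (mul_nonneg (rf_nonneg _ _) ArithmeticFunction.vonMangoldt_nonneg) (by positivity)

lemma bb_lam (z X:ℝ) (n:ℕ) : bb (lam z) X n=(cl z X n:ℂ) := by unfold bb lam cl; push_cast; ring

lemma wT_summ (z X T y:ℝ) (hT : 1≤T) (hs : Summable (cl z X)) : Summable (fun n => cl z X n*wT T (log n+y)) := by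
  refine Summable.of_nonneg_of_le (fun n => mul_nonneg (cl_nonneg _ _ _) (wT_pos _ _ hT).le) (fun n => ?_) (hs.mul_right T)
  exact mul_le_mul_of_nonneg_left (wT_le _ _ hT) (cl_nonneg _ _ _)

lemma lam_int (z X T:ℝ) (hT : 1≤T) (hs : Summable (cl z X)) :
    ∫ v, ((gT T v-gT 1 v:ℝ):ℂ)*Lv (lam z) X v*ee (v*(-X)) =
      ((∑' n, cl z X n*wT T (log n + -X)-∑' n, cl z X n*wT 1 (log n + -X):ℝ):ℂ) := by
  have hs' : Summable (fun n => ‖bb (lam z) X n‖) := by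
    refine hs.congr fun n => ?_
    rw [bb_lam, Complex.norm_real, Real.norm_of_nonneg (cl_nonneg _ _ _)]
  have hi1 : Integrable (fun v => ((gT T v-gT 1 v:ℝ):ℂ)) := ((gT_int T (by linarith)).sub (gT_int 1 one_pos)).ofReal
  have hi2 := ee_mul_int _ hi1 (-X)
  have e0 : ∀ v, ((gT T v-gT 1 v:ℝ):ℂ)*Lv (lam z) X v*ee (v*(-X)) =
      (((gT T v-gT 1 v:ℝ):ℂ)*ee (v*(-X)))*Sr (bb (lam z) X) (fun n => log n) v := fun v => by unfold Lv; ring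
  simp_rw [e0]
  rw [Sr_inter _ hi2 _ _ hs', ← (wT_summ z X T (-X) hT hs).tsum_sub (wT_summ z X 1 (-X) le_rfl hs), Complex.ofReal_tsum]
  refine tsum_congr fun n => ?_
  have e2 : ∀ v, ((gT T v-gT 1 v:ℝ):ℂ)*ee (v*(-X))*ee (v*log n)=(gT T v:ℂ)*ee (v*(log n+-X))-(gT 1 v:ℂ)*ee (v*(log n+-X)) := fun v => by
    rw [mul_assoc, ← ee_add, show v*(-X)+v*log n=v*(log n+-X) by ring]; push_cast; ring
  simp_rw [e2]
  rw [integral_sub (ee_mul_int (fun v => (gT T v:ℂ)) (gT_int T (by linarith)).ofReal _) (ee_mul_int (fun v => (gT 1 v:ℂ)) (gT_int 1 one_pos).ofReal _),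
    gT_fourier T (by linarith), gT_fourier 1 one_pos, bb_lam]
  unfold wT; push_cast; ring

lemma cheb (x:ℝ) (hx : 300^4≤x) : x≤Chebyshev.theta (4*x)-Chebyshev.theta x := by
  have hx0 : 0<x := by linarith
  obtain ⟨u, hu0, hu⟩ : ∃ u : ℝ, 0<u ∧ x=u^4 := ⟨√(√x), by positivity, by
    rw [show √√x^4=(√√x^2)^2 by ring, sq_sqrt (by positivity), sq_sqrt hx0.le]⟩
  have hu3 : 300≤u := by
    rw [hu] at hx; exact le_of_pow_le_pow_left₀ (by norm_num) hu0.le hx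
  have h1 := Chebyshev.theta_ge' (x := 4*x) (by linarith)
  have h2 := Chebyshev.theta_le_log4_mul_x hx0.le
  have l2 := Real.log_two_gt_d9
  have l2' := Real.log_two_lt_d9
  have l4 : log 4=2*log 2 := by rw [show (4:ℝ)=2^2 by norm_num, log_pow]; norm_num
  have lu := Real.log_le_sub_one_of_pos hu0
  have a1 : log (4*x)≤2+4*u := by
    rw [log_mul (by norm_num) hx0.ne', l4, hu, log_pow]; push_cast; linarith
  have a2 : log (4*x+2)≤3+4*u := by
    have : log (4*x+2)≤ log (2*(4*x)) := log_le_log (by linarith) (by linarith)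
    rw [log_mul (by norm_num) (by positivity)] at this
    linarith
  have a3 : √(4*x)=2*u^2 := by
    rw [show 4*x=(2*u^2)^2 by rw [hu]; ring, sqrt_sq (by positivity)]
  rw [a3] at h1
  rw [l4] at h2
  have a4 : 2*(2*u^2)*log (4*x)≤2*(2*u^2)*(2+4*u) := by gcongr
  have a5 : u^3*300≤x := by rw [hu, pow_succ u 3]; gcongr
  have a6 : u^2*300≤u^3 := by rw [pow_succ u 2]; gcongr
  have a7 : u*300≤u^2 := by rw [sq]; gcongr
  nlinarith

lemma prime_sum (z X:ℝ) (hX : 64≤X) (hz : z≤exp X) (hs : Summable (cl z X)) :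
    exp (-9)/4≤∑' n, cl z X n*wT 1 (log n + -X) := by
  have hX0 : 0<X := by linarith
  set x := exp X with hx
  have hxp : 0<x := exp_pos X
  have hbig : 300^4≤x := by
    have : exp 64≤x := exp_le_exp.2 hX
    have h2 : (2.7:ℝ)^64≤exp 64 := by
      rw [show (64:ℝ)=(64:ℕ)*1 by norm_num, exp_nat_mul]
      exact pow_le_pow_left₀ (by norm_num) (by linarith [exp_one_gt_d9]) 64
    have h3 : (300:ℝ)^4≤2.7^64 := by norm_num
    linarith
  have hch := cheb x hbig
  have hfl : ⌊x⌋₊≤⌊4*x⌋₊ := Nat.floor_le_floor (by linarith)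
  set s := (Finset.Ioc ⌊x⌋₊ ⌊4*x⌋₊).filter Nat.Prime with hsd
  have hth : Chebyshev.theta (4*x)-Chebyshev.theta x=∑ p ∈ s, log p := by
    unfold Chebyshev.theta
    rw [hsd, Finset.sum_filter, Finset.sum_filter, Finset.sum_filter, sub_eq_iff_eq_add, add_comm]
    exact (Finset.sum_Ioc_consecutive _ (Nat.zero_le _) hfl).symm
  refine le_trans ?_ ((wT_summ z X 1 (-X) le_rfl hs).sum_le_tsum s (fun n _ => mul_nonneg (cl_nonneg _ _ _) (wT_pos _ _ le_rfl).le))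
  have key : ∀ p ∈ s, log p*(exp (-9)/(4*x))≤cl z X p*wT 1 (log p + -X) := by
    intro p hp
    rw [hsd, Finset.mem_filter, Finset.mem_Ioc, Nat.floor_lt hxp.le, Nat.le_floor_iff (by positivity)] at hp
    obtain ⟨⟨hp1, hp2⟩, hpp⟩ := hp
    have hp0 : (0:ℝ)<p := by linarith
    have hrf : rf z p=1 := by
      unfold rf
      rw [if_pos ⟨hpp.ne_zero, fun r hr hrp => by rw [(Nat.prime_dvd_prime_iff_eq hr hpp).1 hrp]; linarith⟩]
    have hlo : X≤ log p := by rw [Real.le_log_iff_exp_le hp0]; exact hp1.le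
    have hl4 : log 4≤1.4 := by
      rw [show (4:ℝ)=2^2 by norm_num, log_pow]; have := Real.log_two_lt_d9; push_cast; linarith
    have hhi : log p≤X+1.4 := by
      have := log_le_log hp0 hp2
      rw [log_mul (by norm_num) hxp.ne', hx, log_exp] at this
      linarith
    unfold cl wT
    rw [hrf, ArithmeticFunction.vonMangoldt_apply_prime hpp, one_mul, one_mul, mul_assoc]
    refine mul_le_mul_of_nonneg_left ?_ (by linarith)
    have hr : (p:ℝ)^(-(1+1/X))=exp (-(log p))*exp (-(log p/X)) := by
      rw [rpow_def_of_pos hp0, ← exp_add]; congr 1; ring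
    have h1 : 1/(4*x)≤exp (-(log p)) := by
      rw [exp_neg, exp_log hp0, ← one_div]; exact one_div_le_one_div_of_le hp0 hp2
    have h2 : exp (-2)≤exp (-(log p/X)) := by
      apply exp_le_exp.2; apply neg_le_neg; rw [div_le_iff₀ hX0]; linarith
    have h3 : exp (-7)≤exp (-π*1^2*(log p + -X)^2) := by
      apply exp_le_exp.2
      have hpi := pi_lt_d2
      have : (log p + -X)^2≤1.4^2 := by
        apply pow_le_pow_left₀ <;> linarith
      nlinarith [pi_pos]
    rw [hr]
    calc exp (-9)/(4*x)=1/(4*x)*exp (-2)*exp (-7) := by rw [mul_assoc, ← exp_add]; norm_num; ring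
      _≤_ := by gcongr
  calc exp (-9)/4=x*(exp (-9)/(4*x)) := by field_simp
    _≤(∑ p ∈ s, log p)*(exp (-9)/(4*x)) := by rw [← hth]; gcongr
    _≤_ := by rw [Finset.sum_mul]; exact Finset.sum_le_sum key

set_option maxHeartbeats 1000000 in
theorem HOH : ∃ c : ℝ, 0<c ∧ ∀ κ θ : ℝ, 0<κ → κ<θ → θ≤1/32 → ∃ X0 : ℝ, ∀ X ≥ X0,
    c*exp ((1-θ)*X)≤∑ n ∈ Finset.Icc ⌈exp (X-exp (-κ*X))⌉₊ ⌊exp (X+exp (-κ*X))⌋₊, vonMangoldt n := by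
  set c0 : ℝ := exp (-9)/4 with hc0
  have hc0p : 0<c0 := by positivity
  obtain ⟨η, hη, hη1, X1, hX1, hX1', hcore⟩ := core (c0/2) (by positivity)
  obtain ⟨K, hK, htr⟩ := bb_triv
  refine ⟨c0/(4*exp 1), by positivity, ?_⟩
  intro κ θ hκ hκθ hθ
  refine ⟨max X1 (max (1/(2*(θ-κ)^2)) (4*K/(η*c0))), ?_⟩
  intro X hX
  simp only [ge_iff_le, max_le_iff] at hX
  obtain ⟨hXX1, hXθ, hXK⟩ := hX
  have hX64 : 64≤X := by linarith
  have hX0 : 0<X := by linarith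
  have hXη : 10/η≤X := by linarith
  set ρ := exp (-κ*X) with hρ
  have hρ0 : 0<ρ := exp_pos _
  have hρ1 : ρ≤1 := exp_le_one_iff.2 (by nlinarith)
  set T := exp (θ*X) with hT
  have hT1 : 1≤T := one_le_exp (mul_nonneg (by linarith) hX0.le)
  have hTX : T≤exp (X/32) := exp_le_exp.2 (by nlinarith)
  set z := exp (η*X) with hz
  have hzX : z≤exp X := exp_le_exp.2 (by nlinarith)
  obtain ⟨hs', ht'⟩ := htr η X hη (by linarith) hXη 1 (by norm_num) (lam z) (lam_norm z)
  have e : ∀ n, ‖bb (lam z) X n‖=cl z X n := fun n => by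
    rw [bb_lam, Complex.norm_real, Real.norm_of_nonneg (cl_nonneg _ _ _)]
  simp_rw [e] at hs' ht'
  have h1 := hcore X hXX1 T hT1 hTX
  rw [lam_int z X T hT1 hs', Complex.norm_real, Real.norm_eq_abs] at h1
  have h2 := prime_sum z X hX64 hzX hs'
  have h3 := (abs_le.1 h1).1
  set W := Finset.Icc ⌈exp (X-ρ)⌉₊ ⌊exp (X+ρ)⌋₊ with hW
  have hup : ∀ n : ℕ, cl z X n*wT T (log n + -X)≤(if n ∈ W then vonMangoldt n*(exp 1*exp (-X)*T) else 0)+cl z X n*(T*exp (-π*T^2*ρ^2)) := by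
    intro n
    have hc := cl_nonneg z X n
    by_cases hn : n ∈ W
    · rw [if_pos hn]
      have hn' := hn
      rw [hW, Finset.mem_Icc, Nat.ceil_le] at hn
      have hn0 : (0:ℝ)<n := (exp_pos _).trans_le hn.1
      have hln : X-1≤ log n := by
        rw [Real.le_log_iff_exp_le hn0]; exact (exp_le_exp.2 (by linarith)).trans hn.1
      have hcl : cl z X n≤vonMangoldt n*(exp 1*exp (-X)) := by
        unfold cl
        have hv : 0≤vonMangoldt n := ArithmeticFunction.vonMangoldt_nonneg
        have : rf z n*vonMangoldt n≤vonMangoldt n := mul_le_of_le_one_left hv (rf_le_one _ _)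
        refine mul_le_mul this ?_ (by positivity) hv
        rw [rpow_def_of_pos hn0, ← exp_add]
        apply exp_le_exp.2
        have : 0≤1/X := by positivity
        nlinarith
      have : cl z X n*wT T (log n + -X)≤vonMangoldt n*(exp 1*exp (-X))*T :=
        mul_le_mul hcl (wT_le _ _ hT1) (wT_pos _ _ hT1).le (hc.trans hcl)
      have : 0≤cl z X n*(T*exp (-π*T^2*ρ^2)) := by positivity
      linarith
    · rw [if_neg hn, zero_add]
      rcases Nat.eq_zero_or_pos n with h0 | h0
      · have : cl z X n=0 := by unfold cl; rw [h0, rf_zero]; simp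
        rw [this]; simp
      have hn0 : (0:ℝ)<n := by exact_mod_cast h0
      refine mul_le_mul_of_nonneg_left ?_ hc
      unfold wT
      refine mul_le_mul_of_nonneg_left ?_ (by positivity)
      apply exp_le_exp.2
      have hab : ρ ≤ |log n + -X| := by
        by_contra hcon
        push Not at hcon
        rw [abs_lt] at hcon
        apply hn
        rw [hW, Finset.mem_Icc, Nat.ceil_le, Nat.le_floor_iff (exp_pos _).le]
        constructor
        · rw [← Real.le_log_iff_exp_le hn0]; linarith
        · rw [← Real.log_le_iff_le_exp hn0]; linarith
      have : ρ^2≤(log n + -X)^2 := by rw [← sq_abs (log n + -X)]; gcongr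
      have hpT : 0≤π*T^2 := by positivity
      nlinarith
  have hsupp : HasSum (fun n : ℕ => if n ∈ W then vonMangoldt n*(exp 1*exp (-X)*T) else 0) (∑ n ∈ W, vonMangoldt n*(exp 1*exp (-X)*T)) := by
    have : HasSum (fun n : ℕ => if n ∈ W then vonMangoldt n*(exp 1*exp (-X)*T) else 0) (∑ n ∈ W, if n ∈ W then vonMangoldt n*(exp 1*exp (-X)*T) else 0) :=
      hasSum_sum_of_ne_finset_zero (fun b hb => if_neg hb)
    rwa [Finset.sum_congr rfl (fun n hn => if_pos hn)] at this
  have h4 := (wT_summ z X T (-X) hT1 hs').tsum_le_tsum hup (hsupp.summable.add (hs'.mul_right _))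
  rw [hsupp.summable.tsum_add (hs'.mul_right _), hsupp.tsum_eq, tsum_mul_right, ← Finset.sum_mul] at h4
  have htail : (∑' n, cl z X n)*(T*exp (-π*T^2*ρ^2))≤c0/4 := by
    have q1 : T*exp (-π*T^2*ρ^2)≤exp (-(2*X)) := by
      have e1 : T^2*ρ^2=exp (2*(θ-κ)*X) := by
        rw [hT, hρ, ← exp_nat_mul, ← exp_nat_mul, ← exp_add]; congr 1; push_cast; ring
      rw [hT, ← exp_add]
      apply exp_le_exp.2
      have e2 := Real.quadratic_le_exp_of_nonneg (x := 2*(θ-κ)*X) (mul_nonneg (by linarith) hX0.le)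
      rw [← e1] at e2
      have e3 : 1≤X*(2*(θ-κ)^2) := by
        rwa [div_le_iff₀ (by have : 0<θ-κ := by linarith
                             positivity)] at hXθ
      have e4 : 0≤2*(θ-κ)*X := mul_nonneg (by linarith) hX0.le
      have e5 : X≤T^2*ρ^2 := by nlinarith
      have := pi_gt_three
      nlinarith
    have q2 : exp (-(2*X))≤1/X^2 := by
      rw [exp_neg, ← one_div]; apply one_div_le_one_div_of_le (by positivity)
      have := Real.quadratic_le_exp_of_nonneg (x := 2*X) (by linarith)
      nlinarith
    have q3 : 0≤∑' n, cl z X n := tsum_nonneg (cl_nonneg z X)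
    rw [pow_one] at ht'
    calc _≤(K*X/η)*(1/X^2) := mul_le_mul ht' (q1.trans q2) (by positivity) (by positivity)
      _=K/(η*X) := by field_simp
      _≤c0/4 := by
        rw [div_le_iff₀ (by positivity)] at hXK ⊢
        linarith
  have h5 : c0/4≤(∑ n ∈ W, vonMangoldt n)*(exp 1*exp (-X)*T) := by linarith
  calc c0/(4*exp 1)*exp ((1-θ)*X)=c0/4*(1/(exp 1*exp (-X)*T)) := by
        rw [hT, show (1-θ)*X=X-θ*X by ring, exp_sub, exp_neg]; field_simp
    _≤(∑ n ∈ W, vonMangoldt n)*(exp 1*exp (-X)*T)*(1/(exp 1*exp (-X)*T)) := by gcongr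
    _=_ := by field_simp

end M5f
end H12
namespace H12
section M6a
open Real Finset

variable {q : ℕ} [Fact q.Prime]

noncomputable def ps (x : ZMod q) : ℂ := ZMod.stdAddChar x
lemma ps_add (x y : ZMod q) : ps (x+y)=ps x*ps y := AddChar.map_add_eq_mul _ x y
lemma ps_zero : ps (0 : ZMod q)=1 := AddChar.map_zero_eq_one _
lemma ps_norm (x : ZMod q) : ‖ps x‖=1 := AddChar.norm_apply _ x
lemma ps_neg (x : ZMod q) : ps (-x)=(starRingEnd ℂ) (ps x) := AddChar.map_neg_eq_conj _ x
lemma ps_conj (x y : ZMod q) : ps x*(starRingEnd ℂ) (ps y)=ps (x-y) := by rw [← ps_neg, ← ps_add, sub_eq_add_neg]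
lemma ps_sum (b : ZMod q) : ∑ x : ZMod q, ps (x*b)=if b=0 then (q:ℂ) else 0 := by
  have := AddChar.sum_mulShift b (ZMod.isPrimitive_stdAddChar q)
  unfold ps; rw [this, ZMod.card]; split_ifs <;> simp
lemma ps_ee (n:ℕ) : ps (n : ZMod q)=ee ((n:ℝ)/q) := by
  have := ZMod.stdAddChar_coe (N := q) (n:ℤ)
  unfold ps ee; push_cast at this; rw [this]; congr 1; push_cast; ring

/-- Parseval -/
lemma parseval {ι : Type*} (s : Finset ι) (c : ι → ℂ) (f : ι → ZMod q) :
    ((∑ l : ZMod q, ‖∑ i ∈ s, c i*ps (l*f i)‖^2:ℝ):ℂ)=q*∑ i ∈ s, ∑ j ∈ s, if f i=f j then c i*(starRingEnd ℂ) (c j) else 0 := by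
  push_cast
  simp_rw [← Complex.mul_conj', map_sum, sum_mul_sum]
  rw [sum_comm, mul_sum]
  refine sum_congr rfl fun i _ => ?_
  rw [sum_comm, mul_sum]
  refine sum_congr rfl fun j _ => ?_
  have e : ∀ l : ZMod q, c i*ps (l*f i)*(starRingEnd ℂ) (c j*ps (l*f j))=c i*(starRingEnd ℂ) (c j)*ps (l*(f i-f j)) := fun l => by
    rw [map_mul, mul_sub, ← ps_conj]; ring
  simp_rw [e]
  rw [← mul_sum, ps_sum]
  simp only [sub_eq_zero]
  split_ifs <;> ring


noncomputable def bq (t : ZMod q) : ℝ := if t=0 then 1 else 1/(2*(t.val:ℝ))+1/(2*((q:ℝ)-t.val))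

lemma val_pos' (t : ZMod q) (ht : t ≠ 0) : (1:ℝ)≤t.val := by
  have := (ZMod.val_ne_zero t).2 ht
  exact_mod_cast Nat.one_le_iff_ne_zero.2 this
lemma val_lt' (t : ZMod q) : (t.val:ℝ)+1≤q := by exact_mod_cast ZMod.val_lt t

lemma bq_nonneg (t : ZMod q) : 0≤bq t := by
  unfold bq
  split_ifs with h
  · norm_num
  · have := val_pos' t h; have := val_lt' t
    have : 0<(q:ℝ)-t.val := by linarith
    positivity

lemma sum_range_zmod (f : ZMod q → ℝ) : ∑ t : ZMod q, f t=∑ n ∈ range q, f n := by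
  refine sum_bij' (fun x _ => x.val) (fun n _ => (n : ZMod q)) ?_ ?_ ?_ ?_ ?_
  · intro x _; exact mem_range.2 (ZMod.val_lt x)
  · intro n _; exact mem_univ _
  · intro x _; exact ZMod.natCast_rightInverse x
  · intro n hn; exact ZMod.val_cast_of_lt (mem_range.1 hn)
  · intro x _; beta_reduce; rw [ZMod.natCast_zmod_val]

lemma bq_sum : ∑ t : ZMod q, bq t≤2+log q := by
  have hq1 : 1<q := (Fact.out : q.Prime).one_lt
  rw [sum_range_zmod]
  obtain ⟨r, rfl⟩ : ∃ r, q=r+1 := ⟨q-1, by omega⟩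
  rw [sum_range_succ']
  have e : ∀ n ∈ range r, bq ((n+1:ℕ) : ZMod (r+1))=1/2*(1/((n:ℝ)+1))+1/2*(1/((r-1-n:ℕ)+1:ℝ)) := by
    intro n hn
    rw [mem_range] at hn
    have h0 : ((n+1:ℕ) : ZMod (r+1)).val=n+1 := ZMod.val_cast_of_lt (by omega)
    have h1 : ((n+1:ℕ) : ZMod (r+1)) ≠ 0 := by rw [← ZMod.val_ne_zero, h0]; omega
    unfold bq; rw [if_neg h1, h0]
    have : ((r-1-n:ℕ):ℝ)=r-1-n := by rw [Nat.cast_sub (by omega), Nat.cast_sub (by omega)]; simp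
    rw [this]; push_cast
    congr 1
    · rw [one_div_mul_one_div]
    · rw [one_div_mul_one_div]; congr 1; ring
  rw [sum_congr rfl e, sum_add_distrib, ← mul_sum, ← mul_sum, sum_range_reflect (fun n : ℕ => 1/((n:ℝ)+1)) r]
  have h0 : bq (((0:ℕ)) : ZMod (r+1))=1 := by unfold bq; simp
  have hH := harmonic_le_one_add_log r
  have hH2 : ((harmonic r : ℚ):ℝ)=∑ n ∈ range r, 1/((n:ℝ)+1) := by unfold harmonic; push_cast; simp [one_div]
  have hl : log r≤ log ((r+1:ℕ):ℝ) := log_le_log (by exact_mod_cast (by omega : 0< r)) (by push_cast; linarith)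
  rw [h0, ← hH2]; linarith

lemma geo (t : ZMod q) (a b:ℕ) (hb : b<q) : ‖∑ n ∈ Icc a b, ps (t*(n:ZMod q))‖≤q*bq t := by
  have hq0 : (0:ℝ)<q := by exact_mod_cast (Fact.out : q.Prime).pos
  rcases lt_or_ge b a with hab | hab
  · rw [Icc_eq_empty (by omega), sum_empty, norm_zero]; exact mul_nonneg hq0.le (bq_nonneg t)
  by_cases ht : t=0
  · refine (norm_sum_le _ _).trans ?_
    simp only [ps_norm, sum_const, nsmul_eq_mul, mul_one, Nat.card_Icc]
    unfold bq; rw [if_pos ht, mul_one]; exact_mod_cast (by omega)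
  · have hv1 := val_pos' t ht
    have hv2 := val_lt' t
    have tel : (∑ n ∈ Icc a b, ps (t*(n:ZMod q)))*(ps t-1)=ps (t*((b+1:ℕ) : ZMod q))-ps (t*(a:ZMod q)) := by
      rw [← Finset.sum_Ico_sub (fun n : ℕ => ps (t*(n:ZMod q))) (by omega : a≤b+1), sum_mul]
      refine sum_congr rfl fun n _ => ?_
      push_cast; rw [mul_add, ps_add, mul_one]; ring
    have hn : ‖∑ n ∈ Icc a b, ps (t*(n:ZMod q))‖*‖ps t-1‖≤2 := by
      rw [← norm_mul, tel]
      refine (norm_sub_le _ _).trans ?_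
      rw [ps_norm, ps_norm]; norm_num
    have hlow : 4*(min (t.val:ℝ) (q-t.val))/q≤‖ps t-1‖ := by
      rw [norm_sub_rev]
      have ht' : ps t=ee ((t.val:ℝ)/q) := by rw [← ps_ee, ZMod.natCast_zmod_val]
      rcases le_total ((t.val:ℝ)) (q-t.val) with h | h
      · rw [min_eq_left h, mul_div_assoc, ht']
        exact one_sub_ee_norm (by positivity) (by rw [div_le_iff₀ hq0]; linarith)
      · rw [min_eq_right h, mul_div_assoc, ht']
        have e1 : ‖1-ee ((t.val:ℝ)/q)‖=‖1-ee (((q:ℝ)-t.val)/q)‖ := by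
          have : ee (((q:ℝ)-t.val)/q)=(starRingEnd ℂ) (ee ((t.val:ℝ)/q)) := by
            rw [← ee_neg, show ((q:ℝ)-t.val)/q=1 + -((t.val:ℝ)/q) by field_simp; ring, ee_add]
            have : ee 1=1 := by unfold ee; rw [mul_one]; push_cast; exact Complex.exp_two_pi_mul_I
            rw [this, one_mul]
          rw [this, ← Complex.norm_conj, map_sub, map_one]
        rw [e1]
        exact one_sub_ee_norm (div_nonneg (by linarith) hq0.le) (by rw [div_le_iff₀ hq0]; linarith)
    unfold bq; rw [if_neg ht]
    set m := min (t.val:ℝ) (q-t.val) with hm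
    have hm0 : 0< m := lt_min (by linarith) (by linarith)
    have h1 : ‖∑ n ∈ Icc a b, ps (t*(n:ZMod q))‖*(4*m/q)≤2 := (mul_le_mul_of_nonneg_left hlow (norm_nonneg _)).trans hn
    have h2 : ‖∑ n ∈ Icc a b, ps (t*(n:ZMod q))‖≤q*(1/(2*m)) := by
      rw [mul_one_div, le_div_iff₀ (by positivity)]
      rw [mul_div_assoc', div_le_iff₀ hq0] at h1; linarith
    refine h2.trans (mul_le_mul_of_nonneg_left ?_ hq0.le)
    have p1 : 0<1/(2*(t.val:ℝ)) := by positivity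
    have p2 : 0 < 1/(2*((q:ℝ)-t.val)) := by have : 0 < (q:ℝ)-t.val := by linarith
                                            positivity
    rcases min_choice (t.val:ℝ) (q-t.val) with h | h <;> rw [hm, h] <;> linarith

noncomputable def cJ (a b:ℕ) (t : ZMod q) : ℂ := 1/q*∑ k ∈ Icc a b, ps (-t*(k:ZMod q))

lemma cJ_norm (a b:ℕ) (hb : b<q) (t : ZMod q) : ‖cJ a b t‖≤bq t := by
  have hq0 : (0:ℝ)<q := by exact_mod_cast (Fact.out : q.Prime).pos
  unfold cJ
  have e : ∑ k ∈ Icc a b, ps (-t*(k:ZMod q))=(starRingEnd ℂ) (∑ k ∈ Icc a b, ps (t*(k:ZMod q))) := by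
    rw [map_sum]; refine sum_congr rfl fun k _ => by rw [← ps_neg, neg_mul]
  rw [norm_mul, e, Complex.norm_conj, norm_div, norm_one, Complex.norm_natCast, one_div_mul_eq_div, div_le_iff₀ hq0, mul_comm (bq t)]
  exact geo t a b hb

lemma compl (a b:ℕ) (hb : b<q) (s : Finset ℕ) (hs : ∀ n ∈ s, n<q) (g : ℕ → ℂ) :
    ∑ n ∈ s.filter (fun n : ℕ => a≤n ∧ n≤b), g n=∑ t : ZMod q, cJ a b t*∑ n ∈ s, g n*ps (t*(n:ZMod q)) := by
  have hq0 : (q:ℂ) ≠ 0 := by exact_mod_cast (Fact.out : q.Prime).ne_zero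
  simp_rw [mul_sum]
  rw [sum_comm, sum_filter]
  refine sum_congr rfl fun n hn => ?_
  have e : ∀ t : ZMod q, cJ a b t*(g n*ps (t*(n:ZMod q)))=g n*(1/q)*∑ k ∈ Icc a b, ps (t*((n:ZMod q)-(k:ZMod q))) := fun t => by
    unfold cJ; rw [mul_assoc, sum_mul, mul_sum, mul_sum]
    refine sum_congr rfl fun k _ => ?_
    rw [show t*((n:ZMod q)-(k:ZMod q))=t*n + -t*k by ring, ps_add]; ring
  simp_rw [e]
  rw [← mul_sum, sum_comm]
  have e2 : ∀ k ∈ Icc a b, ∑ t : ZMod q, ps (t*((n:ZMod q)-(k:ZMod q)))=if n=k then (q:ℂ) else 0 := by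
    intro k hk
    rw [ps_sum]
    have : (n:ZMod q)-k=0 ↔ n=k := by
      rw [sub_eq_zero, ZMod.natCast_eq_natCast_iff', Nat.mod_eq_of_lt (hs n hn), Nat.mod_eq_of_lt (lt_of_le_of_lt (mem_Icc.1 hk).2 hb)]
    simp only [this]
  rw [sum_congr rfl e2, sum_ite_eq]
  simp only [mem_Icc]
  split_ifs
  · field_simp
  · simp

end M6a
end H12
namespace H12
section M6b
open Real Finset

variable {q : ℕ} [Fact q.Prime]

noncomputable def Kl (u v : ZMod q) : ℂ := ∑ x : ZMod q, ps (u*x+v*x⁻¹)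

lemma kl_count (s w : ZMod q) (hs : s ≠ 0) : #{z : ZMod q | (z+s)⁻¹-z⁻¹=w}≤4 := by
  have key : ∃ z0 : ZMod q, ∀ z : ZMod q, (z+s)⁻¹-z⁻¹=w → z ∈ ({0, -s, z0, -s-z0} : Finset (ZMod q)) := by
    by_cases h : ∃ z0 : ZMod q, z0 ≠ 0 ∧ z0+s ≠ 0 ∧ (z0+s)⁻¹-z0⁻¹=w
    · obtain ⟨z0, h0, h1, h2⟩ := h
      refine ⟨z0, fun z hz => ?_⟩
      simp only [mem_insert, mem_singleton]
      by_contra hc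
      push Not at hc
      obtain ⟨c0, c1, c2, c3⟩ := hc
      have c1' : z+s ≠ 0 := fun h => c1 (eq_neg_of_add_eq_zero_left h)
      rw [← h2] at hz
      field_simp at hz
      have e : s*((z-z0)*(z+z0+s))=0 := by linear_combination hz
      rcases mul_eq_zero.1 ((mul_eq_zero.1 e).resolve_left hs) with h | h
      · exact c2 (sub_eq_zero.1 h)
      · exact c3 (by linear_combination h)
    · push Not at h
      refine ⟨0, fun z hz => ?_⟩
      simp only [mem_insert, mem_singleton]
      by_contra hc
      push Not at hc
      exact h z hc.1 (fun h => hc.2.1 (eq_neg_of_add_eq_zero_left h)) hz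
  obtain ⟨z0, h⟩ := key
  refine (card_le_card (fun z hz => h z (mem_filter.1 hz).2)).trans ?_
  exact (card_insert_le _ _).trans (Nat.succ_le_succ ((card_insert_le _ _).trans (Nat.succ_le_succ (card_le_two))))

lemma Kl_moment : ∑ u : ZMod q, ∑ v : ZMod q, ‖Kl u v‖^4≤5*(q:ℝ)^4 := by
  set f : ZMod q × ZMod q → ZMod q := fun i => i.1⁻¹-i.2⁻¹ with hf
  set g : ZMod q × ZMod q → ZMod q := fun i => i.1-i.2 with hg
  have h1 : ∀ u v : ZMod q, ‖Kl u v‖^4=‖∑ i : ZMod q × ZMod q, ps (u*g i)*ps (v*f i)‖^2 := by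
    intro u v
    have : ∑ i : ZMod q × ZMod q, ps (u*g i)*ps (v*f i)=((‖Kl u v‖^2:ℝ):ℂ) := by
      rw [Complex.ofReal_pow, ← Complex.mul_conj']
      unfold Kl
      rw [map_sum, sum_mul_sum, Fintype.sum_prod_type]
      refine sum_congr rfl fun x _ => sum_congr rfl fun y _ => ?_
      rw [ps_conj, ← ps_add]; congr 1; simp only [hf, hg]; ring
    rw [this, Complex.norm_real, Real.norm_of_nonneg (by positivity)]; ring
  have h2 : ((∑ u : ZMod q, ∑ v : ZMod q, ‖Kl u v‖^4:ℝ):ℂ) =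
      q^2*∑ i : ZMod q × ZMod q, (#{j : ZMod q × ZMod q | f i=f j ∧ g i=g j}:ℂ) := by
    simp_rw [h1]
    rw [Complex.ofReal_sum]
    simp_rw [parseval]
    rw [← mul_sum, sum_comm, mul_sum, mul_sum]
    refine sum_congr rfl fun i _ => ?_
    rw [sum_comm, card_filter]
    push_cast
    rw [mul_sum, mul_sum]
    refine sum_congr rfl fun j _ => ?_
    by_cases hij : f i=f j
    · simp only [hij, if_true, true_and]
      have : ∀ u : ZMod q, ps (u*g i)*(starRingEnd ℂ) (ps (u*g j))=ps (u*(g i-g j)) := fun u => by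
        rw [ps_conj]; congr 1; ring
      simp_rw [this]
      rw [ps_sum]
      simp only [sub_eq_zero]
      split_ifs <;> ring
    · simp [hij]
  have h3 : ∀ i : ZMod q × ZMod q, #{j : ZMod q × ZMod q | f i=f j ∧ g i=g j}≤4+if i.1=i.2 then q else 0 := by
    intro i
    split_ifs with hi
    · refine le_trans ?_ (Nat.le_add_left q 4)
      calc _≤#(univ : Finset (ZMod q)) := by
            refine card_le_card_of_injOn (fun j => j.2) (fun _ _ => mem_univ _) ?_
            intro j hj k hk hjk
            simp only [coe_filter, mem_univ, true_and, Set.mem_setOf_eq, hg] at hj hk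
            have := hj.2.symm.trans hk.2
            beta_reduce at hjk
            rw [hjk] at this
            exact Prod.ext (sub_left_injective this) hjk
        _=q := by rw [card_univ, ZMod.card]
    · refine le_trans (card_le_card_of_injOn (fun j => j.2) ?_ ?_) (kl_count (g i) (f i) (sub_ne_zero.2 hi))
      · intro j hj
        simp only [coe_filter, mem_univ, true_and, Set.mem_setOf_eq] at hj ⊢
        rw [hj.1, hj.2]; simp only [hf, hg]; congr 2; ring
      · intro j hj k hk hjk
        simp only [coe_filter, mem_univ, true_and, Set.mem_setOf_eq, hg] at hj hk
        have := hj.2.symm.trans hk.2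
        beta_reduce at hjk
        rw [hjk] at this
        exact Prod.ext (sub_left_injective this) hjk
  have h4 : ∑ i : ZMod q × ZMod q, #{j : ZMod q × ZMod q | f i=f j ∧ g i=g j}≤5*q^2 := by
    refine (sum_le_sum fun i _ => h3 i).trans (le_of_eq ?_)
    rw [sum_add_distrib, sum_const, card_univ, Fintype.card_prod, ZMod.card, Fintype.sum_prod_type]
    simp only [sum_ite_eq, mem_univ, if_true, sum_const, card_univ, ZMod.card, smul_eq_mul]; ring
  have h5 : ∑ u : ZMod q, ∑ v : ZMod q, ‖Kl u v‖^4=(q:ℝ)^2*((∑ i : ZMod q × ZMod q, #{j : ZMod q × ZMod q | f i=f j ∧ g i=g j}:ℕ):ℝ) := by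
    exact_mod_cast h2
  rw [h5]
  calc _≤(q:ℝ)^2*((5*q^2:ℕ):ℝ) := by gcongr
    _=_ := by push_cast; ring

lemma Kl_bound (t h : ZMod q) (hh : h ≠ 0) : ‖Kl t h‖^4≤10*(q:ℝ)^3 := by
  have hq2 : (2:ℝ)≤q := by exact_mod_cast (Fact.out : q.Prime).two_le
  by_cases ht : t=0
  · have : Kl t h=0 := by
      unfold Kl
      have := Equiv.sum_comp (Equiv.inv (ZMod q)) (fun x => ps (x*h))
      rw [ps_sum, if_neg hh] at this
      rw [← this]
      refine sum_congr rfl fun x _ => ?_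
      rw [ht, zero_mul, zero_add, mul_comm]; rfl
    rw [this]; norm_num
  · have e : ∀ r : ZMod q, r ≠ 0 → Kl (t*r) (h*r⁻¹)=Kl t h := by
      intro r hr
      unfold Kl
      rw [← Equiv.sum_comp (Equiv.mulLeft₀ r hr) (fun x => ps (t*x+h*x⁻¹))]
      refine sum_congr rfl fun x _ => ?_
      change _=ps (t*(r*x)+h*(r*x)⁻¹)
      simp only [mul_inv, mul_assoc]
    have h1 : ((q:ℝ)-1)*‖Kl t h‖^4≤∑ u : ZMod q, ∑ v : ZMod q, ‖Kl u v‖^4 := by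
      rw [← Equiv.sum_comp (Equiv.mulLeft₀ t ht) (fun u => ∑ v : ZMod q, ‖Kl u v‖^4)]
      calc ((q:ℝ)-1)*‖Kl t h‖^4=∑ r ∈ univ.erase (0:ZMod q), ‖Kl (t*r) (h*r⁻¹)‖^4 := by
            rw [sum_congr rfl (fun r hr => by rw [e r (ne_of_mem_erase hr)]), sum_const, card_erase_of_mem (mem_univ _), card_univ, ZMod.card,
              nsmul_eq_mul, Nat.cast_sub (by exact_mod_cast (by linarith : (1:ℝ)≤q))]; simp
        _≤∑ r : ZMod q, ‖Kl (t*r) (h*r⁻¹)‖^4 := sum_le_sum_of_subset_of_nonneg (erase_subset _ _) (fun _ _ _ => by positivity)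
        _≤_ := sum_le_sum fun r _ => single_le_sum (f := fun v => ‖Kl (t*r) v‖^4) (fun _ _ => by positivity) (mem_univ _)
    have h2 := h1.trans Kl_moment
    have h3 : (q:ℝ)/2*‖Kl t h‖^4≤5*(q:ℝ)^4 := (mul_le_mul_of_nonneg_right (by linarith) (by positivity)).trans h2
    have hq0 : (0:ℝ)<q := by linarith
    refine le_of_mul_le_mul_left (h3.trans (le_of_eq ?_)) (by positivity : (0:ℝ)<q/2)
    ring

lemma incomplete (h : ZMod q) (hh : h ≠ 0) (a b:ℕ) (hb : b<q) :
    ‖∑ n ∈ Icc a b, ps (h*(n:ZMod q)⁻¹)‖≤(2+log q)*(2*(q:ℝ)^(3/4:ℝ)) := by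
  have hq0 : (0:ℝ)≤q := by positivity
  have e : Icc a b=(range q).filter (fun n : ℕ => a≤n ∧ n≤b) := by
    ext n; simp only [mem_Icc, mem_filter, mem_range]; omega
  rw [e, compl a b hb _ (fun n hn => mem_range.1 hn)]
  have hk : ∀ t : ZMod q, ‖∑ n ∈ range q, ps (h*(n:ZMod q)⁻¹)*ps (t*(n:ZMod q))‖≤2*(q:ℝ)^(3/4:ℝ) := by
    intro t
    have e1 : ∑ n ∈ range q, ps (h*(n:ZMod q)⁻¹)*ps (t*(n:ZMod q))=Kl t h := by
      unfold Kl
      refine sum_bij' (fun n _ => (n : ZMod q)) (fun x _ => x.val) (fun _ _ => mem_univ _) (fun x _ => mem_range.2 (ZMod.val_lt x))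
        (fun n hn => ZMod.val_cast_of_lt (mem_range.1 hn)) (fun x _ => ZMod.natCast_rightInverse x) (fun n _ => ?_)
      rw [← ps_add, add_comm]
    rw [e1]
    refine le_of_pow_le_pow_left₀ (n := 4) (by norm_num) (by positivity) ((Kl_bound t h hh).trans ?_)
    rw [mul_pow, ← rpow_natCast ((q:ℝ)^(3/4:ℝ)), ← rpow_mul hq0]
    norm_num
    gcongr; norm_num
  refine (norm_sum_le _ _).trans ?_
  calc _≤∑ t : ZMod q, bq t*(2*(q:ℝ)^(3/4:ℝ)) := sum_le_sum fun t _ => by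
        rw [norm_mul]; exact mul_le_mul (cJ_norm a b hb t) (hk t) (norm_nonneg _) (bq_nonneg t)
    _≤_ := by rw [← sum_mul]; exact mul_le_mul_of_nonneg_right bq_sum (by positivity)

end M6b
end H12
namespace H12
section M6c
open Real Finset

lemma divisor_bound (ε:ℝ) (hε : 0<ε) : ∃ C : ℝ, 1≤C ∧ ∀ n : ℕ, n ≠ 0 → (#n.divisors:ℝ)≤C*(n:ℝ)^ε := by
  have hl2 : 0< log 2 := log_pos (by norm_num)
  set K : ℝ := 1+1/(ε*log 2) with hK
  have hK1 : 1 ≤ K := by have : 0 < 1/(ε*log 2) := by positivity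
                         linarith
  obtain ⟨P, hP⟩ := exists_nat_gt (exp (log 2/ε))
  refine ⟨K^P, one_le_pow₀ hK1, fun n hn => ?_⟩
  rw [Nat.card_divisors hn]
  have e : (n:ℝ)^ε=∏ p ∈ n.primeFactors, ((p:ℝ)^(ε*(n.factorization p:ℝ))) := by
    conv_lhs => rw [← Nat.prod_factorization_pow_eq_self hn]
    rw [Finsupp.prod, Nat.support_factorization, Nat.cast_prod, ← finsetProd_rpow _ _ (fun _ _ => by positivity)]
    refine prod_congr rfl fun p _ => ?_
    rw [Nat.cast_pow, ← rpow_natCast, ← rpow_mul (by positivity), mul_comm]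
  have h1 : ∀ p ∈ n.primeFactors, (n.factorization p+1:ℝ)≤(if p<P then K else 1)*(p:ℝ)^(ε*(n.factorization p:ℝ)) := by
    intro p hp
    have hp2 : (2:ℝ)≤p := by exact_mod_cast (Nat.prime_of_mem_primeFactors hp).two_le
    set a : ℝ := (n.factorization p:ℝ)
    have ha : 0≤a := by positivity
    rw [rpow_def_of_pos (by linarith)]
    split_ifs with h
    · have : ε*a*log 2+1≤exp (log p*(ε*a)) := (add_one_le_exp _).trans (exp_le_exp.2 (by
        have := log_le_log (by norm_num) hp2
        have := mul_le_mul_of_nonneg_right this (by positivity : 0≤ε*a); linarith))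
      have e2 : a+1≤K*(ε*a*log 2+1) := by
        have : K*(ε*a*log 2+1)=a+1+(ε*a*log 2+1/(ε*log 2)) := by rw [hK]; field_simp; ring
        have : 0≤ε*a*log 2+1/(ε*log 2) := by positivity
        linarith
      exact e2.trans (mul_le_mul_of_nonneg_left this (by linarith))
    · push Not at h
      have hPp : exp (log 2/ε)≤p := hP.le.trans (by exact_mod_cast h)
      have : log 2≤ log p*ε := by
        rw [← div_le_iff₀ hε]; exact (le_log_iff_exp_le (by linarith)).2 hPp
      have h2 : (n.factorization p+1:ℝ)≤(2:ℝ)^(n.factorization p) := by exact_mod_cast Nat.succ_le_of_lt Nat.lt_two_pow_self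
      rw [one_mul]
      refine h2.trans ?_
      rw [← rpow_natCast, rpow_def_of_pos (by norm_num)]
      refine exp_le_exp.2 ?_
      have := mul_le_mul_of_nonneg_right this ha
      linarith
  push_cast
  rw [e]
  refine (prod_le_prod (fun _ _ => by positivity) h1).trans ?_
  rw [prod_mul_distrib]
  refine mul_le_mul_of_nonneg_right ?_ (prod_nonneg fun _ _ => by positivity)
  rw [prod_ite, prod_const_one, mul_one, prod_const]
  refine pow_le_pow_right₀ hK1 ?_
  refine (card_le_card (t := range P) (fun x hx => mem_range.2 (mem_filter.1 hx).2)).trans (by simp)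

noncomputable def nu (q N:ℕ) (l : ZMod q) : ℕ := #{n ∈ Icc 1 N ×ˢ Icc 1 N | (n.1:ZMod q)⁻¹-(n.2:ZMod q)⁻¹=l}

lemma cast_ne {q : ℕ} {n : ℕ} (h1 : 1≤n) (h2 : n<q) : (n : ZMod q) ≠ 0 := by
  rw [Ne, ZMod.natCast_eq_zero_iff]
  exact fun h => absurd (Nat.le_of_dvd (by omega) h) (by omega)

lemma cast_inj {q : ℕ} {m n : ℕ} (hm : m<q) (hn : n<q) (h : (m : ZMod q)=n) : m=n := by
  rw [ZMod.natCast_eq_natCast_iff'] at h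
  rwa [Nat.mod_eq_of_lt hm, Nat.mod_eq_of_lt hn] at h

set_option maxHeartbeats 1000000 in
lemma nu_bound (ε:ℝ) (hε : 0<ε) : ∃ C : ℝ, 1≤C ∧ ∀ q : ℕ, q.Prime → ∀ N : ℕ, N<q → ∀ l : ZMod q, l ≠ 0 →
    (nu q N l:ℝ)≤C*(q:ℝ)^ε*(1+N*√N/√q) := by
  obtain ⟨C, hC1, hC⟩ := divisor_bound (ε/2) (by positivity)
  refine ⟨8*C*(3:ℝ)^(ε/2), ?_, ?_⟩
  · have : (1:ℝ)≤(3:ℝ)^(ε/2) := one_le_rpow (by norm_num) (by positivity)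
    nlinarith
  intro q hq N hN l hl
  haveI : Fact q.Prime := ⟨hq⟩
  rcases Nat.eq_zero_or_pos N with rfl | hN0
  · simp [nu]; positivity
  have hq0 : (0:ℝ)<q := by exact_mod_cast hq.pos
  have hNr : (0:ℝ)<N := by exact_mod_cast hN0
  set sq := √(q:ℝ) with hsq
  set sN := √(N:ℝ) with hsN
  have sq0 : 0< sq := sqrt_pos.2 hq0
  have sN0 : 0< sN := sqrt_pos.2 hNr
  have sq2 : sq^2=q := sq_sqrt hq0.le
  have sN2 : sN^2=N := sq_sqrt hNr.le
  have hlt : sN< sq := sqrt_lt_sqrt hNr.le (by exact_mod_cast hN)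
  have hN1 : (1:ℝ)≤N := by exact_mod_cast hN0
  have sN1 : 1≤ sN := one_le_sqrt.2 hN1
  have sq1 : 1≤ sq := by linarith
  have hn0 : 0<⌊sq*sN⌋₊ := Nat.floor_pos.2 (by nlinarith)
  obtain ⟨j, b, hb0, hbn, hab⟩ := Real.exists_int_int_abs_mul_sub_le ((l.val:ℝ)/q) hn0
  have hb : (b:ℝ)≤ sq*sN := by
    have h1 : (b:ℝ)≤(⌊sq*sN⌋₊:ℝ) := by exact_mod_cast hbn
    exact h1.trans (Nat.floor_le (by positivity))
  have hb0r : (0:ℝ)<b := by exact_mod_cast hb0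
  set a : ℤ := b*l.val-j*q with ha
  have hal : |(a:ℝ)| ≤ sq/sN := by
    have e : (a:ℝ)=q*(b*((l.val:ℝ)/q)-j) := by rw [ha]; push_cast; field_simp
    rw [e, abs_mul, abs_of_pos hq0]
    have h2 : sq*sN≤(⌊sq*sN⌋₊:ℝ)+1 := (Nat.lt_floor_add_one _).le
    calc _≤(q:ℝ)*(1/((⌊sq*sN⌋₊:ℝ)+1)) := by gcongr
      _≤q*(1/(sq*sN)) := by gcongr
      _=_ := by rw [← sq2]; field_simp
  have hbq : (b:ℝ)<q := by nlinarith
  have hbq' : b<q := by exact_mod_cast hbq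
  have hbz : ¬ (q:ℤ) ∣ b := fun h => absurd (Int.le_of_dvd hb0 h) (by omega)
  have az : (a : ZMod q)=(b:ZMod q)*l := by rw [ha]; push_cast; simp
  have bz : (b : ZMod q) ≠ 0 := by rwa [Ne, ZMod.intCast_zmod_eq_zero_iff_dvd]
  have a0 : a ≠ 0 := by
    intro h; rw [h] at az; simp only [Int.cast_zero] at az
    exact mul_ne_zero bz hl az.symm
  set K : ℝ := 2*(N*sN/sq) with hK
  have hK0 : 0≤K := by positivity
  set W : ℤ → ℤ := fun k => a*(q*k)-b^2 with hW
  have hW0 : ∀ k, W k ≠ 0 := by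
    intro k h
    apply hbz
    have hp : Prime (q:ℤ) := Nat.prime_iff_prime_int.1 hq
    exact hp.dvd_of_dvd_pow (n := 2) ⟨a*k, by simp only [hW] at h; linarith⟩
  have hWb : ∀ k : ℤ, |(k:ℝ)| ≤ K → |(W k:ℝ)| ≤ 3*(q:ℝ)^2 := by
    intro k hk
    have e : (W k:ℝ)=a*(q*k)-b^2 := by simp only [hW]; push_cast; ring
    rw [e]
    have h1 : |(a:ℝ)*(q*k)| ≤ (sq/sN)*(q*K) := by
      rw [abs_mul, abs_mul, abs_of_pos hq0]; gcongr
    have h2 : (sq/sN)*(q*K)=2*(q*N) := by rw [hK]; field_simp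
    have h3 : |(b:ℝ)^2| ≤ q*N := by
      rw [abs_of_nonneg (by positivity)]
      calc (b:ℝ)^2≤(sq*sN)^2 := by gcongr
        _=_ := by rw [mul_pow, sq2, sN2]
    have h4 : (q:ℝ)*N≤q^2 := by rw [pow_two]; gcongr
    have := abs_sub (a*(q*k):ℝ) (b^2)
    linarith
  set Dv : ℤ → Finset ℤ := fun w => w.natAbs.divisors.image (fun d : ℕ => (d:ℤ)) ∪ w.natAbs.divisors.image (fun d : ℕ => -(d:ℤ)) with hDv
  have hDc : ∀ w, #(Dv w)≤2*#w.natAbs.divisors := fun w => by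
    refine (card_union_le _ _).trans ?_
    have := card_image_le (s := w.natAbs.divisors) (f := fun d : ℕ => (d:ℤ))
    have := card_image_le (s := w.natAbs.divisors) (f := fun d : ℕ => -(d:ℤ))
    omega
  have hDm : ∀ w d : ℤ, w ≠ 0 → d ∣ w → d ∈ Dv w := by
    intro w d hw hd
    simp only [hDv, mem_union, mem_image]
    have hm : d.natAbs ∈ w.natAbs.divisors := Nat.mem_divisors.2 ⟨Int.natAbs_dvd_natAbs.2 hd, by simpa using hw⟩
    rcases Int.natAbs_eq d with h | h
    · exact Or.inl ⟨_, hm, h.symm⟩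
    · exact Or.inr ⟨_, hm, h.symm⟩
  set T : Finset ℤ := (Icc (-(⌊K⌋₊:ℤ)) ⌊K⌋₊).biUnion (fun k => Dv (W k)) with hT
  have hcard : nu q N l≤#T := by
    unfold nu
    refine card_le_card_of_injOn (fun n => a*(n.1:ℤ)-b) ?_ ?_
    · intro n hn
      simp only [coe_filter, mem_product, mem_Icc] at hn
      obtain ⟨⟨⟨h1, h2⟩, h3, h4⟩, h5⟩ := hn
      have z1 := cast_ne h1 (h2.trans_lt hN)
      have z2 := cast_ne h3 (h4.trans_lt hN)
      have e1 : ((a*n.1*n.2-b*(n.2-n.1):ℤ) : ZMod q)=0 := by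
        push_cast; rw [az, ← h5]; field_simp; ring
      rw [ZMod.intCast_zmod_eq_zero_iff_dvd] at e1
      obtain ⟨k, hk⟩ := e1
      have hkr : (a:ℝ)*n.1*n.2-b*(n.2-n.1)=q*k := by exact_mod_cast hk
      have n1N : (n.1:ℝ)≤N := by exact_mod_cast h2
      have n2N : (n.2:ℝ)≤N := by exact_mod_cast h4
      have hkK : |(k:ℝ)| ≤ K := by
        have q1 : |(a:ℝ)*n.1*n.2| ≤ sq/sN*N*N := by
          rw [abs_mul, abs_mul, Nat.abs_cast, Nat.abs_cast]; gcongr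
        have q2 : |(b:ℝ)*(n.2-n.1)| ≤ sq*sN*N := by
          rw [abs_mul, abs_of_pos hb0r]
          have : |(n.2:ℝ)-n.1| ≤ N := abs_le.2 ⟨by linarith [(Nat.cast_nonneg n.2 : (0:ℝ)≤n.2)], by linarith [(Nat.cast_nonneg n.1 : (0:ℝ)≤n.1)]⟩
          gcongr
        have q3 : |(q:ℝ)*k| ≤ sq/sN*N*N+sq*sN*N := by
          rw [← hkr]; exact (abs_sub _ _).trans (add_le_add q1 q2)
        rw [abs_mul, abs_of_pos hq0] at q3
        refine le_of_mul_le_mul_left (q3.trans (le_of_eq ?_)) hq0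
        rw [hK, ← sq2, ← sN2]; field_simp; ring
      simp only [hT, coe_biUnion, Set.mem_iUnion, mem_coe, mem_Icc]
      have hka : (k.natAbs:ℝ)≤K := by rwa [Nat.cast_natAbs, Int.cast_abs]
      have := Nat.le_floor hka
      refine ⟨k, ⟨by omega, by omega⟩, hDm _ _ (hW0 k) ⟨a*n.2+b, ?_⟩⟩
      simp only [hW]; rw [← hk]; ring
    · intro n hn m hm hnm
      simp only [coe_filter, mem_product, mem_Icc] at hn hm
      obtain ⟨⟨⟨h1, h2⟩, h3, h4⟩, h5⟩ := hn
      obtain ⟨⟨⟨g1, g2⟩, g3, g4⟩, g5⟩ := hm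
      have e1 : (n.1:ℤ)=m.1 := mul_left_cancel₀ a0 (by simpa using hnm)
      have e1' : n.1=m.1 := by exact_mod_cast e1
      refine Prod.ext e1' ?_
      rw [← g5, e1'] at h5
      exact cast_inj (h4.trans_lt hN) (g4.trans_lt hN) (inv_injective (sub_right_injective h5))
  have hT2 : (#T:ℝ)≤(2*K+1)*(2*(C*(3*(q:ℝ)^2)^(ε/2))) := by
    have h1 : (#T:ℝ)≤∑ k ∈ Icc (-(⌊K⌋₊:ℤ)) ⌊K⌋₊, (#(Dv (W k)):ℝ) := by exact_mod_cast card_biUnion_le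
    have h2 : ∀ k ∈ Icc (-(⌊K⌋₊:ℤ)) ⌊K⌋₊, (#(Dv (W k)):ℝ)≤2*(C*(3*(q:ℝ)^2)^(ε/2)) := by
      intro k hk
      rw [mem_Icc] at hk
      have hkK : |(k:ℝ)| ≤ K := by
        refine le_trans ?_ (Nat.floor_le hK0)
        rw [abs_le]; exact ⟨by exact_mod_cast hk.1, by exact_mod_cast hk.2⟩
      calc (#(Dv (W k)):ℝ)≤2*(#(W k).natAbs.divisors:ℝ) := by exact_mod_cast hDc _
        _≤2*(C*((W k).natAbs:ℝ)^(ε/2)) := by gcongr; exact hC _ (by simpa using hW0 k)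
        _≤_ := by
          have := hWb k hkK
          rw [← Int.cast_abs, ← Nat.cast_natAbs] at this
          gcongr
    refine h1.trans ((sum_le_sum h2).trans ?_)
    rw [sum_const, nsmul_eq_mul, Int.card_Icc]
    refine mul_le_mul_of_nonneg_right ?_ (by positivity)
    have : ((⌊K⌋₊:ℤ)+1-(-(⌊K⌋₊:ℤ))).toNat=2*⌊K⌋₊+1 := by omega
    rw [this]; push_cast
    linarith [Nat.floor_le hK0]
  have hcr : (nu q N l:ℝ)≤#T := by exact_mod_cast hcard
  refine hcr.trans (hT2.trans ?_)
  have e3 : (3*(q:ℝ)^2)^(ε/2)=(3:ℝ)^(ε/2)*(q:ℝ)^ε := by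
    rw [mul_rpow (by norm_num) (by positivity), ← rpow_natCast, ← rpow_mul hq0.le]; norm_num
    left; congr 1; ring
  rw [e3, hK]
  have hp : 0≤C*(3:ℝ)^(ε/2)*(q:ℝ)^ε := by positivity
  have hx : 0≤N*sN/sq := by positivity
  nlinarith [mul_nonneg hp hx]

lemma nu_sum (q:ℕ) [Fact q.Prime] (N:ℕ) : ∑ l : ZMod q, nu q N l=N^2 := by
  unfold nu
  rw [← card_eq_sum_card_fiberwise (fun _ _ => mem_coe.2 (mem_univ _)), card_product, Nat.card_Icc]; simp [pow_two]

lemma nu_sq (ε:ℝ) (hε : 0<ε) : ∃ C : ℝ, 1≤C ∧ ∀ q : ℕ, ∀ _ : Fact q.Prime, ∀ N : ℕ, N<q →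
    ∑ l : ZMod q, (nu q N l:ℝ)^2≤C*(q:ℝ)^ε*(N^2*(1+N*√N/√q)) := by
  obtain ⟨C, hC1, hC⟩ := nu_bound ε hε
  refine ⟨C+1, by linarith, fun q hq N hN => ?_⟩
  have hq1 : (1:ℝ)≤q := by exact_mod_cast hq.out.one_le
  have hqe : 1≤(q:ℝ)^ε := one_le_rpow hq1 hε.le
  have h0 : nu q N 0≤N := by
    unfold nu
    refine le_trans (card_le_card_of_injOn (t := Icc 1 N) (fun n => n.1) ?_ ?_) (by simp)
    · intro n hn
      simp only [coe_filter, mem_product] at hn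
      exact hn.1.1
    · intro n hn m hm hnm
      simp only [coe_filter, mem_product, mem_Icc] at hn hm
      have e1 : n.1=m.1 := hnm
      refine Prod.ext e1 ?_
      have h5 := hn.2.trans hm.2.symm
      rw [e1] at h5
      exact cast_inj (hn.1.2.2.trans_lt hN) (hm.1.2.2.trans_lt hN) (inv_injective (sub_right_injective h5))
  have h0' : (nu q N 0:ℝ)≤N := by exact_mod_cast h0
  set B := C*(q:ℝ)^ε*(1+N*√N/√q) with hB
  have hB0 : 0≤B := by positivity
  have key : ∀ l : ZMod q, (nu q N l:ℝ)^2≤B*nu q N l+if l=0 then (N:ℝ)^2 else 0 := by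
    intro l
    by_cases hl : l=0
    · rw [hl, if_pos rfl]
      have : (nu q N 0:ℝ)^2≤N^2 := by gcongr
      have : 0≤B*nu q N 0 := by positivity
      linarith
    · rw [if_neg hl, add_zero, pow_two]
      exact mul_le_mul_of_nonneg_right (hC q hq.out N hN l hl) (by positivity)
  refine (sum_le_sum fun l _ => key l).trans ?_
  rw [sum_add_distrib, ← mul_sum, sum_ite_eq' , if_pos (mem_univ _), ← Nat.cast_sum, nu_sum, hB]
  push_cast
  have h1 : (N:ℝ)^2≤(q:ℝ)^ε*(N^2*(1+N*√N/√q)) := by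
    have : 0≤N*√N/√(q:ℝ) := by positivity
    calc (N:ℝ)^2=1*(N^2*1) := by ring
      _≤_ := by gcongr; linarith
  linarith

end M6c
end H12
namespace H12
section M6d
open Real Finset

variable {q : ℕ} [Fact q.Prime]

lemma nu_fiber (N:ℕ) (F : ZMod q → ℝ) :
    ∑ i ∈ Icc 1 N ×ˢ Icc 1 N, F ((i.1:ZMod q)⁻¹-(i.2:ZMod q)⁻¹)=∑ l : ZMod q, (nu q N l:ℝ)*F l := by
  rw [← sum_fiberwise (Icc 1 N ×ˢ Icc 1 N) (fun i => (i.1:ZMod q)⁻¹-(i.2:ZMod q)⁻¹)]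
  refine sum_congr rfl fun l _ => ?_
  rw [sum_congr rfl (fun i hi => by rw [(mem_filter.1 hi).2]), sum_const, nsmul_eq_mul]; rfl

lemma E_four (h : ZMod q) (hh : h ≠ 0) (M:ℕ) :
    ∑ l : ZMod q, ‖∑ m ∈ Icc 1 M, ps (l*(h*(m:ZMod q)⁻¹))‖^4=q*∑ l : ZMod q, (nu q M l:ℝ)^2 := by
  set f : ℕ × ℕ → ZMod q := fun i => h*((i.1:ZMod q)⁻¹-(i.2:ZMod q)⁻¹) with hf
  have h1 : ∀ l : ZMod q, ‖∑ m ∈ Icc 1 M, ps (l*(h*(m:ZMod q)⁻¹))‖^4=‖∑ i ∈ Icc 1 M ×ˢ Icc 1 M, 1*ps (l*f i)‖^2 := by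
    intro l
    have : ∑ i ∈ Icc 1 M ×ˢ Icc 1 M, 1*ps (l*f i)=((‖∑ m ∈ Icc 1 M, ps (l*(h*(m:ZMod q)⁻¹))‖^2:ℝ):ℂ) := by
      rw [Complex.ofReal_pow, ← Complex.mul_conj', map_sum, sum_mul_sum, sum_product]
      refine sum_congr rfl fun x _ => sum_congr rfl fun y _ => ?_
      rw [ps_conj, one_mul]; congr 1; simp only [hf]; ring
    rw [this, Complex.norm_real, Real.norm_of_nonneg (by positivity)]; ring
  have h2 := parseval (Icc 1 M ×ˢ Icc 1 M) (fun _ => 1) f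
  simp only [map_one, mul_one] at h2
  simp_rw [h1]
  have h3 : ∀ i j : ℕ × ℕ, (f i=f j)=((j.1:ZMod q)⁻¹-(j.2:ZMod q)⁻¹=(i.1:ZMod q)⁻¹-(i.2:ZMod q)⁻¹) := by
    intro i j; rw [hf]; beta_reduce; rw [mul_right_inj' hh]; exact propext eq_comm
  simp_rw [h3, ← sum_filter, sum_const, nsmul_eq_mul, mul_one] at h2
  have h4 : ∑ l : ZMod q, ‖∑ i ∈ Icc 1 M ×ˢ Icc 1 M, 1*ps (l*f i)‖^2=q*∑ i ∈ Icc 1 M ×ˢ Icc 1 M, (nu q M ((i.1:ZMod q)⁻¹-(i.2:ZMod q)⁻¹):ℝ) := by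
    unfold nu; exact_mod_cast h2
  rw [h4, nu_fiber M (fun l => (nu q M l:ℝ))]
  simp only [pow_two]

lemma bil (h : ZMod q) (hh : h ≠ 0) (M N:ℕ) (α β : ℕ → ℂ) (A B X:ℝ) (hA : 0≤A) (hB : 0≤B) (hX : 0≤X)
    (hα : ∀ m : ℕ, ‖α m‖≤A) (hβ : ∀ n : ℕ, ‖β n‖≤B)
    (hb : (M:ℝ)^4*N^4*q*(∑ l : ZMod q, (nu q M l:ℝ)^2)*(∑ l : ZMod q, (nu q N l:ℝ)^2)≤X^8) :
    ‖∑ m ∈ Icc 1 M, ∑ n ∈ Icc 1 N, α m*β n*ps (h*((m:ZMod q)⁻¹*(n:ZMod q)⁻¹))‖≤A*B*X := by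
  set S := ∑ m ∈ Icc 1 M, ∑ n ∈ Icc 1 N, α m*β n*ps (h*((m:ZMod q)⁻¹*(n:ZMod q)⁻¹)) with hS
  set I : ℕ → ℂ := fun m => ∑ n ∈ Icc 1 N, β n*ps (h*((m:ZMod q)⁻¹*(n:ZMod q)⁻¹)) with hI
  set E : ZMod q → ℂ := fun l => ∑ m ∈ Icc 1 M, ps (l*(h*(m:ZMod q)⁻¹)) with hE
  have s1 : ‖S‖≤A*∑ m ∈ Icc 1 M, ‖I m‖ := by
    rw [hS, mul_sum]
    refine (norm_sum_le _ _).trans (sum_le_sum fun m _ => ?_)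
    have : ∑ n ∈ Icc 1 N, α m*β n*ps (h*((m:ZMod q)⁻¹*(n:ZMod q)⁻¹))=α m*I m := by
      rw [hI]; beta_reduce; rw [mul_sum]; exact sum_congr rfl fun n _ => by ring
    rw [this, norm_mul]; exact mul_le_mul_of_nonneg_right (hα m) (norm_nonneg _)
  have s2 : (∑ m ∈ Icc 1 M, ‖I m‖)^2≤M*∑ m ∈ Icc 1 M, ‖I m‖^2 := by
    have := sq_sum_le_card_mul_sum_sq (s := Icc 1 M) (f := fun m => ‖I m‖)
    simpa using this
  have s3 : ((∑ m ∈ Icc 1 M, ‖I m‖^2:ℝ):ℂ)=∑ i ∈ Icc 1 N ×ˢ Icc 1 N, β i.1*(starRingEnd ℂ) (β i.2)*E ((i.1:ZMod q)⁻¹-(i.2:ZMod q)⁻¹) := by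
    rw [Complex.ofReal_sum]
    simp_rw [hE, mul_sum]
    rw [sum_comm]
    refine sum_congr rfl fun m _ => ?_
    rw [Complex.ofReal_pow, ← Complex.mul_conj', hI]
    beta_reduce
    rw [map_sum, sum_mul_sum, sum_product]
    refine sum_congr rfl fun x _ => sum_congr rfl fun y _ => ?_
    rw [map_mul, mul_mul_mul_comm, ps_conj]; congr 2; ring
  have s4 : ∑ m ∈ Icc 1 M, ‖I m‖^2≤B^2*∑ l : ZMod q, (nu q N l:ℝ)*‖E l‖ := by
    have e : ∑ m ∈ Icc 1 M, ‖I m‖^2=‖((∑ m ∈ Icc 1 M, ‖I m‖^2:ℝ):ℂ)‖ := by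
      rw [Complex.norm_real, Real.norm_of_nonneg (sum_nonneg fun _ _ => by positivity)]
    rw [e, s3, ← nu_fiber N (fun l => ‖E l‖), mul_sum]
    refine (norm_sum_le _ _).trans (sum_le_sum fun i _ => ?_)
    rw [norm_mul, norm_mul, RCLike.norm_conj, pow_two]
    refine mul_le_mul_of_nonneg_right ?_ (norm_nonneg _)
    exact mul_le_mul (hβ _) (hβ _) (norm_nonneg _) hB
  set P := ∑ l : ZMod q, (nu q N l:ℝ)*‖E l‖ with hP
  have hP0 : 0≤P := sum_nonneg fun _ _ => by positivity
  have s5 : P^2≤N^2*∑ l : ZMod q, (nu q N l:ℝ)*‖E l‖^2 := by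
    have := sum_sq_le_sum_mul_sum_of_sq_eq_mul univ (r := fun l : ZMod q => (nu q N l:ℝ)*‖E l‖) (f := fun l => (nu q N l:ℝ))
      (g := fun l => (nu q N l:ℝ)*‖E l‖^2) (fun _ _ => by positivity) (fun _ _ => by positivity) (fun _ _ => by ring)
    rw [← Nat.cast_sum, nu_sum] at this
    exact_mod_cast this
  have s6 : (∑ l : ZMod q, (nu q N l:ℝ)*‖E l‖^2)^2≤(∑ l : ZMod q, (nu q N l:ℝ)^2)*(q*∑ l : ZMod q, (nu q M l:ℝ)^2) := by
    rw [← E_four h hh M]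
    refine (sum_mul_sq_le_sq_mul_sq univ _ _).trans (le_of_eq ?_)
    congr 1
    exact sum_congr rfl fun l _ => by ring
  have s7 : P^4≤(N:ℝ)^4*((∑ l : ZMod q, (nu q N l:ℝ)^2)*(q*∑ l : ZMod q, (nu q M l:ℝ)^2)) := by
    calc P^4=(P^2)^2 := by ring
      _≤(N^2*∑ l : ZMod q, (nu q N l:ℝ)*‖E l‖^2)^2 := by gcongr
      _=(N:ℝ)^4*(∑ l : ZMod q, (nu q N l:ℝ)*‖E l‖^2)^2 := by ring
      _≤_ := by gcongr
  have s8 : ‖S‖^2≤A^2*(M*(B^2*P)) := by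
    calc ‖S‖^2≤(A*∑ m ∈ Icc 1 M, ‖I m‖)^2 := by gcongr
      _=A^2*(∑ m ∈ Icc 1 M, ‖I m‖)^2 := by ring
      _≤A^2*(M*(B^2*P)) := by
        gcongr; exact s2.trans (by gcongr)
  refine le_of_pow_le_pow_left₀ (n := 8) (by norm_num) (by positivity) ?_
  calc ‖S‖^8=(‖S‖^2)^4 := by ring
    _≤(A^2*(M*(B^2*P)))^4 := by gcongr
    _=A^8*B^8*(M^4*P^4) := by ring
    _≤A^8*B^8*((M:ℝ)^4*((N:ℝ)^4*((∑ l : ZMod q, (nu q N l:ℝ)^2)*(q*∑ l : ZMod q, (nu q M l:ℝ)^2)))) := by gcongr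
    _=A^8*B^8*((M:ℝ)^4*N^4*q*(∑ l : ZMod q, (nu q M l:ℝ)^2)*(∑ l : ZMod q, (nu q N l:ℝ)^2)) := by ring
    _≤A^8*B^8*X^8 := by gcongr
    _=_ := by ring

set_option maxHeartbeats 1000000 in
/-- numerical size of the bilinear bound -/
lemma bil_num : ∃ C : ℝ, 1≤C ∧ ∀ q : ℕ, ∀ _ : Fact q.Prime, ∀ M N : ℕ, M<q → N<q → (M:ℝ)*N≤2*q →
    (M:ℝ)≤2*(q:ℝ)^(4/5:ℝ) → (N:ℝ)≤2*(q:ℝ)^(4/5:ℝ) →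
    (M:ℝ)^4*N^4*q*(∑ l : ZMod q, (nu q M l:ℝ)^2)*(∑ l : ZMod q, (nu q N l:ℝ)^2)≤(C*(q:ℝ)^(193/200:ℝ))^8 := by
  obtain ⟨C, hC1, hC⟩ := nu_sq (1/100) (by norm_num)
  refine ⟨C*4, by linarith, fun q hq M N hM hN hMN hM' hN' => ?_⟩
  have hq1 : (1:ℝ)≤q := by exact_mod_cast hq.out.one_le
  have hq0 : (0:ℝ)<q := by linarith
  have g : ∀ M : ℕ, (M:ℝ)≤2*(q:ℝ)^(4/5:ℝ) → M*√M/√q≤4*(q:ℝ)^(7/10:ℝ) := by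
    intro M hM
    rw [sqrt_eq_rpow, sqrt_eq_rpow, div_le_iff₀ (by positivity), mul_assoc, ← rpow_add hq0]
    have h1 : ((M:ℝ))^(1/2:ℝ)≤2*(q:ℝ)^(2/5:ℝ) := by
      calc ((M:ℝ))^(1/2:ℝ)≤(2*(q:ℝ)^(4/5:ℝ))^(1/2:ℝ) := by gcongr
        _=(2:ℝ)^(1/2:ℝ)*(q:ℝ)^(2/5:ℝ) := by rw [mul_rpow (by norm_num) (by positivity), ← rpow_mul hq0.le]; norm_num
        _≤(2:ℝ)^(1:ℝ)*(q:ℝ)^(2/5:ℝ) := by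
          gcongr; · norm_num
          norm_num
        _=_ := by rw [rpow_one]
    calc (M:ℝ)*(M:ℝ)^(1/2:ℝ)≤(2*(q:ℝ)^(4/5:ℝ))*(2*(q:ℝ)^(2/5:ℝ)) := by gcongr
      _=4*(q:ℝ)^(4/5+2/5:ℝ) := by rw [rpow_add hq0]; ring
      _=_ := by norm_num
  have gm := g M hM'
  have gn := g N hN'
  have gmn : (M*√M/√q)*(N*√N/√q)≤4*(q:ℝ)^(7/10:ℝ) := by
    have e : (M*√M/√q)*(N*√N/√q)=(M*N:ℝ)*√(M*N)/q := by
      rw [sqrt_mul (by positivity)]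
      have := mul_self_sqrt hq0.le
      field_simp
      rw [pow_two, this]; ring
    rw [e, div_le_iff₀ hq0]
    have : √((M:ℝ)*N)≤2*√q := by
      rw [sqrt_le_left (by positivity), mul_pow, sq_sqrt hq0.le]; linarith
    calc (M*N:ℝ)*√(M*N)≤(2*q)*(2*√q) := by gcongr
      _=4*(q:ℝ)^(1/2:ℝ)*q := by rw [sqrt_eq_rpow]; ring
      _≤_ := by gcongr 4*?_*_; exact rpow_le_rpow_of_exponent_le hq1 (by norm_num)
  have g1 : 1≤(q:ℝ)^(7/10:ℝ) := one_le_rpow hq1 (by norm_num)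
  have prod : (1+M*√M/√q)*(1+N*√N/√q)≤13*(q:ℝ)^(7/10:ℝ) := by nlinarith
  have jm := hC q hq M hM
  have jn := hC q hq N hN
  calc _≤(M:ℝ)^4*N^4*q*(C*(q:ℝ)^(1/100:ℝ)*(M^2*(1+M*√M/√q)))*(C*(q:ℝ)^(1/100:ℝ)*(N^2*(1+N*√N/√q))) := by gcongr
    _=C^2*(M*N:ℝ)^6*(q*((q:ℝ)^(1/100:ℝ))^2)*((1+M*√M/√q)*(1+N*√N/√q)) := by ring
    _≤C^2*(2*q)^6*(q*((q:ℝ)^(1/100:ℝ))^2)*(13*(q:ℝ)^(7/10:ℝ)) := by gcongr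
    _=(832*C^2)*((q:ℝ)^7*((q:ℝ)^(1/100:ℝ))^2*(q:ℝ)^(7/10:ℝ)) := by ring
    _=(832*C^2)*(q:ℝ)^(193/25:ℝ) := by
      congr 1
      rw [← rpow_natCast, ← rpow_natCast, ← rpow_mul hq0.le, ← rpow_add hq0, ← rpow_add hq0]; norm_num
    _≤(C*4)^8*(q:ℝ)^(193/25:ℝ) := by
      gcongr
      have : C^2≤C^8 := pow_le_pow_right₀ hC1 (by norm_num)
      have : 0≤C^8 := by positivity
      rw [mul_pow]; linarith
    _=_ := by
      rw [mul_pow (C*4), ← rpow_natCast ((q:ℝ)^(193/200:ℝ)), ← rpow_mul hq0.le]; norm_num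

set_option maxHeartbeats 1000000 in
/-- type II sums with a sharp interval -/
lemma klTypeII : ∃ C : ℝ, 1≤C ∧ ∀ q : ℕ, ∀ _ : Fact q.Prime, 2*(q:ℝ)^(4/5:ℝ)<q → ∀ h : ZMod q, h ≠ 0 →
    ∀ x y : ℕ, 1≤x → y<q → ∀ (α β : ℕ → ℂ) (A B:ℝ), 0≤A → 0≤B → (∀ k : ℕ, ‖α k‖≤A) → (∀ k : ℕ, ‖β k‖≤B) →
    (∀ k : ℕ, α k ≠ 0 → (q:ℝ)^(1/5:ℝ)≤k ∧ (k:ℝ)≤(q:ℝ)^(4/5:ℝ)) →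
    ‖∑ k ∈ Icc 1 y, ∑ m ∈ (Icc 1 y).filter (fun m : ℕ => x≤k*m ∧ k*m≤y), α k*β m*ps (h*((k:ZMod q)⁻¹*(m:ZMod q)⁻¹))‖
      ≤ A*B*(C*(2+log q)^2*(q:ℝ)^(193/200:ℝ)) := by
  obtain ⟨C, hC1, hC⟩ := bil_num
  refine ⟨3*C, by linarith, ?_⟩
  intro q hq hlarge h hh x y hx hy α β A B hA hB hα hβ hs
  have hq1 : (1:ℝ)≤q := by exact_mod_cast hq.out.one_le
  have hq0 : (0:ℝ)<q := by linarith
  have hlq : 0≤ log q := log_nonneg hq1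
  set X := C*(q:ℝ)^(193/200:ℝ) with hX
  have hX0 : 0≤X := by positivity
  set F : ℕ → ℂ := fun k => ∑ m ∈ (Icc 1 y).filter (fun m : ℕ => x≤k*m ∧ k*m≤y), α k*β m*ps (h*((k:ZMod q)⁻¹*(m:ZMod q)⁻¹)) with hF
  have block : ∀ j : ℕ, ‖∑ k ∈ (Icc 1 y).filter (fun k : ℕ => Nat.log 2 k=j), F k‖≤(2+log q)*(A*B*X) := by
    intro j
    by_cases hex : ∃ k0 ∈ (Icc 1 y).filter (fun k : ℕ => Nat.log 2 k=j), α k0 ≠ 0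
    swap
    · push Not at hex
      rw [sum_eq_zero, norm_zero]
      · positivity
      · intro k hk
        simp only [hF]
        exact sum_eq_zero fun m _ => by rw [hex k hk]; ring
    obtain ⟨k0, hk0, ha0⟩ := hex
    obtain ⟨hk1, hk2⟩ := hs k0 ha0
    rw [mem_filter, mem_Icc] at hk0
    have p1 : 2^j≤k0 := by rw [← hk0.2]; exact Nat.pow_log_le_self 2 (by omega)
    have p2 : k0<2^(j+1) := by rw [← hk0.2]; exact Nat.lt_pow_succ_log_self (by norm_num) _
    have p1r : (2:ℝ)^j≤k0 := by exact_mod_cast p1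
    have p2r : (k0:ℝ)<2^(j+1) := by exact_mod_cast p2
    set M := 2^(j+1) with hM
    set N := q/2^j with hN
    have hMr : (M:ℝ)=2*2^j := by rw [hM]; push_cast; ring
    have hNr : (N:ℝ)≤q/2^j := by rw [hN]; exact_mod_cast Nat.cast_div_le (m := q) (n := 2^j) (α := ℝ)
    have b1 : (M:ℝ)≤2*(q:ℝ)^(4/5:ℝ) := by linarith
    have b2 : (N:ℝ)≤2*(q:ℝ)^(4/5:ℝ) := by
      refine hNr.trans ?_
      rw [div_le_iff₀ (by positivity)]
      have : (q:ℝ)^(1/5:ℝ)≤2*2^j := by rw [pow_succ] at p2r; linarith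
      calc (q:ℝ)=(q:ℝ)^(4/5:ℝ)*(q:ℝ)^(1/5:ℝ) := by rw [← rpow_add hq0]; norm_num
        _≤(q:ℝ)^(4/5:ℝ)*(2*2^j) := by gcongr
        _=_ := by ring
    have hMq : M<q := by exact_mod_cast b1.trans_lt hlarge
    have hNq : N<q := by exact_mod_cast b2.trans_lt hlarge
    have b3 : (M:ℝ)*N≤2*q := by
      calc (M:ℝ)*N≤(2*2^j)*(q/2^j) := by rw [hMr]; gcongr
        _=_ := by field_simp
    have hb := hC q hq M N hMq hNq b3 b1 b2
    set lo : ℕ → ℕ := fun k => (x+k-1)/k with hlo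
    have eF : ∀ k ∈ (Icc 1 y).filter (fun k : ℕ => Nat.log 2 k=j), F k=∑ t : ZMod q, cJ (lo k) (y/k) t *
        ∑ m ∈ Icc 1 N, α k*β m*ps (h*((k:ZMod q)⁻¹*(m:ZMod q)⁻¹))*ps (t*(m:ZMod q)) := by
      intro k hk
      rw [mem_filter, mem_Icc] at hk
      have hk0 : 0<k := by omega
      have hkj : 2^j≤k := by rw [← hk.2]; exact Nat.pow_log_le_self 2 (by omega)
      rw [← compl (lo k) (y/k) ((Nat.div_le_self y k).trans_lt hy) (Icc 1 N) (fun n hn => (mem_Icc.1 hn).2.trans_lt hNq)]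
      simp only [hF]
      refine sum_congr ?_ (fun _ _ => rfl)
      ext m
      simp only [mem_filter, mem_Icc, hlo]
      have e1 : (x+k-1)/k≤ m ↔ x≤k*m := by
        rw [← Nat.lt_add_one_iff, Nat.div_lt_iff_lt_mul hk0, add_mul, one_mul, mul_comm k m]
        omega
      have e2 : m≤y/k ↔ k*m≤y := by rw [Nat.le_div_iff_mul_le hk0, mul_comm]
      rw [e1, e2]
      constructor
      · rintro ⟨⟨m1, _⟩, h3⟩
        refine ⟨⟨m1, ?_⟩, h3⟩
        rw [hN, Nat.le_div_iff_mul_le (by positivity)]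
        calc m*2^j≤ m*k := by gcongr
          _=k*m := mul_comm _ _
          _≤q := by omega
      · rintro ⟨⟨m1, _⟩, h3⟩
        refine ⟨⟨m1, ?_⟩, h3⟩
        exact (Nat.le_mul_of_pos_left m hk0).trans h3.2
    rw [sum_congr rfl eF, sum_comm]
    calc _≤∑ t : ZMod q, bq t*(A*B*X) := by
          refine (norm_sum_le _ _).trans (sum_le_sum fun t _ => ?_)
          set α' : ℕ → ℂ := fun k => if k ∈ (Icc 1 y).filter (fun k : ℕ => Nat.log 2 k=j) then α k*cJ (lo k) (y/k) t else 0 with hα'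
          have := bil h hh M N α' (fun m => β m*ps (t*(m:ZMod q))) (A*bq t) B X (mul_nonneg hA (bq_nonneg t)) hB hX0
            (fun k => by
              simp only [hα']
              split_ifs with hk
              · rw [norm_mul]
                exact mul_le_mul (hα k) (cJ_norm _ _ ((Nat.div_le_self y k).trans_lt hy) t) (norm_nonneg _) hA
              · rw [norm_zero]; exact mul_nonneg hA (bq_nonneg t))
            (fun m => by rw [norm_mul, ps_norm, mul_one]; exact hβ m) hb
          refine le_trans (le_of_eq ?_) (this.trans (le_of_eq (by ring)))
          congr 1
          have hsub : (Icc 1 y).filter (fun k : ℕ => Nat.log 2 k=j) ⊆ Icc 1 M := by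
            intro k hk
            rw [mem_filter, mem_Icc] at hk
            rw [mem_Icc]
            refine ⟨hk.1.1, ?_⟩
            rw [hM, ← hk.2]; exact (Nat.lt_pow_succ_log_self (by norm_num) _).le
          rw [← sum_subset hsub]
          · refine sum_congr rfl fun k hk => ?_
            rw [mul_sum]
            refine sum_congr rfl fun m _ => ?_
            simp only [hα', if_pos hk]; ring
          · intro k _ hk
            refine sum_eq_zero fun m _ => ?_
            simp only [hα', if_neg hk, zero_mul]
      _=(∑ t : ZMod q, bq t)*(A*B*X) := by rw [sum_mul]
      _≤_ := by gcongr; exact bq_sum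
  have split : ∑ k ∈ Icc 1 y, F k=∑ j ∈ range (Nat.log 2 q+1), ∑ k ∈ (Icc 1 y).filter (fun k : ℕ => Nat.log 2 k=j), F k := by
    rw [sum_fiberwise_of_maps_to]
    intro k hk
    rw [mem_Icc] at hk
    exact mem_range.2 (Nat.lt_succ_of_le (Nat.log_mono_right (by omega)))
  rw [split]
  refine (norm_sum_le _ _).trans ((sum_le_sum fun j _ => block j).trans ?_)
  rw [sum_const, card_range, nsmul_eq_mul]
  have hlog : ((Nat.log 2 q+1:ℕ):ℝ)≤3*(2+log q) := by
    have h2 : (2:ℝ)^(Nat.log 2 q)≤q := by exact_mod_cast Nat.pow_log_le_self 2 hq.out.ne_zero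
    have := log_le_log (by positivity) h2
    rw [log_pow] at this
    have : (1/2:ℝ)< log 2 := by have := log_two_gt_d9; linarith
    push_cast
    have h0 : (0:ℝ)≤(Nat.log 2 q:ℝ) := by positivity
    nlinarith
  calc _≤3*(2+log q)*((2+log q)*(A*B*X)) := by gcongr
    _=_ := by rw [hX]; ring

end M6d
end H12
namespace H12
section M7
open Real Finset ArithmeticFunction
open scoped ArithmeticFunction.zeta ArithmeticFunction.Moebius

variable {q : ℕ} [Fact q.Prime]

noncomputable def Sk (h : ZMod q) (x y:ℕ) (f : ArithmeticFunction ℝ) : ℂ := ∑ n ∈ Icc x y, (f n:ℂ)*ps (h*(n:ZMod q)⁻¹)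

lemma Sk_mul (h : ZMod q) (x y:ℕ) (hx : 1≤x) (f g : ArithmeticFunction ℝ) : Sk h x y (f*g) =
    ∑ k ∈ Icc 1 y, ∑ m ∈ (Icc 1 y).filter (fun m : ℕ => x≤k*m ∧ k*m≤y), (f k:ℂ)*(g m:ℂ)*ps (h*((k:ZMod q)⁻¹*(m:ZMod q)⁻¹)) := by
  simp_rw [sum_filter]
  rw [← sum_product (f := fun p : ℕ × ℕ => if x≤p.1*p.2 ∧ p.1*p.2≤y then (f p.1:ℂ)*(g p.2:ℂ)*ps (h*((p.1:ZMod q)⁻¹*(p.2:ZMod q)⁻¹)) else 0),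
    ← sum_filter, ← sum_fiberwise_of_maps_to (t := Icc x y) (g := fun p : ℕ × ℕ => p.1*p.2) (fun p hp => by
      rw [mem_Icc]; exact (mem_filter.1 hp).2)]
  refine sum_congr rfl fun n hn => ?_
  rw [mem_Icc] at hn
  rw [ArithmeticFunction.mul_apply, Complex.ofReal_sum, sum_mul]
  refine sum_congr ?_ fun p hp => ?_
  · ext p
    simp only [Nat.mem_divisorsAntidiagonal, mem_filter, mem_product, mem_Icc]
    constructor
    · rintro ⟨h1, h2⟩
      have a1 : 0<p.1 := Nat.pos_of_ne_zero fun h0 => h2 (by rw [← h1, h0, zero_mul])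
      have a2 : 0<p.2 := Nat.pos_of_ne_zero fun h0 => h2 (by rw [← h1, h0, mul_zero])
      have := Nat.le_mul_of_pos_right p.1 a2
      have := Nat.le_mul_of_pos_left p.2 a1
      refine ⟨⟨⟨⟨?_, ?_⟩, ?_, ?_⟩, ?_⟩, h1⟩ <;> omega
    · rintro ⟨_, h1⟩; exact ⟨h1, by omega⟩
  · rw [mem_filter] at hp
    rw [← hp.2]; push_cast; rw [mul_inv]

lemma absum (a b:ℕ) (ha : 1≤a) (c : ℕ → ℂ) (K:ℝ) (hK : ∀ a' : ℕ, ‖∑ m ∈ Icc a' b, c m‖≤K) :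
    ‖∑ m ∈ Icc a b, ((Real.log m:ℝ):ℂ)*c m‖≤Real.log (b+1)*K := by
  set δ : ℕ → ℝ := fun i => Real.log ((i+1:ℕ)+1)-Real.log (i+1) with hδ
  have tel : ∀ n : ℕ, ∑ i ∈ range n, δ i=Real.log (n+1) := by
    intro n
    rw [sum_range_sub (fun i : ℕ => Real.log ((i:ℝ)+1))]; simp
  have hδ0 : ∀ i, 0≤δ i := fun i => sub_nonneg.2 (log_le_log (by positivity) (by push_cast; linarith))
  have e1 : ∀ m ∈ Icc a b, ((Real.log m:ℝ):ℂ)*c m=∑ i ∈ range b, if i+2≤ m then (δ i:ℂ)*c m else 0 := by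
    intro m hm
    rw [mem_Icc] at hm
    have : Real.log m=∑ i ∈ range (m-1), δ i := by rw [tel, Nat.cast_sub (by omega)]; simp
    rw [this, Complex.ofReal_sum, sum_mul, ← sum_filter]
    refine sum_congr ?_ fun _ _ => rfl
    ext i; simp only [mem_range, mem_filter]; omega
  rw [sum_congr rfl e1, sum_comm, ← tel, sum_mul]
  refine (norm_sum_le _ _).trans (sum_le_sum fun i _ => ?_)
  rw [← sum_filter, ← mul_sum, norm_mul, Complex.norm_real, Real.norm_of_nonneg (hδ0 i)]
  refine mul_le_mul_of_nonneg_left ?_ (hδ0 i)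
  have : (Icc a b).filter (fun m : ℕ => i+2≤ m)=Icc (max a (i+2)) b := by
    ext m; simp only [mem_filter, mem_Icc]; omega
  rw [this]; exact hK _

lemma klTypeI (h : ZMod q) (hh : h ≠ 0) (x y:ℕ) (hx : 1≤x) (hy : y<q) (f g : ArithmeticFunction ℝ) (F G V:ℝ) (hF : 0≤F) (hG : 0≤G)
    (hV : 0≤V) (hf : ∀ k : ℕ, |f k| ≤ F) (hfV : ∀ k : ℕ, V<k → f k=0)
    (hg : ∀ h' : ZMod q, h' ≠ 0 → ∀ a b : ℕ, 1≤a → b<q → ‖∑ m ∈ Icc a b, (g m:ℂ)*ps (h' * (m:ZMod q)⁻¹)‖≤G) :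
    ‖Sk h x y (f*g)‖≤V*(F*G) := by
  rw [Sk_mul h x y hx]
  have h1 : ∀ k ∈ Icc 1 y, ‖∑ m ∈ (Icc 1 y).filter (fun m : ℕ => x≤k*m ∧ k*m≤y), (f k:ℂ)*(g m:ℂ)*ps (h*((k:ZMod q)⁻¹*(m:ZMod q)⁻¹))‖
      ≤ if k ∈ Icc 1 ⌊V⌋₊ then F*G else 0 := by
    intro k hk
    rw [mem_Icc] at hk
    split_ifs with hkV
    · have hk0 : 0<k := by omega
      have e : (Icc 1 y).filter (fun m : ℕ => x≤k*m ∧ k*m≤y)=Icc ((x+k-1)/k) (y/k) := by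
        ext m
        simp only [mem_filter, mem_Icc]
        have e1 : (x+k-1)/k≤ m ↔ x≤k*m := by
          rw [← Nat.lt_add_one_iff, Nat.div_lt_iff_lt_mul hk0, add_mul, one_mul, mul_comm k m]; omega
        have e2 : m≤y/k ↔ k*m≤y := by rw [Nat.le_div_iff_mul_le hk0, mul_comm]
        rw [e1, e2]
        refine ⟨fun h => h.2, fun h => ⟨⟨Nat.pos_of_ne_zero fun h0 => ?_, (Nat.le_mul_of_pos_left m hk0).trans h.2⟩, h⟩⟩
        rw [h0, mul_zero] at h; omega
      have e3 : ∀ m : ℕ, (f k:ℂ)*(g m:ℂ)*ps (h*((k:ZMod q)⁻¹*(m:ZMod q)⁻¹))=(f k:ℂ)*((g m:ℂ)*ps (h*(k:ZMod q)⁻¹*(m:ZMod q)⁻¹)) :=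
        fun m => by rw [mul_assoc, mul_assoc h]
      rw [e, sum_congr rfl (fun m _ => e3 m), ← mul_sum, norm_mul, Complex.norm_real]
      exact mul_le_mul (hf k) (hg _ (mul_ne_zero hh (inv_ne_zero (cast_ne hk.1 (hk.2.trans_lt hy)))) _ _
        ((Nat.one_le_div_iff hk0).2 (by omega)) ((Nat.div_le_self y k).trans_lt hy)) (norm_nonneg _) hF
    · have : f k=0 := hfV k (by
        rw [mem_Icc] at hkV
        exact (Nat.floor_lt hV).1 (by omega))
      rw [sum_eq_zero (fun m _ => by rw [this]; simp), norm_zero]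
  refine (norm_sum_le _ _).trans ((sum_le_sum h1).trans ?_)
  rw [← sum_filter, sum_const, nsmul_eq_mul]
  refine mul_le_mul_of_nonneg_right (le_trans ?_ (Nat.floor_le hV)) (by positivity)
  have : #((Icc 1 y).filter (fun k => k ∈ Icc 1 ⌊V⌋₊))≤#(Icc 1 ⌊V⌋₊) := card_le_card fun k hk => (mem_filter.1 hk).2
  rw [Nat.card_Icc] at this
  exact_mod_cast this

noncomputable def lowp (V:ℝ) (f : ArithmeticFunction ℝ) : ArithmeticFunction ℝ := ⟨fun n => if (n:ℝ)≤V then f n else 0, by simp⟩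

lemma lowp_apply (V:ℝ) (f : ArithmeticFunction ℝ) (n:ℕ) : lowp V f n=if (n:ℝ)≤V then f n else 0 := rfl

lemma highp_apply (V:ℝ) (f : ArithmeticFunction ℝ) (n:ℕ) : (f-lowp V f) n=if (n:ℝ)≤V then 0 else f n := by
  rw [sub_eq_add_neg, ArithmeticFunction.add_apply, ArithmeticFunction.neg_apply, lowp_apply]; split_ifs <;> simp

lemma Sk_add (h : ZMod q) (x y:ℕ) (f g : ArithmeticFunction ℝ) : Sk h x y (f+g)=Sk h x y f+Sk h x y g := by
  unfold Sk; rw [← sum_add_distrib]; exact sum_congr rfl fun n _ => by rw [ArithmeticFunction.add_apply]; push_cast; ring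

lemma Sk_neg (h : ZMod q) (x y:ℕ) (f : ArithmeticFunction ℝ) : Sk h x y (-f) = - Sk h x y f := by
  unfold Sk; rw [← sum_neg_distrib]; exact sum_congr rfl fun n _ => by rw [ArithmeticFunction.neg_apply]; push_cast; ring

lemma mul_zeta_log (f l : ArithmeticFunction ℝ) (n:ℕ) (hf : ∀ k : ℕ, |f k| ≤ 1) (hl : ∀ k : ℕ, |l k| ≤ vonMangoldt k) :
    |(f*l) n| ≤ Real.log n := by
  rw [ArithmeticFunction.mul_apply, ← vonMangoldt_sum, ← Nat.map_div_left_divisors, sum_map]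
  refine (abs_sum_le_sum_abs _ _).trans (sum_le_sum fun d _ => ?_)
  change |f (n/d)*l d| ≤ _
  rw [abs_mul]
  calc _≤1 * |l d| := mul_le_mul_of_nonneg_right (hf _) (abs_nonneg _)
    _≤_ := by rw [one_mul]; exact hl _

set_option maxHeartbeats 1000000 in
lemma vaughan : ∃ q0 : ℝ, ∀ q : ℕ, ∀ _ : Fact q.Prime, q0≤q → ∀ h : ZMod q, h ≠ 0 → ∀ x y : ℕ, 1≤x → y<q →
    ‖∑ n ∈ Icc x y, (vonMangoldt n:ℂ)*ps (h*(n:ZMod q)⁻¹)‖≤(q:ℝ)^(1-1/32:ℝ) := by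
  obtain ⟨C, hC1, hC⟩ := klTypeII
  obtain ⟨L1, hL1, hL⟩ := pow_le_exp_ev ((5+2*C)*8) (3/800) (by norm_num) 3
  refine ⟨exp (L1+5), fun q hq hq0 h hh x y hx hy => ?_⟩
  have hqp : (0:ℝ)<q := (exp_pos _).trans_le hq0
  have hlq : L1+5≤Real.log q := (le_log_iff_exp_le hqp).2 hq0
  have hq1 : (1:ℝ)≤q := (one_le_exp (by linarith)).trans hq0
  set V : ℝ := (q:ℝ)^(1/5:ℝ) with hV
  have hV0 : 0≤V := by positivity
  set L := Real.log q with hLdef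
  have hlarge : 2*(q:ℝ)^(4/5:ℝ)<q := by
    have e1 : (q:ℝ)=(q:ℝ)^(4/5:ℝ)*(q:ℝ)^(1/5:ℝ) := by rw [← rpow_add hqp]; norm_num
    have e2 : 2<(q:ℝ)^(1/5:ℝ) := by
      rw [rpow_def_of_pos hqp]
      have h1 := exp_one_gt_d9
      have : exp 1≤exp (Real.log q*(1/5)) := exp_le_exp.2 (by linarith)
      linarith
    have : 0<(q:ℝ)^(4/5:ℝ) := by positivity
    conv_rhs => rw [e1]
    nlinarith
  have lgq : ∀ n : ℕ, n<q → Real.log n≤L := by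
    intro n hn
    rcases Nat.eq_zero_or_pos n with rfl | h0
    · simp; linarith
    · exact log_le_log (by exact_mod_cast h0) (by exact_mod_cast hn.le)
  set G : ℝ := L*((2+L)*(2*(q:ℝ)^(3/4:ℝ))) with hG
  set m1 := lowp V (μ : ArithmeticFunction ℝ) with hm1
  set l1 := lowp V vonMangoldt with hl1
  set m2 := (μ : ArithmeticFunction ℝ)-m1 with hm2
  set l2 := vonMangoldt-l1 with hl2
  have hμ : ∀ k : ℕ, |(μ : ArithmeticFunction ℝ) k| ≤ 1 := fun k => by
    rw [intCoe_apply]; exact_mod_cast abs_moebius_le_one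
  have hm1b : ∀ k : ℕ, |m1 k| ≤ 1 := fun k => by
    rw [hm1, lowp_apply]; split_ifs; · exact hμ k
    simp
  have hl1b : ∀ k : ℕ, |l1 k| ≤ vonMangoldt k := fun k => by
    rw [hl1, lowp_apply]; split_ifs
    · rw [abs_of_nonneg vonMangoldt_nonneg]
    · rw [abs_zero]; exact vonMangoldt_nonneg
  have hl2b : ∀ k : ℕ, |l2 k| ≤ vonMangoldt k := fun k => by
    rw [hl2, highp_apply]; split_ifs
    · rw [abs_zero]; exact vonMangoldt_nonneg
    · rw [abs_of_nonneg vonMangoldt_nonneg]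
  have hζ : ∀ k : ℕ, |(ζ : ArithmeticFunction ℝ) k| ≤ 1 := fun k => by
    rw [natCoe_apply, zeta_apply]; split_ifs <;> simp
  set a := m1*l1 with ha
  have hab : ∀ k, |a k| ≤ Real.log k := fun k => mul_zeta_log m1 l1 k hm1b hl1b
  have haV : ∀ k : ℕ, a k ≠ 0 → (k:ℝ)≤V*V := by
    intro k hk
    rw [ha, ArithmeticFunction.mul_apply] at hk
    obtain ⟨p, hp, hne⟩ := exists_ne_zero_of_sum_ne_zero hk
    rw [Nat.mem_divisorsAntidiagonal] at hp
    rw [← hp.1]; push_cast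
    have i1 : (p.1:ℝ)≤V := by
      by_contra hc; apply hne; rw [hm1, lowp_apply, if_neg hc, zero_mul]
    have i2 : (p.2:ℝ)≤V := by
      by_contra hc; apply hne; rw [hl1, lowp_apply V vonMangoldt, if_neg hc, mul_zero]
    gcongr
  have haq : ∀ k, |a k| ≤ L := by
    intro k
    by_cases hk : a k=0
    · rw [hk, abs_zero]; linarith
    · have h2 := haV k hk
      refine (hab k).trans (lgq k ?_)
      have : V*V≤(q:ℝ)^(4/5:ℝ) := by
        rw [hV, ← rpow_add hqp]; exact rpow_le_rpow_of_exponent_le hq1 (by norm_num)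
      have h3 : 0<(q:ℝ)^(4/5:ℝ) := by positivity
      exact_mod_cast (by linarith : (k:ℝ)<q)
  set a1 := lowp V a with ha1
  set a2 := a-a1 with ha2
  have ident : (vonMangoldt : ArithmeticFunction ℝ)=l1+m1*ArithmeticFunction.log + -(a1*ζ) + -(a2*ζ)+m2*(ζ*l2) := by
    have e1 : (μ : ArithmeticFunction ℝ)*(ζ : ArithmeticFunction ℝ)=1 := coe_moebius_mul_coe_zeta
    rw [← vonMangoldt_mul_zeta, ha2, ha, hm2, hl2]
    linear_combination (-(vonMangoldt-l1))*e1
  have t1 : ‖Sk h x y l1‖≤V*L := by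
    unfold Sk
    have b : ∀ n ∈ Icc x y, ‖(l1 n:ℂ)*ps (h*(n:ZMod q)⁻¹)‖≤ if n ∈ Icc 1 ⌊V⌋₊ then L else 0 := by
      intro n hn
      rw [mem_Icc] at hn
      rw [norm_mul, ps_norm, mul_one, Complex.norm_real]
      split_ifs with hc
      · exact (hl1b n).trans (vonMangoldt_le_log.trans (lgq n (by omega)))
      · rw [mem_Icc] at hc
        have : ¬ (n:ℝ)≤V := not_le.2 ((Nat.floor_lt hV0).1 (by omega))
        rw [hl1, lowp_apply, if_neg this, norm_zero]
    refine (norm_sum_le _ _).trans ((sum_le_sum b).trans ?_)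
    rw [← sum_filter, sum_const, nsmul_eq_mul]
    refine mul_le_mul_of_nonneg_right (le_trans ?_ (Nat.floor_le hV0)) (by linarith)
    have : #((Icc x y).filter (fun k => k ∈ Icc 1 ⌊V⌋₊))≤#(Icc 1 ⌊V⌋₊) := card_le_card fun k hk => (mem_filter.1 hk).2
    rw [Nat.card_Icc] at this
    exact_mod_cast this
  have hlow : ∀ f : ArithmeticFunction ℝ, ∀ k : ℕ, V<k → lowp V f k=0 := fun f k hk => by
    rw [lowp_apply, if_neg (not_le.2 hk)]
  have t2 : ‖Sk h x y (m1*ArithmeticFunction.log)‖≤V*(1*G) := by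
    refine klTypeI h hh x y hx hy m1 _ 1 G V (by norm_num) (by positivity) hV0 hm1b (hlow _) ?_
    intro h' hh' a b ha hb
    refine (absum a b ha (fun m => ps (h' * (m:ZMod q)⁻¹)) _ (fun a' => incomplete h' hh' a' b hb)).trans ?_
    refine mul_le_mul_of_nonneg_right ?_ (by positivity)
    exact log_le_log (by positivity) (by exact_mod_cast hb)
  have t3 : ‖Sk h x y (a1*ζ)‖≤V*(L*G) := by
    refine klTypeI h hh x y hx hy a1 _ L G V (by linarith) (by positivity) hV0 ?_ (hlow _) ?_
    · intro k
      rw [ha1, lowp_apply]; split_ifs; · exact haq k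
      rw [abs_zero]; linarith
    intro h' hh' a b ha hb
    have e : ∑ m ∈ Icc a b, ((ζ : ArithmeticFunction ℝ) m:ℂ)*ps (h' * (m:ZMod q)⁻¹)=∑ m ∈ Icc a b, ps (h' * (m:ZMod q)⁻¹) := by
      refine sum_congr rfl fun m hm => ?_
      rw [mem_Icc] at hm
      rw [natCoe_apply, zeta_apply, if_neg (by omega)]; simp
    rw [e]
    refine (incomplete h' hh' a b hb).trans (le_mul_of_one_le_left (by positivity) (by linarith))
  have t4 : ‖Sk h x y (a2*ζ)‖≤L*1*(C*(2+L)^2*(q:ℝ)^(193/200:ℝ)) := by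
    rw [Sk_mul h x y hx]
    refine hC q hq hlarge h hh x y hx hy (fun k => (a2 k:ℂ)) (fun k => ((ζ : ArithmeticFunction ℝ) k:ℂ)) L 1 (by linarith) (by norm_num) ?_ ?_ ?_
    · intro k
      rw [Complex.norm_real, Real.norm_eq_abs, ha2, highp_apply]; split_ifs; · rw [abs_zero]; linarith
      exact haq k
    · intro k; rw [Complex.norm_real]; exact hζ k
    · intro k hk
      beta_reduce at hk
      rw [Complex.ofReal_ne_zero, ha2, highp_apply] at hk
      split_ifs at hk with hc
      · exact absurd rfl hk
      · refine ⟨(not_le.1 hc).le, (haV k hk).trans ?_⟩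
        rw [hV, ← rpow_add hqp]; exact rpow_le_rpow_of_exponent_le hq1 (by norm_num)
  have hzl : ∀ m, |((ζ : ArithmeticFunction ℝ)*l2) m| ≤ Real.log m := fun m => mul_zeta_log _ _ m hζ hl2b
  have t5 : ‖Sk h x y (m2*(ζ*l2))‖≤1*L*(C*(2+L)^2*(q:ℝ)^(193/200:ℝ)) := by
    rw [Sk_mul h x y hx]
    refine le_trans (le_of_eq ?_) (hC q hq hlarge h hh x y hx hy (fun k => if (k:ℝ)≤(q:ℝ)^(4/5:ℝ) then (m2 k:ℂ) else 0)
      (fun k => if k≤y then (((ζ : ArithmeticFunction ℝ)*l2) k:ℂ) else 0) 1 L (by norm_num) (by linarith) ?_ ?_ ?_)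
    · congr 1
      refine sum_congr rfl fun k hk => sum_congr rfl fun m hm => ?_
      rw [mem_filter, mem_Icc] at hm
      beta_reduce
      rw [if_pos hm.1.2]
      split_ifs with hc
      · rfl
      · have hz : ((ζ : ArithmeticFunction ℝ)*l2) m=0 := by
          rw [ArithmeticFunction.mul_apply]
          refine sum_eq_zero fun p hp => ?_
          have hp2 : p.2≤ m := Nat.divisor_le (Nat.snd_mem_divisors_of_mem_antidiagonal hp)
          have : (p.2:ℝ)≤V := by
            have h1 : (p.2:ℝ)≤ m := by exact_mod_cast hp2
            have h2 : (k:ℝ)*m≤q := by exact_mod_cast hm.2.2.trans hy.le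
            have e1 : (q:ℝ)=(q:ℝ)^(4/5:ℝ)*V := by rw [hV, ← rpow_add hqp]; norm_num
            have h3 : (q:ℝ)^(4/5:ℝ)*m≤(q:ℝ)^(4/5:ℝ)*V := by
              rw [← e1]; refine le_trans ?_ h2; gcongr; exact (not_le.1 hc).le
            exact h1.trans (le_of_mul_le_mul_left h3 (by positivity))
          rw [hl2, highp_apply, if_pos this, mul_zero]
        rw [hz]; simp
    · intro k
      beta_reduce; split_ifs
      · rw [Complex.norm_real, Real.norm_eq_abs, hm2, highp_apply]; split_ifs; · simp
        exact hμ k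
      · simp
    · intro k
      beta_reduce; split_ifs with hk
      · rw [Complex.norm_real]; exact (hzl k).trans (lgq k (by omega))
      · rw [norm_zero]; linarith
    · intro k hk
      beta_reduce at hk
      split_ifs at hk with hc
      · rw [Complex.ofReal_ne_zero, hm2, highp_apply] at hk
        split_ifs at hk with hc2
        · exact absurd rfl hk
        · exact ⟨(not_le.1 hc2).le, hc⟩
      · exact absurd rfl hk
  change ‖Sk h x y vonMangoldt‖≤_
  rw [ident, Sk_add, Sk_add, Sk_add, Sk_add, Sk_neg, Sk_neg]
  refine (norm_add_le_of_le (norm_add_le_of_le (norm_add_le_of_le (norm_add_le_of_le t1 t2) ((norm_neg _).trans_le t3)) ((norm_neg _).trans_le t4)) t5).trans ?_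
  set Q := (q:ℝ)^(193/200:ℝ) with hQ
  have v1 : V≤Q := rpow_le_rpow_of_exponent_le hq1 (by norm_num)
  have v2 : V*(q:ℝ)^(3/4:ℝ)≤Q := by
    rw [hV, ← rpow_add hqp]; exact rpow_le_rpow_of_exponent_le hq1 (by norm_num)
  have hL0 : 5≤L := by linarith
  have hQ0 : 0≤Q := by positivity
  have fin1 : V*L+V*(1*G)+V*(L*G)+L*1*(C*(2+L)^2*Q)+1*L*(C*(2+L)^2*Q)≤((5+2*C)*8)*(1+L)^3*Q := by
    have w1 : V*L≤(1+L)^3*Q := by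
      rw [mul_comm V]; gcongr; nlinarith [sq_nonneg L]
    have w2 : V*(1*G)≤2*(8*(1+L)^3*Q) := by
      calc V*(1*G)=2*(L*(2+L)*(V*(q:ℝ)^(3/4:ℝ))) := by rw [hG]; ring
        _≤2*(8*(1+L)^3*Q) := by
          have : L*(2+L)≤8*(1+L)^3 := by nlinarith [pow_nonneg (by linarith : 0≤L) 2, pow_nonneg (by linarith : 0≤L) 3]
          exact mul_le_mul_of_nonneg_left (mul_le_mul this v2 (by positivity) (by positivity)) (by norm_num)
    have w3 : V*(L*G)≤2*(8*(1+L)^3*Q) := by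
      calc V*(L*G)=2*(L^2*(2+L)*(V*(q:ℝ)^(3/4:ℝ))) := by rw [hG]; ring
        _≤2*(8*(1+L)^3*Q) := by
          have : L^2*(2+L)≤8*(1+L)^3 := by nlinarith [pow_nonneg (by linarith : 0≤L) 2, pow_nonneg (by linarith : 0≤L) 3]
          exact mul_le_mul_of_nonneg_left (mul_le_mul this v2 (by positivity) (by positivity)) (by norm_num)
    have w4 : L*(C*(2+L)^2*Q)≤C*(8*(1+L)^3*Q) := by
      calc L*(C*(2+L)^2*Q)=C*(L*(2+L)^2*Q) := by ring
        _≤_ := by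
          have : L*(2+L)^2≤8*(1+L)^3 := by nlinarith [pow_nonneg (by linarith : 0≤L) 2, pow_nonneg (by linarith : 0≤L) 3]
          exact mul_le_mul_of_nonneg_left (mul_le_mul_of_nonneg_right this hQ0) (by linarith)
    have w0 : 0≤(1+L)^3*Q := by positivity
    linarith only [w1, w2, w3, w4, w0]
  refine fin1.trans ?_
  calc ((5+2*C)*8)*(1+L)^3*Q≤exp (3/800*L)*Q := by gcongr; exact hL L (by linarith)
    _=_ := by
      rw [hQ, mul_comm (3/800:ℝ), hLdef, ← rpow_def_of_pos hqp, ← rpow_add hqp]; norm_num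

end M7
end H12
namespace H12
section M8
open Real Finset

lemma detect {q : ℕ} [Fact q.Prime] (L x y:ℕ) (hL : L≤q) (hx : 1≤x) (hy : y<q) (K:ℝ)
    (hK : ∀ h : ZMod q, h ≠ 0 → ‖∑ n ∈ Icc x y, (ArithmeticFunction.vonMangoldt n:ℂ)*ps (h*(n:ZMod q)⁻¹)‖≤K)
    (hno : ∀ p ∈ Icc x y, p.Prime → ∀ u<L, ∀ v<L, (u:ZMod q)-v ≠ (p:ZMod q)⁻¹) :
    (L:ℝ)^2*∑ n ∈ Icc x y, ArithmeticFunction.vonMangoldt n≤q*(L*(2*√q*log q))+K*(q*L) := by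
  have hq1 : (1:ℝ)≤q := by exact_mod_cast (Fact.out : q.Prime).one_le
  set lam : ℕ → ℝ := fun n => ArithmeticFunction.vonMangoldt n with hlam
  set R : ZMod q → ℕ := fun w => #{i ∈ range L ×ˢ range L | (i.1:ZMod q)-i.2=w} with hR
  set T : ZMod q → ℂ := fun t => ∑ u ∈ range L, 1*ps (t*(u:ZMod q)) with hT
  set Z : ZMod q → ℂ := fun h => ∑ n ∈ Icc x y, (lam n:ℂ)*ps (h*(n:ZMod q)⁻¹) with hZ
  have pars : ∑ t : ZMod q, ‖T t‖^2=q*L := by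
    have h1 := parseval (range L) (fun _ => 1) (fun u : ℕ => (u:ZMod q))
    simp only [map_one, mul_one] at h1
    have h2 : ∑ i ∈ range L, ∑ j ∈ range L, (if (i:ZMod q)=(j:ZMod q) then (1:ℂ) else 0)=L := by
      rw [sum_congr rfl (g := fun _ => (1:ℂ))]
      · simp
      intro i hi
      rw [sum_eq_single_of_mem i hi]
      · simp
      intro j hj hji
      rw [if_neg]
      intro he
      exact hji (cast_inj ((mem_range.1 hj).trans_le hL) ((mem_range.1 hi).trans_le hL) he.symm)
    rw [h2] at h1
    exact_mod_cast h1
  have four : ∀ w : ZMod q, ∑ t : ZMod q, ((‖T t‖^2:ℝ):ℂ)*ps (-t*w)=q*R w := by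
    intro w
    have e : ∀ t : ZMod q, ((‖T t‖^2:ℝ):ℂ)*ps (-t*w)=∑ i ∈ range L ×ˢ range L, ps (t*((i.1:ZMod q)-(i.2:ZMod q)-w)) := by
      intro t
      rw [Complex.ofReal_pow, ← Complex.mul_conj', hT]
      beta_reduce
      rw [map_sum, sum_mul_sum, sum_product, sum_mul]
      refine sum_congr rfl fun u _ => ?_
      rw [sum_mul]
      refine sum_congr rfl fun v _ => ?_
      rw [one_mul, one_mul, ps_conj, ← ps_add]; congr 1; ring
    simp_rw [e]
    rw [sum_comm]
    simp_rw [ps_sum, sub_eq_zero]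
    rw [← sum_filter, sum_const, nsmul_eq_mul, mul_comm]
  set P : ℝ := ∑ n ∈ Icc x y, lam n*R ((n:ZMod q)⁻¹) with hP
  have main : ((q*P:ℝ):ℂ)=∑ t : ZMod q, ((‖T t‖^2:ℝ):ℂ)*Z (-t) := by
    rw [hP, hZ]
    simp_rw [mul_sum]
    rw [sum_comm, Complex.ofReal_sum]
    refine sum_congr rfl fun n _ => ?_
    have := four ((n:ZMod q)⁻¹)
    push_cast at this ⊢
    rw [mul_left_comm, ← this, mul_sum]
    exact sum_congr rfl fun t _ => by ring
  have h0 : ((‖T 0‖^2:ℝ):ℂ)*Z (-0)=(((L:ℝ)^2*∑ n ∈ Icc x y, lam n:ℝ):ℂ) := by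
    simp only [hT, hZ, neg_zero, zero_mul, ps_zero, mul_one]
    push_cast; simp
  rw [← add_sum_erase _ _ (mem_univ (0:ZMod q)), h0] at main
  have err : ‖∑ t ∈ univ.erase (0:ZMod q), ((‖T t‖^2:ℝ):ℂ)*Z (-t)‖≤K*(q*L) := by
    rw [← pars, mul_sum]
    refine (norm_sum_le _ _).trans ?_
    calc _≤∑ t ∈ univ.erase (0:ZMod q), K*‖T t‖^2 := sum_le_sum fun t ht => by
          rw [norm_mul, Complex.norm_real, Real.norm_of_nonneg (by positivity), mul_comm]
          exact mul_le_mul_of_nonneg_right (hK _ (neg_ne_zero.2 (ne_of_mem_erase ht))) (by positivity)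
      _≤_ := sum_le_sum_of_subset_of_nonneg (erase_subset _ _) (fun t _ _ => by
          have : 0≤K := (norm_nonneg _).trans (hK 1 one_ne_zero)
          positivity)
  have low : (L:ℝ)^2*∑ n ∈ Icc x y, lam n≤q*P+K*(q*L) := by
    have e : (((L:ℝ)^2*∑ n ∈ Icc x y, lam n-q*P:ℝ):ℂ) = -∑ t ∈ univ.erase (0:ZMod q), ((‖T t‖^2:ℝ):ℂ)*Z (-t) := by
      rw [Complex.ofReal_sub, main]; ring
    have := le_abs_self ((L:ℝ)^2*∑ n ∈ Icc x y, lam n-q*P)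
    rw [← Real.norm_eq_abs, ← Complex.norm_real, e, norm_neg] at this
    linarith
  have hRL : ∀ w, R w≤L := by
    intro w
    refine le_trans (card_le_card_of_injOn (t := range L) (fun i => i.1) ?_ ?_) (by simp)
    · intro i hi
      simp only [coe_filter, mem_product] at hi
      exact hi.1.1
    · intro i hi j hj hij
      simp only [coe_filter, mem_product, mem_range] at hi hj
      have e1 : i.1=j.1 := hij
      have h5 := hi.2.trans hj.2.symm
      rw [e1] at h5
      exact Prod.ext e1 (cast_inj (hi.1.2.trans_le hL) (hj.1.2.trans_le hL) (sub_right_injective h5))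
  have up : P≤L*(2*√q*log q) := by
    have hc := Chebyshev.psi_sub_theta_le hq1
    rw [Chebyshev.psi_sub_theta_eq_sum_not_prime, Nat.floor_natCast] at hc
    refine le_trans ?_ (mul_le_mul_of_nonneg_left hc (by positivity))
    rw [mul_sum]
    have h1 : ∀ n ∈ Icc x y, n ∉ (Icc x y).filter (fun n => ¬ n.Prime) → lam n*R ((n:ZMod q)⁻¹)=0 := by
      intro n hn hnp
      have hp : n.Prime := by
        by_contra hc; exact hnp (mem_filter.2 ⟨hn, hc⟩)
      have : R ((n:ZMod q)⁻¹)=0 := by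
        rw [hR]; beta_reduce
        rw [card_eq_zero, filter_eq_empty_iff]
        intro i hi
        rw [mem_product, mem_range, mem_range] at hi
        exact hno n hn hp _ hi.1 _ hi.2
      rw [this]; simp
    rw [hP, ← sum_subset (filter_subset _ _) h1]
    calc _≤∑ n ∈ (Icc x y).filter (fun n => ¬ n.Prime), L*ArithmeticFunction.vonMangoldt n := sum_le_sum fun n _ => by
          rw [mul_comm]
          exact mul_le_mul_of_nonneg_right (by exact_mod_cast hRL _) ArithmeticFunction.vonMangoldt_nonneg
      _≤_ := by
          refine sum_le_sum_of_subset_of_nonneg (fun n hn => ?_) (fun n _ _ => mul_nonneg (by positivity) ArithmeticFunction.vonMangoldt_nonneg)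
          simp only [mem_filter, mem_Icc, mem_Ioc] at hn ⊢
          exact ⟨⟨by omega, by omega⟩, hn.2⟩
  have : (q:ℝ)*P≤q*(L*(2*√q*log q)) := by gcongr
  linarith

open Filter in
set_option maxHeartbeats 1000000 in
lemma final (A0 C D:ℝ) (h0 : 0<A0) (h1 : A0<1) (hC : 0<C) (hD : 0<D) (hCD : C+D<1/32) :
    ∀ᶠ q : ℕ in atTop, q.Prime →
      ∃ p : ℕ, p.Prime ∧ p ≠ q ∧
        A0*q≤(p:ℝ) ∧ (p:ℝ)≤(A0+(q:ℝ)^(-C))*q ∧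
        ∃ pbar : ℤ, (p:ℤ)*pbar ≡ 1 [ZMOD (q:ℤ)] ∧
          -((q:ℝ)/2)<(pbar:ℝ) ∧ (pbar:ℝ)≤(q:ℝ)/2 ∧
          |(pbar:ℝ)| ≤ (q:ℝ)^(1-D) := by
  obtain ⟨c, hc, hH⟩ := HOH
  obtain ⟨q0, hV⟩ := vaughan
  set s := 1/32-C-D with hs
  have hs0 : 0< s := by linarith
  set κ := C+s/4 with hκ
  set θ := C+s/2 with hθ
  obtain ⟨X0, hX0⟩ := hH κ θ (by linarith) (by linarith) (by linarith)
  obtain ⟨L1, hL1, hL⟩ := pow_le_exp_ev 2 (1/4) (by norm_num) 1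
  have ev : ∀ ε B : ℝ, 0<ε → ∀ᶠ q : ℕ in atTop, B<(q:ℝ)^ε := fun ε B hε =>
    ((tendsto_rpow_atTop hε).comp tendsto_natCast_atTop_atTop).eventually_gt_atTop B
  have evl : ∀ B : ℝ, ∀ᶠ q : ℕ in atTop, B≤(q:ℝ) := fun B => tendsto_natCast_atTop_atTop.eventually_ge_atTop B
  filter_upwards [evl q0, evl (exp X0/A0), evl (exp L1), ev (κ-C) 8 (by linarith), ev C (1/(1-A0)) hC, ev D 2 hD,
    ev (1-D) 2 (by linarith), ev (1/32-D-θ) (4/(c*A0)) (by linarith), evl 1] with q e1 e2 e3 e4 e5 e6 e7 e8 e9 hq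
  haveI : Fact q.Prime := ⟨hq⟩
  have hq0 : (0:ℝ)<q := by linarith
  have split : ∀ a b : ℝ, (q:ℝ)^(a+b)=(q:ℝ)^a*(q:ℝ)^b := fun a b => rpow_add hq0 a b
  set w := (q:ℝ)^(1-C) with hw
  have hw0 : 0<w := by positivity
  have hwC : w=(q:ℝ)^(-C)*q := by rw [hw, sub_eq_neg_add, split, rpow_one]
  have hwq : w≤q := by
    rw [hw]; exact (rpow_le_rpow_of_exponent_le e9 (by linarith : 1-C≤1)).trans_eq (rpow_one _)
  set E := A0*q+w/2 with hE
  have hE0 : 0<E := by positivity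
  set X := log E with hX
  have hEX : exp X=E := exp_log hE0
  have hXX : X0≤X := by
    rw [hX, le_log_iff_exp_le hE0]
    rw [div_le_iff₀ h0] at e2
    linarith
  have hsum := hX0 X hXX
  set ρ := exp (-κ*X) with hρ
  have hρ0 : 0<ρ := exp_pos _
  have hEρ : E*ρ≤w/4 := by
    have a1 : E*ρ=E^(1-κ) := by
      rw [rpow_def_of_pos hE0, ← hX, ← hEX, hρ, ← exp_add]; congr 1; ring
    have a2 : E≤2*q := by nlinarith
    have a3 : E^(1-κ)≤2*(q:ℝ)^(1-κ) := by
      calc E^(1-κ)≤(2*q)^(1-κ) := rpow_le_rpow hE0.le a2 (by linarith)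
        _=(2:ℝ)^(1-κ)*(q:ℝ)^(1-κ) := mul_rpow (by norm_num) hq0.le
        _≤(2:ℝ)^(1:ℝ)*(q:ℝ)^(1-κ) := mul_le_mul_of_nonneg_right (rpow_le_rpow_of_exponent_le (by norm_num) (by linarith)) (by positivity)
        _=_ := by rw [rpow_one]
    have a4 : w=(q:ℝ)^(1-κ)*(q:ℝ)^(κ-C) := by rw [hw, ← split]; congr 1; ring
    have : 0<(q:ℝ)^(1-κ) := by positivity
    rw [a1, a4]; nlinarith
  have hρ2 : ρ≤1/2 := by
    have : w/2≤E := by have := mul_pos h0 hq0; linarith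
    by_contra hcon
    push Not at hcon
    nlinarith
  set x := ⌈exp (X-ρ)⌉₊ with hx
  set y := ⌊exp (X+ρ)⌋₊ with hy
  have hlo : A0*q≤exp (X-ρ) := by
    have b1 : 1-ρ≤exp (-ρ) := by have := add_one_le_exp (-ρ); linarith
    rw [sub_eq_add_neg, exp_add, hEX]
    have := mul_le_mul_of_nonneg_left b1 hE0.le
    linarith
  have hhi : exp (X+ρ)≤A0*q+w := by
    have b1 : exp ρ≤1+2*ρ := by
      have b2 : 1-ρ≤exp (-ρ) := by have := add_one_le_exp (-ρ); linarith
      have b3 : exp ρ*exp (-ρ)=1 := by rw [← exp_add]; simp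
      have : exp ρ*(1-ρ)≤1 := (mul_le_mul_of_nonneg_left b2 (exp_pos ρ).le).trans b3.le
      have : 1≤(1+2*ρ)*(1-ρ) := by nlinarith
      exact le_of_mul_le_mul_right (by linarith) (by linarith : 0<1-ρ)
    rw [exp_add, hEX]
    have := mul_le_mul_of_nonneg_left b1 hE0.le
    linarith
  have hx1 : 1≤x := Nat.one_le_ceil_iff.2 (exp_pos _)
  have hyr : (y:ℝ)≤A0*q+w := (Nat.floor_le (exp_pos _).le).trans hhi
  have hyq : y<q := by
    have : w<(1-A0)*q := by
      rw [hwC, rpow_neg hq0.le]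
      refine mul_lt_mul_of_pos_right ?_ hq0
      rw [inv_lt_comm₀ (by positivity) (by linarith), ← one_div]; exact e5
    exact_mod_cast (by linarith : (y:ℝ)<q)
  have hqD : (q:ℝ)=(q:ℝ)^(1-D)*(q:ℝ)^D := by rw [← split]; simp
  have hq1D : (q:ℝ)^(1-D)<q/2 := by
    have : 0<(q:ℝ)^(1-D) := by positivity
    nlinarith
  set L := ⌊(q:ℝ)^(1-D)⌋₊ with hLd
  have hLr : (L:ℝ)≤(q:ℝ)^(1-D) := Nat.floor_le (by positivity)
  have hL2 : (q:ℝ)^(1-D)/2≤L := by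
    have := Nat.lt_floor_add_one ((q:ℝ)^(1-D)); linarith
  have hLq : L≤q := by exact_mod_cast (by linarith : (L:ℝ)≤q)
  by_cases hno : ∀ p ∈ Icc x y, p.Prime → ∀ u<L, ∀ v<L, (u:ZMod q)-v ≠ (p:ZMod q)⁻¹
  · exfalso
    have hdet := detect L x y hLq hx1 hyq _ (fun h hh => hV q ⟨hq⟩ e1 h hh x y hx1 hyq) hno
    have hLpos : (0:ℝ)<L := by linarith
    have hEθ : A0*(q:ℝ)^(1-θ)≤exp ((1-θ)*X) := by
      rw [mul_comm (1-θ), hX, ← rpow_def_of_pos hE0]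
      calc A0*(q:ℝ)^(1-θ)=A0^(1:ℝ)*(q:ℝ)^(1-θ) := by rw [rpow_one]
        _≤A0^(1-θ)*(q:ℝ)^(1-θ) := mul_le_mul_of_nonneg_right (rpow_le_rpow_of_exponent_ge h0 h1.le (by linarith)) (by positivity)
        _=(A0*q)^(1-θ) := (mul_rpow h0.le hq0.le).symm
        _≤_ := rpow_le_rpow (by positivity) (by linarith) (by linarith)
    have lower : (L:ℝ)*(L*(c*(A0*(q:ℝ)^(1-θ))))≤L*(q*(2*√q*log q)+(q:ℝ)^(1-1/32:ℝ)*q) := by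
      calc _≤(L:ℝ)*(L*(∑ n ∈ Icc x y, ArithmeticFunction.vonMangoldt n)) := by
            gcongr; exact (mul_le_mul_of_nonneg_left hEθ hc.le).trans hsum
        _=(L:ℝ)^2*(∑ n ∈ Icc x y, ArithmeticFunction.vonMangoldt n) := by ring
        _≤_ := hdet
        _=_ := by ring
    have lower2 := le_of_mul_le_mul_left lower hLpos
    set Q := (q:ℝ)^(1-1/32:ℝ)*q with hQ
    have hQ0 : 0<Q := by positivity
    have r1 : q*(2*√q*log q)≤Q := by
      have l1 : 2*(1+log q)≤(q:ℝ)^(1/4:ℝ) := by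
        have := hL (log q) ((le_log_iff_exp_le hq0).2 e3)
        rw [pow_one] at this
        rwa [rpow_def_of_pos hq0, mul_comm (log _)]
      have l2 : √(q:ℝ)*(q:ℝ)^(1/4:ℝ)≤(q:ℝ)^(1-1/32:ℝ) := by
        rw [sqrt_eq_rpow, ← split]; exact rpow_le_rpow_of_exponent_le e9 (by norm_num)
      calc q*(2*√q*log q)=√q*(2*log q)*q := by ring
        _≤√q*(q:ℝ)^(1/4:ℝ)*q := by gcongr; linarith
        _≤_ := by rw [hQ]; gcongr
    have r2 : c*A0/2*(Q*(q:ℝ)^(1/32-D-θ))≤L*(c*(A0*(q:ℝ)^(1-θ))) := by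
      have : Q*(q:ℝ)^(1/32-D-θ)=(q:ℝ)^(1-D)*(q:ℝ)^(1-θ) := by
        rw [hQ]; nth_rewrite 2 [← rpow_one (q:ℝ)]
        rw [← split, ← split, ← split]; congr 1; ring
      rw [this]
      calc _=((q:ℝ)^(1-D)/2)*(c*(A0*(q:ℝ)^(1-θ))) := by ring
        _≤_ := by gcongr
    have r3 : 2*Q<c*A0/2*(Q*(q:ℝ)^(1/32-D-θ)) := by
      rw [div_lt_iff₀ (by positivity)] at e8
      have := mul_lt_mul_of_pos_right e8 hQ0
      linarith
    linarith
  · push Not at hno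
    obtain ⟨p, hp, hpp, u, hu, v, hv, huv⟩ := hno
    rw [mem_Icc] at hp
    have hpy : (p:ℝ)≤y := by exact_mod_cast hp.2
    have hpx : (x:ℝ)≤p := by exact_mod_cast hp.1
    have hab : |(((u:ℤ)-v:ℤ):ℝ)| ≤ (q:ℝ)^(1-D) := by
      refine le_trans ?_ hLr
      have : |(u:ℤ)-v| ≤ L := abs_le.2 ⟨by omega, by omega⟩
      rw [← Int.cast_abs]; exact_mod_cast this
    refine ⟨p, hpp, by omega, hlo.trans ((Nat.le_ceil _).trans hpx), ?_, (u:ℤ)-v, ?_, ?_, ?_, hab⟩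
    · rw [add_mul, ← hwC]; linarith
    · rw [← ZMod.intCast_eq_intCast_iff]
      push_cast
      rw [huv, mul_inv_cancel₀ (cast_ne hpp.one_le (hp.2.trans_lt hyq))]
    · have := (abs_le.1 hab).1; linarith
    · have := (abs_le.1 hab).2; linarith

end M8
end H12
open Real Filter

theorem stmt12 (A0 C D : ℝ) (h0 : 0 < A0) (h1 : A0 < 1)
    (hC : 0 < C) (hD : 0 < D) (hCD : C + D < 1 / 32) :
    ∀ᶠ q : ℕ in atTop, q.Prime →
      ∃ p : ℕ, p.Prime ∧ p ≠ q ∧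
        A0 * q ≤ (p : ℝ) ∧ (p : ℝ) ≤ (A0 + (q : ℝ) ^ (-C)) * q ∧
        ∃ pbar : ℤ, (p : ℤ) * pbar ≡ 1 [ZMOD (q : ℤ)] ∧
          -((q : ℝ) / 2) < (pbar : ℝ) ∧ (pbar : ℝ) ≤ (q : ℝ) / 2 ∧
          |(pbar : ℝ)| ≤ (q : ℝ) ^ (1 - D) :=
  H12.final A0 C D h0 h1 hC hD hCD
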